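/- Let Γ and Λ be finite simplicial graphs with de Rahm decompositions A(Γ) = A(Γ₁) × ⋯ × A(Γ_k) and A(Λ) = A(Λ₁) × ⋯ × A(Λ_l), let B_Γ ⊆ VΓ and B_Λ ⊆ VΛ, and suppose (f, f_*) : (A(Γ), 𝒫_{B_Γ}) → (A(Λ), 𝒫_{B_Λ}) is a relative quasi-isometry. Then k = l and, after reordering the factors of Λ, there exist relative quasi-isometries gᵢ : (A(Γᵢ), 𝒫_{B_Γ ∩ VΓᵢ}) → (A(Λᵢ), 𝒫_{B_Λ ∩ VΛᵢ}) such that g := g₁ × ⋯ × g_k is a relative quasi-isometry (A(Γ), 𝒫_{B_Γ}) → (A(Λ), 𝒫_{B_Λ}) with g_* = f_*. -/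

import Mathlib

noncomputable section

universe u v

/-- Word metric (distance function) on a group with respect to a generating set `S`. -/
def wordDist {G : Type*} [Group G] (S : Set G) (g h : G) : ℝ :=
  sInf ((fun l : List G => (l.length : ℝ)) ''
    {l : List G | (∀ x ∈ l, x ∈ S ∨ x⁻¹ ∈ S) ∧ g * l.prod = h})

/-- `f` is `(K, A)`-coarse Lipschitz. -/
def CoarseLipschitzWith {X Y : Type*} (K A : ℝ) (dX : X → X → ℝ) (dY : Y → Y → ℝ)
    (f : X → Y) : Prop :=
  ∀ x x', dY (f x) (f x') ≤ K * dX x x' + A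

/-- `f` is a `(K, A)`-quasi-isometry. -/
def IsQIWith {X Y : Type*} (K A : ℝ) (dX : X → X → ℝ) (dY : Y → Y → ℝ) (f : X → Y) : Prop :=
  1 ≤ K ∧ 0 ≤ A ∧
  (∀ x x', dX x x' / K - A ≤ dY (f x) (f x') ∧ dY (f x) (f x') ≤ K * dX x x' + A) ∧
  (∀ y, ∃ x, dY (f x) y ≤ A)

/-- `f` is a quasi-isometry. -/
def IsQI {X Y : Type*} (dX : X → X → ℝ) (dY : Y → Y → ℝ) (f : X → Y) : Prop :=
  ∃ K A : ℝ, IsQIWith K A dX dY f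

/-- The Hausdorff distance between `S` and `T` (w.r.t. the distance `d`) is at most `r`. -/
def HausLE {X : Type*} (d : X → X → ℝ) (S T : Set X) (r : ℝ) : Prop :=
  (∀ s ∈ S, ∃ t ∈ T, d s t ≤ r) ∧ (∀ t ∈ T, ∃ s ∈ S, d s t ≤ r)

/-- `S` and `T` are at finite Hausdorff distance. -/
def FinHaus {X : Type*} (d : X → X → ℝ) (S T : Set X) : Prop :=
  ∃ r : ℝ, 0 ≤ r ∧ HausLE d S T r

/-- The commutator relations of a right-angled Artin group. -/
def raagRels {V : Type} (Γ : SimpleGraph V) : Set (FreeGroup V) :=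
  {r | ∃ x y : V, Γ.Adj x y ∧
    r = FreeGroup.of x * FreeGroup.of y * (FreeGroup.of x)⁻¹ * (FreeGroup.of y)⁻¹}

/-- The right-angled Artin group `A(Γ)` of a simplicial graph `Γ`. -/
abbrev Raag {V : Type} (Γ : SimpleGraph V) : Type := PresentedGroup (raagRels Γ)

/-- The generator of `Raag Γ` corresponding to a vertex. -/
def raagGen {V : Type} (Γ : SimpleGraph V) (x : V) : Raag Γ :=
  PresentedGroup.of (rels := raagRels Γ) x

/-- The word metric on `Raag Γ` with respect to the vertex generators. -/
def raagDist {V : Type} (Γ : SimpleGraph V) : Raag Γ → Raag Γ → ℝ :=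
  wordDist (Set.range (raagGen Γ))

/-- `A(Γ)` and `A(Λ)` are quasi-isometric (w.r.t. the vertex word metrics). -/
def RaagQI {V W : Type} (Γ : SimpleGraph V) (Λ : SimpleGraph W) : Prop :=
  ∃ f : Raag Γ → Raag Λ, IsQI (raagDist Γ) (raagDist Λ) f

/-- A standard geodesic: the coset `g⟨v⟩`, recorded by a basepoint `g` and a label `v`. -/
structure StdGeod {V : Type} (Γ : SimpleGraph V) where
  base : Raag Γ
  label : V

/-- The parametrization `n ↦ g vⁿ` of a standard geodesic, identifying it with `ℤ`. -/
def StdGeod.param {V : Type} {Γ : SimpleGraph V} (l : StdGeod Γ) : ℤ → Raag Γ :=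
  fun n => l.base * raagGen Γ l.label ^ n

/-- The underlying subset of a standard geodesic. -/
def StdGeod.carrier {V : Type} {Γ : SimpleGraph V} (l : StdGeod Γ) : Set (Raag Γ) :=
  Set.range l.param

/-- Two standard geodesics are parallel if they are at finite Hausdorff distance. -/
def Parallel {V : Type} {Γ : SimpleGraph V} (l k : StdGeod Γ) : Prop :=
  FinHaus (raagDist Γ) l.carrier k.carrier

/-- A based quasi-isometry `(A(Γ), l) → (A(Λ), l')`. -/
def IsBasedQI {V W : Type} {Γ : SimpleGraph V} {Λ : SimpleGraph W}
    (f : Raag Γ → Raag Λ) (l : StdGeod Γ) (l' : StdGeod Λ) : Prop :=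
  IsQI (raagDist Γ) (raagDist Λ) f ∧ FinHaus (raagDist Λ) (f '' l.carrier) l'.carrier

/-- `str(f, l, C) = r`: on `l`, the map `f` is `C`-close to `n ↦ ±⌊r n⌋ + b`
(read through the identifications of `l` and `l'` with `ℤ`). -/
def StrWith {V W : Type} {Γ : SimpleGraph V} {Λ : SimpleGraph W}
    (f : Raag Γ → Raag Λ) (l : StdGeod Γ) (l' : StdGeod Λ) (C : ℝ) (r : ℚ) : Prop :=
  ∃ ε : ℤ, (ε = 1 ∨ ε = -1) ∧ ∃ b : ℤ,
    ∀ n : ℤ, raagDist Λ (f (l.param n)) (l'.param (ε * ⌊r * (n : ℚ)⌋ + b)) ≤ C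

/-- The stretch factor `str(f, l)` (computed with respect to `l'`) is well-defined
and equals `r`. -/
def HasStr {V W : Type} {Γ : SimpleGraph V} {Λ : SimpleGraph W}
    (f : Raag Γ → Raag Λ) (l : StdGeod Γ) (l' : StdGeod Λ) (r : ℚ) : Prop :=
  ∃ C : ℝ, 0 ≤ C ∧ StrWith f l l' C r

/-- `l` is an `𝓡`-geodesic. -/
def IsRGeod {V : Type} {Γ : SimpleGraph V} (l : StdGeod Γ) : Prop :=
  ∀ (W : Type) [Fintype W] (Λ : SimpleGraph W) (l' : StdGeod Λ)
    (f g : Raag Γ → Raag Λ),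
    IsBasedQI f l l' → IsBasedQI g l l' →
    ∃ r : ℚ, HasStr f l l' r ∧ HasStr g l l' r

/-- The parallelism class `𝒮_l` of a standard geodesic (as a family of subsets). -/
def parClass {V : Type} {Γ : SimpleGraph V} (l : StdGeod Γ) : Set (Set (Raag Γ)) :=
  {S | ∃ k : StdGeod Γ, S = k.carrier ∧ Parallel l k}

/-- The peripheral structure `𝒫_B` on `Raag Γ` determined by a set `B` of vertices. -/
def periph {V : Type} (Γ : SimpleGraph V) (B : Set V) : Set (Set (Set (Raag Γ))) :=
  {F | ∃ l : StdGeod Γ, l.label ∈ B ∧ F = parClass l}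

/-- A `(K, A)`-relative quasi-isometry between spaces with peripheral structures. -/
def IsRelQIWith {X Y : Type*} (K A : ℝ) (dX : X → X → ℝ) (dY : Y → Y → ℝ)
    (PX : Set (Set (Set X))) (PY : Set (Set (Set Y)))
    (f : X → Y) (fs : Set (Set X) → Set (Set Y)) : Prop :=
  IsQIWith K A dX dY f ∧
  Set.BijOn fs PX PY ∧
  ∀ F ∈ PX, (∀ a ∈ F, ∃ b ∈ fs F, HausLE dY (f '' a) b A) ∧
            (∀ b ∈ fs F, ∃ a ∈ F, HausLE dY (f '' a) b A)

/-- The two spaces with peripheral structures are relatively quasi-isometric. -/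
def IsRelQI {X Y : Type*} (dX : X → X → ℝ) (dY : Y → Y → ℝ)
    (PX : Set (Set (Set X))) (PY : Set (Set (Set Y))) : Prop :=
  ∃ (K A : ℝ) (f : X → Y) (fs : Set (Set X) → Set (Set Y)),
    IsRelQIWith K A dX dY PX PY f fs

/-- Left translation of a family of subsets of `Raag Γ`. -/
def translateFam {V : Type} {Γ : SimpleGraph V} (g : Raag Γ) (F : Set (Set (Raag Γ))) :
    Set (Set (Raag Γ)) :=
  (fun a => (fun x => g * x) '' a) '' F

/-- A decoration on `𝒫_B` that is invariant under the left translation action. -/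
def DecorInvariant {V : Type} (Γ : SimpleGraph V) (B : Set V) {O : Type}
    (δ : Set (Set (Raag Γ)) → O) : Prop :=
  ∀ g : Raag Γ, ∀ F ∈ periph Γ B, δ (translateFam g F) = δ F

/-- A decoration-preserving based relative quasi-isometry
`(A(Γ), 𝒫_{BΓ}, δΓ, l) → (A(Λ), 𝒫_{BΛ}, δΛ, l')`. -/
def IsDecorBasedRelQI {V W : Type} (Γ : SimpleGraph V) (Λ : SimpleGraph W)
    (BΓ : Set V) (BΛ : Set W) {O : Type}
    (δΓ : Set (Set (Raag Γ)) → O) (δΛ : Set (Set (Raag Λ)) → O)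
    (l : StdGeod Γ) (l' : StdGeod Λ)
    (f : Raag Γ → Raag Λ) (fs : Set (Set (Raag Γ)) → Set (Set (Raag Λ))) : Prop :=
  (∃ K A : ℝ, IsRelQIWith K A (raagDist Γ) (raagDist Λ) (periph Γ BΓ) (periph Λ BΛ) f fs) ∧
  (∀ F ∈ periph Γ BΓ, δΛ (fs F) = δΓ F) ∧
  FinHaus (raagDist Λ) (f '' l.carrier) l'.carrier

/-- `A(Γ)` is a dovetail RAAG. -/
def Dovetail {V : Type} (Γ : SimpleGraph V) : Prop :=
  ∀ (W : Type) [Fintype W] (Λ : SimpleGraph W) (BΓ : Set V) (BΛ : Set W)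
    (O : Type) (δΓ : Set (Set (Raag Γ)) → O) (δΛ : Set (Set (Raag Λ)) → O),
    DecorInvariant Γ BΓ δΓ → DecorInvariant Λ BΛ δΛ →
    ∀ (l : StdGeod Γ) (l' : StdGeod Λ) (f : Raag Γ → Raag Λ)
      (fs : Set (Set (Raag Γ)) → Set (Set (Raag Λ))),
      IsDecorBasedRelQI Γ Λ BΓ BΛ δΓ δΛ l l' f fs →
      ∀ lam : Set (Set (Raag Γ)) → ℚ,
        (∀ F ∈ periph Γ BΓ, 0 < lam F) →
        (∃ M : ℚ, 1 ≤ M ∧ ∀ F ∈ periph Γ BΓ, 1 / M ≤ lam F ∧ lam F ≤ M) →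
        (∀ F ∈ periph Γ BΓ, ∀ F' ∈ periph Γ BΓ, δΓ F = δΓ F' → lam F = lam F') →
        ∃ C : ℝ, 0 ≤ C ∧
          ∃ (g : Raag Γ → Raag Λ) (gs : Set (Set (Raag Γ)) → Set (Set (Raag Λ))),
            IsDecorBasedRelQI Γ Λ BΓ BΛ δΓ δΛ l l' g gs ∧
            (∀ l2 : StdGeod Γ, l2.label ∈ BΓ → ¬ IsRGeod l2 →
              ∀ l3 : StdGeod Λ, FinHaus (raagDist Λ) (g '' l2.carrier) l3.carrier →
                StrWith g l2 l3 C (lam (parClass l2))) ∧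
            (∀ l2 : StdGeod Γ, l2.label ∈ BΓ → IsRGeod l2 →
              ∀ l3 : StdGeod Λ, FinHaus (raagDist Λ) (g '' l2.carrier) l3.carrier →
                ∃ r : ℚ, StrWith g l2 l3 C r)

/-- The closed star of a vertex, as a vertex set. -/
def starSet {V : Type} (Γ : SimpleGraph V) (x : V) : Set V :=
  insert x {u | Γ.Adj x u}

/-- The link of a vertex, as a vertex set. -/
def lkSet {V : Type} (Γ : SimpleGraph V) (x : V) : Set V := {u | Γ.Adj x u}

/-- The link of `x` inside the induced subgraph on `S`. -/
def lkIn {V : Type} (Γ : SimpleGraph V) (S : Set V) (x : V) : Set V :=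
  {u | u ∈ S ∧ Γ.Adj x u}

/-- `x` is a cut vertex: deleting it (and incident edges) disconnects the graph. -/
def CutVertex {V : Type} (Γ : SimpleGraph V) (x : V) : Prop :=
  ¬ (Γ.induce {u : V | u ≠ x}).Preconnected

/-- The vertex set `S` spans a biconnected subgraph: connected with no cut vertex. -/
def Biconn {V : Type} (Γ : SimpleGraph V) (S : Set V) : Prop :=
  (Γ.induce S).Connected ∧ ∀ x ∈ S, (Γ.induce (S \ {x})).Preconnected

/-- `S` spans a maximal biconnected subgraph. -/
def MaxBiconn {V : Type} (Γ : SimpleGraph V) (S : Set V) : Prop :=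
  Biconn Γ S ∧ ∀ T : Set V, Biconn Γ T → S ⊆ T → S = T

/-- The collection `C₁` of maximal biconnected subgraphs: those containing at least
two cut vertices, or not contained in the star of any cut vertex. -/
def C1 {V : Type} (Γ : SimpleGraph V) : Set (Set V) :=
  {S | MaxBiconn Γ S ∧
    ((∃ x ∈ S, ∃ y ∈ S, x ≠ y ∧ CutVertex Γ x ∧ CutVertex Γ y) ∨
     (∀ x : V, CutVertex Γ x → ¬ S ⊆ starSet Γ x))}

/-- `Γ` is an `n`-clique tree-graded graph. -/
def NCliqueTreeGraded {V : Type} (Γ : SimpleGraph V) (n : ℕ) : Prop :=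
  Γ.Connected ∧
  (∀ x : V, CutVertex Γ x ∨ (∃! u : V, Γ.Adj x u)) ∧
  (∃ x y : V, 3 ≤ Γ.dist x y) ∧
  (∀ S : Set V, MaxBiconn Γ S →
    ((Γ.IsClique S ∧ S.ncard = n ∧ ∀ x ∈ S, CutVertex Γ x) ∨
     (Γ.IsClique S ∧ S.ncard = 2 ∧ ∃! x : V, x ∈ S ∧ CutVertex Γ x)))

/-- The subgroup of `Raag Γ` generated by the vertices in `T`. -/
def subRaag {V : Type} (Γ : SimpleGraph V) (T : Set V) : Subgroup (Raag Γ) :=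
  Subgroup.closure (raagGen Γ '' T)

/-- The word metric on the subgroup generated by `T`, w.r.t. the generators from `T`. -/
def subDist {V : Type} (Γ : SimpleGraph V) (T : Set V) :
    ↥(subRaag Γ T) → ↥(subRaag Γ T) → ℝ :=
  wordDist {x : ↥(subRaag Γ T) | ∃ u ∈ T, (x : Raag Γ) = raagGen Γ u}

/-- The cylinder group `A(star(x))`. -/
def cylGroup {V : Type} (Γ : SimpleGraph V) (x : V) : Subgroup (Raag Γ) :=
  subRaag Γ (starSet Γ x)

/-- The word metric on the cylinder `A(star(x))` w.r.t. the vertices of `star(x)`. -/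
def cylDist {V : Type} (Γ : SimpleGraph V) (x : V) :
    ↥(cylGroup Γ x) → ↥(cylGroup Γ x) → ℝ :=
  subDist Γ (starSet Γ x)

/-- The coset `a⟨x⟩`, as a subset of the cylinder `A(star(x))`. -/
def cylCoset {V : Type} (Γ : SimpleGraph V) (x : V) (a : Raag Γ) :
    Set ↥(cylGroup Γ x) :=
  {g | ∃ n : ℤ, (g : Raag Γ) = a * raagGen Γ x ^ n}

/-- The peripheral structure `𝒫_x` on the cylinder `A(star(x))`: one element for each
coset `g·A(star_{Γ'}(x))` with `Γ' ∈ C₁` containing `x`, namely the family of cosets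
`{g·h·⟨x⟩ : h ∈ A(lk_{Γ'}(x))}`. -/
def cylPeriph {V : Type} (Γ : SimpleGraph V) (x : V) :
    Set (Set (Set ↥(cylGroup Γ x))) :=
  {F | ∃ S ∈ C1 Γ, x ∈ S ∧ ∃ g : Raag Γ, g ∈ cylGroup Γ x ∧
    F = {c | ∃ h ∈ subRaag Γ (lkIn Γ S x), c = cylCoset Γ x (g * h)}}

/-- The factors `A(T) ≤ A(Γ)` and `A(T') ≤ A(Λ)` are quasi-isometric. -/
def FactorQI {V W : Type} (Γ : SimpleGraph V) (Λ : SimpleGraph W)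
    (T : Set V) (T' : Set W) : Prop :=
  ∃ φ : ↥(subRaag Γ T) → ↥(subRaag Λ T'), IsQI (subDist Γ T) (subDist Λ T') φ

/-- `S` does not split as a join of two nonempty subgraphs. -/
def JoinIrreducibleSet {V : Type} (Γ : SimpleGraph V) (S : Set V) : Prop :=
  ¬ ∃ S₁ S₂ : Set V, S₁.Nonempty ∧ S₂.Nonempty ∧ Disjoint S₁ S₂ ∧ S₁ ∪ S₂ = S ∧
    ∀ x ∈ S₁, ∀ y ∈ S₂, Γ.Adj x y

/-- `P` describes the de Rahm decomposition of `Γ`: the fibres of `P` are the factors of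
the maximal join decomposition, the fibre of `0` being the maximal clique factor and the
other fibres being nonempty and join-irreducible. -/
def IsDeRahm {V : Type} (Γ : SimpleGraph V) {k : ℕ} (hk : 0 < k) (P : V → Fin k) : Prop :=
  (∀ x y : V, x ≠ y → P x ≠ P y → Γ.Adj x y) ∧
  Γ.IsClique {x | P x = ⟨0, hk⟩} ∧
  (∀ x : V, (∀ y : V, y ≠ x → Γ.Adj x y) → P x = ⟨0, hk⟩) ∧
  (∀ i : Fin k, i ≠ ⟨0, hk⟩ → (P ⁻¹' {i}).Nonempty) ∧
  (∀ i : Fin k, i ≠ ⟨0, hk⟩ → JoinIrreducibleSet Γ (P ⁻¹' {i}))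

/-- The coset `a⟨u⟩`, regarded as a subset of the subgroup `A(T) ≤ A(Γ)`. -/
def subStdSet {V : Type} (Γ : SimpleGraph V) (T : Set V) (a : Raag Γ) (u : V) :
    Set ↥(subRaag Γ T) :=
  {x | ∃ n : ℤ, (x : Raag Γ) = a * raagGen Γ u ^ n}

/-- The parallelism class of the standard geodesic `a⟨u⟩` inside the factor `A(T)`. -/
def subParClass {V : Type} (Γ : SimpleGraph V) (T : Set V) (a : Raag Γ) (u : V) :
    Set (Set ↥(subRaag Γ T)) :=
  {S | ∃ (a' : Raag Γ) (u' : V), u' ∈ T ∧ a' ∈ subRaag Γ T ∧ S = subStdSet Γ T a' u' ∧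
    FinHaus (subDist Γ T) (subStdSet Γ T a u) (subStdSet Γ T a' u')}

/-- The peripheral structure `𝒫_{B ∩ T}` on the factor `A(T) ≤ A(Γ)`. -/
def subPeriph {V : Type} (Γ : SimpleGraph V) (T B : Set V) :
    Set (Set (Set ↥(subRaag Γ T))) :=
  {F | ∃ (a : Raag Γ) (u : V), u ∈ B ∧ u ∈ T ∧ a ∈ subRaag Γ T ∧
    F = subParClass Γ T a u}

namespace DeRahmSplit

/-- The field of coefficients. -/
abbrev F2 := ZMod 2

/-- Chains: formal sums of lists of points, a list of length `r` being a simplex of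
dimension `r - 1`. -/
abbrev Ch (Y : Type*) := List Y →₀ F2

section Chains

variable {Y Z : Type*}

/-- The cone of a chain at a point. -/
def cons (x : Y) : Ch Y →ₗ[F2] Ch Y := Finsupp.lmapDomain F2 F2 (List.cons x)

/-- The list `l` seen as a chain. -/
def sg (l : List Y) : Ch Y := Finsupp.single l 1

/-- The boundary of a list. -/
def bdL : List Y → Ch Y
  | [] => 0
  | x :: l => sg l + cons x (bdL l)

/-- The linear extension of a function on lists. -/
def lext {M : Type*} [AddCommGroup M] [Module F2 M] (φ : List Y → M) : Ch Y →ₗ[F2] M :=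
  Finsupp.linearCombination F2 φ

/-- The boundary operator (augmented in list length zero). -/
def bd : Ch Y →ₗ[F2] Ch Y := lext bdL

/-- The chain map induced by a map of points. -/
def mp (f : Y → Z) : Ch Y →ₗ[F2] Ch Z := Finsupp.lmapDomain F2 F2 (List.map f)

section Module
variable {M : Type*} [AddCommGroup M] [Module F2 M]

lemma add_self_F2 (c : M) : c + c = 0 := by
  rw [← two_smul F2 c, show (2 : F2) = 0 from rfl, zero_smul]

lemma two_nsmul_F2 (c : M) : (2 : ℕ) • c = 0 := by rw [two_smul, add_self_F2]

lemma two_zsmul_F2 (c : M) : (2 : ℤ) • c = 0 := by rw [two_smul, add_self_F2]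

lemma eq_of_add_eq_zero_F2 {a b : M} (h : a + b = 0) : a = b := by
  have := add_self_F2 b
  rw [← this] at h
  exact add_right_cancel h

lemma lin_ext {f g : Ch Y →ₗ[F2] M} (h : ∀ l, f (sg l) = g (sg l)) (c : Ch Y) : f c = g c := by
  have : f = g := Finsupp.lhom_ext' fun l => LinearMap.ext_ring (h l)
  rw [this]

@[simp] lemma lext_sg (φ : List Y → M) (l : List Y) : lext φ (sg l) = φ l := by
  simp [lext, sg]

end Module

@[simp] lemma cons_sg (x : Y) (l : List Y) : cons x (sg l) = sg (x :: l) := by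
  simp [cons, sg]

@[simp] lemma mp_sg (f : Y → Z) (l : List Y) : mp f (sg l) = sg (l.map f) := by
  simp [mp, sg]

@[simp] lemma bd_sg (l : List Y) : bd (sg l) = bdL l := by simp [bd]

lemma bd_cons (x : Y) (c : Ch Y) : bd (cons x c) = c + cons x (bd c) := by
  have := lin_ext (f := bd ∘ₗ cons x) (g := LinearMap.id + cons x ∘ₗ bd) (fun l => by
    simp [bdL]) c
  simpa using this

lemma bdL_cons (x : Y) (l : List Y) : bdL (x :: l) = sg l + cons x (bdL l) := rfl

lemma bd_bdL (l : List Y) : bd (bdL l) = 0 := by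
  induction l with
  | nil => simp [bdL]
  | cons x l ih => rw [bdL_cons, map_add, bd_sg, bd_cons, ih, map_zero, add_zero, add_self_F2]

lemma bd_bd (c : Ch Y) : bd (bd c) = 0 := by
  have := lin_ext (f := bd ∘ₗ bd) (g := 0) (fun l => by simp [bd_bdL]) c
  simpa using this

lemma cycle_eq (v : Y) {c : Ch Y} (h : bd c = 0) : bd (cons v c) = c := by
  rw [bd_cons, h, map_zero, add_zero]

lemma mp_cons (f : Y → Z) (x : Y) (c : Ch Y) : mp f (cons x c) = cons (f x) (mp f c) := by
  have := lin_ext (f := mp f ∘ₗ cons x) (g := cons (f x) ∘ₗ mp f) (fun l => by simp) c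
  simpa using this

lemma bdL_map (f : Y → Z) (l : List Y) : bdL (l.map f) = mp f (bdL l) := by
  induction l with
  | nil => simp [bdL]
  | cons x l ih => simp [bdL_cons, ih, mp_cons]

lemma bd_mp (f : Y → Z) (c : Ch Y) : bd (mp f c) = mp f (bd c) := by
  have := lin_ext (f := bd ∘ₗ mp f) (g := mp f ∘ₗ bd) (fun l => by simp [bdL_map]) c
  simpa using this

lemma mp_mp {W : Type*} (g : Z → W) (f : Y → Z) (c : Ch Y) : mp g (mp f c) = mp (g ∘ f) c := by
  have := lin_ext (f := mp g ∘ₗ mp f) (g := mp (g ∘ f)) (fun l => by simp) c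
  simpa using this

lemma mp_id (c : Ch Y) : mp id c = c := by
  have := lin_ext (f := mp (id : Y → Y)) (g := LinearMap.id) (fun l => by simp) c
  simpa using this

/-! ### Prisms -/

/-- The prism on a list between the maps `f` and `g`. -/
def prL (f g : Y → Z) : List Y → Ch Z
  | [] => 0
  | x :: l => sg (f x :: g x :: l.map g) + cons (f x) (prL f g l)

/-- The prism operator. -/
def pr (f g : Y → Z) : Ch Y →ₗ[F2] Ch Z := lext (prL f g)

lemma pr_cons (f g : Y → Z) (x : Y) (c : Ch Y) :
    pr f g (cons x c) = cons (f x) (cons (g x) (mp g c)) + cons (f x) (pr f g c) := by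
  have := lin_ext (f := pr f g ∘ₗ cons x)
    (g := cons (f x) ∘ₗ cons (g x) ∘ₗ mp g + cons (f x) ∘ₗ pr f g)
    (fun l => by simp [pr, prL]) c
  simpa using this

lemma bd_pr (f g : Y → Z) (c : Ch Y) :
    bd (pr f g c) + pr f g (bd c) = mp f c + mp g c := by
  have := lin_ext (f := bd ∘ₗ pr f g + pr f g ∘ₗ bd) (g := mp f + mp g) (fun l => ?_) c
  · simpa using this
  · induction l with
    | nil => simp [bdL, pr, prL, add_self_F2]
    | cons x l ih =>
      have ih' : bd (pr f g (sg l)) = pr f g (bdL l) + (sg (l.map f) + sg (l.map g)) := by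
        apply eq_of_add_eq_zero_F2
        have : bd (pr f g (sg l)) + pr f g (bdL l) = sg (l.map f) + sg (l.map g) := by
          simpa using ih
        rw [← add_assoc, this, add_self_F2]
      have e : pr f g (sg (x :: l)) = sg (f x :: g x :: l.map g) + cons (f x) (pr f g (sg l)) := by
        simp [pr, prL]
      simp only [LinearMap.add_apply, LinearMap.comp_apply, e, map_add, bd_sg, bdL_cons, bd_cons,
        ih', pr_cons, mp_sg, List.map_cons, bdL_map, cons_sg]
      have t' := fun c : Ch Z => two_zsmul_F2 c
      abel_nf
      simp [t']

/-- The composite of the prisms of a sequence of maps. -/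
def prs (h : ℕ → Y → Z) (m : ℕ) : Ch Y →ₗ[F2] Ch Z := ∑ k ∈ Finset.range m, pr (h k) (h (k + 1))

lemma bd_prs (h : ℕ → Y → Z) (m : ℕ) (c : Ch Y) :
    bd (prs h m c) + prs h m (bd c) = mp (h 0) c + mp (h m) c := by
  induction m with
  | zero => simp [prs, add_self_F2]
  | succ m ih =>
    have e : ∀ d, prs h (m + 1) d = prs h m d + pr (h m) (h (m + 1)) d := fun d => by
      simp [prs, Finset.sum_range_succ]
    rw [e, e, map_add, add_add_add_comm, ih, bd_pr, add_assoc, ← add_assoc (mp (h m) c),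
      add_self_F2, zero_add]

/-! ### Cochains -/

/-- The cup product of the coboundaries of the functions in the list. -/
def coQ : List (Y → F2) → List Y → F2
  | [], [_] => 1
  | s :: L, x :: y :: l => (s x + s y) * coQ L (y :: l)
  | _, _ => 0

/-- The cup product where one factor is not differentiated. -/
def coT : List (Y → F2) → (Y → F2) → List (Y → F2) → List Y → F2
  | [], s, L, x :: l => s x * coQ L (x :: l)
  | t :: L', s, L, x :: y :: l => (t x + t y) * coT L' s L (y :: l)
  | _, _, _, _ => 0

/-- The cup product where the first factor is not differentiated. -/
def coP : List (Y → F2) → List Y → F2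
  | [], [] => 1
  | s :: L, l => coT [] s L l
  | _, _ => 0

lemma lext_cons (φ : List Y → F2) (x : Y) (c : Ch Y) :
    lext φ (cons x c) = lext (fun l => φ (x :: l)) c := by
  have := lin_ext (f := lext φ ∘ₗ cons x) (g := lext (fun l => φ (x :: l))) (fun l => by simp) c
  simpa using this

lemma lext_mul (a : F2) (φ : List Y → F2) (c : Ch Y) :
    lext (fun l => a * φ l) c = a * lext φ c := by
  have := lin_ext (f := lext (fun l => a * φ l)) (g := a • lext φ) (fun l => by simp) c
  simpa using this

lemma lext_coQ_bdL (L : List (Y → F2)) (l : List Y) : lext (coQ L) (bdL l) = 0 := by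
  induction L generalizing l with
  | nil =>
    match l with
    | [] => simp [bdL]
    | [x] => simp [bdL, coQ]
    | [x, y] => simp [bdL, coQ, add_self_F2]
    | x :: y :: z :: l =>
      rw [bdL_cons, bdL_cons]
      simp only [map_add, lext_sg, coQ, cons_sg, lext_cons, zero_add]
      exact lin_ext (g := 0) (fun l => by simp) _
  | cons s L ih =>
    match l with
    | [] => simp [bdL]
    | [x] => simp [bdL, coQ]
    | [x, y] => simp [bdL, coQ]
    | x :: y :: z :: l =>
      have h := ih (y :: z :: l)
      rw [bdL_cons] at h ⊢
      rw [bdL_cons, bdL_cons]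
      rw [bdL_cons] at h
      simp only [map_add, lext_sg, cons_sg, lext_cons, coQ, lext_mul] at h ⊢
      have t := CharTwo.two_eq_zero (R := F2)
      linear_combination (s x + s y) * h + (s z) * coQ L (z :: l) * t

lemma lext_coT_bdL (L₁ : List (Y → F2)) (s : Y → F2) (L₂ : List (Y → F2)) (l : List Y) :
    lext (coT L₁ s L₂) (bdL l) = coQ (L₁ ++ s :: L₂) l := by
  induction L₁ generalizing l with
  | nil =>
    match l with
    | [] => simp [bdL, coQ]
    | [x] => simp [bdL, coQ, coT]
    | x :: y :: l =>
      have h := lext_coQ_bdL L₂ (x :: y :: l)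
      rw [bdL_cons, bdL_cons] at h ⊢
      simp only [map_add, lext_sg, cons_sg, lext_cons, coQ, coT, lext_mul,
        List.nil_append] at h ⊢
      have t := CharTwo.two_eq_zero (R := F2)
      linear_combination (s x) * h - s x * coQ L₂ (y :: l) * t
  | cons t L₁ ih =>
    match l with
    | [] => simp [bdL, coQ]
    | [x] => simp [bdL, coQ, coT]
    | [x, y] =>
      have h : coQ (L₁ ++ s :: L₂) [y] = 0 := by cases L₁ <;> rfl
      simp [bdL, coQ, coT, h]
    | x :: y :: z :: l =>
      have h := ih (y :: z :: l)
      rw [bdL_cons] at h ⊢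
      rw [bdL_cons, bdL_cons]
      rw [bdL_cons] at h
      simp only [map_add, lext_sg, cons_sg, lext_cons, coQ, coT, lext_mul,
        List.cons_append] at h ⊢
      have t' := CharTwo.two_eq_zero (R := F2)
      linear_combination (t x + t y) * h + (t z) * coT L₁ s L₂ (z :: l) * t'

lemma lext_coT_bd (L₁ : List (Y → F2)) (s : Y → F2) (L₂ : List (Y → F2)) (c : Ch Y) :
    lext (coT L₁ s L₂) (bd c) = lext (coQ (L₁ ++ s :: L₂)) c :=
  lin_ext (f := lext (coT L₁ s L₂) ∘ₗ bd) (g := lext (coQ (L₁ ++ s :: L₂)))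
    (fun l => by simp [lext_coT_bdL]) c

lemma lext_coP_eq_coT (v : Y) {c : Ch Y} (hc : bd c = 0) (L₁ : List (Y → F2)) (s : Y → F2)
    (L₂ : List (Y → F2)) : lext (coP (L₁ ++ s :: L₂)) c = lext (coT L₁ s L₂) c := by
  rw [← cycle_eq v hc, lext_coT_bd]
  cases L₁ with
  | nil =>
    have : coP ([] ++ s :: L₂) = coT [] s L₂ := by ext l; simp [coP]
    rw [this, lext_coT_bd]
  | cons t L₁ =>
    have : coP (t :: L₁ ++ s :: L₂) = coT [] t (L₁ ++ s :: L₂) := by ext l; simp [coP]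
    rw [this, lext_coT_bd]; rfl

/-- The function `t` takes a single value on the list `l`. -/
def ConstOn (t : Y → F2) (l : List Y) : Prop := ∀ x ∈ l, ∀ y ∈ l, t x = t y

lemma ConstOn.tail {t : Y → F2} {x : Y} {l : List Y} (h : ConstOn t (x :: l)) : ConstOn t l :=
  fun a ha b hb => h a (by simp [ha]) b (by simp [hb])

lemma coQ_eq_zero {L : List (Y → F2)} {l : List Y} {t : Y → F2} (ht : t ∈ L)
    (h : ConstOn t l) : coQ L l = 0 := by
  induction L generalizing l with
  | nil => simp at ht
  | cons s L ih =>
    match l with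
    | [] => rfl
    | [x] => rfl
    | x :: y :: l =>
      rcases List.mem_cons.1 ht with rfl | ht
      · simp [coQ, h x (by simp) y (by simp), add_self_F2]
      · simp [coQ, ih ht h.tail]

lemma coT_eq_zero {L₁ L₂ : List (Y → F2)} {s : Y → F2} {l : List Y} {t : Y → F2}
    (ht : t ∈ L₁ ∨ t ∈ L₂) (h : ConstOn t l) : coT L₁ s L₂ l = 0 := by
  induction L₁ generalizing l with
  | nil =>
    match l with
    | [] => rfl
    | x :: l => simp [coT, coQ_eq_zero (by simpa using ht) h]
  | cons s' L ih =>
    match l with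
    | [] => rfl
    | [x] => rfl
    | x :: y :: l =>
      rcases ht with ht | ht
      · rcases List.mem_cons.1 ht with rfl | ht
        · simp [coT, h x (by simp) y (by simp), add_self_F2]
        · simp [coT, ih (Or.inl ht) h.tail]
      · simp [coT, ih (Or.inr ht) h.tail]

lemma coT_add (L₁ L₂ : List (Y → F2)) (s s' : Y → F2) (l : List Y) :
    coT L₁ s L₂ l + coT L₁ s' L₂ l = coT L₁ (s + s') L₂ l := by
  induction L₁ generalizing l with
  | nil => cases l <;> simp [coT, add_mul]
  | cons t L ih =>
    match l with
    | [] => simp [coT]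
    | [x] => simp [coT]
    | x :: y :: l => simp only [coT]; rw [← mul_add, ih]

lemma coT_zero_of {L₁ L₂ : List (Y → F2)} {s : Y → F2} {l : List Y} (h : ∀ x ∈ l, s x = 0) :
    coT L₁ s L₂ l = 0 := by
  induction L₁ generalizing l with
  | nil =>
    match l with
    | [] => rfl
    | x :: l => simp [coT, h x (by simp)]
  | cons t L ih =>
    match l with
    | [] => rfl
    | [x] => rfl
    | x :: y :: l => simp [coT, ih (fun z hz => h z (List.mem_cons_of_mem _ hz))]

lemma coQ_map (f : Y → Z) (L : List (Z → F2)) (l : List Y) :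
    coQ (L.map (· ∘ f)) l = coQ L (l.map f) := by
  induction L generalizing l with
  | nil =>
    match l with
    | [] => rfl
    | [x] => rfl
    | x :: y :: l => rfl
  | cons s L ih =>
    match l with
    | [] => rfl
    | [x] => rfl
    | x :: y :: l => have := ih (y :: l); simp_all [coQ]

lemma coP_map (f : Y → Z) (L : List (Z → F2)) (l : List Y) :
    coP (L.map (· ∘ f)) l = coP L (l.map f) := by
  cases L with
  | nil => cases l <;> rfl
  | cons s L => cases l with
    | nil => rfl
    | cons x l => have := coQ_map f L (x :: l); simp_all [coP, coT]

lemma lext_coP_mp (f : Y → Z) (L : List (Z → F2)) (c : Ch Y) :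
    lext (coP L) (mp f c) = lext (coP (L.map (· ∘ f))) c :=
  lin_ext (f := lext (coP L) ∘ₗ mp f) (g := lext (coP (L.map (· ∘ f))))
    (fun l => by simp [coP_map]) c

/-! ### Supports -/

/-- The chains supported in a set of lists. -/
def Sup (S : Set (List Y)) : Submodule F2 (Ch Y) := Finsupp.supported F2 F2 S

lemma sg_mem_Sup {S : Set (List Y)} {l : List Y} (h : l ∈ S) : sg l ∈ Sup S :=
  Finsupp.single_mem_supported F2 1 h

lemma Sup_mono {S T : Set (List Y)} (h : S ⊆ T) : Sup S ≤ Sup T := Finsupp.supported_mono h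

lemma Sup_induction {M : Type*} [AddCommGroup M] [Module F2 M] {S : Set (List Y)}
    (φ : Ch Y →ₗ[F2] M) (T : Submodule F2 M) (h : ∀ l ∈ S, φ (sg l) ∈ T) {c : Ch Y}
    (hc : c ∈ Sup S) : φ c ∈ T := by
  have : Sup S ≤ T.comap φ := by
    rw [Sup, Finsupp.supported_eq_span_single, Submodule.span_le]
    rintro _ ⟨l, hl, rfl⟩
    exact h l hl
  exact this hc

lemma lext_congr {M : Type*} [AddCommGroup M] [Module F2 M] {S : Set (List Y)}
    {φ ψ : List Y → M} (h : ∀ l ∈ S, φ l = ψ l) {c : Ch Y} (hc : c ∈ Sup S) :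
    lext φ c = lext ψ c := by
  have := Sup_induction (lext φ - lext ψ) ⊥ (S := S)
    (fun l hl => by simp [h l hl]) hc
  simpa [sub_eq_zero] using this

lemma lext_eq_zero {M : Type*} [AddCommGroup M] [Module F2 M] {S : Set (List Y)}
    {φ : List Y → M} (h : ∀ l ∈ S, φ l = 0) {c : Ch Y} (hc : c ∈ Sup S) : lext φ c = 0 := by
  have := Sup_induction (lext φ) ⊥ (S := S) (fun l hl => by simp [h l hl]) hc
  simpa using this

lemma Sup_map {S : Set (List Y)} {T : Set (List Z)}
    (φ : Ch Y →ₗ[F2] Ch Z) (h : ∀ l ∈ S, φ (sg l) ∈ Sup T) {c : Ch Y}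
    (hc : c ∈ Sup S) : φ c ∈ Sup T := Sup_induction φ _ h hc

open Classical in
/-- The part of a chain supported on the lists satisfying a predicate. -/
def filt (p : Set (List Y)) : Ch Y →ₗ[F2] Ch Y := lext fun l => if l ∈ p then sg l else 0

lemma filt_mem {S p : Set (List Y)} {c : Ch Y} (hc : c ∈ Sup S) : filt p c ∈ Sup (S ∩ p) := by
  refine Sup_map _ (fun l hl => ?_) hc
  by_cases h : l ∈ p
  · simpa [filt, h] using sg_mem_Sup (S := S ∩ p) ⟨hl, h⟩
  · simp [filt, h]

lemma filt_add_compl (p : Set (List Y)) (c : Ch Y) : filt p c + filt pᶜ c = c := by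
  have := lin_ext (f := filt p + filt pᶜ) (g := LinearMap.id) (fun l => by
    by_cases h : l ∈ p <;> simp [filt, h]) c
  simpa using this

lemma lext_filt (p : Set (List Y)) {M : Type*} [AddCommGroup M] [Module F2 M]
    (φ : List Y → M) (c : Ch Y) :
    lext φ (filt p c) = lext (fun l => (open Classical in if l ∈ p then φ l else 0)) c := by
  refine lin_ext (f := lext φ ∘ₗ filt p) (fun l => ?_) c
  by_cases h : l ∈ p <;> simp [filt, h]

/-- The lists obtained from `l` by deleting one entry. -/
def faces (l : List Y) : Set (List Y) := {m | m.Sublist l ∧ m.length + 1 = l.length}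

lemma cons_mem {S T : Set (List Y)} {x : Y} (h : ∀ l ∈ S, x :: l ∈ T) {c : Ch Y}
    (hc : c ∈ Sup S) : cons x c ∈ Sup T :=
  Sup_map _ (fun l hl => by simpa using sg_mem_Sup (h l hl)) hc

lemma mp_mem {S : Set (List Y)} {T : Set (List Z)} {f : Y → Z} (h : ∀ l ∈ S, l.map f ∈ T)
    {c : Ch Y} (hc : c ∈ Sup S) : mp f c ∈ Sup T :=
  Sup_map _ (fun l hl => by simpa using sg_mem_Sup (h l hl)) hc

lemma bdL_mem_faces (l : List Y) : bdL l ∈ Sup (faces l) := by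
  induction l with
  | nil => simp [bdL]
  | cons x l ih =>
    rw [bdL_cons]
    refine add_mem (sg_mem_Sup ⟨by simp, by simp⟩) (cons_mem (fun m hm => ?_) ih)
    exact ⟨by simpa using hm.1, by simpa using hm.2⟩

lemma bd_mem {S T : Set (List Y)} (h : ∀ l ∈ S, faces l ⊆ T) {c : Ch Y} (hc : c ∈ Sup S) :
    bd c ∈ Sup T :=
  Sup_map _ (fun l hl => by simpa using Sup_mono (h l hl) (bdL_mem_faces l)) hc

/-- The lists of length `r` with entries in `U` and whose pairs of entries satisfy `R`. -/
def Lst (r : ℕ) (R : Y → Y → Prop) (U : Set Y) : Set (List Y) :=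
  {l | l.length = r ∧ (∀ x ∈ l, ∀ y ∈ l, R x y) ∧ ∀ x ∈ l, x ∈ U}

lemma Lst_mono {r : ℕ} {R R' : Y → Y → Prop} {U U' : Set Y} (hR : ∀ x y, R x y → R' x y)
    (hU : U ⊆ U') : Lst r R U ⊆ Lst r R' U' :=
  fun _ hl => ⟨hl.1, fun x hx y hy => hR _ _ (hl.2.1 x hx y hy), fun x hx => hU (hl.2.2 x hx)⟩

lemma bd_Lst {r : ℕ} {R : Y → Y → Prop} {U : Set Y} {c : Ch Y}
    (hc : c ∈ Sup (Lst (r + 1) R U)) : bd c ∈ Sup (Lst r R U) := by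
  refine bd_mem (fun l hl m hm => ?_) hc
  have hs := hm.1.subset
  exact ⟨by have := hm.2; have := hl.1; omega, fun x hx y hy => hl.2.1 x (hs hx) y (hs hy),
    fun x hx => hl.2.2 x (hs hx)⟩

lemma mp_Lst {r : ℕ} {R : Y → Y → Prop} {U : Set Y} {R' : Z → Z → Prop} {U' : Set Z}
    {f : Y → Z} (hR : ∀ x ∈ U, ∀ y ∈ U, R x y → R' (f x) (f y)) (hU : ∀ x ∈ U, f x ∈ U')
    {c : Ch Y} (hc : c ∈ Sup (Lst r R U)) : mp f c ∈ Sup (Lst r R' U') := by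
  refine mp_mem (T := Lst r R' U') (fun l hl => ⟨by simpa using hl.1, ?_, ?_⟩) hc
  · simp only [List.mem_map]
    rintro _ ⟨x, hx, rfl⟩ _ ⟨y, hy, rfl⟩
    exact hR x (hl.2.2 x hx) y (hl.2.2 y hy) (hl.2.1 x hx y hy)
  · simp only [List.mem_map]
    rintro _ ⟨x, hx, rfl⟩
    exact hU x (hl.2.2 x hx)

/-- The lists whose entries are images of entries of `l`, one longer than `l`. -/
def prSet (f g : Y → Z) (l : List Y) : Set (List Z) :=
  {m | m.length = l.length + 1 ∧ ∀ z ∈ m, ∃ x ∈ l, z = f x ∨ z = g x}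

lemma prL_mem (f g : Y → Z) (l : List Y) : prL f g l ∈ Sup (prSet f g l) := by
  induction l with
  | nil => simp [prL]
  | cons x l ih =>
    rw [prL]
    refine add_mem (sg_mem_Sup (S := prSet f g (x :: l)) ⟨by simp, ?_⟩)
      (cons_mem (T := prSet f g (x :: l)) (fun m hm => ⟨by simp [hm.1], ?_⟩) ih)
    · simp only [List.mem_cons, List.mem_map]
      rintro z (rfl | rfl | ⟨y, hy, rfl⟩)
      · exact ⟨x, by simp⟩
      · exact ⟨x, by simp⟩
      · exact ⟨y, by simp [hy]⟩
    · simp only [List.mem_cons]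
      rintro z (rfl | hz)
      · exact ⟨x, by simp⟩
      · obtain ⟨y, hy, h⟩ := hm.2 z hz
        exact ⟨y, Or.inr hy, h⟩

lemma pr_Lst {r : ℕ} {R : Y → Y → Prop} {U : Set Y} {R' : Z → Z → Prop} {U' : Set Z}
    {f g : Y → Z}
    (hR : ∀ x ∈ U, ∀ y ∈ U, R x y → R' (f x) (f y) ∧ R' (f x) (g y) ∧ R' (g x) (f y) ∧
      R' (g x) (g y)) (hU : ∀ x ∈ U, f x ∈ U' ∧ g x ∈ U')
    {c : Ch Y} (hc : c ∈ Sup (Lst r R U)) : pr f g c ∈ Sup (Lst (r + 1) R' U') := by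
  refine Sup_map _ (fun l hl => ?_) hc
  rw [pr, lext_sg]
  refine Sup_mono (T := Lst (r + 1) R' U') (fun m hm => ⟨by rw [hm.1, hl.1], fun z hz w hw => ?_, fun z hz => ?_⟩)
    (prL_mem f g l)
  · obtain ⟨x, hx, h⟩ := hm.2 z hz
    obtain ⟨y, hy, h'⟩ := hm.2 w hw
    obtain ⟨h1, h2, h3, h4⟩ := hR x (hl.2.2 x hx) y (hl.2.2 y hy) (hl.2.1 x hx y hy)
    rcases h with rfl | rfl <;> rcases h' with rfl | rfl <;> assumption
  · obtain ⟨x, hx, h⟩ := hm.2 z hz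
    obtain ⟨h1, h2⟩ := hU x (hl.2.2 x hx)
    rcases h with rfl | rfl <;> assumption

lemma prs_Lst {r : ℕ} {R : Y → Y → Prop} {U : Set Y} {R' : Z → Z → Prop} {U' : Set Z}
    {h : ℕ → Y → Z} {m : ℕ}
    (hR : ∀ k < m, ∀ x ∈ U, ∀ y ∈ U, R x y → R' (h k x) (h k y) ∧ R' (h k x) (h (k + 1) y) ∧
      R' (h (k + 1) x) (h k y) ∧ R' (h (k + 1) x) (h (k + 1) y))
    (hU : ∀ k ≤ m, ∀ x ∈ U, h k x ∈ U')
    {c : Ch Y} (hc : c ∈ Sup (Lst r R U)) : prs h m c ∈ Sup (Lst (r + 1) R' U') := by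
  rw [prs, LinearMap.sum_apply]
  refine sum_mem fun k hk => ?_
  have hk := Finset.mem_range.1 hk
  exact pr_Lst (hR k hk) (fun x hx => ⟨hU k hk.le x hx, hU (k + 1) hk x hx⟩) hc

lemma cons_Lst {r : ℕ} {R R' : Y → Y → Prop} {U U' : Set Y} {v : Y} (hv : v ∈ U') (hvv : R' v v)
    (hR : ∀ x ∈ U, ∀ y ∈ U, R x y → R' x y) (hR' : ∀ x ∈ U, R' x v ∧ R' v x)
    (hU : U ⊆ U') {c : Ch Y} (hc : c ∈ Sup (Lst r R U)) :
    cons v c ∈ Sup (Lst (r + 1) R' U') := by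
  refine cons_mem (T := Lst (r + 1) R' U') (fun l hl => ⟨by simp [hl.1], ?_, ?_⟩) hc
  · simp only [List.mem_cons]
    rintro x (rfl | hx) y (rfl | hy)
    · exact hvv
    · exact (hR' y (hl.2.2 y hy)).2
    · exact (hR' x (hl.2.2 x hx)).1
    · exact hR x (hl.2.2 x hx) y (hl.2.2 y hy) (hl.2.1 x hx y hy)
  · simp only [List.mem_cons]
    rintro x (rfl | hx)
    · exact hv
    · exact hU (hl.2.2 x hx)

end Chains
end DeRahmSplit

namespace DeRahmSplit

section Chains2
variable {Y Z : Type*}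

lemma mp_congr {S : Set (List Y)} {f g : Y → Z} (h : ∀ l ∈ S, ∀ x ∈ l, f x = g x) {c : Ch Y}
    (hc : c ∈ Sup S) : mp f c = mp g c := by
  have := Sup_induction (mp f - mp g) ⊥ (S := S) (fun l hl => by
    have : l.map f = l.map g := List.map_congr_left (h l hl)
    simp [this]) hc
  simpa [sub_eq_zero] using this

lemma mp_eq_self {S : Set (List Y)} {f : Y → Y} (h : ∀ l ∈ S, ∀ x ∈ l, f x = x) {c : Ch Y}
    (hc : c ∈ Sup S) : mp f c = c := by
  rw [mp_congr (g := id) (fun l hl x hx => h l hl x hx) hc, mp_id]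

/-- The set of points occurring in a chain. -/
def verts (c : Ch Y) : Set Y := {x | ∃ l ∈ c.support, x ∈ l}

lemma verts_finite (c : Ch Y) : (verts c).Finite := by
  have : verts c = ⋃ l ∈ c.support, {x | x ∈ l} := by ext; simp [verts]
  rw [this]
  exact Set.Finite.biUnion c.support.finite_toSet fun l _ => l.finite_toSet

lemma Sup_Lst_mono {r : ℕ} {R R' : Y → Y → Prop} {U U' : Set Y} (hR : ∀ x y, R x y → R' x y)
    (hU : U ⊆ U') {c : Ch Y} (hc : c ∈ Sup (Lst r R U)) : c ∈ Sup (Lst r R' U') :=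
  Sup_mono (Lst_mono hR hU) hc

lemma bd_of_length_zero {R : Y → Y → Prop} {U : Set Y} {c : Ch Y}
    (hc : c ∈ Sup (Lst 0 R U)) : bd c = 0 := by
  have := Sup_induction bd ⊥ (S := Lst 0 R U) (fun l hl => by
    have : l = [] := by simpa using hl.1
    simp [this, bdL]) hc
  simpa using this

open Classical in
lemma apply_eq_lext (c : Ch Y) (l : List Y) : c l = lext (fun m => if m = l then (1 : F2) else 0) c := by
  refine lin_ext (f := Finsupp.lapply l) (fun m => ?_) c
  rw [lext_sg]
  simp [sg, Finsupp.single_apply]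

end Chains2

section Metric
variable {Y : Type*} [MetricSpace Y]

/-- The relation of being at distance at most `ε`. -/
def Near (ε : ℝ) (x y : Y) : Prop := dist x y ≤ ε

/-- The complement of a ball. -/
def Off (q : Y) (δ : ℝ) : Set Y := {x | δ ≤ dist x q}

/-- The function `s` is locally constant away from `y`, up to `δ`, in the strong sense that
points with different values are joined through `y`. -/
def Adm (δ : ℝ) (y : Y) (s : Y → F2) : Prop :=
  ∀ z z', s z ≠ s z' → dist z y + dist z' y ≤ dist z z' + 2 * δ

lemma Adm.mono {δ δ' : ℝ} {y : Y} {s : Y → F2} (h : Adm δ y s) (hδ : δ ≤ δ') : Adm δ' y s :=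
  fun z z' hz => (h z z' hz).trans (by linarith)

lemma Near.mono {ε ε' : ℝ} (h : ε ≤ ε') {x y : Y} (hx : Near ε x y) : Near ε' x y :=
  le_trans hx h

lemma Off_mono {q : Y} {δ δ' : ℝ} (h : δ' ≤ δ) : Off q δ ⊆ Off q δ' := fun _ hx => h.trans hx

lemma Adm.constOn {δ η ε : ℝ} {q : Y} {s : Y → F2} (hs : Adm η q s) {x : Y} {l : List Y}
    (hx : x ∈ l) (hq : δ ≤ dist x q) (hl : ∀ x ∈ l, ∀ y ∈ l, dist x y ≤ ε)
    (h : 3 * ε + 2 * η < 2 * δ) : ConstOn s l := by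
  intro a ha b hb
  by_contra hab
  have h1 := hs a b hab
  have h2 := hl a ha b hb
  have h3 := hl x hx a ha
  have h4 := hl x hx b hb
  have h5 := dist_triangle x a q
  have h6 := dist_triangle x b q
  linarith

variable (Y)

/-- Any two points are joined by a geodesic. -/
def Geod : Prop := ∀ x y : Y, ∃ γ : ℝ → Y, γ 0 = x ∧ γ (dist x y) = y ∧
  ∀ s ∈ Set.Icc 0 (dist x y), ∀ t ∈ Set.Icc 0 (dist x y), dist (γ s) (γ t) ≤ |s - t|

/-- The space is contractible to any point, by uniformly Lipschitz discrete homotopies. -/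
def Contr : Prop := ∃ C : ℝ, 1 ≤ C ∧ ∀ (e : Y) (ε : ℝ), 0 < ε → ∀ F : Set Y, F.Finite →
  ∃ (h : ℕ → Y → Y) (m : ℕ), (∀ x, h 0 x = x) ∧ (∀ k, h k e = e) ∧
    (∀ k x y, dist (h k x) (h k y) ≤ C * dist x y) ∧ (∀ k x, dist (h k x) (h (k + 1) x) ≤ ε) ∧
    ∀ k, m ≤ k → ∀ x ∈ F, h k x = e

/-- The space is unbounded. -/
def Far : Prop := ∀ (q : Y) (δ : ℝ), ∃ x : Y, δ ≤ dist x q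

/-- Fine cycles off a point, of length at most `N`, on which all the tests vanish,
bound off this point, with linear control. -/
def Fills (N : ℕ) (Test : Y → ℝ → Set (List (Y → F2))) : Prop :=
  ∃ C : ℝ, 1 ≤ C ∧ ∀ (q : Y) (ε δ : ℝ), 0 < ε → 0 < δ → C * ε ≤ δ → ∀ r ≤ N, ∀ c : Ch Y,
    c ∈ Sup (Lst r (Near ε) (Off q δ)) → bd c = 0 →
    (r < N ∨ ∀ L ∈ Test q (δ / 4), lext (coP L) c = 0) →
    ∃ e ∈ Sup (Lst (r + 1) (Near (C * ε)) (Off q (δ / C))), bd e = c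

/-- The package of properties of a space propagated to products. -/
structure FillData (N : ℕ) (Test : Y → ℝ → Set (List (Y → F2))) : Prop where
  pos : 0 < N
  fills : Fills Y N Test
  contr : Contr Y
  far : Far Y
  const : ∀ q η, ∀ L ∈ Test q η, ∀ (ε δ : ℝ) (l : List Y), ∀ x ∈ l, δ ≤ dist x q →
    (∀ x ∈ l, ∀ y ∈ l, dist x y ≤ ε) → 3 * ε + 2 * η < 2 * δ → ∃ s ∈ L, ConstOn s l
  length : ∀ q η, ∀ L ∈ Test q η, L.length = N
  mono : ∀ q η η', η ≤ η' → Test q η ⊆ Test q η'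

variable {Y}

/-- Points in the same branch at `q`, at scale `η`. -/
def Branch (q : Y) (η : ℝ) : Y → Y → Prop :=
  Relation.EqvGen fun z z' => dist z z' + 2 * η < dist z q + dist z' q

open Classical in
/-- The indicator function of the branch of a point. -/
def branchInd (q : Y) (η : ℝ) (e : Y) : Y → F2 := fun z => if Branch q η e z then 1 else 0

lemma branchInd_adm (q : Y) (η : ℝ) (e : Y) : Adm η q (branchInd q η e) := by
  intro z z' h
  by_contra hlt
  push Not at hlt
  apply h
  have h1 : Branch q η z z' := Relation.EqvGen.rel _ _ hlt
  have : Branch q η e z ↔ Branch q η e z' :=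
    ⟨fun h => h.trans _ _ _ h1, fun h => h.trans _ _ _ (h1.symm _ _)⟩
  unfold branchInd
  split_ifs <;> tauto

/-- A discrete path with steps at most `ε` in the set `U`. -/
def DPath (ε : ℝ) (U : Set Y) (x y : Y) : Prop :=
  ∃ (p : ℕ → Y) (m : ℕ), p 0 = x ∧ p m = y ∧ (∀ k < m, dist (p k) (p (k + 1)) ≤ ε) ∧
    ∀ k ≤ m, p k ∈ U

lemma DPath.refl {ε : ℝ} {U : Set Y} {x : Y} (hx : x ∈ U) : DPath ε U x x :=
  ⟨fun _ => x, 0, rfl, rfl, by simp, by simpa using hx⟩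

lemma DPath.symm {ε : ℝ} {U : Set Y} {x y : Y} (h : DPath ε U x y) : DPath ε U y x := by
  obtain ⟨p, m, h0, h1, h2, h3⟩ := h
  refine ⟨fun k => p (m - k), m, by simpa, by simpa, fun k hk => ?_, fun k _ => h3 _ (by omega)⟩
  have := h2 (m - (k + 1)) (by omega)
  rw [show m - (k + 1) + 1 = m - k by omega] at this
  rwa [dist_comm]

lemma DPath.trans {ε : ℝ} {U : Set Y} {x y z : Y} (h : DPath ε U x y) (h' : DPath ε U y z) :
    DPath ε U x z := by
  obtain ⟨p, m, h0, h1, h2, h3⟩ := h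
  obtain ⟨p', m', h0', h1', h2', h3'⟩ := h'
  refine ⟨fun k => if k ≤ m then p k else p' (k - m), m + m', by simpa, ?_, ?_, ?_⟩
  · by_cases hm : m' = 0
    · subst hm; simp [h1, ← h1', h0']
    · simp [hm, h1']
  · intro k hk
    by_cases h : k + 1 ≤ m
    · simpa [h, (by omega : k ≤ m)] using h2 k (by omega)
    · by_cases hk' : k = m
      · subst hk'
        simpa [h1, ← h0'] using h2' 0 (by omega)
      · have := h2' (k - m) (by omega)
        have hkm : ¬ k ≤ m := by omega
        simp only [h, hkm, if_false, (by omega : k + 1 - m = k - m + 1)]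
        exact this
  · intro k hk
    by_cases h : k ≤ m
    · simpa [h] using h3 k h
    · simpa [h] using h3' (k - m) (by omega)

lemma Geod.dpath (hY : Geod Y) {ε : ℝ} (hε : 0 < ε) (x y : Y) :
    DPath ε {z | dist x z + dist z y ≤ dist x y} x y := by
  obtain ⟨γ, h0, h1, h2⟩ := hY x y
  set d := dist x y with hd
  have hd0 : 0 ≤ d := dist_nonneg
  obtain ⟨m, hm⟩ := exists_nat_gt (d / ε)
  have hm0 : (0 : ℝ) < m := lt_of_le_of_lt (by positivity) hm
  have hmε : d < m * ε := by rwa [div_lt_iff₀ hε] at hm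
  have hmem : ∀ k : ℕ, k ≤ m → (k : ℝ) / m * d ∈ Set.Icc 0 d := fun k hk => by
    have : (k : ℝ) / m ≤ 1 := by rw [div_le_one hm0]; exact_mod_cast hk
    exact ⟨by positivity, by nlinarith⟩
  refine ⟨fun k => γ (k / m * d), m, by simp [h0], by simp [hm0.ne', h1], fun k hk => ?_,
    fun k hk => ?_⟩
  · refine (h2 _ (hmem k hk.le) _ (hmem (k + 1) hk)).trans ?_
    rw [show (k : ℝ) / m * d - ((k + 1 : ℕ) : ℝ) / m * d = - (d / m) by push_cast; ring, abs_neg,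
      abs_of_nonneg (by positivity), div_le_iff₀ hm0]
    linarith
  · have a := h2 0 ⟨le_refl _, hd0⟩ _ (hmem k hk)
    have b := h2 _ (hmem k hk) d ⟨hd0, le_refl _⟩
    rw [h0, zero_sub, abs_neg, abs_of_nonneg (hmem k hk).1] at a
    rw [h1, abs_of_nonpos (by linarith [(hmem k hk).2])] at b
    simp only [Set.mem_ofPred_eq]
    linarith

lemma branch_dpath (hY : Geod Y) {ε : ℝ} (hε : 0 < ε) {q : Y} {η : ℝ} {x y : Y}
    (h : Branch q η x y) (hx : η ≤ dist x q) (hy : η ≤ dist y q) : DPath ε (Off q η) x y := by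
  have key : ∀ x y : Y, Branch q η x y → x = y ∨ DPath ε (Off q η) x y := by
    intro x y h
    induction h with
    | rel x y h =>
      right
      obtain ⟨p, m, h0, h1, h2, h3⟩ := hY.dpath hε x y
      refine ⟨p, m, h0, h1, h2, fun k hk => ?_⟩
      have := h3 k hk
      have a := dist_triangle x (p k) q
      have b := dist_triangle_left y q (p k)
      simp only [Off, Set.mem_ofPred_eq] at this ⊢
      linarith
    | refl x => exact Or.inl rfl
    | symm x y _ ih =>
      rcases ih with rfl | ih
      · exact Or.inl rfl
      · exact Or.inr ih.symm
    | trans x y z _ _ ih ih' =>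
      rcases ih with rfl | ih
      · exact ih'
      · rcases ih' with rfl | ih'
        · exact Or.inr ih
        · exact Or.inr (ih.trans ih')
  rcases key x y h with rfl | h
  · exact DPath.refl hx
  · exact h

end Metric
end DeRahmSplit

namespace DeRahmSplit

section Homotopy
variable {X Y Y' : Type*} [MetricSpace X] [MetricSpace Y] [MetricSpace Y']

lemma dpath_chain {ε : ℝ} (hε : 0 ≤ ε) {U : Set Y} {x y : Y} (h : DPath ε U x y) :
    ∃ k ∈ Sup (Lst 2 (Near ε) U), bd k = sg [x] + sg [y] := by
  obtain ⟨p, m, h0, h1, h2, h3⟩ := h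
  refine ⟨prs (fun k (_ : Unit) => p k) m (sg [()]), ?_, ?_⟩
  · refine prs_Lst (R := fun _ _ => True) (U := Set.univ) (r := 1) ?_ ?_ (sg_mem_Sup ?_)
    · intro k hk _ _ _ _ _
      have := h2 k hk
      simp [Near, hε, this, dist_comm (p (k + 1)) (p k)]
    · intro k hk _ _; exact h3 k hk
    · exact ⟨rfl, by simp, by simp⟩
  · have := bd_prs (fun k (_ : Unit) => p k) m (sg [()])
    simpa [bdL, prs, pr, prL, h0, h1] using this

lemma homotopy_chain {h : ℕ → X → X} {m : ℕ} {C ε : ℝ} (hε : 0 ≤ ε) {T : X → X} {F : Set X}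
    (h0 : ∀ x, h 0 x = x) (hL : ∀ k x y, dist (h k x) (h k y) ≤ C * dist x y)
    (hC : 0 ≤ C) (hs : ∀ k x, dist (h k x) (h (k + 1) x) ≤ ε) (hm : ∀ x ∈ F, h m x = T x) :
    (∀ c ∈ Sup {l : List X | ∀ x ∈ l, x ∈ F},
      bd (prs h m c) + prs h m (bd c) = c + mp T c) ∧
    ∀ (r : ℕ) (ε₁ : ℝ) (U U' : Set X), (∀ p ∈ U, ∀ k, h k p ∈ U') →
      ∀ c ∈ Sup (Lst r (Near ε₁) U), prs h m c ∈ Sup (Lst (r + 1) (Near (C * ε₁ + ε)) U') := by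
  constructor
  · intro c hc
    rw [bd_prs, mp_eq_self (fun l _ x _ => h0 x) hc, mp_congr (S := {l : List X | ∀ x ∈ l, x ∈ F})
      (fun l hl x hx => hm x (hl x hx)) hc]
  · intro r ε₁ U U' hU c hc
    refine prs_Lst (fun k _ x _ y _ hxy => ?_) (fun k _ x hx => hU x hx k) hc
    have hxy : dist x y ≤ ε₁ := hxy
    have a := hL k x y
    have a' := hL (k + 1) x y
    have b := hs k x
    have b' := hs k y
    have e := mul_le_mul_of_nonneg_left hxy hC
    have t := dist_triangle (h k x) (h k y) (h (k + 1) y)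
    have t' := dist_triangle (h (k + 1) x) (h k x) (h k y)
    rw [dist_comm (h (k + 1) x) (h k x)] at t'
    refine ⟨?_, ?_, ?_, ?_⟩ <;> simp only [Near] <;> linarith

/-- The properties of the operator contracting the first coordinate. -/
lemma Contr.left (hY : Contr Y) : ∃ C : ℝ, 1 ≤ C ∧ ∀ (u : Y) (ε : ℝ), 0 < ε → ∀ F : Set Y,
    F.Finite → ∃ D : Ch (Y × Y') →ₗ[F2] Ch (Y × Y'),
      (∀ c ∈ Sup {l : List (Y × Y') | ∀ x ∈ l, x.1 ∈ F},
        bd (D c) + D (bd c) = c + mp (fun p => (u, p.2)) c) ∧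
      ∀ (r : ℕ) (ε₁ : ℝ) (U U' : Set (Y × Y')),
        (∀ p ∈ U, ∀ a, dist a u ≤ C * dist p.1 u → (a, p.2) ∈ U') →
        ∀ c ∈ Sup (Lst r (Near ε₁) U), D c ∈ Sup (Lst (r + 1) (Near (C * ε₁ + ε)) U') := by
  obtain ⟨C, hC, H⟩ := hY
  refine ⟨C, hC, fun u ε hε F hF => ?_⟩
  obtain ⟨h, m, h0, he, hL, hs, hm⟩ := H u ε hε F hF
  obtain ⟨h1, h2⟩ := homotopy_chain (X := Y × Y') (h := fun k p => (h k p.1, p.2)) (m := m)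
    (C := C) (ε := ε) hε.le (T := fun p => (u, p.2)) (F := {p | p.1 ∈ F})
    (fun x => by simp [h0]) (fun k x y => by
      rw [Prod.dist_eq, Prod.dist_eq]
      refine max_le ((hL k _ _).trans ?_) ?_
      · exact mul_le_mul_of_nonneg_left (le_max_left _ _) (by linarith)
      · refine (le_max_right (dist x.1 y.1) _).trans ?_
        exact le_mul_of_one_le_left (le_max_of_le_left dist_nonneg) hC)
    (by linarith) (fun k x => by
      rw [Prod.dist_eq]
      exact max_le (hs k _) (by simp [hε.le]))
    (fun x hx => by simp [hm m le_rfl _ hx])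
  refine ⟨prs (fun k p => (h k p.1, p.2)) m, h1, fun r ε₁ U U' hU => h2 r ε₁ U U' ?_⟩
  intro p hp k
  refine hU p hp _ ?_
  have := hL k p.1 u
  rwa [he] at this

/-- The properties of the operator contracting the second coordinate. -/
lemma Contr.right (hY : Contr Y') : ∃ C : ℝ, 1 ≤ C ∧ ∀ (u : Y') (ε : ℝ), 0 < ε → ∀ F : Set Y',
    F.Finite → ∃ D : Ch (Y × Y') →ₗ[F2] Ch (Y × Y'),
      (∀ c ∈ Sup {l : List (Y × Y') | ∀ x ∈ l, x.2 ∈ F},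
        bd (D c) + D (bd c) = c + mp (fun p => (p.1, u)) c) ∧
      ∀ (r : ℕ) (ε₁ : ℝ) (U U' : Set (Y × Y')),
        (∀ p ∈ U, ∀ a, dist a u ≤ C * dist p.2 u → (p.1, a) ∈ U') →
        ∀ c ∈ Sup (Lst r (Near ε₁) U), D c ∈ Sup (Lst (r + 1) (Near (C * ε₁ + ε)) U') := by
  obtain ⟨C, hC, H⟩ := hY
  refine ⟨C, hC, fun u ε hε F hF => ?_⟩
  obtain ⟨h, m, h0, he, hL, hs, hm⟩ := H u ε hε F hF
  obtain ⟨h1, h2⟩ := homotopy_chain (X := Y × Y') (h := fun k p => (p.1, h k p.2)) (m := m)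
    (C := C) (ε := ε) hε.le (T := fun p => (p.1, u)) (F := {p | p.2 ∈ F})
    (fun x => by simp [h0]) (fun k x y => by
      rw [Prod.dist_eq, Prod.dist_eq]
      refine max_le ?_ ((hL k _ _).trans ?_)
      · refine (le_max_left _ (dist x.2 y.2)).trans ?_
        exact le_mul_of_one_le_left (le_max_of_le_left dist_nonneg) hC
      · exact mul_le_mul_of_nonneg_left (le_max_right _ _) (by linarith))
    (by linarith) (fun k x => by
      rw [Prod.dist_eq]
      exact max_le (by simp [hε.le]) (hs k _))
    (fun x hx => by simp [hm m le_rfl _ hx])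
  refine ⟨prs (fun k p => (p.1, h k p.2)) m, h1, fun r ε₁ U U' hU => h2 r ε₁ U U' ?_⟩
  intro p hp k
  refine hU p hp _ ?_
  have := hL k p.2 u
  rwa [he] at this

lemma Contr.prod (h : Contr Y) (h' : Contr Y') : Contr (Y × Y') := by
  obtain ⟨C, hC, H⟩ := h
  obtain ⟨C', hC', H'⟩ := h'
  refine ⟨max C C', le_max_of_le_left hC, fun e ε hε F hF => ?_⟩
  obtain ⟨h, m, h0, he, hL, hs, hm⟩ := H e.1 ε hε (Prod.fst '' F) (hF.image _)
  obtain ⟨h', m', h0', he', hL', hs', hm'⟩ := H' e.2 ε hε (Prod.snd '' F) (hF.image _)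
  refine ⟨fun k p => (h k p.1, h' k p.2), max m m', ?_, ?_, ?_, ?_, ?_⟩
  · simp [h0, h0']
  · simp [he, he']
  · intro k x y
    rw [Prod.dist_eq, Prod.dist_eq]
    have a := hL k x.1 y.1
    have b := hL' k x.2 y.2
    have p1 : (0 : ℝ) ≤ dist x.1 y.1 := dist_nonneg
    have p2 : (0 : ℝ) ≤ dist x.2 y.2 := dist_nonneg
    refine max_le (a.trans ?_) (b.trans ?_)
    · exact mul_le_mul (le_max_left _ _) (le_max_left _ _) p1 (le_max_of_le_left (by linarith))
    · exact mul_le_mul (le_max_right _ _) (le_max_right _ _) p2 (le_max_of_le_left (by linarith))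
  · intro k x
    rw [Prod.dist_eq]
    exact max_le (hs k _) (hs' k _)
  · intro k hk x hx
    simp [hm k ((le_max_left _ _).trans hk) x.1 ⟨x, hx, rfl⟩,
      hm' k ((le_max_right _ _).trans hk) x.2 ⟨x, hx, rfl⟩]

end Homotopy

section Base
variable {Y : Type*} [MetricSpace Y]

/-- The tests on a single factor. -/
def Test1 (Y : Type*) [MetricSpace Y] (q : Y) (η : ℝ) : Set (List (Y → F2)) :=
  {L | ∃ s, Adm η q s ∧ L = [s]}

lemma fill_length_zero {q x : Y} {ε ε' δ δ' : ℝ} (hx : δ' ≤ dist x q) (hε : 0 ≤ ε') {c : Ch Y}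
    (hc : c ∈ Sup (Lst 0 (Near ε) (Off q δ))) :
    ∃ e ∈ Sup (Lst 1 (Near ε') (Off q δ')), bd e = c := by
  refine ⟨cons x c, ?_, cycle_eq x (bd_of_length_zero hc)⟩
  refine cons_mem (T := Lst 1 (Near ε') (Off q δ')) (fun l hl => ?_) hc
  have : l = [] := by simpa using hl.1
  subst this
  exact ⟨rfl, by simpa [Near] using hε, by simpa [Off] using hx⟩

/-- A representative of the branch of a point. -/
def brep (q : Y) (η : ℝ) (x : Y) : Y :=
  haveI : Nonempty Y := ⟨q⟩
  Classical.epsilon fun y => Branch q η x y ∧ η ≤ dist y q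

lemma brep_spec {q : Y} {η : ℝ} {x : Y} (hx : η ≤ dist x q) :
    Branch q η x (brep q η x) ∧ η ≤ dist (brep q η x) q :=
  Classical.epsilon_spec (p := fun y => Branch q η x y ∧ η ≤ dist y q)
    ⟨x, Relation.EqvGen.refl x, hx⟩

lemma brep_eq {q : Y} {η : ℝ} {x y : Y} (h : Branch q η x y) : brep q η x = brep q η y := by
  have : (fun z => Branch q η x z ∧ η ≤ dist z q) = fun z => Branch q η y z ∧ η ≤ dist z q := by
    ext z
    exact and_congr_left fun _ => ⟨fun h' => (h.symm _ _).trans _ _ _ h', fun h' => h.trans _ _ _ h'⟩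
  unfold brep
  rw [this]

lemma brep_iff {q : Y} {η : ℝ} {x y : Y} (hx : η ≤ dist x q) (hy : η ≤ dist y q) :
    brep q η x = brep q η y ↔ Branch q η x y := by
  refine ⟨fun h => ?_, brep_eq⟩
  have := (brep_spec hx).1
  rw [h] at this
  exact this.trans _ _ _ ((brep_spec hy).1.symm _ _)

lemma fillData_one (hg : Geod Y) (hc : Contr Y) (hf : Far Y) : FillData Y 1 (Test1 Y) where
  pos := one_pos
  contr := hc
  far := hf
  const := by
    rintro q η _ ⟨s, hs, rfl⟩ ε δ l x hx hd hl h
    exact ⟨s, by simp, hs.constOn hx hd hl h⟩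
  length := by rintro q η _ ⟨s, hs, rfl⟩; rfl
  mono := by rintro q η η' h _ ⟨s, hs, rfl⟩; exact ⟨s, hs.mono h, rfl⟩
  fills := by
    classical
    refine ⟨4, by norm_num, fun q ε δ hε hδ hεδ r hr c hc hcyc ht => ?_⟩
    obtain rfl | rfl : r = 0 ∨ r = 1 := by omega
    · obtain ⟨x, hx⟩ := hf q (δ / 4)
      exact fill_length_zero hx (by linarith) hc
    replace ht := ht.resolve_left (by omega)
    set η := δ / 4 with hη
    have hoff : ∀ {x : Y}, x ∈ Off q δ → η ≤ dist x q := fun {x} hx => by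
      have : δ ≤ dist x q := hx
      linarith
    have hpath : ∀ x : Y, ∃ k : Ch Y, x ∈ Off q δ →
        k ∈ Sup (Lst 2 (Near ε) (Off q η)) ∧ bd k = sg [x] + sg [brep q η x] := fun x => by
      by_cases hx : x ∈ Off q δ
      · have hx' := hoff hx
        obtain ⟨k, hk⟩ := dpath_chain hε.le
          (branch_dpath hg hε (brep_spec hx').1 hx' (brep_spec hx').2)
        exact ⟨k, fun _ => hk⟩
      · exact ⟨0, fun h => absurd h hx⟩
    choose K hK using hpath
    set KL : List Y → Ch Y := fun l => match l with | [x] => K x | _ => 0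
    have hl1 : ∀ l ∈ Lst 1 (Near ε) (Off q δ), ∃ x ∈ Off q δ, l = [x] := fun l hl => by
      obtain ⟨x, rfl⟩ := List.length_eq_one_iff.1 hl.1
      exact ⟨x, hl.2.2 x (by simp), rfl⟩
    have hmp : mp (brep q η) c = 0 := by
      ext l
      by_contra hne
      have hl : l ∈ (mp (brep q η) c).support := by simpa using hne
      have hin : mp (brep q η) c ∈ Sup {l | ∃ x ∈ Off q δ, l = [brep q η x]} :=
        mp_mem (fun l hl => by
          obtain ⟨x, hx, rfl⟩ := hl1 l hl
          exact ⟨x, hx, rfl⟩) hc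
      obtain ⟨x, hx, rfl⟩ := hin hl
      apply hne
      have ht' := ht _ ⟨branchInd q η x, (branchInd_adm q η x), rfl⟩
      rw [apply_eq_lext]
      have e := lin_ext (f := lext (fun m => if m = [brep q η x] then (1 : F2) else 0) ∘ₗ
        mp (brep q η)) (g := lext (fun m => if m.map (brep q η) = [brep q η x] then (1 : F2) else 0))
        (fun l => by simp) c
      rw [LinearMap.comp_apply] at e
      rw [e, Finsupp.zero_apply]
      refine Eq.trans ?_ ht'
      refine lext_congr (fun l hl => ?_) hc
      obtain ⟨y, hy, rfl⟩ := hl1 l hl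
      have := brep_iff (hoff hx) (hoff hy)
      simp [coP, coT, coQ, branchInd, ← this, eq_comm]
    refine ⟨lext KL c, ?_, ?_⟩
    · refine Sup_map _ (fun l hl => ?_) hc
      obtain ⟨x, hx, rfl⟩ := hl1 l hl
      rw [lext_sg]
      exact Sup_Lst_mono (fun x y => Near.mono (by linarith)) subset_rfl (hK x hx).1
    · have : bd (lext KL c) + (c + mp (brep q η) c) = 0 := by
        have := Sup_induction (bd ∘ₗ lext KL + (LinearMap.id + mp (brep q η))) ⊥ (fun l hl => ?_) hc
        · simpa using this
        · obtain ⟨x, hx, rfl⟩ := hl1 l hl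
          simp [KL, (hK x hx).2, add_self_F2]
      rw [hmp, add_zero] at this
      exact eq_of_add_eq_zero_F2 this

end Base
end DeRahmSplit

namespace DeRahmSplit

section Step
variable {Y Y' : Type*} [MetricSpace Y] [MetricSpace Y']

/-- The points near the list `l` in the first coordinate and away from `q'` in the second. -/
def Tube (q' : Y') (ρ δ : ℝ) (l : List (Y × Y')) : Set (Y × Y') :=
  {p | (∃ u ∈ l, dist p.1 u.1 ≤ ρ) ∧ δ ≤ dist p.2 q'}

/-- A chain homotopy, on short lists, between the identity and the map pushing the second
coordinate to `e'`. -/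
def IsPush (q' e' : Y') (C ε δ : ℝ) (d : ℕ) (H : Ch (Y × Y') →ₗ[F2] Ch (Y × Y')) : Prop :=
  ∀ r < d, ∀ l ∈ Lst r (Near ε) {p : Y × Y' | δ ≤ dist p.2 q'},
    H (sg l) ∈ Sup (Lst (r + 1) (Near (C * ε)) (Tube q' (C * ε) (δ / C) l)) ∧
    bd (H (sg l)) = sg l + mp (fun p => (p.1, e')) (sg l) + H (bdL l)

lemma IsPush.cycle {q' e' : Y'} {C ε δ : ℝ} {d : ℕ} {H : Ch (Y × Y') →ₗ[F2] Ch (Y × Y')}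
    (hH : IsPush q' e' C ε δ d H) (hC : 1 ≤ C) (hε : 0 < ε) (hδ : 0 < δ) (he' : δ ≤ dist e' q')
    {l : List (Y × Y')} (hl : l ∈ Lst d (Near ε) {p : Y × Y' | δ ≤ dist p.2 q'}) :
    sg l + mp (fun p => (p.1, e')) (sg l) + H (bdL l) ∈
        Sup (Lst d (Near (C * ε)) (Tube q' (C * ε) (δ / C) l)) ∧
      bd (sg l + mp (fun p => (p.1, e')) (sg l) + H (bdL l)) = 0 := by
  have hεC : ε ≤ C * ε := le_mul_of_one_le_left hε.le hC
  have hδC : δ / C ≤ δ := div_le_self hδ.le hC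
  have hlU : l ∈ Lst d (Near (C * ε)) (Tube q' (C * ε) (δ / C) l) :=
    ⟨hl.1, fun x hx y hy => (hl.2.1 x hx y hy).mono hεC,
      fun x hx => ⟨⟨x, hx, by simp; positivity⟩, hδC.trans (hl.2.2 x hx)⟩⟩
  constructor
  · refine add_mem (add_mem (sg_mem_Sup hlU) ?_) ?_
    · refine mp_Lst (fun x _ y _ hxy => ?_) (fun x hx => ?_) (sg_mem_Sup hlU)
      · have : dist x y ≤ C * ε := hxy
        rw [Prod.dist_eq] at this
        have h0 : 0 ≤ C * ε := by positivity
        simp only [Near, Prod.dist_eq, dist_self]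
        exact max_le ((le_max_left _ _).trans this) h0
      · exact ⟨hx.1, hδC.trans he'⟩
    · match d, hl with
      | 0, hl =>
        have : l = [] := by simpa using hl.1
        simp [this, bdL]
      | d + 1, hl =>
        refine Sup_map (S := faces l) H (fun m hm => ?_) (bdL_mem_faces l)
        have hs := hm.1.subset
        have := hH d (by omega) m ⟨by have := hm.2; have := hl.1; omega,
          fun x hx y hy => hl.2.1 x (hs hx) y (hs hy), fun x hx => hl.2.2 x (hs hx)⟩
        refine Sup_Lst_mono (fun _ _ h => h) ?_ this.1
        rintro p ⟨⟨u, hu, h⟩, h'⟩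
        exact ⟨⟨u, hs hu, h⟩, h'⟩
  · match d, hl with
    | 0, hl =>
      have : l = [] := by simpa using hl.1
      simp [this, bdL]
    | d + 1, hl =>
      have hf : bdL l ∈ Sup (Lst d (Near ε) {p : Y × Y' | δ ≤ dist p.2 q'}) := by
        have := bd_Lst (sg_mem_Sup hl)
        rwa [bd_sg] at this
      have := Sup_induction (bd ∘ₗ H - (LinearMap.id + mp (fun p => (p.1, e')) + H ∘ₗ bd)) ⊥
        (fun m hm => by simp [(hH d (by omega) m hm).2]) hf
      have : bd (H (bdL l)) = bdL l + mp (fun p => (p.1, e')) (bdL l) := by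
        simpa [sub_eq_zero, bd_bdL] using this
      simp only [map_add, bd_sg, bd_mp, this]
      exact add_self_F2 _

/-- The uniform version of contraction of the first coordinate applied to the cycles built from
a partial push. -/
lemma IsPush.contract {C₀ : ℝ} (hC₀ : 1 ≤ C₀)
    (h₀ : ∀ (u : Y) (ε : ℝ), 0 < ε → ∀ F : Set Y,
      F.Finite → ∃ D : Ch (Y × Y') →ₗ[F2] Ch (Y × Y'),
      (∀ c ∈ Sup {l : List (Y × Y') | ∀ x ∈ l, x.1 ∈ F},
        bd (D c) + D (bd c) = c + mp (fun p => (u, p.2)) c) ∧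
      ∀ (r : ℕ) (ε₁ : ℝ) (U U' : Set (Y × Y')),
        (∀ p ∈ U, ∀ a, dist a u ≤ C₀ * dist p.1 u → (a, p.2) ∈ U') →
        ∀ c ∈ Sup (Lst r (Near ε₁) U), D c ∈ Sup (Lst (r + 1) (Near (C₀ * ε₁ + ε)) U'))
    {q' : Y'} {C ε δ : ℝ} {d : ℕ} (hC : 1 ≤ C) (hε : 0 < ε) {x : Y × Y'} {l : List (Y × Y')}
    (hl : ∀ y ∈ x :: l, dist x y ≤ ε) {z : Ch (Y × Y')}
    (hz : z ∈ Sup (Lst d (Near (C * ε)) (Tube q' (C * ε) (δ / C) (x :: l)))) (hb : bd z = 0) :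
    ∃ w ∈ Sup (Lst (d + 1) (Near (2 * C₀ * C * ε))
      {p : Y × Y' | dist p.1 x.1 ≤ 2 * C₀ * C * ε ∧ δ / C ≤ dist p.2 q'}),
      bd w = z + mp (fun p => (x.1, p.2)) z := by
  obtain ⟨D, h1, h2⟩ := h₀ x.1 ε hε (Prod.fst '' verts z) ((verts_finite z).image _)
  have hCC : (1 : ℝ) ≤ C₀ * C := by nlinarith
  refine ⟨D z, ?_, ?_⟩
  · refine Sup_Lst_mono (fun _ _ => Near.mono ?_) subset_rfl (h2 d (C * ε) _ _ ?_ z hz)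
    · nlinarith
    · rintro p ⟨⟨u, hu, h⟩, h'⟩ a ha
      refine ⟨ha.trans ?_, h'⟩
      have := hl u hu
      rw [Prod.dist_eq] at this
      have t1 := (le_max_left _ _).trans this
      have t2 := dist_triangle p.1 u.1 x.1
      rw [dist_comm u.1] at t2
      have : dist p.1 x.1 ≤ 2 * (C * ε) := by nlinarith
      nlinarith
  · have := h1 z (by
      rw [Sup, Finsupp.mem_supported]
      exact fun l hl x hx => ⟨x, ⟨l, hl, hx⟩, rfl⟩)
    rwa [hb, map_zero, add_zero] at this

lemma exists_push (hY : Contr Y) {n : ℕ} {Test' : Y' → ℝ → Set (List (Y' → F2))}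
    (hF : Fills Y' n Test') : ∀ d ≤ n, ∃ C : ℝ, 1 ≤ C ∧ ∀ (q' e' : Y') (ε δ : ℝ), 0 < ε → 0 < δ →
      C * ε ≤ δ → δ ≤ dist e' q' →
      ∃ H : Ch (Y × Y') →ₗ[F2] Ch (Y × Y'), IsPush q' e' C ε δ d H := by
  classical
  obtain ⟨C₀, hC₀, h₀⟩ := hY.left (Y' := Y')
  obtain ⟨Cf, hCf, hf⟩ := hF
  intro d
  induction d with
  | zero => exact fun _ => ⟨1, le_rfl, fun q' e' ε δ _ _ _ _ => ⟨0, fun r hr => by omega⟩⟩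
  | succ d ih =>
    intro hd
    obtain ⟨C, hC, hH⟩ := ih (by omega)
    have hCf2 : 1 ≤ Cf * C := by nlinarith
    have hbig : C ≤ 4 * C₀ * Cf * C ^ 2 ∧ 2 * C₀ * C ≤ 4 * C₀ * Cf * C ^ 2 ∧
        Cf * C ≤ 4 * C₀ * Cf * C ^ 2 ∧ Cf * C ^ 2 ≤ 4 * C₀ * Cf * C ^ 2 := by
      have a1 : 0 ≤ C₀ * (Cf * C - 1) * C := by apply mul_nonneg (mul_nonneg _ _) <;> linarith
      have a2 : 0 ≤ (C₀ - 1) * C := by apply mul_nonneg <;> linarith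
      have a3 : 0 ≤ (C₀ - 1) * (Cf * C ^ 2) := by apply mul_nonneg; linarith; positivity
      have a4 : 0 ≤ Cf * C * (C - 1) := by apply mul_nonneg (mul_nonneg _ _) <;> linarith
      refine ⟨?_, ?_, ?_, ?_⟩ <;> nlinarith
    obtain ⟨hb1, hb2, hb3, hb4⟩ := hbig
    refine ⟨4 * C₀ * Cf * C ^ 2, hC.trans hb1, fun q' e' ε δ hε hδ hεδ he' => ?_⟩
    set C₁ := 4 * C₀ * Cf * C ^ 2 with hC₁
    have hC₁0 : 1 ≤ C₁ := hC.trans hb1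
    obtain ⟨H, hH⟩ := hH q' e' ε δ hε hδ ((mul_le_mul_of_nonneg_right hb1 hε.le).trans hεδ) he'
    have key : ∀ l ∈ Lst d (Near ε) {p : Y × Y' | δ ≤ dist p.2 q'}, ∃ h : Ch (Y × Y'),
        h ∈ Sup (Lst (d + 1) (Near (C₁ * ε)) (Tube q' (C₁ * ε) (δ / C₁) l)) ∧
        bd h = sg l + mp (fun p => (p.1, e')) (sg l) + H (bdL l) := by
      intro l hl
      obtain ⟨hz, hzb⟩ := hH.cycle hC hε hδ he' hl
      set z := sg l + mp (fun p => (p.1, e')) (sg l) + H (bdL l) with hzdef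
      match l, hl, hz, hzdef with
      | [], hl, hz, hzdef =>
        exact ⟨0, zero_mem _, by rw [hzdef]; simp [bdL, add_self_F2]⟩
      | x :: l, hl, hz, hzdef =>
        obtain ⟨w, hw, hwb⟩ := IsPush.contract hC₀ h₀ hC hε
          (hl.2.1 x (by simp)) hz hzb
        have hy : mp Prod.snd z ∈ Sup (Lst d (Near (C * ε)) (Off q' (δ / C))) := by
          refine mp_Lst (fun a _ b _ hab => ?_) (fun a ha => ha.2) hz
          exact (le_max_right _ _).trans (by rw [← Prod.dist_eq]; exact hab)
        obtain ⟨e, he, heb⟩ := hf q' (C * ε) (δ / C) (by positivity) (by positivity) (by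
          rw [le_div_iff₀ (by positivity)]
          nlinarith) d (by omega) _ hy (by rw [bd_mp, hzb, map_zero]) (Or.inl (by omega))
        refine ⟨w + mp (fun y => (x.1, y)) e, add_mem ?_ ?_, ?_⟩
        · refine Sup_Lst_mono (fun _ _ => Near.mono ?_) ?_ hw
          · exact mul_le_mul_of_nonneg_right hb2 hε.le
          · rintro p ⟨h1, h2⟩
            exact ⟨⟨x, by simp, h1.trans (mul_le_mul_of_nonneg_right hb2 hε.le)⟩,
              le_trans (div_le_div_of_nonneg_left hδ.le (by positivity) hb1) h2⟩
        · refine mp_Lst (fun a _ b _ hab => ?_) (fun a ha => ?_) he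
          · have hab : dist a b ≤ Cf * (C * ε) := hab
            have : dist a b ≤ C₁ * ε := hab.trans (by nlinarith)
            simp only [Near, Prod.dist_eq, dist_self]
            exact max_le (by positivity) this
          · refine ⟨⟨x, by simp, by simp; positivity⟩, le_trans ?_ ha⟩
            rw [div_div]
            exact div_le_div_of_nonneg_left hδ.le (by positivity) (by linarith)
        · rw [map_add, hwb, bd_mp, heb, mp_mp]
          have : ((fun y => (x.1, y)) ∘ Prod.snd : Y × Y' → Y × Y') = fun p => (x.1, p.2) := rfl
          rw [this, add_assoc, add_self_F2, add_zero]
    choose! h hh using key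
    set H' : Ch (Y × Y') →ₗ[F2] Ch (Y × Y') :=
      lext fun l => if l.length = d then h l else H (sg l) with hH'
    have agree : ∀ c ∈ Sup {l : List (Y × Y') | l.length ≠ d}, H' c = H c := fun c hc => by
      have e : H c = lext (fun l => H (sg l)) c := lin_ext (fun l => by simp) c
      rw [e]
      exact lext_congr (fun l (hl : l.length ≠ d) => by simp [hl]) hc
    refine ⟨H', fun r hr l hl => ?_⟩
    have hbdl : H' (bdL l) = H (bdL l) := agree _ (Sup_mono (fun m hm => by
      have := hm.2; have := hl.1; show m.length ≠ d; omega) (bdL_mem_faces l))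
    rw [hbdl]
    rcases Nat.lt_succ_iff_lt_or_eq.1 hr with hr | rfl
    · have e : H' (sg l) = H (sg l) :=
        agree _ (sg_mem_Sup (show l.length ≠ d by have := hl.1; omega))
      rw [e]
      refine ⟨Sup_Lst_mono (fun _ _ => Near.mono ?_) ?_ (hH r hr l hl).1, (hH r hr l hl).2⟩
      · exact mul_le_mul_of_nonneg_right hb1 hε.le
      · rintro p ⟨⟨u, hu, h1⟩, h2⟩
        exact ⟨⟨u, hu, h1.trans (mul_le_mul_of_nonneg_right hb1 hε.le)⟩,
          le_trans (div_le_div_of_nonneg_left hδ.le (by positivity) hb1) h2⟩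
    · have e : H' (sg l) = h l := by simp [hH', hl.1]
      rw [e]
      exact hh l hl

end Step
end DeRahmSplit

namespace DeRahmSplit

section Step
variable {Y Y' : Type*} [MetricSpace Y] [MetricSpace Y']

lemma IsPush.le {q' e' : Y'} {C ε δ : ℝ} {d d' : ℕ} {H : Ch (Y × Y') →ₗ[F2] Ch (Y × Y')}
    (hH : IsPush q' e' C ε δ d H) (h : d' ≤ d) : IsPush q' e' C ε δ d' H :=
  fun r hr => hH r (by omega)

/-- Cycles in the product whose first coordinates lie in one branch are homologous to their
push to a far second coordinate. -/
lemma exists_fill_branch (hg : Geod Y) (hY : Contr Y) {n : ℕ}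
    {Test' : Y' → ℝ → Set (List (Y' → F2))} (hF : Fills Y' n Test') :
    ∃ C : ℝ, 1 ≤ C ∧ ∀ (q1 e1 : Y) (q' e' : Y') (ε δ : ℝ), 0 < ε → 0 < δ →
      C * ε ≤ δ → δ ≤ dist e' q' → δ / 8 ≤ dist e1 q1 → ∀ r ≤ n, ∀ γ : Ch (Y × Y'),
      γ ∈ Sup (Lst r (Near ε) {p : Y × Y' | (δ ≤ dist p.1 q1 ∧ δ ≤ dist p.2 q') ∧
        Branch q1 (δ / 8) p.1 e1}) → bd γ = 0 →
      (r < n ∨ ∀ L ∈ Test' q' (δ / 4), lext (coP L) (mp Prod.snd γ) = 0) →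
      ∃ κ ∈ Sup (Lst (r + 1) (Near (C * ε)) {p : Y × Y' | δ / C ≤ dist p.1 q1 ∧
        δ / C ≤ dist p.2 q'}), bd κ = γ + mp (fun p => (p.1, e')) γ := by
  classical
  obtain ⟨C₀, hC₀, h₀⟩ := hY.left (Y' := Y')
  obtain ⟨Cp, hCh, hpush⟩ := exists_push hY hF n le_rfl
  obtain ⟨Cf, hCf, hf⟩ := hF
  set C := 8 * C₀ * Cp * Cf with hC
  have hChf : 1 ≤ Cp * Cf := by nlinarith
  have hC0h : 1 ≤ C₀ * Cp := by nlinarith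
  have hC0hf : 1 ≤ C₀ * Cp * Cf := by nlinarith
  have hC8 : 8 ≤ C := by rw [hC]; nlinarith
  have b1 : 8 * (C₀ * Cp) ≤ C := by
    rw [hC]; nlinarith [mul_nonneg (by linarith : 0 ≤ C₀ * Cp) (by linarith : 0 ≤ Cf - 1)]
  have b2 : Cf ≤ C := by
    rw [hC]; nlinarith [mul_nonneg (by linarith : 0 ≤ C₀ * Cp - 1) (by linarith : 0 ≤ Cf)]
  have b3 : Cp ≤ C := by nlinarith
  refine ⟨C, by linarith, fun q1 e1 q' e' ε δ hε hδ hεδ he' he1 r hr γ hγ hγb htest => ?_⟩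
  obtain ⟨H, hH⟩ := hpush q' e' ε δ hε hδ ((mul_le_mul_of_nonneg_right b3 hε.le).trans hεδ) he'
  replace hH := hH.le hr
  set ι : Y × Y' → Y × Y' := fun p => (p.1, e') with hι
  set G : Set (Y × Y') := {p : Y × Y' | (δ ≤ dist p.1 q1 ∧ δ ≤ dist p.2 q') ∧
        Branch q1 (δ / 8) p.1 e1} with hG
  set U' : Set (Y × Y') := {p : Y × Y' | δ / C ≤ dist p.1 q1 ∧ δ / C ≤ dist p.2 q'} with hU'
  have hdC : δ / C ≤ δ / 8 := div_le_div_of_nonneg_left hδ.le (by norm_num) hC8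
  have hdCh : δ / C ≤ δ / Cp := div_le_div_of_nonneg_left hδ.le (by linarith) b3
  have hεC : ε ≤ C * ε := by nlinarith
  have key : ∀ l ∈ Lst r (Near ε) G, ∃ θ ∈ Sup (Lst (r + 1) (Near (C * ε)) U'),
      bd θ = (sg l + mp ι (sg l) + H (bdL l)) +
        mp (fun y => (e1, y)) (mp Prod.snd (sg l + mp ι (sg l) + H (bdL l))) := by
    intro l hl
    have hl' : l ∈ Lst r (Near ε) {p : Y × Y' | δ ≤ dist p.2 q'} :=
      Lst_mono (fun _ _ h => h) (fun p hp => hp.1.2) hl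
    obtain ⟨hz, hzb⟩ := hH.cycle hCh hε hδ he' hl'
    rw [← hι] at hz hzb
    set z := sg l + mp ι (sg l) + H (bdL l) with hzdef
    match l, hl, hz, hzdef with
    | [], hl, hz, hzdef =>
      refine ⟨0, zero_mem _, ?_⟩
      have : z = 0 := by rw [hzdef]; simp [bdL, add_self_F2]
      simp [this]
    | x :: l, hl, hz, hzdef =>
      have hx := hl.2.2 x (by simp)
      obtain ⟨w, hw, hwb⟩ := IsPush.contract hC₀ h₀ hCh hε (hl.2.1 x (by simp)) hz hzb
      obtain ⟨p, m, p0, pm, ps, pU⟩ := branch_dpath hg hε hx.2 (by linarith [hx.1.1]) he1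
      refine ⟨w + prs (fun k y => (p k, y)) m (mp Prod.snd z), add_mem ?_ ?_, ?_⟩
      · refine Sup_Lst_mono (fun _ _ => Near.mono ?_) ?_ hw
        · nlinarith
        · rintro u ⟨h1, h2⟩
          refine ⟨?_, hdCh.trans h2⟩
          have t := dist_triangle_left x.1 q1 u.1
          have := hx.1.1
          have : 2 * C₀ * Cp * ε ≤ δ / 4 := by nlinarith
          have : δ / 8 ≤ dist u.1 q1 := by linarith
          linarith
      · have hy : mp Prod.snd z ∈ Sup (Lst r (Near (Cp * ε)) (Off q' (δ / Cp))) := by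
          refine mp_Lst (fun a _ b _ hab => ?_) (fun a ha => ha.2) hz
          exact (le_max_right _ _).trans (by rw [← Prod.dist_eq]; exact hab)
        refine prs_Lst (R := Near (Cp * ε)) (U := Off q' (δ / Cp)) ?_ ?_ hy
        · intro k hk a _ b _ hab
          have hab : dist a b ≤ Cp * ε := hab
          have hab' : dist a b ≤ C * ε := by nlinarith
          have h1 := (ps k hk).trans hεC
          have h2 : dist (p (k + 1)) (p k) ≤ C * ε := by rwa [dist_comm]
          have h0 : 0 ≤ C * ε := by positivity
          simp only [Near, Prod.dist_eq, dist_self]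
          exact ⟨max_le h0 hab', max_le h1 hab', max_le h2 hab', max_le h0 hab'⟩
        · intro k hk a ha
          exact ⟨hdC.trans (pU k hk), hdCh.trans ha⟩
      · have := bd_prs (fun k y => (p k, y)) m (mp Prod.snd z)
        rw [bd_mp, hzb, map_zero, map_zero, add_zero, p0, pm, mp_mp] at this
        rw [map_add, hwb, this]
        have e : ((fun y => (x.1, y)) ∘ Prod.snd : Y × Y' → Y × Y') = fun p => (x.1, p.2) := rfl
        rw [e]
        rw [add_assoc, ← add_assoc (mp (fun p : Y × Y' => (x.1, p.2)) z), add_self_F2, zero_add]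
  choose! θ hθ hθb using key
  obtain ⟨e, he, heb⟩ := hf q' ε δ hε hδ ((mul_le_mul_of_nonneg_right b2 hε.le).trans hεδ) r hr
    (mp Prod.snd γ) (mp_Lst (R := Near ε) (U := G) (R' := Near ε) (U' := Off q' δ)
      (fun a _ b _ hab => (le_max_right _ _).trans (by rw [← Prod.dist_eq]; exact hab))
      (fun a ha => ha.1.2) hγ)
    (by rw [bd_mp, hγb, map_zero]) htest
  set γ' := mp (fun _ : Y × Y' => e') γ with hγ'
  refine ⟨lext θ γ + mp (fun y => (e1, y)) (e + cons e' γ'), add_mem ?_ ?_, ?_⟩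
  · exact Sup_map _ (fun l hl => by simpa using hθ l hl) hγ
  · have he'2 : δ / C ≤ dist e' q' := by linarith
    have he1' : δ / C ≤ dist e1 q1 := by linarith
    have h1 : e ∈ Sup (Lst (r + 1) (Near (C * ε)) (Off q' (δ / C))) :=
      Sup_Lst_mono (fun _ _ => Near.mono (mul_le_mul_of_nonneg_right b2 hε.le))
        (Off_mono (div_le_div_of_nonneg_left hδ.le (by linarith) b2)) he
    have h0 : 0 ≤ C * ε := by positivity
    have h2 : cons e' γ' ∈ Sup (Lst (r + 1) (Near (C * ε)) (Off q' (δ / C))) := by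
      have : γ' ∈ Sup (Lst r (Near (C * ε)) {e'}) :=
        mp_Lst (R := Near ε) (U := G) (R' := Near (C * ε)) (U' := {e'})
          (fun _ _ _ _ _ => by simpa [Near] using h0) (fun _ _ => rfl) hγ
      refine cons_Lst (R := Near (C * ε)) (U := {e'}) he'2 (by simpa [Near] using h0)
        (fun _ _ _ _ h => h) ?_ ?_ this
      · rintro x rfl; simpa [Near] using h0
      · rintro x rfl; exact he'2
    refine mp_Lst (R := Near (C * ε)) (U := Off q' (δ / C)) (R' := Near (C * ε)) (U' := U') (f := fun y => (e1, y))
      (fun a _ b _ hab => ?_) (fun a ha => ⟨he1', ha⟩) (add_mem h1 h2)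
    have hab : dist a b ≤ C * ε := hab
    simp only [Near, Prod.dist_eq, dist_self]
    exact max_le h0 hab
  · have hΘ : bd (lext θ γ) = (γ + mp ι γ) + mp (fun y => (e1, y)) (mp Prod.snd (γ + mp ι γ)) := by
      have := Sup_induction (bd ∘ₗ lext θ - ((LinearMap.id + mp ι + H ∘ₗ bd) +
        mp (fun y => (e1, y)) ∘ₗ mp Prod.snd ∘ₗ (LinearMap.id + mp ι + H ∘ₗ bd))) ⊥
        (fun l hl => by simp [hθb l hl]) hγ
      simpa [sub_eq_zero, hγb] using this
    have hc : bd (cons e' γ') = γ' := cycle_eq _ (by rw [hγ', bd_mp, hγb, map_zero])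
    rw [map_add, hΘ, bd_mp, map_add bd, heb, hc, map_add (mp Prod.snd), mp_mp (Prod.snd : Y × Y' → Y')]
    have e : (Prod.snd ∘ ι : Y × Y' → Y') = fun _ => e' := rfl
    rw [e, ← hγ', add_assoc, add_self_F2, add_zero]

end Step
end DeRahmSplit

namespace DeRahmSplit

lemma mem_Sup_verts {Y : Type*} (c : Ch Y) : c ∈ Sup {l : List Y | ∀ x ∈ l, x ∈ verts c} := by
  rw [Sup, Finsupp.mem_supported]
  exact fun l hl x hx => ⟨l, hl, hx⟩

lemma Sup_inter {Y : Type*} {S T : Set (List Y)} {c : Ch Y} (h : c ∈ Sup S) (h' : c ∈ Sup T) :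
    c ∈ Sup (S ∩ T) := by
  rw [Sup, Finsupp.mem_supported] at *
  exact Set.subset_inter h h'

section Step
variable {Y Y' : Type*} [MetricSpace Y] [MetricSpace Y']

/-- Gluing: a cycle which is the sum of a chain off the first coordinate and a chain off the second
coordinate with common boundary in a far slice bounds. -/
lemma exists_glue (hY : Contr Y) (hY' : Contr Y') : ∃ C : ℝ, 1 ≤ C ∧ ∀ (q : Y × Y') (e1 : Y)
    (e' : Y') (ε δ : ℝ), 0 < ε → 0 < δ → δ ≤ dist e1 q.1 → δ ≤ dist e' q.2 →
    ∀ (r : ℕ) (α β : Ch (Y × Y')), α ∈ Sup (Lst (r + 1) (Near ε) {p | δ ≤ dist p.1 q.1}) →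
      β ∈ Sup (Lst (r + 1) (Near ε) {p | δ ≤ dist p.2 q.2}) → bd α = bd β →
      bd α ∈ Sup (Lst r (Near ε) {p | p.2 = e'}) →
      ∃ X ∈ Sup (Lst (r + 2) (Near (C * ε)) (Off q δ)), bd X = α + β := by
  obtain ⟨C', hC', hR⟩ := hY'.right (Y := Y)
  obtain ⟨C, hC, hL⟩ := hY.left (Y' := Y')
  have hCC : 1 ≤ C * C' := by nlinarith
  refine ⟨C * (C' + 2) + 1, by nlinarith, ?_⟩
  intro q e1 e' ε δ hε hδ he1 he' r α β hα hβ hαβ hg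
  set g := bd α with hgdef
  set ι : Y × Y' → Y × Y' := fun p => (p.1, e') with hι
  set ι1 : Y × Y' → Y × Y' := fun p => (e1, p.2) with hι1
  have hεb : C' * ε + ε ≤ (C * (C' + 2) + 1) * ε := by
    nlinarith [mul_nonneg (mul_nonneg (by linarith : 0 ≤ C - 1) (by linarith : 0 ≤ C' + 2)) hε.le]
  have hεb2 : C * ε + ε ≤ (C * (C' + 2) + 1) * ε := by
    nlinarith [mul_nonneg (mul_nonneg (by linarith : 0 ≤ C) (by linarith : 0 ≤ C' + 1)) hε.le]
  have hεb3 : C * ((C' + 2) * ε) + ε = (C * (C' + 2) + 1) * ε := by ring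
  have hεb4 : C' * ε + ε ≤ (C' + 2) * ε := by nlinarith
  obtain ⟨D, hD1, hD2⟩ := hR e' ε hε
    (Prod.snd '' (verts α ∪ verts g ∪ verts (mp ι1 β) ∪ verts (mp ι1 g)))
    ((((verts_finite _).union (verts_finite _)).union (verts_finite _)).union
      (verts_finite _) |>.image _)
  have hb : ∀ c : Ch (Y × Y'), verts c ⊆ verts α ∪ verts g ∪ verts (mp ι1 β) ∪ verts (mp ι1 g) →
      bd (D c) + D (bd c) = c + mp ι c := fun c hc =>
    hD1 c (Sup_mono (fun l hl x hx => ⟨x, hc (hl x hx), rfl⟩) (mem_Sup_verts c))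
  have hbg : bd g = 0 := bd_bd _
  have d1 : bd (D α) = α + mp ι α + D g := by
    have := hb α (fun x hx => by simp [hx])
    rw [← this, add_assoc, ← hgdef, add_self_F2, add_zero]
  have d2 : bd (D g) = g + mp ι g := by
    simpa [hbg] using hb g (fun x hx => by simp [hx])
  have d3 : bd (D (mp ι1 β)) = mp ι1 β + mp ι (mp ι1 β) + D (mp ι1 g) := by
    have := hb (mp ι1 β) (fun x hx => by simp [hx])
    rw [bd_mp, ← hαβ] at this
    rw [← this, add_assoc, add_self_F2, add_zero]
  set R := D g + mp ι α with hRdef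
  have hbR : bd R = g := by
    rw [hRdef, map_add, d2, bd_mp, ← hgdef, add_assoc, add_self_F2, add_zero]
  obtain ⟨D', hD1', hD2'⟩ := hL e1 ε hε (Prod.fst '' (verts β ∪ verts R))
    (((verts_finite _).union (verts_finite _)).image _)
  have hb' : ∀ c : Ch (Y × Y'), verts c ⊆ verts β ∪ verts R →
      bd (D' c) + D' (bd c) = c + mp ι1 c := fun c hc =>
    hD1' c (Sup_mono (fun l hl x hx => ⟨x, hc (hl x hx), rfl⟩) (mem_Sup_verts c))
  have d4 : bd (D' β) = β + mp ι1 β + D' g := by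
    have := hb' β (fun x hx => by simp [hx])
    rw [← this, add_assoc, ← hαβ, add_self_F2, add_zero]
  have d5 : bd (D' R) = R + mp ι1 R + D' g := by
    have := hb' R (fun x hx => by simp [hx])
    rw [← this, add_assoc, hbR, add_self_F2, add_zero]
  set v : Y × Y' := (e1, e') with hv
  set T := mp ι1 R + mp ι (mp ι1 β) + D (mp ι1 g) with hT
  have hsum : α + β = bd (D α + D' β + D' R + D (mp ι1 β)) + T := by
    rw [map_add, map_add, map_add, d1, d3, d4, d5, hT]
    have e1 := add_self_F2 (mp ι1 R)
    have e2 := add_self_F2 (mp ι (mp ι1 β))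
    have e3 := add_self_F2 (D (mp ι1 g))
    have e4 := add_self_F2 (mp ι1 β)
    have e5 := add_self_F2 (D' g)
    have e6 := add_self_F2 R
    have e7 : mp ι α + D g = R := add_comm _ _
    calc α + β = α + β + (R + R) + (mp ι1 R + mp ι1 R) + (mp ι (mp ι1 β) + mp ι (mp ι1 β)) +
          (D (mp ι1 g) + D (mp ι1 g)) + (mp ι1 β + mp ι1 β) + (D' g + D' g) := by
            rw [e1, e2, e3, e4, e5, e6]; simp
      _ = α + β + ((mp ι α + D g) + R) + (mp ι1 R + mp ι1 R) +
          (mp ι (mp ι1 β) + mp ι (mp ι1 β)) +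
          (D (mp ι1 g) + D (mp ι1 g)) + (mp ι1 β + mp ι1 β) + (D' g + D' g) := by rw [e7]
      _ = _ := by abel
  have near0 : ∀ ε' : ℝ, 0 ≤ ε' → ∀ x : Y × Y', Near ε' x x := fun ε' h x => by
    simpa [Near] using h
  have hDg : D g ∈ Sup (Lst (r + 1) (Near (C' * ε + ε)) {p | p.2 = e'}) := by
    refine hD2 r ε {p | p.2 = e'} {p | p.2 = e'} ?_ g hg
    intro p hp a ha
    have hp : p.2 = e' := hp
    rw [hp, dist_self, mul_zero] at ha
    exact dist_le_zero.1 ha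
  have hια : mp ι α ∈ Sup (Lst (r + 1) (Near (C' * ε + ε)) {p | p.2 = e'}) := by
    refine mp_Lst (f := ι) (R' := Near (C' * ε + ε)) (U' := {p : Y × Y' | p.2 = e'})
      (fun a _ b _ hab => ?_) (fun a _ => rfl) hα
    have hab : dist a b ≤ ε := hab
    rw [Prod.dist_eq] at hab
    simp only [Near, hι, Prod.dist_eq, dist_self]
    have := (le_max_left _ _).trans hab
    exact max_le (by nlinarith) (by positivity)
  have hRmem : R ∈ Sup (Lst (r + 1) (Near ((C' + 2) * ε)) {p | p.2 = e'}) :=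
    Sup_Lst_mono (fun _ _ => Near.mono hεb4) subset_rfl (add_mem hDg hια)
  have hι1mem : ∀ (s : ℕ) (ε' : ℝ) (U : Set (Y × Y')), ∀ c ∈ Sup (Lst s (Near ε') U),
      mp ι1 c ∈ Sup (Lst s (Near ε') {p | p.1 = e1}) := by
    intro s ε' U c hc
    refine mp_Lst (f := ι1) (R' := Near ε') (U' := {p : Y × Y' | p.1 = e1})
      (fun a _ b _ hab => ?_) (fun a _ => rfl) hc
    have hab : dist a b ≤ ε' := hab
    have h0 : 0 ≤ ε' := dist_nonneg.trans hab
    rw [Prod.dist_eq] at hab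
    simp only [Near, hι1, Prod.dist_eq, dist_self]
    exact max_le h0 ((le_max_right _ _).trans hab)
  have hTmem : T ∈ Sup (Lst (r + 1) (Near ((C' + 2) * ε)) {v}) := by
    refine add_mem (add_mem ?_ ?_) ?_
    · refine mp_Lst (f := ι1) (R' := Near ((C' + 2) * ε)) (U' := {v}) (fun a ha b hb hab => ?_)
        (fun a (ha : a.2 = e') => by simp [hι1, hv, ha]) hRmem
      have ha : a.2 = e' := ha
      have hb : b.2 = e' := hb
      simp only [hι1, ha, hb]
      exact near0 _ (by positivity) _
    · refine mp_Lst (f := ι) (R' := Near ((C' + 2) * ε)) (U' := {v}) (fun a ha b hb hab => ?_)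
        (fun a (ha : a.1 = e1) => by simp [hι, hv, ha]) (hι1mem _ _ _ _ hβ)
      have ha : a.1 = e1 := ha
      have hb : b.1 = e1 := hb
      simp only [hι, ha, hb]
      exact near0 _ (by positivity) _
    · refine Sup_Lst_mono (fun _ _ => Near.mono hεb4) subset_rfl
        (hD2 r ε {v} {v} ?_ (mp ι1 g) ?_)
      · rintro p rfl a ha
        have : dist a e' ≤ 0 := by simpa [hv] using ha
        have := dist_le_zero.1 this
        simp [hv, this]
      · refine mp_Lst (f := ι1) (R' := Near ε) (U' := {v}) (fun a ha b hb hab => ?_)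
          (fun a (ha : a.2 = e') => by simp [hι1, hv, ha]) hg
        have ha : a.2 = e' := ha
        have hb : b.2 = e' := hb
        simp only [hι1, ha, hb]
        exact near0 _ hε.le _
  have hbT : bd T = 0 := by
    have h := congrArg bd hsum
    rw [map_add, map_add, bd_bd, zero_add, ← hgdef, ← hαβ, add_self_F2] at h
    exact h.symm
  refine ⟨D α + D' β + D' R + D (mp ι1 β) + cons v T, ?_, ?_⟩
  · refine add_mem (add_mem (add_mem (add_mem ?_ ?_) ?_) ?_) ?_
    · refine Sup_Lst_mono (fun _ _ => Near.mono hεb) ?_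
        (hD2 _ ε _ {p : Y × Y' | δ ≤ dist p.1 q.1} (fun p hp a _ => hp) α hα)
      exact fun p hp => show δ ≤ dist p q from le_trans hp (le_max_left _ _)
    · refine Sup_Lst_mono (fun _ _ => Near.mono hεb2) ?_
        (hD2' _ ε _ {p : Y × Y' | δ ≤ dist p.2 q.2} (fun p hp a _ => hp) β hβ)
      exact fun p hp => show δ ≤ dist p q from le_trans hp (le_max_right _ _)
    · refine Sup_Lst_mono (fun _ _ => Near.mono hεb3.le) ?_
        (hD2' _ _ _ {p : Y × Y' | p.2 = e'} (fun p hp a _ => hp) R hRmem)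
      intro p hp
      have hp : p.2 = e' := hp
      exact show δ ≤ dist p q from le_trans (by rw [hp]; exact he') (le_max_right (dist p.1 q.1) (dist p.2 q.2))
    · refine Sup_Lst_mono (fun _ _ => Near.mono hεb) ?_
        (hD2 _ ε _ {p : Y × Y' | p.1 = e1} (fun p hp a _ => hp) _ (hι1mem _ _ _ _ hβ))
      intro p hp
      have hp : p.1 = e1 := hp
      exact show δ ≤ dist p q from le_trans (by rw [hp]; exact he1) (le_max_left (dist p.1 q.1) (dist p.2 q.2))
    · have hvq : v ∈ Off q δ := le_trans he1 (le_max_left _ _)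
      have h0 : 0 ≤ (C * (C' + 2) + 1) * ε := by positivity
      refine cons_Lst (R := Near ((C' + 2) * ε)) (U := {v}) hvq (near0 _ h0 _)
        (fun _ _ _ _ h => h.mono (by nlinarith)) ?_ ?_ hTmem
      · rintro x rfl; exact ⟨near0 _ h0 _, near0 _ h0 _⟩
      · rintro x rfl; exact hvq
  · rw [map_add, cycle_eq v hbT, hsum]

end Step
end DeRahmSplit

namespace DeRahmSplit

lemma filt_sg_mem {Y : Type*} {p : Set (List Y)} {l : List Y} (h : l ∈ p) :
    filt p (sg l) = sg l := by simp [filt, h]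

lemma filt_sg_not_mem {Y : Type*} {p : Set (List Y)} {l : List Y} (h : l ∉ p) :
    filt p (sg l) = 0 := by simp [filt, h]

lemma filt_eq_self {Y : Type*} {p : Set (List Y)} {c : Ch Y} (h : c ∈ Sup p) : filt p c = c := by
  have := Sup_induction (filt p - LinearMap.id) ⊥ (S := p) (fun l hl => by
    simp [filt_sg_mem hl]) h
  simpa [sub_eq_zero] using this

lemma filt_eq_zero {Y : Type*} {p S : Set (List Y)} {c : Ch Y} (h : c ∈ Sup S)
    (hS : ∀ l ∈ S, l ∉ p) : filt p c = 0 := by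
  have := Sup_induction (filt p) ⊥ (S := S) (fun l hl => by
    simp [filt_sg_not_mem (hS l hl)]) h
  simpa using this

section Step
variable {Y Y' : Type*} [MetricSpace Y] [MetricSpace Y']

/-- The tests on a product. -/
def TestP (Test' : Y' → ℝ → Set (List (Y' → F2))) (q : Y × Y') (η : ℝ) :
    Set (List (Y × Y' → F2)) :=
  {L | ∃ s L', Adm η q.1 s ∧ L' ∈ Test' q.2 η ∧ L = (s ∘ Prod.fst) :: L'.map (· ∘ Prod.snd)}

open Classical in
lemma sum_filt {Y A : Type*} (g : List Y → A) {c : Ch Y} {E : Finset A}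
    (h : ∀ l ∈ c.support, g l ∈ E) : ∑ e ∈ E, filt {l | g l = e} c = c := by
  have := Sup_induction ((∑ e ∈ E, filt {l | g l = e}) - LinearMap.id) ⊥ (S := {l | g l ∈ E})
    (fun l hl => ?_) (c := c) (by rw [Sup, Finsupp.mem_supported]; exact h)
  · simpa [sub_eq_zero] using this
  · have hl : g l ∈ E := hl
    rw [Submodule.mem_bot, LinearMap.sub_apply, LinearMap.sum_apply, sub_eq_zero,
      LinearMap.id_apply, Finset.sum_eq_single (g l)]
    · exact filt_sg_mem rfl
    · intro b _ hb
      exact filt_sg_not_mem fun h => hb h.symm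
    · exact fun h => absurd hl h

lemma exists_kappa (hg : Geod Y) (hY : Contr Y) {n : ℕ} (hn : 0 < n)
    {Test' : Y' → ℝ → Set (List (Y' → F2))} (hF : Fills Y' n Test')
    (hlen : ∀ q η, ∀ L ∈ Test' q η, L.length = n)
    (hconst : ∀ q η, ∀ L ∈ Test' q η, ∀ (ε δ : ℝ) (l : List Y'), ∀ x ∈ l, δ ≤ dist x q →
      (∀ x ∈ l, ∀ y ∈ l, dist x y ≤ ε) → 3 * ε + 2 * η < 2 * δ → ∃ s ∈ L, ConstOn s l)
    (hmono : ∀ q η η', η ≤ η' → Test' q η ⊆ Test' q η') :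
    ∃ C : ℝ, 1 ≤ C ∧ ∀ (q : Y × Y') (e' : Y') (ε δ : ℝ), 0 < ε → 0 < δ →
      C * ε ≤ δ → δ ≤ dist e' q.2 → ∀ r ≤ n, ∀ α β : Ch (Y × Y'),
      α ∈ Sup (Lst (r + 1) (Near ε) {p | δ ≤ dist p.1 q.1}) →
      β ∈ Sup (Lst (r + 1) (Near ε) {p | δ ≤ dist p.2 q.2}) → bd α = bd β →
      (r < n ∨ ∀ L ∈ TestP Test' q (δ / 2), lext (coP L) (α + β) = 0) →
      ∃ κ ∈ Sup (Lst (r + 1) (Near (C * ε)) {p | δ / C ≤ dist p.1 q.1 ∧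
        δ / C ≤ dist p.2 q.2}), bd κ = bd α + mp (fun p => (p.1, e')) (bd α) := by
  classical
  obtain ⟨C, hC, H⟩ := exists_fill_branch hg hY hF
  refine ⟨C + 4, by linarith, fun q e' ε δ hε hδ hεδ he' r hr α β hα hβ hαβ ht => ?_⟩
  have hC0 : 0 < C := by linarith
  have hε4 : 4 * ε ≤ δ := by nlinarith
  set K : Submodule F2 (Ch (Y × Y')) :=
    (Sup (Lst (r + 1) (Near (C * ε)) {p : Y × Y' | δ / C ≤ dist p.1 q.1 ∧
      δ / C ≤ dist p.2 q.2})).map bd |>.comap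
        (LinearMap.id + mp (fun p : Y × Y' => (p.1, e'))) with hK
  suffices hmem : bd α ∈ K by
    obtain ⟨κ, hκ, hb⟩ := hmem
    refine ⟨κ, Sup_Lst_mono (fun _ _ => Near.mono (by nlinarith)) ?_ hκ, hb⟩
    have : δ / (C + 4) ≤ δ / C := div_le_div_of_nonneg_left hδ.le hC0 (by linarith)
    exact fun p hp => ⟨this.trans hp.1, this.trans hp.2⟩
  set ρ : Y → Y := brep q.1 (δ / 8) with hρ
  have hfar : ∀ {x : Y}, δ ≤ dist x q.1 → δ / 8 ≤ dist x q.1 := fun h => by linarith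
  -- the branches of the points of a list agree
  have hcls : ∀ l ∈ Lst (r + 1) (Near ε) {p : Y × Y' | δ ≤ dist p.1 q.1}, ∀ x ∈ l, ∀ y ∈ l,
      ρ x.1 = ρ y.1 := by
    intro l hl x hx y hy
    have h1 : δ ≤ dist x.1 q.1 := hl.2.2 x hx
    have h2 : δ ≤ dist y.1 q.1 := hl.2.2 y hy
    rw [hρ, brep_iff (hfar h1) (hfar h2)]
    have h3 : dist x.1 y.1 ≤ ε := (le_max_left _ _).trans (hl.2.1 x hx y hy)
    exact Relation.EqvGen.rel _ _ (by linarith)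
  set hd : List (Y × Y') → Y := fun l => ρ (l.head?.getD q).1 with hhd
  have hhdeq : ∀ l ∈ Lst (r + 1) (Near ε) {p : Y × Y' | δ ≤ dist p.1 q.1}, ∀ x ∈ l,
      ρ x.1 = hd l := by
    intro l hl x hx
    match l, hl with
    | y :: l, hl => exact hcls _ hl x hx y (by simp)
  rw [← sum_filt hd (c := α) (E := α.support.image hd) fun l hl => Finset.mem_image_of_mem _ hl,
    map_sum]
  refine sum_mem fun E hE => ?_
  obtain ⟨l₀, hl₀, hE⟩ := Finset.mem_image.1 hE
  have hl₀' := hα hl₀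
  obtain ⟨x₀, hx₀⟩ : ∃ x, x ∈ l₀ := by
    match l₀, hl₀' with
    | y :: l, hl => exact ⟨y, by simp⟩
  have hx₀E : ρ x₀.1 = E := (hhdeq _ hl₀' _ hx₀).trans hE
  have hx₀f : δ / 8 ≤ dist x₀.1 q.1 := hfar (hl₀'.2.2 x₀ hx₀)
  obtain ⟨hE1, hE2⟩ := brep_spec hx₀f
  rw [← hρ, hx₀E] at hE1 hE2
  have hρE : ρ E = E := by rw [← hx₀E]; exact (brep_eq (by rw [hx₀E]; exact hE1)).symm
  set αE := filt {l | hd l = E} α with hαE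
  have hαEm : αE ∈ Sup (Lst (r + 1) (Near ε) {p : Y × Y' | δ ≤ dist p.1 q.1 ∧ ρ p.1 = E}) := by
    refine Sup_mono (fun l hl => ?_) (filt_mem hα)
    exact ⟨hl.1.1, hl.1.2.1, fun x hx => ⟨hl.1.2.2 x hx, (hhdeq _ hl.1 x hx).trans hl.2⟩⟩
  have hbr : ∀ x : Y, δ ≤ dist x q.1 → ρ x = E → Branch q.1 (δ / 8) x E := fun x hx h => by
    rw [← hρE] at h
    exact (brep_iff (hfar hx) hE2).1 h
  refine H q.1 E q.2 e' ε δ hε hδ (le_trans (by nlinarith) hεδ) he' hE2 r hr (bd αE) ?_ (bd_bd _) ?_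
  · have h1 := bd_Lst hαEm
    match r, hr, hα, hβ, ht, hhdeq, hcls, hαEm, h1 with
    | 0, _, _, _, _, _, _, _, h1 =>
      refine Sup_mono (fun l hl => ?_) h1
      have : l = [] := by simpa using hl.1
      subst this
      exact ⟨rfl, by simp, by simp⟩
    | r + 1, _, hα, hβ, _, hhdeq, _, hαEm, h1 =>
      set pE : Set (List (Y × Y')) := {l | l ≠ [] ∧ ∀ x ∈ l, ρ x.1 = E} with hpE
      have hcomm : bd αE = filt pE (bd α) := by
        have hsplit := filt_add_compl {l | hd l = E} α
        rw [← hαE] at hsplit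
        rw [← hsplit, map_add, map_add, filt_eq_self (p := pE) (c := bd αE), filt_eq_zero
          (S := Lst (r + 1) (Near ε) {p : Y × Y' | ρ p.1 ≠ E}), add_zero]
        · refine bd_Lst (Sup_mono (S := Lst (r + 1 + 1) (Near ε) {p : Y × Y' | δ ≤ dist p.1 q.1} ∩
            {l | hd l = E}ᶜ) (T := Lst (r + 1 + 1) (Near ε) {p : Y × Y' | ρ p.1 ≠ E})
            (fun l hl => ⟨hl.1.1, hl.1.2.1, fun x hx h => ?_⟩) (filt_mem hα))
          exact hl.2 ((hhdeq _ hl.1 x hx).symm.trans h)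
        · intro l hl hl'
          obtain ⟨x, hx⟩ := List.exists_mem_of_ne_nil l hl'.1
          exact hl.2.2 x hx (hl'.2 x hx)
        · refine Sup_mono (T := pE) (S := Lst (r + 1) (Near ε)
            {p : Y × Y' | δ ≤ dist p.1 q.1 ∧ ρ p.1 = E})
            (fun l hl => ⟨?_, fun x hx => (hl.2.2 x hx).2⟩) h1
          rintro rfl
          simpa using hl.1
      have h2 : bd αE ∈ Sup (Lst (r + 1) (Near ε) {p : Y × Y' | δ ≤ dist p.2 q.2}) := by
        rw [hcomm, hαβ]
        exact Sup_mono Set.inter_subset_left (filt_mem (bd_Lst hβ))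
      refine Sup_mono (T := Lst (r + 1) (Near ε) {p : Y × Y' | (δ ≤ dist p.1 q.1 ∧
        δ ≤ dist p.2 q.2) ∧ Branch q.1 (δ / 8) p.1 E})
        (S := Lst (r + 1) (Near ε) {p : Y × Y' | δ ≤ dist p.1 q.1 ∧ ρ p.1 = E} ∩
          Lst (r + 1) (Near ε) {p : Y × Y' | δ ≤ dist p.2 q.2})
        (fun l hl => ⟨hl.1.1, hl.1.2.1, fun x hx => ?_⟩) (Sup_inter h1 h2)
      have := hl.1.2.2 x hx
      exact ⟨⟨this.1, hl.2.2.2 x hx⟩, hbr _ this.1 this.2⟩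
  · rcases ht with ht | ht
    · exact Or.inl ht
    right
    intro L' hL'
    have hL'n := hlen _ _ _ hL'
    obtain ⟨t, L3, rfl⟩ : ∃ t L3, L' = t :: L3 := by
      match L', hL'n with
      | [], h => simp at h; omega
      | t :: L3, _ => exact ⟨t, L3, rfl⟩
    have hcyc : bd (mp Prod.snd (bd αE)) = 0 := by rw [bd_mp, bd_bd, map_zero]
    have hT : (branchInd q.1 (δ / 8) E ∘ Prod.fst) :: (t :: L3).map (· ∘ Prod.snd) ∈
        TestP Test' q (δ / 2) :=
      ⟨_, _, (branchInd_adm _ _ _).mono (by linarith), hmono _ _ _ (by linarith) hL', rfl⟩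
    have h0 := ht _ hT
    have hcoP : ∀ {Z : Type _} (s : Z → F2) (L : List (Z → F2)), coP (s :: L) = coT [] s L :=
      fun s L => by ext l; simp [coP]
    rw [map_add, hcoP, lext_eq_zero (c := β) (fun l hl => ?_) hβ, add_zero] at h0
    · rw [lext_coP_mp, List.map_cons, hcoP, lext_coT_bd, hαE, lext_filt]
      refine (lext_congr (fun l hl => ?_) hα).trans h0
      match l, hl with
      | x :: l, hl =>
        have h1 : δ ≤ dist x.1 q.1 := hl.2.2 x (by simp)
        have h2 := hhdeq _ hl x (by simp)
        have h3 : branchInd q.1 (δ / 8) E x.1 = if hd (x :: l) = E then 1 else 0 := by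
          rw [branchInd]
          refine if_congr ?_ rfl rfl
          rw [← h2]
          constructor
          · intro h; rw [← hρE]; exact (brep_eq h).symm
          · intro h; exact (hbr _ h1 h).symm
        simp only [coT, Function.comp, h3, List.map_cons, List.nil_append, Set.mem_ofPred_eq]
        split_ifs <;> simp
    · match l, hl with
      | x :: l, hl =>
        obtain ⟨s, hs, hc⟩ := hconst q.2 (δ / 4) _ hL' ε δ ((x :: l).map Prod.snd) x.2 (by simp)
          (hl.2.2 x (by simp)) (by
            intro y hy z hz
            obtain ⟨y', hy', rfl⟩ := List.mem_map.1 hy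
            obtain ⟨z', hz', rfl⟩ := List.mem_map.1 hz
            exact (le_max_right _ _).trans (hl.2.1 y' hy' z' hz')) (by linarith)
        refine coT_eq_zero (t := s ∘ Prod.snd) (Or.inr (List.mem_map_of_mem hs)) ?_
        intro y hy z hz
        exact hc _ (List.mem_map_of_mem hy) _ (List.mem_map_of_mem hz)

end Step
end DeRahmSplit

namespace DeRahmSplit

section Step
variable {Y Y' : Type*} [MetricSpace Y] [MetricSpace Y']

lemma FillData.prod (hg : Geod Y) (hY : Contr Y) (hf : Far Y) {n : ℕ}
    {Test' : Y' → ℝ → Set (List (Y' → F2))} (H : FillData Y' n Test') :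
    FillData (Y × Y') (n + 1) (TestP Test') where
  pos := Nat.succ_pos n
  contr := hY.prod H.contr
  far := fun q δ => by
    obtain ⟨x, hx⟩ := hf q.1 δ
    exact ⟨(x, q.2), hx.trans (le_max_left _ _)⟩
  const := by
    rintro q η _ ⟨s, L', hs, hL', rfl⟩ ε δ l x hx hd hl h
    rcases le_max_iff.1 hd with hd | hd
    · refine ⟨_, List.mem_cons_self .., ?_⟩
      have := hs.constOn (l := l.map Prod.fst) (List.mem_map_of_mem hx) hd (by
        intro y hy z hz
        obtain ⟨y', hy', rfl⟩ := List.mem_map.1 hy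
        obtain ⟨z', hz', rfl⟩ := List.mem_map.1 hz
        exact (le_max_left _ _).trans (hl y' hy' z' hz')) h
      exact fun y hy z hz => this _ (List.mem_map_of_mem hy) _ (List.mem_map_of_mem hz)
    · obtain ⟨t, ht, this⟩ := H.const _ _ _ hL' ε δ (l.map Prod.snd) _ (List.mem_map_of_mem hx) hd
        (by
        intro y hy z hz
        obtain ⟨y', hy', rfl⟩ := List.mem_map.1 hy
        obtain ⟨z', hz', rfl⟩ := List.mem_map.1 hz
        exact (le_max_right _ _).trans (hl y' hy' z' hz')) h
      refine ⟨_, List.mem_cons_of_mem _ (List.mem_map_of_mem ht), ?_⟩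
      exact fun y hy z hz => this _ (List.mem_map_of_mem hy) _ (List.mem_map_of_mem hz)
  length := by
    rintro q η _ ⟨s, L', hs, hL', rfl⟩
    simp [H.length _ _ _ hL']
  mono := by
    rintro q η η' h _ ⟨s, L', hs, hL', rfl⟩
    exact ⟨s, L', hs.mono h, H.mono _ _ _ h hL', rfl⟩
  fills := by
    obtain ⟨C₁, hC₁, H₁⟩ := exists_kappa hg hY H.pos H.fills H.length H.const H.mono
    obtain ⟨C₂, hC₂, H₂⟩ := exists_glue hY H.contr
    have hC₁0 : 0 < C₁ := by linarith
    refine ⟨2 * C₁ * C₂, by nlinarith, fun q ε δ₀ hε hδ₀ hεδ r hr c hc hbc ht => ?_⟩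
    set δ := δ₀ / 2 with hδdef
    have hδ : 0 < δ := by positivity
    have hC12 : C₁ ≤ C₁ * C₂ := by nlinarith
    have hC1ε : C₁ * ε ≤ δ := by
      have : C₁ * ε ≤ C₁ * C₂ * ε := mul_le_mul_of_nonneg_right hC12 hε.le
      linarith
    have hε2 : ε ≤ δ := by nlinarith
    have hCpos : 0 < 2 * C₁ * C₂ := by nlinarith
    have hdiv : δ₀ / (2 * C₁ * C₂) ≤ δ / C₁ := by
      rw [hδdef, div_div]
      exact div_le_div_of_nonneg_left hδ₀.le (by positivity) (by nlinarith)
    obtain ⟨e₁, he₁⟩ := hf q.1 (max δ δ₀)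
    obtain ⟨e', he'⟩ := H.far q.2 δ
    match r, hr, hc with
    | 0, _, hc =>
      refine fill_length_zero (x := (e₁, e')) ?_ (by positivity) hc
      refine hdiv.trans (le_trans ?_ (le_max_left _ _))
      exact (div_le_self hδ.le hC₁).trans ((le_max_left _ _).trans he₁)
    | r + 1, hr, hc =>
      set S : Set (List (Y × Y')) := {l | ∃ x ∈ l, δ₀ ≤ dist x.1 q.1} with hS
      have hsplit : filt S c + filt Sᶜ c = c := filt_add_compl S c
      set α := filt S c with hαdef
      set β := filt Sᶜ c with hβdef
      have hα : α ∈ Sup (Lst (r + 1) (Near ε) {p : Y × Y' | δ ≤ dist p.1 q.1}) := by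
        refine Sup_mono (S := Lst (r + 1) (Near ε) (Off q δ₀) ∩ S) (fun l hl => ?_) (filt_mem hc)
        refine ⟨hl.1.1, hl.1.2.1, fun y hy => ?_⟩
        obtain ⟨x, hx, hxd⟩ := hl.2
        have h1 : dist x.1 y.1 ≤ ε := (le_max_left _ _).trans (hl.1.2.1 x hx y hy)
        have h2 := dist_triangle x.1 y.1 q.1
        show δ ≤ dist y.1 q.1
        linarith
      have hβ : β ∈ Sup (Lst (r + 1) (Near ε) {p : Y × Y' | δ ≤ dist p.2 q.2}) := by
        refine Sup_mono (S := Lst (r + 1) (Near ε) (Off q δ₀) ∩ Sᶜ) (fun l hl => ?_) (filt_mem hc)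
        refine ⟨hl.1.1, hl.1.2.1, fun y hy => ?_⟩
        have h1 : ¬ δ₀ ≤ dist y.1 q.1 := fun h => hl.2 ⟨y, hy, h⟩
        have h2 : δ₀ ≤ dist y q := hl.1.2.2 y hy
        rcases le_max_iff.1 h2 with h2 | h2
        · exact absurd h2 h1
        · show δ ≤ dist y.2 q.2
          linarith
      have hαβ : bd α = bd β := by
        refine eq_of_add_eq_zero_F2 ?_
        rw [← map_add, hsplit, hbc]
      obtain ⟨κ, hκ, hκb⟩ := H₁ q e' ε δ hε hδ hC1ε he' r (by omega) α β hα hβ hαβ (by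
        rcases ht with ht | ht
        · left; omega
        · right
          intro L hL
          rw [hsplit]
          refine ht L ?_
          have : δ₀ / 4 = δ / 2 := by rw [hδdef]; ring
          rwa [this])
      have hδ1 : δ / C₁ ≤ δ := div_le_self hδ.le hC₁
      have hεC : ε ≤ C₁ * ε := by nlinarith
      obtain ⟨X, hX, hXb⟩ := H₂ q e₁ e' (C₁ * ε) (δ / C₁) (by positivity) (by positivity)
        (hδ1.trans ((le_max_left _ _).trans he₁)) (hδ1.trans he') r (α + κ) (β + κ)
        (add_mem (Sup_Lst_mono (fun _ _ => Near.mono hεC)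
          (U' := {p : Y × Y' | δ / C₁ ≤ dist p.1 q.1}) (fun p hp => hδ1.trans hp) hα)
          (Sup_Lst_mono (fun _ _ => id) (U' := {p : Y × Y' | δ / C₁ ≤ dist p.1 q.1})
            (fun p hp => hp.1) hκ))
        (add_mem (Sup_Lst_mono (fun _ _ => Near.mono hεC)
          (U' := {p : Y × Y' | δ / C₁ ≤ dist p.2 q.2}) (fun p hp => hδ1.trans hp) hβ)
          (Sup_Lst_mono (fun _ _ => id) (U' := {p : Y × Y' | δ / C₁ ≤ dist p.2 q.2})
            (fun p hp => hp.2) hκ))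
        (by rw [map_add, map_add, hαβ])
        (by
          have : bd (α + κ) = mp (fun p : Y × Y' => (p.1, e')) (bd α) := by
            rw [map_add, hκb, ← add_assoc, ← two_nsmul, two_nsmul_F2, zero_add]
          rw [this]
          have h1 := bd_Lst hα
          refine mp_Lst (f := fun p : Y × Y' => (p.1, e')) (R := Near ε) (R' := Near (C₁ * ε))
            (U := {p : Y × Y' | δ ≤ dist p.1 q.1}) (U' := {p : Y × Y' | p.2 = e'})
            ?_ ?_ h1
          · intro x _ y _ hxy
            have h2 : dist x.1 y.1 ≤ ε := (le_max_left _ _).trans hxy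
            exact max_le (h2.trans hεC) (by simp; positivity)
          · intro x _
            rfl)
      refine ⟨X, Sup_Lst_mono (fun _ _ => Near.mono ?_) ?_ hX, ?_⟩
      · have : 0 ≤ C₁ * C₂ * ε := by positivity
        linarith
      · exact fun p hp => hdiv.trans hp
      · rw [hXb, ← hsplit]
        have : κ + κ = 0 := by rw [← two_nsmul, two_nsmul_F2]
        rw [add_add_add_comm, this, add_zero]

end Step
end DeRahmSplit

namespace DeRahmSplit

section Transport
variable {Z Z' : Type*} [MetricSpace Z] [MetricSpace Z']

lemma FillData.comap (e : Z ≃ᵢ Z') {n : ℕ} {T : Z → ℝ → Set (List (Z → F2))}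
    {T' : Z' → ℝ → Set (List (Z' → F2))} (H : FillData Z' n T')
    (hT : ∀ q η L', L' ∈ T' (e q) η → L'.map (· ∘ e) ∈ T q η)
    (hT' : ∀ q η L, L ∈ T q η → L.map (· ∘ e.symm) ∈ T' (e q) η) : FillData Z n T where
  pos := H.pos
  contr := by
    obtain ⟨C, hC, H⟩ := H.contr
    refine ⟨C, hC, fun p ε hε F hF => ?_⟩
    obtain ⟨h, m, h0, he, hL, hs, hm⟩ := H (e p) ε hε (e '' F) (hF.image _)
    refine ⟨fun k x => e.symm (h k (e x)), m, by simp [h0], by simp [he], ?_, ?_, ?_⟩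
    · intro k x y
      rw [e.symm.dist_eq, ← e.dist_eq x y]
      exact hL _ _ _
    · intro k x
      rw [e.symm.dist_eq]
      exact hs _ _
    · intro k hk x hx
      show e.symm (h k (e x)) = p
      rw [hm k hk _ (Set.mem_image_of_mem _ hx), e.symm_apply_apply]
  far := fun q δ => by
    obtain ⟨x, hx⟩ := H.far (e q) δ
    exact ⟨e.symm x, by rwa [← e.dist_eq, e.apply_symm_apply]⟩
  const := by
    intro q η L hL ε δ l x hx hd hl h
    obtain ⟨s, hs, hc⟩ := H.const (e q) η _ (hT' _ _ _ hL) ε δ (l.map e) (e x)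
      (List.mem_map_of_mem hx) (by rwa [e.dist_eq]) (by
        intro y hy z hz
        obtain ⟨y', hy', rfl⟩ := List.mem_map.1 hy
        obtain ⟨z', hz', rfl⟩ := List.mem_map.1 hz
        rw [e.dist_eq]
        exact hl _ hy' _ hz') h
    obtain ⟨t, ht, rfl⟩ := List.mem_map.1 hs
    refine ⟨t, ht, fun y hy z hz => ?_⟩
    simpa using hc _ (List.mem_map_of_mem hy) _ (List.mem_map_of_mem hz)
  length := fun q η L hL => by simpa using H.length _ _ _ (hT' _ _ _ hL)
  mono := fun q η η' h L hL => by
    have := hT _ _ _ (H.mono _ _ _ h (hT' _ _ _ hL))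
    simpa [Function.comp_def] using this
  fills := by
    obtain ⟨C, hC, H⟩ := H.fills
    refine ⟨C, hC, fun q ε δ hε hδ hεδ r hr c hc hbc ht => ?_⟩
    obtain ⟨X, hX, hXb⟩ := H (e q) ε δ hε hδ hεδ r hr (mp e c)
      (mp_Lst (f := e) (R := Near ε) (R' := Near ε) (U := Off q δ) (U' := Off (e q) δ)
        (fun x _ y _ h => by simpa [Near, e.dist_eq] using h)
        (fun x hx => by simpa [Off, e.dist_eq] using hx) hc)
      (by rw [bd_mp, hbc, map_zero]) (by
        refine ht.imp id fun ht L hL => ?_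
        rw [lext_coP_mp]
        exact ht _ (hT _ _ _ hL))
    refine ⟨mp e.symm X, mp_Lst (f := e.symm) (R := Near (C * ε)) (R' := Near (C * ε))
      (U := Off (e q) (δ / C)) (U' := Off q (δ / C))
        (fun x _ y _ h => by simpa [Near, e.symm.dist_eq] using h)
        (fun x hx => by
          show _ ≤ dist (e.symm x) q
          rw [← e.dist_eq, e.apply_symm_apply]; exact hx) hX, ?_⟩
    rw [bd_mp, hXb, mp_mp]
    convert mp_id c
    ext x; simp

end Transport

/-- The tests on a finite product. -/
def TestPi {N : ℕ} (Y : Fin N → Type*) [∀ i, MetricSpace (Y i)] (q : ∀ i, Y i) (η : ℝ) :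
    Set (List ((∀ i, Y i) → F2)) :=
  {L | ∃ s : ∀ i, Y i → F2, (∀ i, Adm η (q i) (s i)) ∧ L = List.ofFn fun i y => s i (y i)}

/-- The isometry splitting off the first factor. -/
def consIsom {N : ℕ} (Y : Fin (N + 1) → Type*) [∀ i, MetricSpace (Y i)] :
    (∀ i, Y i) ≃ᵢ Y 0 × (∀ i : Fin N, Y i.succ) where
  toFun x := (x 0, fun i => x i.succ)
  invFun p := Fin.cons p.1 p.2
  left_inv x := by
    funext i
    refine Fin.cases ?_ (fun i => ?_) i <;> simp
  right_inv p := by simp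
  isometry_toFun := by
    refine Isometry.of_dist_eq fun x y => ?_
    refine le_antisymm (max_le (dist_le_pi_dist x y 0) ?_) ?_
    · exact (dist_pi_le_iff dist_nonneg).2 fun i => dist_le_pi_dist x y i.succ
    · refine (dist_pi_le_iff dist_nonneg).2 fun i => ?_
      refine Fin.cases (le_max_left _ _) (fun i => le_trans ?_ (le_max_right _ _)) i
      exact dist_le_pi_dist (fun i : Fin N => x i.succ) (fun i => y i.succ) i

/-- A product over a one-element type is isometric to its factor. -/
def oneIsom (Y : Fin 1 → Type*) [∀ i, MetricSpace (Y i)] : (∀ i, Y i) ≃ᵢ Y 0 where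
  toFun x := x 0
  invFun p := fun i => (Subsingleton.elim 0 i : (0 : Fin 1) = i) ▸ p
  left_inv x := by
    funext i
    obtain rfl : i = 0 := Subsingleton.elim _ _
    rfl
  right_inv p := rfl
  isometry_toFun := by
    refine Isometry.of_dist_eq fun x y => le_antisymm (dist_le_pi_dist x y 0) ?_
    refine (dist_pi_le_iff dist_nonneg).2 fun i => ?_
    obtain rfl : i = 0 := Subsingleton.elim _ _
    rfl

theorem fillData_pi {N : ℕ} (Y : Fin (N + 1) → Type*) [∀ i, MetricSpace (Y i)]
    (hg : ∀ i, Geod (Y i)) (hc : ∀ i, Contr (Y i)) (hf : ∀ i, Far (Y i)) :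
    FillData (∀ i, Y i) (N + 1) (TestPi Y) := by
  induction N with
  | zero =>
    refine (fillData_one (hg 0) (hc 0) (hf 0)).comap (oneIsom Y) ?_ ?_
    · rintro q η _ ⟨s, hs, rfl⟩
      refine ⟨Fin.cons s fun i => i.elim0, fun i => ?_, ?_⟩
      · exact Fin.cases hs (fun i => i.elim0) i
      · simp
        rfl
    · rintro q η _ ⟨s, hs, rfl⟩
      refine ⟨s 0, hs 0, ?_⟩
      simp
      rfl
  | succ N ih =>
    refine (FillData.prod (hg 0) (hc 0) (hf 0) (ih (fun i => Y i.succ) (fun i => hg _)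
      (fun i => hc _) fun i => hf _)).comap (consIsom Y) ?_ ?_
    · rintro q η _ ⟨s, _, hs, ⟨t, ht, rfl⟩, rfl⟩
      refine ⟨Fin.cons s t, fun i => ?_, ?_⟩
      · exact Fin.cases hs (fun i => ht i) i
      · conv_rhs => rw [List.ofFn_succ]
        simp only [List.map_cons, List.map_ofFn]
        rfl
    · rintro q η _ ⟨s, hs, rfl⟩
      refine ⟨s 0, _, hs 0, ⟨fun i => s i.succ, fun i => hs _, rfl⟩, ?_⟩
      rw [List.ofFn_succ]
      simp only [List.map_cons, List.map_ofFn]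
      rfl

end DeRahmSplit

namespace DeRahmSplit

open Filter Topology

lemma exists_slot {A : Type*} {N : ℕ} (f : Fin N → A) (i : Fin N) :
    ∃ L₁ L₂ : List A, (∀ a, List.ofFn (Function.update f i a) = L₁ ++ a :: L₂) ∧
      ∀ j, j ≠ i → f j ∈ L₁ ∨ f j ∈ L₂ := by
  induction N with
  | zero => exact i.elim0
  | succ N ih =>
    refine Fin.cases ?_ (fun i => ?_) i
    · refine ⟨[], List.ofFn fun j : Fin N => f j.succ, fun a => ?_, fun j hj => Or.inr ?_⟩
      · rw [List.ofFn_succ]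
        simp
      · obtain ⟨j, rfl⟩ := Fin.exists_succ_eq.2 hj
        exact (List.mem_ofFn' _ _).2 ⟨j, rfl⟩
    · obtain ⟨L₁, L₂, h, h'⟩ := ih (fun j => f j.succ) i
      refine ⟨f 0 :: L₁, L₂, fun a => ?_, fun j => ?_⟩
      · have h2 : (fun j : Fin N => Function.update f i.succ a j.succ) =
            Function.update (fun j => f j.succ) i a := by
          funext j
          by_cases hj : j = i
          · subst hj; simp
          · rw [Function.update_of_ne hj, Function.update_of_ne (by simpa using hj)]
        rw [List.ofFn_succ, h2, h, Function.update_of_ne (Fin.succ_ne_zero i).symm]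
        rfl
      · refine Fin.cases (fun _ => by simp) (fun j hj => ?_) j
        rcases h' j (by simpa using hj) with h | h
        · exact Or.inl (List.mem_cons_of_mem _ h)
        · exact Or.inr h

lemma coT_congr {Y : Type*} (L₁ L₂ : List (Y → F2)) {s s' : Y → F2} {l : List Y}
    (h : ∀ x ∈ l, s x = s' x) : coT L₁ s L₂ l = coT L₁ s' L₂ l := by
  apply eq_of_add_eq_zero_F2
  rw [coT_add]
  exact coT_zero_of fun x hx => by simp [h x hx, add_self_F2]

section Branches
variable {Y : Type*} [MetricSpace Y]

lemma Branch.const {p : Y} {χ : Y → F2} (hχ : Adm 0 p χ) {x y : Y} (h : Branch p 0 x y) :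
    χ x = χ y := by
  induction h with
  | rel x y h =>
    by_contra hne
    have := hχ x y hne
    linarith
  | refl => rfl
  | symm _ _ _ ih => exact ih.symm
  | trans _ _ _ _ _ h h' => exact h.trans h'

lemma Branch.symm {p : Y} {η : ℝ} {x y : Y} (h : Branch p η x y) : Branch p η y x :=
  Relation.EqvGen.symm _ _ h

lemma Branch.trans {p : Y} {η : ℝ} {x y z : Y} (h : Branch p η x y) (h' : Branch p η y z) :
    Branch p η x z := Relation.EqvGen.trans _ _ _ h h'

lemma Branch.refl (p : Y) (η : ℝ) (x : Y) : Branch p η x x := Relation.EqvGen.refl _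

lemma Branch.of_lt {p x y : Y} (h : dist x y < dist x p + dist y p) : Branch p 0 x y :=
  Relation.EqvGen.rel _ _ (by linarith)

lemma Branch.eq_center {p x y : Y} (h : Branch p 0 x y) : x = p ↔ y = p := by
  induction h with
  | rel x y h =>
    constructor
    · rintro rfl; rw [dist_self, dist_comm] at h; linarith
    · rintro rfl; rw [dist_self] at h; linarith
  | refl => rfl
  | symm _ _ _ ih => exact ih.symm
  | trans _ _ _ _ _ h h' => exact h.trans h'

lemma dist_of_not_branch {p x y : Y} (h : ¬ Branch p 0 x y) :
    dist x y = dist x p + dist y p := by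
  refine le_antisymm (dist_triangle_right x y p) ?_
  by_contra hlt
  push Not at hlt
  exact h (.of_lt hlt)

lemma Adm.eq_center {δ : ℝ} {p x y : Y} {s : Y → F2} (hs : Adm δ y s) (hxy : ¬ Branch p 0 x y)
    (hδ : δ < dist y p) : s x = s p := by
  by_contra hne
  have h1 := hs x p hne
  have h2 := dist_of_not_branch hxy
  rw [dist_comm p y] at h1
  linarith

lemma Adm.close {δ : ℝ} {p x y z : Y} {s : Y → F2} (hs : Adm δ y s) (hy : dist y p ≤ δ)
    (hxz : dist x z + 4 * δ < dist x p + dist z p) : s x = s z := by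
  by_contra hne
  have h1 := hs x z hne
  have h2 := dist_triangle x y p
  have h3 := dist_triangle z y p
  linarith

/-- A fine function on one branch. -/
lemma Branch.uniform {p x z : Y} (h : Branch p 0 x z) :
    ∃ η : ℝ, 0 < η ∧ ∀ δ ≤ η, ∀ y, dist y p ≤ δ → ∀ s, Adm δ y s → s x = s z := by
  induction h with
  | rel x z h =>
    refine ⟨(dist x p + dist z p - dist x z) / 5, by linarith, fun δ hδ y hy s hs => ?_⟩
    have h0 : 0 ≤ δ := dist_nonneg.trans hy
    exact hs.close hy (by linarith)
  | refl => exact ⟨1, one_pos, fun _ _ _ _ _ _ => rfl⟩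
  | symm _ _ _ ih =>
    obtain ⟨η, h0, h⟩ := ih
    exact ⟨η, h0, fun δ hδ y hy s hs => (h δ hδ y hy s hs).symm⟩
  | trans _ _ _ _ _ ih ih' =>
    obtain ⟨η, h0, h⟩ := ih
    obtain ⟨η', h0', h'⟩ := ih'
    exact ⟨min η η', lt_min h0 h0', fun δ hδ y hy s hs =>
      (h δ (hδ.trans (min_le_left _ _)) y hy s hs).trans
        (h' δ (hδ.trans (min_le_right _ _)) y hy s hs)⟩

lemma exists_reps {p : Y} {K : Set Y} (hK : IsCompact K) (hp : p ∉ K) :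
    ∃ R : Finset Y, (∀ r ∈ R, r ∈ K) ∧ ∃ η : ℝ, 0 < η ∧ ∀ x ∈ K, ∃ r ∈ R, Branch p 0 x r ∧
      ∀ δ ≤ η, ∀ y, dist y p ≤ δ → ∀ s, Adm δ y s → s x = s r := by
  obtain ⟨η, hη, hηK⟩ : ∃ η : ℝ, 0 < η ∧ ∀ x ∈ K, η ≤ dist x p := by
    have := (hK.isClosed.isOpen_compl.mem_nhds (show p ∈ Kᶜ from hp))
    obtain ⟨η, hη, h⟩ := Metric.mem_nhds_iff.1 this
    exact ⟨η, hη, fun x hx => not_lt.1 fun hlt => h hlt hx⟩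
  obtain ⟨t, htK, ht⟩ := hK.elim_nhds_subcover (fun x => Metric.ball x η)
    (fun x _ => Metric.ball_mem_nhds x hη)
  refine ⟨t, htK, η / 5, by positivity, fun x hx => ?_⟩
  obtain ⟨r, hr, hxr⟩ := Set.mem_iUnion₂.1 (ht hx)
  have h1 : dist x r < η := hxr
  have h2 := hηK x hx
  have h3 := hηK r (htK r hr)
  exact ⟨r, hr, .of_lt (by linarith), fun δ hδ y hy s hs => hs.close hy (by linarith)⟩

lemma exists_uniform {p : Y} {K : Set Y} (hK : IsCompact K) (hp : p ∉ K) :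
    ∃ η : ℝ, 0 < η ∧ ∀ δ ≤ η, ∀ y, dist y p ≤ δ → ∀ s, Adm δ y s → ∀ x ∈ K, ∀ z ∈ K,
      Branch p 0 x z → s x = s z := by
  classical
  obtain ⟨R, hR, η, hη, H⟩ := exists_reps hK hp
  have : ∃ η' : ℝ, 0 < η' ∧ ∀ δ ≤ η', ∀ y, dist y p ≤ δ → ∀ s, Adm δ y s →
      ∀ w ∈ R ×ˢ R, Branch p 0 w.1 w.2 → s w.1 = s w.2 := by
    generalize R ×ˢ R = T
    induction T using Finset.induction_on with
    | empty => exact ⟨1, one_pos, by simp⟩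
    | insert a T _ ih =>
      obtain ⟨η', h0, h⟩ := ih
      by_cases ha : Branch p 0 a.1 a.2
      · obtain ⟨η₂, h2, h2'⟩ := ha.uniform
        refine ⟨min η' η₂, lt_min h0 h2, fun δ hδ y hy s hs w hw hb => ?_⟩
        rcases Finset.mem_insert.1 hw with rfl | hw
        · exact h2' δ (hδ.trans (min_le_right _ _)) y hy s hs
        · exact h δ (hδ.trans (min_le_left _ _)) y hy s hs w hw hb
      · refine ⟨η', h0, fun δ hδ y hy s hs w hw hb => ?_⟩
        rcases Finset.mem_insert.1 hw with rfl | hw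
        · exact absurd hb ha
        · exact h δ hδ y hy s hs w hw hb
  obtain ⟨η', h0', H'⟩ := this
  refine ⟨min η η', lt_min hη h0', fun δ hδ y hy s hs x hx z hz hxz => ?_⟩
  obtain ⟨r, hr, hxr, h1⟩ := H x hx
  obtain ⟨r', hr', hzr, h2⟩ := H z hz
  rw [h1 δ (hδ.trans (min_le_left _ _)) y hy s hs, h2 δ (hδ.trans (min_le_left _ _)) y hy s hs]
  exact H' δ (hδ.trans (min_le_right _ _)) y hy s hs (r, r') (Finset.mk_mem_product hr hr')
    ((hxr.symm.trans hxz).trans hzr)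

end Branches

section Spheres
variable {N : ℕ} {X : Fin N → Type*} [∀ i, MetricSpace (X i)]

/-- The evaluation of a chain in a product on a family of functions on the factors. -/
def ev (c : Ch (∀ i, X i)) (s : ∀ i, X i → F2) : F2 :=
  lext (coP (List.ofFn fun i (y : ∀ i, X i) => s i (y i))) c

/-- A sequence of fine cycles in a fixed compact set missing the point `p`. -/
def SphIn (p : ∀ i, X i) (K : Set (∀ i, X i)) (c : ℕ → Ch (∀ i, X i)) : Prop :=
  IsCompact K ∧ p ∉ K ∧ (∀ m, bd (c m) = 0) ∧
    ∀ ε > 0, ∀ᶠ m in atTop, c m ∈ Sup (Lst N (Near ε) K)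

/-- The spheres at `p`. -/
def Sph (p : ∀ i, X i) (c : ℕ → Ch (∀ i, X i)) : Prop := ∃ K, SphIn p K c

/-- The sequence of cycles is trivial off `y`. -/
def Van (c : ℕ → Ch (∀ i, X i)) (y : ∀ i, X i) : Prop :=
  ∃ δ > 0, ∃ m₀, ∀ m ≥ m₀, ∀ s : ∀ i, X i → F2, (∀ i, Adm δ (y i) (s i)) → ev (c m) s = 0

/-- The points at which all coordinates are suitably close to `p` are suitable test centres. -/
def Tame (δ : ℝ) {Y : Type*} [MetricSpace Y] (p : Y) (s : Y → F2) : Prop :=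
  ∃ y, dist y p ≤ δ ∧ Adm δ y s

lemma ev_swap {p : ∀ i, X i} {K : Set (∀ i, X i)} {δ : ℝ} (hδ : 0 < δ)
    (hK : ∀ x ∈ K, ∃ i, 8 * δ ≤ dist (x i) (p i)) {c : Ch (∀ i, X i)}
    (hc : c ∈ Sup (Lst N (Near δ) K)) (hb : bd c = 0) (s : ∀ i, X i → F2) (i : Fin N)
    (hs : ∀ j, j ≠ i → Tame δ (p j) (s j)) (a b : X i → F2)
    (hab : ∀ x ∈ K, 4 * δ ≤ dist (x i) (p i) → a (x i) = b (x i)) :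
    ev c (Function.update s i a) = ev c (Function.update s i b) := by
  obtain ⟨L₁, L₂, h, hL⟩ := exists_slot (fun i (y : ∀ i, X i) => s i (y i)) i
  have key : ∀ a, ev c (Function.update s i a) = lext (coT L₁ (fun y => a (y i)) L₂) c := by
    intro a
    rw [ev, ← lext_coP_eq_coT p hb, ← h]
    congr 4
    funext j
    by_cases hj : j = i
    · subst hj; simp
    · simp [Function.update_of_ne hj]
  rw [key, key, ← sub_eq_zero, ← LinearMap.sub_apply]
  have : (lext (coT L₁ (fun y => a (y i)) L₂) - lext (coT L₁ (fun y => b (y i)) L₂)) c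
      = lext (fun l => coT L₁ (fun y => a (y i)) L₂ l - coT L₁ (fun y => b (y i)) L₂ l) c :=
    lin_ext (f := lext (coT L₁ (fun y => a (y i)) L₂) - lext (coT L₁ (fun y => b (y i)) L₂))
      (fun l => by simp) c
  rw [this]
  refine lext_eq_zero (fun l hl => ?_) hc
  by_cases hfar : ∃ x ∈ l, dist (x i) (p i) < 4 * δ
  · obtain ⟨x, hx, hxi⟩ := hfar
    obtain ⟨j, hj⟩ := hK x (hl.2.2 x hx)
    have hji : j ≠ i := by rintro rfl; linarith
    obtain ⟨y, hy, hsy⟩ := hs j hji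
    have hc : ConstOn (fun z : ∀ i, X i => s j (z j)) l := by
      have := hsy.constOn (δ := 7 * δ) (ε := δ) (x := x j) (l := l.map (· j))
        (List.mem_map_of_mem (f := (· j)) hx) (by
          have := dist_triangle (x j) y (p j)
          linarith) (by
          intro u hu v hv
          obtain ⟨u', hu', rfl⟩ := List.mem_map.1 hu
          obtain ⟨v', hv', rfl⟩ := List.mem_map.1 hv
          exact (dist_le_pi_dist u' v' j).trans (hl.2.1 u' hu' v' hv')) (by linarith)
      exact fun u hu v hv => this _ (List.mem_map_of_mem (f := (· j)) hu) _
        (List.mem_map_of_mem (f := (· j)) hv)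
    rw [coT_eq_zero (hL j hji) hc, coT_eq_zero (hL j hji) hc, sub_zero]
  · push Not at hfar
    rw [sub_eq_zero]
    refine coT_congr _ _ fun x hx => hab x (hl.2.2 x hx) (hfar x hx)

end Spheres
end DeRahmSplit

namespace DeRahmSplit

open Filter Topology

lemma lext_coP_bd {Y : Type*} (L : List (Y → F2)) (c : Ch Y) :
    lext (coP L) (bd c) = lext (coQ L) c := by
  cases L with
  | nil =>
    refine lin_ext (f := lext (coP []) ∘ₗ bd) (g := lext (coQ [])) (fun l => ?_) c
    have h0 : ∀ (x : Y) (c : Ch Y), lext (coP []) (cons x c) = 0 := fun x c =>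
      lin_ext (f := lext (coP []) ∘ₗ cons x) (g := 0) (fun l => by simp [coP]) c
    match l with
    | [] => simp [bdL, coQ]
    | [x] => simp [bdL, coP, coQ]
    | x :: y :: l => simp [bdL_cons, h0, coP, coQ]
  | cons s L =>
    have : coP (s :: L) = coT [] s L := by ext l; simp [coP]
    rw [this, lext_coT_bd]
    rfl

section Spheres
variable {N : ℕ} {X : Fin N → Type*}

lemma ev_slot (s : ∀ i, X i → F2) (i : Fin N) :
    ∃ L₁ L₂ : List ((∀ i, X i) → F2), (∀ (a : X i → F2) (c : Ch (∀ i, X i)) (_ : ∀ i, X i),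
      bd c = 0 → ev c (Function.update s i a) = lext (coT L₁ (fun y => a (y i)) L₂) c) ∧
      ∀ (a : X i → F2) (c : Ch (∀ i, X i)), ev c (Function.update s i a) =
        lext (coP (L₁ ++ (fun y => a (y i)) :: L₂)) c := by
  obtain ⟨L₁, L₂, h, -⟩ := exists_slot (fun i (y : ∀ i, X i) => s i (y i)) i
  have key : ∀ a : X i → F2, (List.ofFn fun j (y : ∀ i, X i) => Function.update s i a j (y j)) =
      L₁ ++ (fun y => a (y i)) :: L₂ := by
    intro a
    rw [← h]
    congr 1
    funext j
    by_cases hj : j = i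
    · subst hj; simp
    · simp [Function.update_of_ne hj]
  refine ⟨L₁, L₂, fun a c p hb => ?_, fun a c => ?_⟩
  · rw [ev, key, lext_coP_eq_coT p hb]
  · rw [ev, key]

lemma ev_update_const (p : ∀ i, X i) {c : Ch (∀ i, X i)} (hb : bd c = 0) (s : ∀ i, X i → F2)
    (i : Fin N) (b : F2) : ev c (Function.update s i fun _ => b) = 0 := by
  obtain ⟨L₁, L₂, -, h⟩ := ev_slot s i
  rw [h]
  nth_rewrite 1 [← cycle_eq p hb]
  rw [lext_coP_bd]
  exact lext_eq_zero (S := Set.univ) (fun l _ => coQ_eq_zero (t := fun _ => b) (by simp)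
    fun _ _ _ _ => rfl) (by simp [Sup])

variable [∀ i, MetricSpace (X i)]

lemma ev_congr {p : ∀ i, X i} {K : Set (∀ i, X i)} {δ : ℝ} (hδ : 0 < δ)
    (hK : ∀ x ∈ K, ∃ i, 8 * δ ≤ dist (x i) (p i)) {c : Ch (∀ i, X i)}
    (hc : c ∈ Sup (Lst N (Near δ) K)) (hb : bd c = 0) (s s' : ∀ i, X i → F2)
    (hs : ∀ j, Tame δ (p j) (s j)) (hs' : ∀ j, Tame δ (p j) (s' j))
    (h : ∀ i, ∀ x ∈ K, 4 * δ ≤ dist (x i) (p i) → s i (x i) = s' i (x i)) :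
    ev c s = ev c s' := by
  classical
  have key : ∀ A : Finset (Fin N), ev c (fun i => if i ∈ A then s' i else s i) = ev c s := by
    intro A
    induction A using Finset.induction_on with
    | empty => simp
    | insert i A hi ih =>
      rw [← ih]
      have e1 : (fun j => if j ∈ insert i A then s' j else s j) =
          Function.update (fun j => if j ∈ A then s' j else s j) i (s' i) := by
        funext j
        by_cases hj : j = i
        · subst hj; simp
        · simp [hj]
      have e2 : (fun j => if j ∈ A then s' j else s j) =
          Function.update (fun j => if j ∈ A then s' j else s j) i (s i) := by
        funext j
        by_cases hj : j = i
        · subst hj; simp [hi]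
        · simp [Function.update_of_ne hj]
      rw [e1]
      nth_rewrite 2 [e2]
      refine ev_swap hδ hK hc hb _ i (fun j _ => ?_) _ _ fun x hx hxi => (h i x hx hxi).symm
      split_ifs
      · exact hs' j
      · exact hs j
  have := key Finset.univ
  simpa using this.symm

/-- A test with nonzero value separates points in each coordinate. -/
lemma ev_ne_zero {p : ∀ i, X i} {K : Set (∀ i, X i)} {δ : ℝ} (hδ : 0 < δ)
    (hK : ∀ x ∈ K, ∃ i, 8 * δ ≤ dist (x i) (p i)) {c : Ch (∀ i, X i)}
    (hc : c ∈ Sup (Lst N (Near δ) K)) (hb : bd c = 0) (s : ∀ i, X i → F2)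
    (hs : ∀ j, Tame δ (p j) (s j)) (hne : ev c s ≠ 0) (i : Fin N) :
    ∃ x ∈ K, ∃ x' ∈ K, 4 * δ ≤ dist (x i) (p i) ∧ 4 * δ ≤ dist (x' i) (p i) ∧
      s i (x i) ≠ s i (x' i) := by
  by_contra hcon
  push Not at hcon
  apply hne
  obtain ⟨b, hbb⟩ : ∃ b, ∀ x ∈ K, 4 * δ ≤ dist (x i) (p i) → s i (x i) = b := by
    by_cases hex : ∃ x ∈ K, 4 * δ ≤ dist (x i) (p i)
    · obtain ⟨x, hx, hxi⟩ := hex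
      exact ⟨s i (x i), fun z hz hzi => hcon z hz x hx hzi hxi⟩
    · push Not at hex
      exact ⟨0, fun x hx hxi => absurd (hex x hx) (not_lt.2 hxi)⟩
  have := ev_swap hδ hK hc hb s i (fun j _ => hs j) (s i) (fun _ => b) hbb
  rw [Function.update_eq_self] at this
  rw [this, ev_update_const p hb]

end Spheres

section Cube

/-- The boundary of the standard cube. -/
def cubeBd (n : ℕ) : Set (Fin n → ℝ) := {x | (∀ i, |x i| ≤ 1) ∧ ∃ i, |x i| = 1}

lemma near_pi {n : ℕ} {ε : ℝ} (h0 : 0 ≤ ε) {x y : Fin n → ℝ} (h : ∀ i, |x i - y i| ≤ ε) :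
    dist x y ≤ ε := (dist_pi_le_iff h0).2 fun i => by rw [Real.dist_eq]; exact h i

lemma exists_cube_fill {n : ℕ} {ε : ℝ} (hε : 0 < ε) {c : Ch (Fin n → ℝ)}
    (hc : c ∈ Sup (Lst n (Near (ε / 2)) (cubeBd n))) (hb : bd c = 0) :
    ∃ e ∈ Sup (Lst (n + 1) (Near ε) {x : Fin n → ℝ | ∀ i, |x i| ≤ 1}), bd e = c := by
  obtain ⟨m, hm⟩ := exists_nat_gt (2 / ε)
  have hm0 : (0 : ℝ) < m := lt_trans (by positivity) hm
  have hm' : 1 / (m : ℝ) ≤ ε / 2 := by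
    rw [div_lt_iff₀ hε] at hm
    rw [div_le_iff₀ hm0]
    linarith
  set h : ℕ → (Fin n → ℝ) → (Fin n → ℝ) := fun k x i => (1 - min (k : ℝ) (m : ℝ) / m) * x i with hh
  have hcoef : ∀ k : ℕ, 0 ≤ 1 - min (k : ℝ) m / m ∧ 1 - min (k : ℝ) m / m ≤ 1 := by
    intro k
    have : min (k : ℝ) m / m ≤ 1 := (div_le_one hm0).2 (min_le_right _ _)
    have : 0 ≤ min (k : ℝ) m / m := by positivity
    constructor <;> linarith
  have hstep : ∀ k : ℕ, |(1 - min (k : ℝ) m / m) - (1 - min ((k + 1 : ℕ) : ℝ) m / m)| ≤ ε / 2 := by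
    intro k
    refine le_trans ?_ hm'
    rw [show (1 - min (k : ℝ) m / m) - (1 - min ((k + 1 : ℕ) : ℝ) m / m) =
      (min ((k + 1 : ℕ) : ℝ) m - min (k : ℝ) m) / m by ring, abs_div, abs_of_pos hm0]
    gcongr
    refine (abs_min_sub_min_le_max _ _ _ _).trans ?_
    simp
  have hbox : ∀ k, ∀ x ∈ cubeBd n, h k x ∈ {x : Fin n → ℝ | ∀ i, |x i| ≤ 1} := by
    intro k x hx i
    simp only [hh]
    rw [abs_mul, abs_of_nonneg (hcoef k).1]
    exact mul_le_one₀ (hcoef k).2 (abs_nonneg _) (hx.1 i)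
  have hd : ∀ (k : ℕ) (x y : Fin n → ℝ), dist x y ≤ ε / 2 → dist (h k x) (h k y) ≤ ε / 2 := by
    intro k x y hxy
    refine near_pi (by positivity) fun i => ?_
    simp only [hh]
    rw [← mul_sub, abs_mul, abs_of_nonneg (hcoef k).1]
    have := (dist_le_pi_dist x y i).trans hxy
    rw [Real.dist_eq] at this
    exact (mul_le_of_le_one_left (abs_nonneg _) (hcoef k).2).trans this
  have hd' : ∀ (k : ℕ), ∀ x ∈ cubeBd n, dist (h k x) (h (k + 1) x) ≤ ε / 2 := by
    intro k x hx
    refine near_pi (by positivity) fun i => ?_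
    simp only [hh]
    rw [← sub_mul, abs_mul]
    exact (mul_le_of_le_one_right (abs_nonneg _) (hx.1 i)).trans (hstep k)
  have hhm : ∀ x, h m x = 0 := fun x => by
    funext i
    simp [hh, div_self hm0.ne']
  refine ⟨prs h m c + cons 0 (mp (h m) c), Submodule.add_mem _ ?_ ?_, ?_⟩
  · refine prs_Lst (R' := Near ε) (R := Near (ε / 2)) (U := cubeBd n)
      (fun k _ x hx y hy hxy => ?_) (fun k _ x hx => hbox k x hx) hc
    have h1 := hd k x y hxy
    have h2 := hd (k + 1) x y hxy
    have h3 := hd' k x hx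
    have h4 := hd' k y hy
    refine ⟨?_, ?_, ?_, ?_⟩ <;> unfold Near
    · linarith
    · linarith [dist_triangle (h k x) (h k y) (h (k + 1) y)]
    · linarith [dist_triangle_left (h (k + 1) x) (h k y) (h k x)]
    · linarith
  · have h1 : mp (h m) c ∈ Sup (Lst n (Near ε) ({0} : Set (Fin n → ℝ))) :=
      mp_Lst (f := h m) (R := Near (ε / 2)) (R' := Near ε) (U := cubeBd n) (U' := {0})
        (fun x _ y _ _ => by simp [hhm, Near, hε.le]) (fun x _ => hhm x) hc
    refine cons_Lst (R := Near ε) (R' := Near ε) (U := {0}) ?_ (by simp [Near, hε.le])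
      (fun x _ y _ hxy => hxy) ?_ ?_ h1
    · intro i; simp
    · rintro x rfl
      simp [Near, hε.le]
    · rintro x rfl i
      simp
  · have := bd_prs h m c
    rw [hb, map_zero, add_zero] at this
    have h0 : mp (h 0) c = c := by
      have : h 0 = id := by funext x i; simp [hh]
      rw [this, mp_id]
    rw [map_add, this, bd_cons, bd_mp, hb, map_zero, map_zero, add_zero, h0, add_assoc,
      add_self_F2, add_zero]

lemma coT_nil_const {Y : Type*} (b : F2) (L : List (Y → F2)) (l : List Y) :
    coT [] (fun _ => b) L l = b * coQ L l := by
  cases l with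
  | nil => cases L <;> simp [coT, coQ]
  | cons x l => simp [coT]

lemma ev_ofFn_succ {n : ℕ} (s : Fin (n + 1) → ℝ → F2) :
    (List.ofFn fun i (y : Fin (n + 1) → ℝ) => s i (y i)) =
      (fun y => s 0 (y 0)) :: List.ofFn fun i : Fin n => fun y => s i.succ (y i.succ) := by
  rw [List.ofFn_succ]

/-- Fine fundamental cycles of the boundary of the cube. -/
theorem exists_cube_cycle (n : ℕ) : ∀ ε > 0, ∃ c ∈ Sup (Lst n (Near ε) (cubeBd n)), bd c = 0 ∧
    ∀ s : Fin n → ℝ → F2, (∀ i t, |t| ≤ 1 → |t - 1| ≤ ε → s i t = s i 1) →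
      (∀ i t, |t| ≤ 1 → |t + 1| ≤ ε → s i t = s i (-1)) →
      ev (X := fun _ => ℝ) c s = ∏ i, (s i 1 + s i (-1)) := by
  induction n with
  | zero =>
    intro ε hε
    refine ⟨sg [], sg_mem_Sup (by simp [Lst]), by simp [bdL], fun s _ _ => ?_⟩
    simp [ev, coP]
  | succ n ih =>
    intro ε hε
    obtain ⟨c, hc, hb, hev⟩ := ih (ε / 2) (by positivity)
    obtain ⟨e, he, hbe⟩ := exists_cube_fill hε hc hb
    obtain ⟨m, hm⟩ := exists_nat_gt (4 / ε)
    have hm0 : (0 : ℝ) < m := lt_trans (by positivity) hm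
    have hm' : 2 / (m : ℝ) ≤ ε / 2 := by
      rw [div_lt_iff₀ hε] at hm
      rw [div_le_iff₀ hm0]
      linarith
    set g : ℝ → (Fin n → ℝ) → (Fin (n + 1) → ℝ) := fun t y => Fin.cons t y with hg
    set h : ℕ → (Fin n → ℝ) → (Fin (n + 1) → ℝ) := fun k => g (-1 + 2 * k / m) with hh
    have hg0 : ∀ t y, g t y 0 = t := fun t y => rfl
    have hgs : ∀ t y i, g t y (Fin.succ i) = y i := fun t y i => rfl
    have hnear : ∀ t t' x y, |t - t'| ≤ ε → dist x y ≤ ε → dist (g t x) (g t' y) ≤ ε := by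
      intro t t' x y ht hxy
      refine near_pi hε.le (Fin.cases ?_ fun i => ?_)
      · simpa [hg0] using ht
      · rw [hgs, hgs, ← Real.dist_eq]
        exact (dist_le_pi_dist x y i).trans hxy
    have hface : ∀ t : ℝ, |t| = 1 → mp (g t) e ∈ Sup (Lst (n + 1) (Near ε) (cubeBd (n + 1))) := by
      intro t ht
      refine mp_Lst (f := g t) (R := Near ε) (R' := Near ε) (U := {x : Fin n → ℝ | ∀ i, |x i| ≤ 1})
        (U' := cubeBd (n + 1)) (fun x _ y _ hxy => hnear _ _ _ _ (by simpa using hε.le) hxy)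
        (fun x hx => ⟨fun i => ?_, 0, ht⟩) he
      refine Fin.cases ?_ (fun i => ?_) i
      · rw [hg0, ht]
      · exact hx i
    have hβ : prs h m c ∈ Sup (Lst (n + 1) (Near ε)
        {x : Fin (n + 1) → ℝ | (∀ i, |x i| ≤ 1) ∧ ∃ i : Fin n, |x i.succ| = 1}) := by
      refine prs_Lst (R := Near (ε / 2)) (R' := Near ε) (U := cubeBd n)
        (U' := {x : Fin (n + 1) → ℝ | (∀ i, |x i| ≤ 1) ∧ ∃ i : Fin n, |x i.succ| = 1})
        (fun k hk x hx y hy hxy => ?_)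
        (fun k hk x hx => ⟨fun i => Fin.cases ?_ (fun i => hx.1 i) i, hx.2⟩) hc
      · have hxy' : dist x y ≤ ε := le_trans hxy (by linarith)
        have e1 : |(-1 + 2 * (k : ℝ) / m) - (-1 + 2 * ((k + 1 : ℕ) : ℝ) / m)| ≤ ε := by
          have : (-1 + 2 * (k : ℝ) / m) - (-1 + 2 * ((k + 1 : ℕ) : ℝ) / m) = -(2 / m) := by
            push_cast; ring
          rw [this, abs_neg, abs_of_pos (by positivity)]
          linarith
        exact ⟨hnear _ _ _ _ (by simpa using hε.le) hxy', hnear _ _ _ _ e1 hxy',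
          hnear _ _ _ _ (by rw [abs_sub_comm]; exact e1) hxy',
          hnear _ _ _ _ (by simpa using hε.le) hxy'⟩
      · show |-1 + 2 * (k : ℝ) / m| ≤ 1
        rw [abs_le]
        have h1 : (k : ℝ) / m ≤ 1 := (div_le_one hm0).2 (by exact_mod_cast hk)
        have h2 : 0 ≤ (k : ℝ) / m := by positivity
        constructor
        · rw [mul_div_assoc]; linarith
        · rw [mul_div_assoc]; linarith
    have hβ' : prs h m c ∈ Sup (Lst (n + 1) (Near ε) (cubeBd (n + 1))) :=
      Sup_Lst_mono (fun _ _ h => h) (fun x hx => by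
        obtain ⟨h1, i, hi⟩ := hx
        exact ⟨h1, i.succ, hi⟩) hβ
    refine ⟨mp (g 1) e + mp (g (-1)) e + prs h m c, Submodule.add_mem _ (Submodule.add_mem _
      (hface 1 (by simp)) (hface (-1) (by simp))) hβ', ?_, fun s hs hs' => ?_⟩
    · have hp := bd_prs h m c
      have h0 : h 0 = g (-1) := by simp [hh]
      have h1 : h m = g 1 := by
        simp only [hh]
        congr 1
        rw [mul_div_assoc, div_self hm0.ne']
        norm_num
      rw [hb, map_zero, add_zero, h0, h1] at hp
      rw [map_add, map_add, bd_mp, bd_mp, hbe, hp, add_comm (mp (g 1) c), add_self_F2]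
    · have hface_ev : ∀ t : ℝ, lext (coT [] (fun y : Fin (n + 1) → ℝ => s 0 (y 0))
          (List.ofFn fun i : Fin n => fun y => s i.succ (y i.succ))) (mp (g t) e) =
          s 0 t * ∏ i : Fin n, (s i.succ 1 + s i.succ (-1)) := by
        intro t
        rw [← hev (fun i => s i.succ) (fun i x hx h1 => hs _ x hx (by linarith))
          (fun i x hx h1 => hs' _ x hx (by linarith)), ev]
        rw [← hbe]
        rw [lext_coP_bd]
        have e1 : coP ((fun y : Fin (n + 1) → ℝ => s 0 (y 0)) ::
            (List.ofFn fun i : Fin n => fun y => s i.succ (y i.succ))) =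
            coT [] (fun y : Fin (n + 1) → ℝ => s 0 (y 0))
              (List.ofFn fun i : Fin n => fun y => s i.succ (y i.succ)) := by
          ext l; simp [coP]
        rw [← e1, lext_coP_mp]
        refine lin_ext (f := lext (coP _)) (g := s 0 t • lext (coQ _)) (fun l => ?_) e
        rw [lext_sg, LinearMap.smul_apply, lext_sg, List.map_cons, coP, smul_eq_mul,
          ← coT_nil_const, List.map_ofFn]
        rfl
      rw [ev, ev_ofFn_succ]
      have e1 : coP ((fun y : Fin (n + 1) → ℝ => s 0 (y 0)) ::
          (List.ofFn fun i : Fin n => fun y => s i.succ (y i.succ))) =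
          coT [] (fun y : Fin (n + 1) → ℝ => s 0 (y 0))
            (List.ofFn fun i : Fin n => fun y => s i.succ (y i.succ)) := by
        ext l; simp [coP]
      rw [e1, map_add, map_add, hface_ev, hface_ev, Fin.prod_univ_succ, ← add_mul]
      refine add_eq_left.2 (lext_eq_zero (fun l hl => ?_) hβ)
      cases l with
      | nil => exact absurd hl.1 (by simp)
      | cons x l =>
        obtain ⟨h1, i, hi⟩ := hl.2.2 x (by simp)
        refine coT_eq_zero (t := fun y => s i.succ (y i.succ)) (Or.inr ?_) ?_
        · exact (List.mem_ofFn' _ _).2 ⟨i, rfl⟩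
        · have key : ∀ z ∈ x :: l, s i.succ (z i.succ) = s i.succ (x i.succ) := by
            intro z hz
            have hzx : |z i.succ - x i.succ| ≤ ε := by
              rw [← Real.dist_eq]
              exact (dist_le_pi_dist z x i.succ).trans (hl.2.1 z hz x (by simp))
            have hz1 := (hl.2.2 z hz).1 i.succ
            rcases abs_eq (zero_le_one' ℝ) |>.1 hi with hi | hi
            · rw [hi] at hzx ⊢
              exact hs _ _ hz1 hzx
            · rw [hi] at hzx ⊢
              exact hs' _ _ hz1 (by simpa using hzx)
          intro z hz z' hz'
          show s i.succ (z i.succ) = s i.succ (z' i.succ)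
          rw [key z hz, key z' hz']

end Cube
end DeRahmSplit

namespace DeRahmSplit

open Filter Topology

lemma Geod.path {Y : Type*} [MetricSpace Y] (hg : Geod Y) (a b : Y) :
    ∃ γ : ℝ → Y, ∃ D : ℝ, 0 < D ∧ (∀ t t', dist (γ t) (γ t') ≤ D * |t - t'|) ∧
      γ 1 = a ∧ γ (-1) = b := by
  obtain ⟨γ, h0, h1, hγ⟩ := hg b a
  set d := dist b a with hd
  have hd0 : 0 ≤ d := dist_nonneg
  refine ⟨fun t => γ (max 0 (min d ((t + 1) / 2 * d))), d + 1, by positivity, fun t t' => ?_,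
    ?_, ?_⟩
  · refine (hγ _ ⟨le_max_left _ _, max_le hd0 (min_le_left _ _)⟩ _
      ⟨le_max_left _ _, max_le hd0 (min_le_left _ _)⟩).trans ?_
    have e1 := abs_max_sub_max_le_max 0 (min d ((t + 1) / 2 * d)) 0 (min d ((t' + 1) / 2 * d))
    have e2 := abs_min_sub_min_le_max d ((t + 1) / 2 * d) d ((t' + 1) / 2 * d)
    simp only [sub_self, abs_zero] at e1 e2
    rw [max_eq_right (abs_nonneg (min d ((t + 1) / 2 * d) - min d ((t' + 1) / 2 * d)))] at e1
    rw [max_eq_right (abs_nonneg ((t + 1) / 2 * d - (t' + 1) / 2 * d))] at e2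
    refine e1.trans (e2.trans ?_)
    rw [show (t + 1) / 2 * d - (t' + 1) / 2 * d = d / 2 * (t - t') by ring, abs_mul,
      abs_of_nonneg (by positivity)]
    gcongr
    linarith
  · simpa [hd0] using h1
  · simpa using h0

lemma isCompact_cubeBd (n : ℕ) : IsCompact (cubeBd n) := by
  have h1 : IsCompact {x : Fin n → ℝ | ∀ i, x i ∈ Set.Icc (-1 : ℝ) 1} :=
    isCompact_pi_infinite fun _ => isCompact_Icc
  have h2 : cubeBd n = {x : Fin n → ℝ | ∀ i, x i ∈ Set.Icc (-1 : ℝ) 1} ∩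
      ⋃ i, {x : Fin n → ℝ | |x i| = 1} := by
    ext x
    simp [cubeBd, abs_le]
  rw [h2]
  refine h1.inter_right (isClosed_iUnion_of_finite fun i => ?_)
  exact isClosed_eq (by fun_prop) continuous_const

section Spheres
variable {N : ℕ} {X : Fin N → Type*} [∀ i, MetricSpace (X i)]

/-- Fine cycles spanning a product sphere around a point. -/
theorem exists_prod_sphere (hg : ∀ i, Geod (X i)) (p a b : ∀ i, X i) (ha : ∀ i, a i ≠ p i)
    (hb : ∀ i, b i ≠ p i) : ∃ c, Sph p c ∧ ∃ δ > 0, ∃ m₀, ∀ m ≥ m₀, ∀ s : ∀ i, X i → F2,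
      (∀ i, Tame δ (p i) (s i)) → ev (c m) s = ∏ i, (s i (a i) + s i (b i)) := by
  choose γ D hD hγ hγa hγb using fun i => (hg i).path (a i) (b i)
  obtain ⟨D', hD'0, hD'⟩ : ∃ D' : ℝ, 0 < D' ∧ ∀ i, D i ≤ D' := by
    obtain ⟨M, hM⟩ := (Set.finite_range D).bddAbove
    exact ⟨max M 1, by positivity, fun i => (hM ⟨i, rfl⟩).trans (le_max_left _ _)⟩
  obtain ⟨δ, hδ, hδa⟩ : ∃ δ : ℝ, 0 < δ ∧ ∀ i, 8 * δ ≤ dist (a i) (p i) ∧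
      8 * δ ≤ dist (b i) (p i) := by
    have : ∀ᶠ δ in 𝓝[>] (0 : ℝ), ∀ i, 8 * δ ≤ dist (a i) (p i) ∧ 8 * δ ≤ dist (b i) (p i) := by
      rw [eventually_all]
      intro i
      have h1 : ∀ r : ℝ, 0 < r → ∀ᶠ δ in 𝓝[>] (0 : ℝ), 8 * δ ≤ r := fun r hr => by
        filter_upwards [Ioo_mem_nhdsGT (show (0 : ℝ) < r / 8 by positivity)] with δ hδ
        linarith [hδ.2]
      exact (h1 _ (dist_pos.2 (ha i))).and (h1 _ (dist_pos.2 (hb i)))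
    obtain ⟨δ, h, h0⟩ := (this.and self_mem_nhdsWithin).exists
    exact ⟨δ, h0, h⟩
  set Φ : (Fin N → ℝ) → ∀ i, X i := fun x i => γ i (x i) with hΦ
  have hΦd : ∀ x y, dist (Φ x) (Φ y) ≤ D' * dist x y := fun x y => by
    refine (dist_pi_le_iff (by positivity)).2 fun i => (hγ i _ _).trans ?_
    have := dist_le_pi_dist x y i
    rw [Real.dist_eq] at this
    exact mul_le_mul (hD' i) this (abs_nonneg _) hD'0.le
  have hΦc : Continuous Φ := by
    refine (LipschitzWith.of_dist_le_mul (K := ⟨D', hD'0.le⟩) fun x y => hΦd x y).continuous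
  choose c hc hbd hev using fun m : ℕ => exists_cube_cycle N (1 / ((m : ℝ) + 1))
    Nat.one_div_pos_of_nat
  refine ⟨fun m => mp Φ (c m), ⟨Φ '' cubeBd N, (isCompact_cubeBd N).image hΦc, ?_, fun m => ?_,
    fun ε hε => ?_⟩, δ, hδ, ?_⟩
  · rintro ⟨x, ⟨-, i, hi⟩, hx⟩
    have hxi : γ i (x i) = p i := congrFun hx i
    rcases abs_eq (zero_le_one' ℝ) |>.1 hi with h | h
    · rw [h, hγa] at hxi; exact ha i hxi
    · rw [h, hγb] at hxi; exact hb i hxi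
  · show bd (mp Φ (c m)) = 0
    rw [bd_mp, hbd, map_zero]
  · have : ∀ᶠ m : ℕ in atTop, 1 / ((m : ℝ) + 1) < ε / D' :=
      (tendsto_one_div_add_atTop_nhds_zero_nat (𝕜 := ℝ)).eventually_lt_const (by positivity)
    filter_upwards [this] with m hm
    refine mp_Lst (f := Φ) (R := Near (1 / ((m : ℝ) + 1))) (R' := Near ε) (U := cubeBd N)
      (U' := Φ '' cubeBd N) (fun x _ y _ hxy => ?_) (fun x hx => ⟨x, hx, rfl⟩) (hc m)
    have hxy' : dist x y ≤ ε / D' := le_trans hxy hm.le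
    refine (hΦd x y).trans ?_
    rw [le_div_iff₀ hD'0] at hxy'
    linarith
  · have : ∀ᶠ m : ℕ in atTop, 1 / ((m : ℝ) + 1) < δ / D' :=
      (tendsto_one_div_add_atTop_nhds_zero_nat (𝕜 := ℝ)).eventually_lt_const (by positivity)
    obtain ⟨m₀, hm₀⟩ := eventually_atTop.1 this
    refine ⟨m₀, fun m hm s hs => ?_⟩
    have hml := hm₀ m hm
    have hend : ∀ i t t', |t - t'| ≤ 1 / ((m : ℝ) + 1) → 8 * δ ≤ dist (γ i t') (p i) →
        s i (γ i t) = s i (γ i t') := by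
      intro i t t' ht hfar
      obtain ⟨y, hy, hsy⟩ := hs i
      have h1 : dist (γ i t) (γ i t') < δ := by
        refine (hγ i t t').trans_lt ?_
        have := (ht.trans_lt hml)
        rw [lt_div_iff₀ hD'0] at this
        refine lt_of_le_of_lt ?_ this
        rw [mul_comm]
        gcongr
        exact hD' i
      have h2 := dist_triangle_left (γ i t') (p i) (γ i t)
      exact hsy.close hy (by linarith)
    have := hev m (fun i t => s i (γ i t)) (fun i t _ ht => hend i t 1 ht (by
      rw [hγa]; exact (hδa i).1)) (fun i t _ ht => hend i t (-1) (by simpa using ht) (by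
      rw [hγb]; exact (hδa i).2))
    simp only [hγa, hγb] at this
    rw [← this, ev, lext_coP_mp, ev, List.map_ofFn]
    rfl

end Spheres

/-- The cycles bound off `q`. -/
def Bounds {Y : Type*} [MetricSpace Y] (N : ℕ) (c : ℕ → Ch Y) (q : Y) : Prop :=
  ∃ δ > 0, ∀ ε > 0, ∀ᶠ m in atTop, ∃ e ∈ Sup (Lst (N + 1) (Near ε) (Off q δ)), bd e = c m

lemma off_of_closed {Y : Type*} [MetricSpace Y] {K : Set Y} (hK : IsClosed K) {q : Y}
    (hq : q ∉ K) : ∃ δ > 0, ∀ δ' ≤ δ, K ⊆ Off q δ' := by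
  obtain ⟨δ, h0, h⟩ := Metric.mem_nhds_iff.1 (hK.isOpen_compl.mem_nhds hq)
  exact ⟨δ, h0, fun δ' hδ' x hx => hδ'.trans (not_lt.1 fun hlt => h hlt hx)⟩

lemma bounds_of_fill {Y : Type*} [MetricSpace Y] {M N : ℕ} {T : Y → ℝ → Set (List (Y → F2))}
    (H : FillData Y M T) {K : Set Y} (hK : IsClosed K) {c : ℕ → Ch Y} (hb : ∀ m, bd (c m) = 0)
    (hc : ∀ ε > 0, ∀ᶠ m in atTop, c m ∈ Sup (Lst N (Near ε) K)) {q : Y} (hq : q ∉ K)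
    (hN : N ≤ M) (hT : N < M ∨ ∃ δ > 0, ∃ m₀, ∀ m ≥ m₀, ∀ L ∈ T q δ, lext (coP L) (c m) = 0) :
    Bounds N c q := by
  obtain ⟨C, hC, hF⟩ := H.fills
  obtain ⟨δ₀, hδ₀, hK'⟩ := off_of_closed hK hq
  have hC0 : 0 < C := by linarith
  obtain ⟨δ, hδ, hle, m₀, hm₀⟩ : ∃ δ > 0, δ ≤ δ₀ ∧ ∃ m₀, ∀ m ≥ m₀,
      (N < M ∨ ∀ L ∈ T q (δ / 4), lext (coP L) (c m) = 0) := by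
    rcases hT with h | ⟨δ, hδ, m₀, h⟩
    · exact ⟨δ₀, hδ₀, le_rfl, 0, fun _ _ => Or.inl h⟩
    · exact ⟨min δ₀ δ, lt_min hδ₀ hδ, min_le_left _ _, m₀, fun m hm => Or.inr fun L hL =>
        h m hm L (H.mono _ _ _ (by linarith [min_le_right δ₀ δ, lt_min hδ₀ hδ]) hL)⟩
  refine ⟨δ / C, by positivity, fun ε hε => ?_⟩
  filter_upwards [hc (min (ε / C) (δ / C)) (lt_min (by positivity) (by positivity)),
    eventually_ge_atTop m₀] with m hm hmm
  have h1 : C * min (ε / C) (δ / C) ≤ δ := by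
    calc C * min (ε / C) (δ / C) ≤ C * (δ / C) := by gcongr; exact min_le_right _ _
      _ = δ := by field_simp
  have h2 : C * min (ε / C) (δ / C) ≤ ε := by
    calc C * min (ε / C) (δ / C) ≤ C * (ε / C) := by gcongr; exact min_le_left _ _
      _ = ε := by field_simp
  obtain ⟨e, he, hbe⟩ := hF q (min (ε / C) (δ / C)) δ (lt_min (by positivity) (by positivity)) hδ
    h1 N hN (c m) (Sup_Lst_mono (fun _ _ h => h) (hK' δ hle) hm) (hb m) (hm₀ m hmm)
  exact ⟨e, Sup_Lst_mono (fun x y h => le_trans h h2) (fun _ h => h) he, hbe⟩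

lemma Bounds.eval {Y : Type*} [MetricSpace Y] {M N : ℕ} {T : Y → ℝ → Set (List (Y → F2))}
    (H : FillData Y M T) {c : ℕ → Ch Y} {q : Y} (h : Bounds N c q) :
    ∃ δ > 0, ∃ m₀, ∀ m ≥ m₀, ∀ L ∈ T q δ, lext (coP L) (c m) = 0 := by
  obtain ⟨δ, hδ, h⟩ := h
  obtain ⟨m₀, hm₀⟩ := eventually_atTop.1 (h (δ / 4) (by positivity))
  refine ⟨δ / 4, by positivity, m₀, fun m hm L hL => ?_⟩
  obtain ⟨e, he, hbe⟩ := hm₀ m hm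
  rw [← hbe, lext_coP_bd]
  refine lext_eq_zero (fun l hl => ?_) he
  cases l with
  | nil => exact absurd hl.1 (by simp)
  | cons x l =>
    obtain ⟨s, hs, hcon⟩ := H.const q (δ / 4) L hL (δ / 4) δ (x :: l) x (by simp)
      (hl.2.2 x (by simp)) hl.2.1 (by linarith)
    exact coQ_eq_zero hs hcon

lemma Bounds.map {Y Z : Type*} [MetricSpace Y] [MetricSpace Z] {F : Y → Z} {A : ℝ} (hA : 0 < A)
    (hF : ∀ x y, dist (F x) (F y) ≤ A * dist x y) (hF' : ∀ x y, dist x y ≤ A * dist (F x) (F y))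
    {N : ℕ} {c : ℕ → Ch Y} {q : Y} (h : Bounds N c q) :
    Bounds N (fun m => mp F (c m)) (F q) := by
  obtain ⟨δ, hδ, h⟩ := h
  refine ⟨δ / A, by positivity, fun ε hε => ?_⟩
  filter_upwards [h (ε / A) (by positivity)] with m ⟨e, he, hbe⟩
  refine ⟨mp F e, ?_, by rw [bd_mp, hbe]⟩
  refine mp_Lst (f := F) (R := Near (ε / A)) (R' := Near ε) (U := Off q δ) (U' := Off (F q) (δ / A))
    (fun x _ y _ hxy => ?_) (fun x hx => ?_) he
  · refine (hF x y).trans ?_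
    have : dist x y ≤ ε / A := hxy
    rw [le_div_iff₀ hA] at this
    linarith
  · show δ / A ≤ dist (F x) (F q)
    rw [div_le_iff₀ hA]
    have : δ ≤ dist x q := hx
    linarith [hF' x q]

section Spheres
variable {N : ℕ} {X : Fin (N + 1) → Type*} [∀ i, MetricSpace (X i)]

lemma van_iff_bounds (hg : ∀ i, Geod (X i)) (hc : ∀ i, Contr (X i)) (hf : ∀ i, Far (X i))
    {p : ∀ i, X i} {K : Set (∀ i, X i)} {c : ℕ → Ch (∀ i, X i)} (hS : SphIn p K c) {y : ∀ i, X i}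
    (hy : y ∉ K) : Van c y ↔ Bounds (N + 1) c y := by
  have H := fillData_pi X hg hc hf
  constructor
  · rintro ⟨δ, hδ, m₀, h⟩
    refine bounds_of_fill H hS.1.isClosed hS.2.2.1 hS.2.2.2 hy le_rfl
      (Or.inr ⟨δ, hδ, m₀, fun m hm L hL => ?_⟩)
    obtain ⟨s, hs, rfl⟩ := hL
    exact h m hm s hs
  · intro h
    obtain ⟨δ, hδ, m₀, h⟩ := h.eval H
    exact ⟨δ, hδ, m₀, fun m hm s hs => h m hm _ ⟨s, hs, rfl⟩⟩

end Spheres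
end DeRahmSplit

namespace DeRahmSplit

open Filter Topology

/-- The ultrafilter along which germs of sequences are taken. -/
abbrev uf : Ultrafilter ℕ := hyperfilter ℕ

section Local
variable {Y : Type*} [MetricSpace Y]

lemma F2_add_of_ne {a b : F2} (h : a ≠ b) : a + b = 1 := by
  revert a b; decide

/-- There are admissible functions at `y` separating `a` from `b`. -/
def Sep (a b y : Y) : Prop := ∀ δ > 0, ∃ t : Y → F2, Adm δ y t ∧ t a ≠ t b

lemma Sep.of_adm {a b y : Y} {χ : Y → F2} (h : Adm 0 y χ) (hne : χ a ≠ χ b) : Sep a b y :=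
  fun _ hδ => ⟨χ, h.mono hδ.le, hne⟩

lemma Sep.split {a b y : Y} (h : Sep a b y) (p : Y) : Sep a p y ∨ Sep b p y := by
  by_contra hcon
  simp only [not_or, Sep, not_forall, not_exists, not_and, not_not] at hcon
  obtain ⟨⟨δ, hδ, h1⟩, δ', hδ', h2⟩ := hcon
  obtain ⟨t, ht, hne⟩ := h (min δ δ') (lt_min hδ hδ')
  exact hne ((h1 t (ht.mono (min_le_left _ _))).trans (h2 t (ht.mono (min_le_right _ _))).symm)

lemma Sep.branch {e p y : Y} (h : Sep e p y) (hy : y ≠ p) : Branch p 0 e y := by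
  by_contra hcon
  have h0 := dist_pos.2 hy
  obtain ⟨t, ht, hne⟩ := h (dist y p / 2) (by positivity)
  exact hne (ht.eq_center hcon (by linarith))

lemma Sep.to_other {e r p y : Y} (h : Sep e p y) (hy : y ≠ p) (hr : ¬ Branch p 0 r y) :
    Sep e r y := by
  intro δ hδ
  have h0 := dist_pos.2 hy
  obtain ⟨t, ht, hne⟩ := h (min δ (dist y p / 2)) (by positivity)
  refine ⟨t, ht.mono (min_le_left _ _), ?_⟩
  rwa [ht.eq_center hr (lt_of_le_of_lt (min_le_right _ _) (by linarith))]

/-- Two points outside the branch of `y` are not separated at `y`. -/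
lemma not_sep {a b p y : Y} (hy : y ≠ p) (ha : ¬ Branch p 0 a y) (hb : ¬ Branch p 0 b y) :
    ¬ Sep a b y := fun h => (h.split p).elim (fun h => ha (h.branch hy)) fun h => hb (h.branch hy)

/-- Tests at `h` can be converted into tests at `g` agreeing on a compact set missing `p`. -/
def Conv (p : Y) (K : Set Y) (rel : Y → Y → Prop) : Prop :=
  ∃ η > 0, ∀ g h, dist g p ≤ η → dist h p ≤ η → rel g h → ∀ δ' > 0, ∃ δ > 0, ∀ s, Adm δ h s →
    ∃ s', Adm δ' g s' ∧ ∀ z ∈ K, s' z = s z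

lemma conv_branch {p : Y} {K : Set Y} (hK : IsCompact K) (hp : p ∉ K) {a b : Y} (ha : a ≠ p)
    (hb : b ≠ p) : Conv p K fun g h => Sep a b g ∧ (g = p ∨ Branch p 0 g h) := by
  classical
  have hK' : IsCompact (insert a (insert b K)) := (hK.insert b).insert a
  have hp' : p ∉ insert a (insert b K) := by
    simp [hp, ha.symm, hb.symm]
  obtain ⟨η, hη, H⟩ := exists_uniform hK' hp'
  have hKK : ∀ z ∈ K, z ∈ insert a (insert b K) := fun z hz => by simp [hz]
  refine ⟨η, hη, fun g h hg hh hrel δ' hδ' => ?_⟩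
  obtain ⟨hsep, rfl | hgh⟩ := hrel
  · refine ⟨η, hη, fun s hs => ?_⟩
    refine ⟨fun z => if h : ∃ x ∈ K, Branch g 0 z x then s h.choose else 0, ?_, ?_⟩
    · refine Adm.mono (δ := 0) ?_ hδ'.le
      intro z z' hne
      by_contra hlt
      push Not at hlt
      have hb : Branch g 0 z z' := .of_lt (by linarith)
      apply hne
      by_cases hz : ∃ x ∈ K, Branch g 0 z x
      · have hz' : ∃ x ∈ K, Branch g 0 z' x := hz.imp fun x hx => ⟨hx.1, hb.symm.trans hx.2⟩
        simp only [dif_pos hz, dif_pos hz']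
        exact H η le_rfl h hh s hs _ (hKK _ hz.choose_spec.1) _ (hKK _ hz'.choose_spec.1)
          ((hz.choose_spec.2.symm.trans hb).trans hz'.choose_spec.2)
      · have hz' : ¬ ∃ x ∈ K, Branch g 0 z' x := fun hz' =>
          hz (hz'.imp fun x hx => ⟨hx.1, hb.trans hx.2⟩)
        simp only [dif_neg hz, dif_neg hz']
    · intro z hz
      have hex : ∃ x ∈ K, Branch g 0 z x := ⟨z, hz, .refl _ _ _⟩
      simp only [dif_pos hex]
      exact H η le_rfl h hh s hs _ (hKK _ hex.choose_spec.1) _ (hKK _ hz) hex.choose_spec.2.symm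
  · by_cases hgp : g = p
    · have hhp : h = p := hgh.eq_center.1 hgp
      subst hgp
      subst hhp
      exact ⟨δ', hδ', fun s hs => ⟨s, hs, fun _ _ => rfl⟩⟩
    have hhp : h ≠ p := fun hhp => hgp (hgh.eq_center.2 hhp)
    have hg0 := dist_pos.2 hgp
    have hh0 := dist_pos.2 hhp
    refine ⟨min η (dist h p / 2), by positivity, fun s hs => ?_⟩
    have hsη := hs.mono (min_le_left _ _)
    by_cases hconst : ∀ x ∈ K, s x = s p
    · exact ⟨fun _ => s p, fun _ _ h => absurd rfl h, fun z hz => (hconst z hz).symm⟩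
    push Not at hconst
    obtain ⟨x₀, hx₀, hne⟩ := hconst
    have hlt : min η (dist h p / 2) < dist h p := lt_of_le_of_lt (min_le_right _ _) (by linarith)
    have hx₀E : Branch p 0 x₀ h := by
      by_contra hcon
      exact hne (hs.eq_center hcon hlt)
    obtain ⟨e, heK, hesep⟩ : ∃ e ∈ insert a (insert b K), Sep e p g :=
      (hsep.split p).elim (fun h => ⟨a, by simp, h⟩) fun h => ⟨b, by simp, h⟩
    obtain ⟨t, ht, hte⟩ := hesep (min δ' (min η (dist g p / 2))) (by positivity)
    have htη := ht.mono ((min_le_right _ _).trans (min_le_left _ _))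
    have htlt : min δ' (min η (dist g p / 2)) < dist g p :=
      lt_of_le_of_lt ((min_le_right _ _).trans (min_le_right _ _)) (by linarith)
    have heE : Branch p 0 e g := hesep.branch hgp
    refine ⟨fun z => t z + (s p + t p), ?_, fun z hz => ?_⟩
    · intro z z' hne'
      exact (ht.mono (min_le_left _ _)) z z' fun h => hne' (by simp [h])
    · by_cases hzE : Branch p 0 z g
      · have h1 : t z = t e := H η le_rfl g hg t htη z (hKK z hz) e heK (hzE.trans heE.symm)
        have h2 : s z = s x₀ := H η le_rfl h hh s hsη z (hKK z hz) x₀ (hKK x₀ hx₀)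
          ((hzE.trans hgh).trans hx₀E.symm)
        show t z + (s p + t p) = s z
        rw [h1, h2]
        generalize s x₀ = u at *
        generalize t e = v at *
        generalize s p = u' at *
        generalize t p = v' at *
        clear * - hne hte
        revert u v u' v'
        decide
      · have h1 : t z = t p := ht.eq_center hzE htlt
        have h2 : s z = s p := hs.eq_center (fun hb => hzE (hb.trans hgh.symm)) hlt
        show t z + (s p + t p) = s z
        rw [h1, h2, add_comm (s p), ← add_assoc, add_self_F2, zero_add]

variable (Y)

/-- Admissible functions can be moved to any nearby point (a property of the line). -/
def Rprop : Prop := ∀ (y y' : Y) (δ : ℝ) (s : Y → F2), 0 ≤ δ → Adm δ y s →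
  ∃ s', Adm 0 y' s' ∧ ∀ z, 3 * (dist y y' + δ) < dist z y → s' z = s z

/-- At each point three rays start in different branches. -/
def Tripod : Prop := ∃ C c : ℝ, 0 < C ∧ 0 < c ∧ ∀ p : Y, ∃ ρ : Fin 3 → ℝ → Y,
  (∀ k, ρ k 0 = p) ∧ (∀ k, ∀ t ≥ 0, ∀ t' ≥ 0, dist (ρ k t) (ρ k t') ≤ C * |t - t'|) ∧
  (∀ k, ∀ t ≥ 0, dist (ρ k t) p = c * t) ∧
  ∀ k, ∀ t ≥ 0, ∃ χ : Y → F2, Adm 0 (ρ k t) χ ∧ (∀ u > t, χ (ρ k u) = 1) ∧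
    (∀ u ≥ 0, u < t → χ (ρ k u) = 0) ∧ ∀ k' ≠ k, ∀ u ≥ 0, χ (ρ k' u) = 0

/-- A geodesic contractible space in which every point separates. -/
structure CutSpace : Prop where
  geod : Geod Y
  contr : Contr Y
  far : Far Y
  two : ∀ p : Y, ∃ a b : Y, a ≠ p ∧ b ≠ p ∧ ∃ χ : Y → F2, Adm 0 p χ ∧ χ a ≠ χ b

variable {Y}

lemma conv_R (hR : Rprop Y) {p : Y} {K : Set Y} (hK : IsCompact K) (hp : p ∉ K) :
    Conv p K fun _ _ => True := by
  obtain ⟨η, hη, H⟩ := off_of_closed hK.isClosed hp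
  refine ⟨η / 16, by positivity, fun g h hg hh _ δ' hδ' => ⟨η / 16, by positivity, fun s hs => ?_⟩⟩
  obtain ⟨s', hs', hz⟩ := hR h g (η / 16) s (by positivity) hs
  refine ⟨s', hs'.mono hδ'.le, fun z hzK => hz z ?_⟩
  have h1 : η ≤ dist z p := H η le_rfl hzK
  have h2 := dist_triangle_right h g p
  have h3 := dist_triangle z h p
  linarith

/-- Rays in different branches. -/
lemma Tripod.not_branch {p : Y} {ρ : Fin 3 → ℝ → Y} (h0 : ∀ k, ρ k 0 = p)
    (hχ : ∀ k, ∀ t ≥ 0, ∃ χ : Y → F2, Adm 0 (ρ k t) χ ∧ (∀ u > t, χ (ρ k u) = 1) ∧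
      (∀ u ≥ 0, u < t → χ (ρ k u) = 0) ∧ ∀ k' ≠ k, ∀ u ≥ 0, χ (ρ k' u) = 0)
    {k k' : Fin 3} (hk : k' ≠ k) : ¬ Branch p 0 (ρ k 1) (ρ k' 1) := by
  intro hb
  obtain ⟨χ, hχ, h1, -, h2⟩ := hχ k 0 le_rfl
  rw [h0] at hχ
  have := hb.const hχ
  rw [h1 1 one_pos, h2 k' hk 1 zero_le_one] at this
  exact one_ne_zero this

end Local

section Germs
variable {N : ℕ} {X : Fin N → Type*} [∀ i, MetricSpace (X i)]

/-- Every sphere trivial off `g` is trivial off `h`. -/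
def Le (p : ∀ i, X i) (g h : ℕ → ∀ i, X i) : Prop :=
  ∀ c, Sph p c → (∀ᶠ n in uf, Van c (g n)) → ∀ᶠ n in uf, Van c (h n)

/-- Some sphere is nontrivial off `g`. -/
def Good (p : ∀ i, X i) (g : ℕ → ∀ i, X i) : Prop :=
  ∃ c, Sph p c ∧ ¬ ∀ᶠ n in uf, Van c (g n)

/-- A coordinate of a good germ. -/
def CGood {Y : Type*} [MetricSpace Y] (p : Y) (g : ℕ → Y) : Prop :=
  ∃ a b, a ≠ p ∧ b ≠ p ∧ ∀ᶠ n in uf, Sep a b (g n)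

lemma exists_sphere_van (hg : ∀ i, Geod (X i)) (p a b : ∀ i, X i) (ha : ∀ i, a i ≠ p i)
    (hb : ∀ i, b i ≠ p i) : ∃ c, Sph p c ∧ ∃ δ > 0, ∀ y, (∀ i, dist (y i) (p i) ≤ δ) →
      (Van c y ↔ ∃ i, ¬ Sep (a i) (b i) (y i)) := by
  obtain ⟨c, hc, δ, hδ, m₀, h⟩ := exists_prod_sphere hg p a b ha hb
  refine ⟨c, hc, δ, hδ, fun y hy => ⟨fun hv => ?_, fun hs => ?_⟩⟩
  · by_contra hcon
    push Not at hcon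
    obtain ⟨δ', hδ', m₁, hv⟩ := hv
    choose t ht hne using fun i => hcon i (min δ δ') (lt_min hδ hδ')
    have h1 := h (max m₀ m₁) (le_max_left _ _) t fun i => ⟨y i, hy i, (ht i).mono (min_le_left _ _)⟩
    rw [hv _ (le_max_right _ _) t fun i => (ht i).mono (min_le_right _ _)] at h1
    rw [Finset.prod_congr rfl fun i _ => F2_add_of_ne (hne i), Finset.prod_const_one] at h1
    exact zero_ne_one h1
  · obtain ⟨i, hi⟩ := hs
    simp only [Sep, not_forall, not_exists, not_and, not_not] at hi
    obtain ⟨δ', hδ', hi⟩ := hi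
    refine ⟨min δ δ', lt_min hδ hδ', m₀, fun m hm s hs => ?_⟩
    rw [h m hm s fun i => ⟨y i, hy i, (hs i).mono (min_le_left _ _)⟩]
    exact Finset.prod_eq_zero (Finset.mem_univ i)
      (by rw [hi _ ((hs i).mono (min_le_right _ _)), add_self_F2])

lemma germ_near {p : ∀ i, X i} {g : ℕ → ∀ i, X i} (hg : Tendsto g uf (𝓝 p)) {δ : ℝ}
    (hδ : 0 < δ) : ∀ᶠ n in uf, ∀ i, dist (g n i) (p i) ≤ δ := by
  filter_upwards [hg (Metric.closedBall_mem_nhds p hδ)] with n hn i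
  exact (dist_le_pi_dist _ _ i).trans hn

lemma good_of_cgood (hG : ∀ i, Geod (X i)) {p : ∀ i, X i} {g : ℕ → ∀ i, X i}
    (hg : Tendsto g uf (𝓝 p)) (h : ∀ i, CGood (p i) fun n => g n i) : Good p g := by
  choose a b ha hb hs using h
  obtain ⟨c, hc, δ, hδ, hv⟩ := exists_sphere_van hG p a b ha hb
  refine ⟨c, hc, fun hcon => ?_⟩
  obtain ⟨n, h1, h2, h3⟩ := (hcon.and ((germ_near hg hδ).and (eventually_all.2 hs))).exists
  obtain ⟨i, hi⟩ := (hv _ h2).1 h1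
  exact hi (h3 i)

/-- The compact set of far values of a coordinate. -/
def farSet (p : ∀ i, X i) (K : Set (∀ i, X i)) (δ : ℝ) (i : Fin N) : Set (X i) :=
  (fun x => x i) '' {x ∈ K | 4 * δ ≤ dist (x i) (p i)}

lemma isCompact_farSet {p : ∀ i, X i} {K : Set (∀ i, X i)} (hK : IsCompact K) (δ : ℝ)
    (i : Fin N) : IsCompact (farSet p K δ i) := by
  refine IsCompact.image ?_ (continuous_apply i)
  exact hK.inter_right (isClosed_le (f := fun _ => 4 * δ)
    (g := fun x : ∀ i, X i => dist (x i) (p i)) continuous_const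
    ((continuous_apply i).dist continuous_const))

lemma notMem_farSet {p : ∀ i, X i} {K : Set (∀ i, X i)} {δ : ℝ} (hδ : 0 < δ)
    (i : Fin N) : p i ∉ farSet p K δ i := by
  rintro ⟨x, ⟨-, h⟩, hx⟩
  simp only at hx
  rw [hx, dist_self] at h
  linarith

lemma exists_far {p : ∀ i, X i} {K : Set (∀ i, X i)} (hK : IsCompact K) (hp : p ∉ K) :
    ∃ δ > 0, ∀ x ∈ K, ∃ i, 8 * δ ≤ dist (x i) (p i) := by
  obtain ⟨δ, hδ, h⟩ := off_of_closed hK.isClosed hp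
  refine ⟨δ / 9, by positivity, fun x hx => ?_⟩
  by_contra hcon
  push Not at hcon
  have h1 : δ ≤ dist x p := h δ le_rfl hx
  have h2 : dist x p ≤ 8 * (δ / 9) := (dist_pi_le_iff (by positivity)).2 fun i => (hcon i).le
  linarith

lemma cgood_of_good {p : ∀ i, X i} {g : ℕ → ∀ i, X i} (hg : Tendsto g uf (𝓝 p)) (h : Good p g)
    (i : Fin N) : CGood (p i) fun n => g n i := by
  obtain ⟨c, ⟨K, hK, hp, hb, hc⟩, hv⟩ := h
  obtain ⟨δ, hδ, hfar⟩ := exists_far hK hp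
  obtain ⟨R, hR, η, hη, H⟩ := exists_reps (isCompact_farSet (p := p) hK δ i)
    (notMem_farSet (K := K) hδ i)
  have hRp : ∀ r ∈ R, r ≠ p i := fun r hr h => notMem_farSet (K := K) hδ i (h ▸ hR r hr)
  have key : ∀ᶠ n in uf, ∃ w ∈ (R ×ˢ R : Finset _), Sep w.1 w.2 (g n i) := by
    filter_upwards [Ultrafilter.eventually_not.2 hv, germ_near hg (lt_min hδ hη)] with n hn hnear
    by_contra hcon
    simp only [Sep, not_exists, not_and, not_forall, not_not] at hcon
    have : ∃ δ' > 0, ∀ w ∈ (R ×ˢ R : Finset _), ∀ t, Adm δ' (g n i) t → t w.1 = t w.2 := by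
      generalize (R ×ˢ R : Finset _) = T at hcon
      classical
      induction T using Finset.induction_on with
      | empty => exact ⟨1, one_pos, by simp⟩
      | insert w T _ ih =>
        obtain ⟨δ₁, h1, h1'⟩ := ih fun w hw => hcon w (Finset.mem_insert_of_mem hw)
        obtain ⟨δ₂, h2, h2'⟩ := hcon w (Finset.mem_insert_self _ _)
        refine ⟨min δ₁ δ₂, lt_min h1 h2, fun z hz t ht => ?_⟩
        rcases Finset.mem_insert.1 hz with rfl | hz
        · exact h2' t (ht.mono (min_le_right _ _))
        · exact h1' z hz t (ht.mono (min_le_left _ _))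
    obtain ⟨δ', hδ', hT⟩ := this
    obtain ⟨m₀, hm₀⟩ := eventually_atTop.1 (hc δ hδ)
    apply hn
    refine ⟨min δ' (min δ η), by positivity, m₀, fun m hm s hs => ?_⟩
    by_contra hne
    have hle1 : min δ' (min δ η) ≤ δ := (min_le_right _ _).trans (min_le_left _ _)
    have hle2 : min δ' (min δ η) ≤ η := (min_le_right _ _).trans (min_le_right _ _)
    obtain ⟨x, hx, x', hx', hxi, hxi', hsx⟩ := ev_ne_zero hδ hfar (hm₀ m hm) (hb m) s
      (fun j => ⟨g n j, (hnear j).trans (min_le_left _ _), (hs j).mono hle1⟩) hne i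
    obtain ⟨r, hr, -, h1⟩ := H (x i) ⟨x, ⟨hx, hxi⟩, rfl⟩
    obtain ⟨r', hr', -, h2⟩ := H (x' i) ⟨x', ⟨hx', hxi'⟩, rfl⟩
    rw [h1 η le_rfl _ ((hnear i).trans (min_le_right _ _)) _ ((hs i).mono hle2),
      h2 η le_rfl _ ((hnear i).trans (min_le_right _ _)) _ ((hs i).mono hle2)] at hsx
    exact hsx (hT (r, r') (Finset.mk_mem_product hr hr') _ ((hs i).mono (min_le_left _ _)))
  have key' := (Ultrafilter.finite_biUnion_mem_iff (f := uf) (R ×ˢ R).finite_toSet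
    (s := fun w => {n | Sep w.1 w.2 (g n i)})).1 (by
      filter_upwards [key] with n hn
      obtain ⟨w, hw, h⟩ := hn
      exact Set.mem_iUnion₂.2 ⟨w, hw, h⟩)
  obtain ⟨w, hw, hs⟩ := key'
  obtain ⟨h1, h2⟩ := Finset.mem_product.1 hw
  exact ⟨w.1, w.2, hRp _ h1, hRp _ h2, hs⟩

variable {T : Set (Fin N)}

lemma le_of_branch (hR : ∀ i ∉ T, Rprop (X i)) {p : ∀ i, X i} {g h : ℕ → ∀ i, X i}
    (hg : Tendsto g uf (𝓝 p)) (hh : Tendsto h uf (𝓝 p)) (hgood : Good p g)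
    (hb : ∀ i ∈ T, ∀ᶠ n in uf, g n i = p i ∨ Branch (p i) 0 (g n i) (h n i)) : Le p g h := by
  rintro c ⟨K, hK, hp, hbd, hc⟩ hv
  obtain ⟨δ, hδ, hfar⟩ := exists_far hK hp
  choose a b ha hb' hsep using fun i => cgood_of_good hg hgood i
  have hconv : ∀ i, Conv (p i) (farSet p K δ i)
      fun x y => i ∈ T → Sep (a i) (b i) x ∧ (x = p i ∨ Branch (p i) 0 x y) := by
    intro i
    by_cases hi : i ∈ T
    · simpa [hi] using conv_branch (isCompact_farSet (p := p) hK δ i)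
        (notMem_farSet (K := K) hδ i) (ha i) (hb' i)
    · simpa [hi] using conv_R (hR i hi) (isCompact_farSet (p := p) hK δ i)
        (notMem_farSet (K := K) hδ i)
  choose η hη H using hconv
  have hrel : ∀ᶠ n in uf, ∀ i, i ∈ T → Sep (a i) (b i) (g n i) ∧
      (g n i = p i ∨ Branch (p i) 0 (g n i) (h n i)) := by
    rw [eventually_all]
    intro i
    by_cases hi : i ∈ T
    · filter_upwards [hsep i, hb i hi] with n h1 h2 _ using ⟨h1, h2⟩
    · simp [hi]
  have hnear : ∀ {f : ℕ → ∀ i, X i}, Tendsto f uf (𝓝 p) →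
      ∀ᶠ n in uf, ∀ i, dist (f n i) (p i) ≤ min δ (η i) := by
    intro f hf
    rw [eventually_all]
    intro i
    filter_upwards [germ_near hf (lt_min hδ (hη i))] with n hn using hn i
  filter_upwards [hv, hrel, hnear hg, hnear hh] with n hvn hn hgn hhn
  obtain ⟨δ₁, hδ₁, m₁, hvn⟩ := hvn
  obtain ⟨m₂, hm₂⟩ := eventually_atTop.1 (hc δ hδ)
  choose δ' hδ' H' using fun i => H i (g n i) (h n i) ((hgn i).trans (min_le_right _ _))
    ((hhn i).trans (min_le_right _ _)) (hn i) (min δ₁ δ) (lt_min hδ₁ hδ)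
  obtain ⟨δ₂, hδ₂, hδ₂le⟩ : ∃ δ₂ > 0, ∀ i, δ₂ ≤ δ' i := by
    have : ∀ᶠ e in 𝓝[>] (0 : ℝ), ∀ i, e ≤ δ' i := by
      rw [eventually_all]
      intro i
      filter_upwards [Ioo_mem_nhdsGT (hδ' i)] with e he using he.2.le
    obtain ⟨e, h, h0⟩ := (this.and self_mem_nhdsWithin).exists
    exact ⟨e, h0, h⟩
  refine ⟨min δ₂ δ, lt_min hδ₂ hδ, max m₁ m₂, fun m hm s hs => ?_⟩
  choose s' hs' hK' using fun i => H' i (s i) ((hs i).mono ((min_le_left _ _).trans (hδ₂le i)))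
  rw [ev_congr hδ hfar (hm₂ m ((le_max_right _ _).trans hm)) (hbd m) s s'
    (fun i => ⟨h n i, (hhn i).trans (min_le_left _ _), (hs i).mono (min_le_right _ _)⟩)
    (fun i => ⟨g n i, (hgn i).trans (min_le_left _ _), (hs' i).mono (min_le_right _ _)⟩)
    (fun i x hx hxi => (hK' i (x i) ⟨x, ⟨hx, hxi⟩, rfl⟩).symm)]
  exact hvn m ((le_max_left _ _).trans hm) s' fun i => (hs' i).mono (min_le_left _ _)

lemma branch_of_le (hG : ∀ i, Geod (X i)) {p : ∀ i, X i} {g h : ℕ → ∀ i, X i}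
    (hg : Tendsto g uf (𝓝 p)) (hh : Tendsto h uf (𝓝 p)) (hgood : Good p h) (hle : Le p g h)
    {i : Fin N} (hi : Tripod (X i)) :
    ∀ᶠ n in uf, g n i = p i ∨ Branch (p i) 0 (g n i) (h n i) := by
  classical
  by_contra hcon
  rw [← Ultrafilter.eventually_not] at hcon
  simp only [not_or] at hcon
  choose a b ha hb hsep using fun i => cgood_of_good hh hgood i
  obtain ⟨C, c, hC, hc, hρ⟩ := hi
  obtain ⟨ρ, h0, -, hd, hχ⟩ := hρ (p i)
  have hρp : ∀ k, ρ k 1 ≠ p i := fun k hk => by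
    have := hd k 1 zero_le_one
    rw [hk, dist_self] at this
    linarith
  have hdis : ∀ y, ∀ k k' : Fin 3, k ≠ k' → Branch (p i) 0 (ρ k 1) y →
      ¬ Branch (p i) 0 (ρ k' 1) y := fun y k k' hk h1 h2 =>
    Tripod.not_branch h0 hχ hk.symm (h1.trans h2.symm)
  set S : Finset (X i) := insert (a i) (insert (b i) (Finset.univ.image fun k => ρ k 1)) with hS
  have hSp : ∀ x ∈ S, x ≠ p i := by
    intro x hx
    simp only [hS, Finset.mem_insert, Finset.mem_image, Finset.mem_univ, true_and] at hx
    rcases hx with rfl | rfl | ⟨k, rfl⟩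
    exacts [ha i, hb i, hρp k]
  have hρS : ∀ k, ρ k 1 ∈ S := fun k => by simp [hS]
  have key : ∀ᶠ n in uf, ∃ w ∈ (S ×ˢ S : Finset _), Sep w.1 w.2 (h n i) ∧
      ¬ Branch (p i) 0 w.1 (g n i) ∧ ¬ Branch (p i) 0 w.2 (g n i) := by
    filter_upwards [hcon, hsep i] with n hn hs
    by_cases hhp : h n i = p i
    · obtain ⟨k, k', hk, h1, h2⟩ : ∃ k k' : Fin 3, k' ≠ k ∧ ¬ Branch (p i) 0 (ρ k 1) (g n i) ∧
          ¬ Branch (p i) 0 (ρ k' 1) (g n i) := by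
        by_cases hk0 : Branch (p i) 0 (ρ 0 1) (g n i)
        · exact ⟨1, 2, by decide, hdis _ 0 1 (by decide) hk0, hdis _ 0 2 (by decide) hk0⟩
        · by_cases hk1 : Branch (p i) 0 (ρ 1 1) (g n i)
          · exact ⟨0, 2, by decide, hk0, hdis _ 1 2 (by decide) hk1⟩
          · exact ⟨0, 1, by decide, hk0, hk1⟩
      refine ⟨(ρ k 1, ρ k' 1), Finset.mk_mem_product (hρS k) (hρS k'), ?_, h1, h2⟩
      obtain ⟨χ, hχ, h1, -, h2⟩ := hχ k 0 le_rfl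
      rw [h0] at hχ
      rw [hhp]
      exact Sep.of_adm hχ (by rw [h1 1 one_pos, h2 k' hk 1 zero_le_one]; exact one_ne_zero)
    · obtain ⟨e, heS, hes⟩ : ∃ e ∈ S, Sep e (p i) (h n i) :=
        (hs.split (p i)).elim (fun h => ⟨a i, by simp [hS], h⟩) fun h => ⟨b i, by simp [hS], h⟩
      have heb := hes.branch hhp
      obtain ⟨k, h1, h2⟩ : ∃ k : Fin 3, ¬ Branch (p i) 0 (ρ k 1) (g n i) ∧
          ¬ Branch (p i) 0 (ρ k 1) (h n i) := by
        by_contra hall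
        push Not at hall
        by_cases hk0 : Branch (p i) 0 (ρ 0 1) (g n i)
        · have e1 := hall 1 (hdis _ 0 1 (by decide) hk0)
          exact hdis _ 1 2 (by decide) e1 (hall 2 (hdis _ 0 2 (by decide) hk0))
        · have e0 := hall 0 hk0
          have e1 : Branch (p i) 0 (ρ 1 1) (g n i) := by
            by_contra hk1
            exact hdis _ 0 1 (by decide) e0 (hall 1 hk1)
          exact hdis _ 0 2 (by decide) e0 (hall 2 (hdis _ 1 2 (by decide) e1))
      refine ⟨(e, ρ k 1), Finset.mk_mem_product heS (hρS k), hes.to_other hhp h2, ?_, h1⟩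
      exact fun hb => hn.2 (hb.symm.trans heb)
  obtain ⟨w, hw, hs⟩ := (Ultrafilter.finite_biUnion_mem_iff (f := uf) (S ×ˢ S).finite_toSet
    (s := fun w => {n | Sep w.1 w.2 (h n i) ∧ ¬ Branch (p i) 0 w.1 (g n i) ∧
      ¬ Branch (p i) 0 w.2 (g n i)})).1 (by
      filter_upwards [key] with n hn
      obtain ⟨w, hw, h⟩ := hn
      exact Set.mem_iUnion₂.2 ⟨w, hw, h⟩)
  obtain ⟨hw1, hw2⟩ := Finset.mem_product.1 hw
  have hs : ∀ᶠ n in (uf : Filter ℕ), Sep w.1 w.2 (h n i) ∧ ¬ Branch (p i) 0 w.1 (g n i) ∧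
      ¬ Branch (p i) 0 w.2 (g n i) := hs
  obtain ⟨c, hc, δ, hδ, hv⟩ := exists_sphere_van hG p (Function.update a i w.1)
    (Function.update b i w.2)
    (fun j => by
      by_cases hj : j = i
      · subst hj; simpa using hSp _ hw1
      · simpa [hj] using ha j)
    (fun j => by
      by_cases hj : j = i
      · subst hj; simpa using hSp _ hw2
      · simpa [hj] using hb j)
  have h1 : ∀ᶠ n in uf, Van c (g n) := by
    filter_upwards [hs, hcon, germ_near hg hδ] with n hn hn' hnear
    refine (hv _ hnear).2 ⟨i, ?_⟩
    simpa using not_sep hn'.1 hn.2.1 hn.2.2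
  obtain ⟨n, hn, hn', hn'', hnear⟩ :=
    ((hle c hc h1).and (hs.and ((eventually_all.2 hsep).and (germ_near hh hδ)))).exists
  obtain ⟨j, hj⟩ := (hv _ hnear).1 hn
  by_cases hji : j = i
  · subst hji
    exact hj (by simpa using hn'.1)
  · exact hj (by simpa [hji] using hn'' j)

end Germs
end DeRahmSplit

namespace DeRahmSplit

open Filter Topology

/-- A bilipschitz bijection. -/
structure BiLip {Y Z : Type*} [MetricSpace Y] [MetricSpace Z] (A : ℝ) (F : Y ≃ Z) : Prop where
  pos : 0 < A
  le : ∀ x y, dist (F x) (F y) ≤ A * dist x y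
  ge : ∀ x y, dist x y ≤ A * dist (F x) (F y)

lemma BiLip.symm {Y Z : Type*} [MetricSpace Y] [MetricSpace Z] {A : ℝ} {F : Y ≃ Z}
    (h : BiLip A F) : BiLip A F.symm :=
  ⟨h.pos, fun x y => by simpa using h.ge (F.symm x) (F.symm y),
    fun x y => by simpa using h.le (F.symm x) (F.symm y)⟩

lemma BiLip.continuous {Y Z : Type*} [MetricSpace Y] [MetricSpace Z] {A : ℝ} {F : Y ≃ Z}
    (h : BiLip A F) : Continuous F :=
  (LipschitzWith.of_dist_le_mul (K := ⟨A, h.pos.le⟩) fun x y => h.le x y).continuous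

/-- A finite family of cut spaces, those indexed by `T` having tripods, and the others being
like the line. -/
structure CutFam {N : ℕ} (X : Fin N → Type*) [∀ i, MetricSpace (X i)] (T : Set (Fin N)) :
    Prop where
  cut : ∀ i, CutSpace (X i)
  tri : ∀ i ∈ T, Tripod (X i)
  line : ∀ i ∉ T, Rprop (X i)

lemma SphIn.map {M N : ℕ} {X : Fin N → Type*} [∀ i, MetricSpace (X i)] {Y : Fin M → Type*}
    [∀ i, MetricSpace (Y i)] {A : ℝ} {F : (∀ i, X i) ≃ (∀ i, Y i)} (hF : BiLip A F)
    {p : ∀ i, X i} {K : Set (∀ i, X i)} {c : ℕ → Ch (∀ i, X i)} (h : SphIn p K c) :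
    IsCompact (F '' K) ∧ F p ∉ F '' K ∧ (∀ m, bd (mp F (c m)) = 0) ∧
      ∀ ε > 0, ∀ᶠ m in atTop, mp F (c m) ∈ Sup (Lst N (Near ε) (F '' K)) := by
  refine ⟨h.1.image hF.continuous, ?_, fun m => ?_, fun ε hε => ?_⟩
  · rw [F.injective.mem_set_image]
    exact h.2.1
  · rw [bd_mp, h.2.2.1, map_zero]
  · filter_upwards [h.2.2.2 (ε / A) (div_pos hε hF.pos)] with m hm
    refine mp_Lst (f := F) (R := Near (ε / A)) (R' := Near ε) (U := K) (U' := F '' K)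
      (fun x _ y _ hxy => ?_) (fun x hx => ⟨x, hx, rfl⟩) hm
    have hxy' : dist x y ≤ ε / A := hxy
    have := hF.le x y
    rw [le_div_iff₀ hF.pos] at hxy'
    show dist (F x) (F y) ≤ ε
    linarith

lemma CutSpace.sep {Y : Type*} [MetricSpace Y] (h : CutSpace Y) (p : Y) :
    ∃ a b : Y, a ≠ p ∧ b ≠ p ∧ Sep a b p := by
  obtain ⟨a, b, ha, hb, χ, hχ, hne⟩ := h.two p
  exact ⟨a, b, ha, hb, Sep.of_adm hχ hne⟩

/-- The number of factors is a bilipschitz invariant. -/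
theorem dim_le {M N : ℕ} {X : Fin N → Type*} [∀ i, MetricSpace (X i)] {Y : Fin M → Type*}
    [∀ i, MetricSpace (Y i)] (hX : ∀ i, CutSpace (X i)) (hY : ∀ i, CutSpace (Y i)) {A : ℝ}
    {F : (∀ i, X i) ≃ (∀ i, Y i)} (hF : BiLip A F) (p : ∀ i, X i) : M ≤ N := by
  by_contra hlt
  push Not at hlt
  obtain _ | M := M
  · omega
  obtain _ | N := N
  · obtain ⟨x, hx⟩ := (hY 0).far (F p 0) 1
    have h1 : F.symm (Function.update (F p) 0 x) = p := Subsingleton.elim _ _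
    have h2 := congrFun (F.symm_apply_eq.1 h1) 0
    rw [Function.update_self] at h2
    rw [h2, dist_self] at hx
    linarith
  choose a b ha hb hs using fun i => (hX i).sep (p i)
  obtain ⟨c, ⟨K, hc⟩, δ, hδ, hv⟩ := exists_sphere_van (fun i => (hX i).geod) p a b ha hb
  obtain ⟨hK, hp, hbd, hcc⟩ := hc.map hF
  have HY := fillData_pi Y (fun i => (hY i).geod) (fun i => (hY i).contr) fun i => (hY i).far
  have h1 : Bounds (N + 1) (fun m => mp F (c m)) (F p) :=
    bounds_of_fill HY hK.isClosed hbd hcc hp hlt.le (Or.inl hlt)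
  have h2 := h1.map hF.symm.pos hF.symm.le hF.symm.ge
  simp only [mp_mp, Equiv.symm_comp_self, mp_id, Equiv.symm_apply_apply] at h2
  have h3 := (van_iff_bounds (fun i => (hX i).geod) (fun i => (hX i).contr)
    (fun i => (hX i).far) hc hc.2.1).2 h2
  obtain ⟨i, hi⟩ := (hv p fun i => by simpa using hδ.le).1 h3
  exact hi (hs i)

lemma mp_symm_mp {Y Z : Type*} (F : Y ≃ Z) (c : Ch Y) : mp F.symm (mp F c) = c := by
  rw [mp_mp, Equiv.symm_comp_self, mp_id]

section Transport
variable {N : ℕ} {X Y : Fin (N + 1) → Type*} [∀ i, MetricSpace (X i)] [∀ i, MetricSpace (Y i)]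
  {S T : Set (Fin (N + 1))} {A : ℝ} {F : (∀ i, X i) ≃ (∀ i, Y i)}

lemma Van.map (hX : CutFam X S) (hY : CutFam Y T) (hF : BiLip A F) {p : ∀ i, X i}
    {K : Set (∀ i, X i)} {c : ℕ → Ch (∀ i, X i)} (hc : SphIn p K c) {y : ∀ i, X i} (hy : y ∉ K)
    (h : Van c y) : Van (fun m => mp F (c m)) (F y) := by
  have h1 := (van_iff_bounds (fun i => (hX.cut i).geod) (fun i => (hX.cut i).contr)
    (fun i => (hX.cut i).far) hc hy).1 h
  refine (van_iff_bounds (fun i => (hY.cut i).geod) (fun i => (hY.cut i).contr)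
    (fun i => (hY.cut i).far) (hc.map hF) ?_).2 (h1.map hF.pos hF.le hF.ge)
  rwa [F.injective.mem_set_image]

lemma eventually_van_map (hX : CutFam X S) (hY : CutFam Y T) (hF : BiLip A F) {p : ∀ i, X i}
    {c : ℕ → Ch (∀ i, X i)} (hc : Sph p c) {g : ℕ → ∀ i, X i} (hg : Tendsto g uf (𝓝 p))
    (h : ∀ᶠ n in uf, Van c (g n)) : ∀ᶠ n in uf, Van (fun m => mp F (c m)) (F (g n)) := by
  obtain ⟨K, hc⟩ := hc
  filter_upwards [h, hg (hc.1.isClosed.isOpen_compl.mem_nhds hc.2.1)] with n h1 h2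
  exact h1.map hX hY hF hc h2

lemma tendsto_map (hF : BiLip A F) {p : ∀ i, X i} {g : ℕ → ∀ i, X i}
    (hg : Tendsto g uf (𝓝 p)) : Tendsto (fun n => F (g n)) uf (𝓝 (F p)) :=
  (hF.continuous.tendsto p).comp hg

lemma Le.map (hX : CutFam X S) (hY : CutFam Y T) (hF : BiLip A F) {p : ∀ i, X i}
    {g h : ℕ → ∀ i, X i} (hg : Tendsto g uf (𝓝 p)) (hh : Tendsto h uf (𝓝 p)) (hle : Le p g h) :
    Le (F p) (fun n => F (g n)) fun n => F (h n) := by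
  intro c hc hv
  have hcs : Sph p (fun m => mp F.symm (c m)) := by
    obtain ⟨K, hc⟩ := hc
    have := hc.map hF.symm
    rw [Equiv.symm_apply_apply] at this
    exact ⟨F.symm '' K, this⟩
  have h1 := eventually_van_map hY hX hF.symm hc (tendsto_map hF hg) hv
  simp only [Equiv.symm_apply_apply] at h1
  have h2 := eventually_van_map hX hY hF hcs hh (hle _ hcs h1)
  simpa only [mp_mp, Equiv.self_comp_symm, mp_id] using h2

lemma Good.map (hX : CutFam X S) (hY : CutFam Y T) (hF : BiLip A F) {p : ∀ i, X i}
    {g : ℕ → ∀ i, X i} (hg : Tendsto g uf (𝓝 p)) (h : Good p g) :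
    Good (F p) fun n => F (g n) := by
  obtain ⟨c, hc, hv⟩ := h
  refine ⟨fun m => mp F (c m), ?_, fun hcon => hv ?_⟩
  · obtain ⟨K, hc⟩ := hc
    exact ⟨F '' K, hc.map hF⟩
  · have hcs : Sph (F p) (fun m => mp F (c m)) := by
      obtain ⟨K, hc⟩ := hc
      exact ⟨F '' K, hc.map hF⟩
    have := eventually_van_map hY hX hF.symm hcs (tendsto_map hF hg) hcon
    simpa only [mp_symm_mp, Equiv.symm_apply_apply] using this

lemma le_iff (hX : CutFam X S) {p : ∀ i, X i} {g h : ℕ → ∀ i, X i} (hg : Tendsto g uf (𝓝 p))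
    (hh : Tendsto h uf (𝓝 p)) (hg' : Good p g) (hh' : Good p h) :
    Le p g h ↔ ∀ i ∈ S, ∀ᶠ n in uf, g n i = p i ∨ Branch (p i) 0 (g n i) (h n i) :=
  ⟨fun hle _ hi => branch_of_le (fun i => (hX.cut i).geod) hg hh hh' hle (hX.tri _ hi),
    fun hb => le_of_branch hX.line hg hh hg' hb⟩

lemma cgood_const {Y : Type*} [MetricSpace Y] (h : CutSpace Y) (p : Y) : CGood p fun _ => p := by
  obtain ⟨a, b, ha, hb, hs⟩ := h.sep p
  exact ⟨a, b, ha, hb, .of_forall fun _ => hs⟩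

lemma CutFam.good (hX : CutFam X S) {p : ∀ i, X i} {g : ℕ → ∀ i, X i}
    (hg : Tendsto g uf (𝓝 p)) (h : ∀ i, CGood (p i) fun n => g n i) : Good p g :=
  good_of_cgood (fun i => (hX.cut i).geod) hg h

/-- A germ moving in no tripod coordinate is sent to such a germ. -/
lemma trivial_map (hX : CutFam X S) (hY : CutFam Y T) (hF : BiLip A F) {p : ∀ i, X i}
    {g : ℕ → ∀ i, X i} (hg : Tendsto g uf (𝓝 p)) (hgood : Good p g)
    (h : ∀ i ∈ S, ∀ᶠ n in uf, g n i = p i) (j : Fin (N + 1)) (hj : j ∈ T) :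
    ∀ᶠ n in uf, F (g n) j = F p j := by
  have hp : Good p fun _ => p := hX.good tendsto_const_nhds fun i => cgood_const (hX.cut i) _
  have hle : Le p g fun _ => p := (le_iff hX hg tendsto_const_nhds hgood hp).2
    fun i hi => (h i hi).mono fun n hn => Or.inl hn
  have := (le_iff hY (tendsto_map hF hg) tendsto_const_nhds (hgood.map hX hY hF hg)
    (hp.map hX hY hF tendsto_const_nhds)).1 (hle.map hX hY hF hg tendsto_const_nhds) j hj
  filter_upwards [this] with n hn
  exact hn.elim id fun hb => hb.eq_center.2 rfl

/-- A germ moving in exactly one tripod coordinate. -/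
structure Leg (S : Set (Fin (N + 1))) (p : ∀ i, X i) (i : Fin (N + 1)) (g : ℕ → ∀ i, X i) :
    Prop where
  mem : i ∈ S
  lim : Tendsto g uf (𝓝 p)
  good : Good p g
  ne : ∀ᶠ n in uf, g n i ≠ p i
  eq : ∀ i' ∈ S, i' ≠ i → ∀ᶠ n in uf, g n i' = p i'

/-- Germs can be modified coordinatewise. -/
lemma mix_germ (hX : CutFam X S) {p : ∀ i, X i} {g : ℕ → ∀ i, X i}
    (h : ∀ i, (∃ a : ℕ → ∀ i, X i, Tendsto a uf (𝓝 p) ∧ Good p a ∧ ∀ n, g n i = a n i) ∨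
      ∀ n, g n i = p i) : Tendsto g uf (𝓝 p) ∧ Good p g := by
  have hl : Tendsto g uf (𝓝 p) := by
    rw [tendsto_pi_nhds]
    intro i
    rcases h i with ⟨a, ha, -, he⟩ | he
    · simpa only [he] using tendsto_pi_nhds.1 ha i
    · simpa only [he] using tendsto_const_nhds
  refine ⟨hl, hX.good hl fun i => ?_⟩
  rcases h i with ⟨a, ha, hg, he⟩ | he
  · simpa only [he] using cgood_of_good ha hg i
  · simpa only [he] using cgood_const (hX.cut i) _

lemma Leg.single (hX : CutFam X S) {p : ∀ i, X i} {g : ℕ → ∀ i, X i}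
    (hg : Tendsto g uf (𝓝 p)) (hgood : Good p g) {i : Fin (N + 1)} (hi : i ∈ S)
    (hne : ∀ᶠ n in uf, g n i ≠ p i) : Leg S p i fun n => Function.update p i (g n i) := by
  have := mix_germ (g := fun n => Function.update p i (g n i)) hX fun i' => by
    by_cases hi' : i' = i
    · subst hi'
      exact Or.inl ⟨g, hg, hgood, fun n => by simp⟩
    · exact Or.inr fun n => by simp [hi']
  refine ⟨hi, this.1, this.2, by simpa using hne, fun i' _ hi' => by simp [hi']⟩

/-- A leg is sent to a leg. -/
lemma Leg.map (hX : CutFam X S) (hY : CutFam Y T) (hF : BiLip A F) {p : ∀ i, X i}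
    {i : Fin (N + 1)} {g : ℕ → ∀ i, X i} (hg : Leg S p i g) :
    ∃ j, Leg T (F p) j fun n => F (g n) := by
  have hFl := tendsto_map hF hg.lim
  have hFg := hg.good.map hX hY hF hg.lim
  obtain ⟨j, hj, hne⟩ : ∃ j ∈ T, ∀ᶠ n in uf, F (g n) j ≠ F p j := by
    by_contra hcon
    push Not at hcon
    have := trivial_map hY hX hF.symm hFl hFg hcon i hg.mem
    simp only [Equiv.symm_apply_apply] at this
    obtain ⟨n, h1, h2⟩ := (this.and hg.ne).exists
    exact h2 h1
  refine ⟨j, hj, hFl, hFg, hne, fun j' hj' hjj' => ?_⟩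
  have hl := Leg.single hY hFl hFg hj hne
  set h : ℕ → ∀ i, X i := fun n => F.symm (Function.update (F p) j (F (g n) j)) with hh
  have hlim : Tendsto h uf (𝓝 p) := by simpa using tendsto_map hF.symm hl.lim
  have hgood : Good p h := by simpa using hl.good.map hY hX hF.symm hl.lim
  have h1 : Le (F p) (fun n => Function.update (F p) j (F (g n) j)) fun n => F (g n) := by
    refine (le_iff hY hl.lim hFl hl.good hFg).2 fun i' hi' => ?_
    by_cases hij : i' = j
    · subst hij
      exact .of_forall fun n => Or.inr (by simpa using Branch.refl _ _ _)
    · exact .of_forall fun n => Or.inl (by simp [hij])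
  have h2 : Le p h g := by simpa using h1.map hY hX hF.symm hl.lim hFl
  have h3 := (le_iff hX hlim hg.lim hgood hg.good).1 h2
  have h4 : Le p g h := by
    refine (le_iff hX hg.lim hlim hg.good hgood).2 fun i' hi' => ?_
    by_cases hii : i' = i
    · subst hii
      have hnt : ∀ᶠ n in uf, h n i' ≠ p i' := by
        by_contra hcon
        rw [← Ultrafilter.eventually_not] at hcon
        have := trivial_map hX hY hF hlim hgood (fun k hk => ?_) j hj
        · obtain ⟨n, hn1, hn2⟩ := (this.and hne).exists
          exact hn2 (by simpa [hh] using hn1)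
        · by_cases hki : k = i'
          · subst hki; simpa using hcon
          · filter_upwards [h3 k hk, hg.eq k hk hki] with n hn1 hn2
            rcases hn1 with hn1 | hn1
            · exact hn1
            · exact hn1.eq_center.2 hn2
      filter_upwards [h3 i' hi', hnt] with n hn1 hn2
      exact Or.inr (hn1.resolve_left hn2).symm
    · exact (hg.eq i' hi' hii).mono fun n hn => Or.inl hn
  have h5 := h4.map hX hY hF hg.lim hlim
  simp only [hh, Equiv.apply_symm_apply] at h5
  filter_upwards [(le_iff hY hFl hl.lim hFg hl.good).1 h5 j' hj'] with n hn
  rcases hn with hn | hn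
  · exact hn
  · exact hn.eq_center.2 (by simp [hjj'])

lemma Leg.unique {p : ∀ i, X i} {g : ℕ → ∀ i, X i} {i i' : Fin (N + 1)} (h : Leg S p i g)
    (h' : Leg S p i' g) : i = i' := by
  by_contra hne
  obtain ⟨n, h1, h2⟩ := (h.ne.and (h'.eq i h.mem hne)).exists
  exact h1 h2

lemma Leg.le_mix (hX : CutFam X S) {p : ∀ i, X i} {a h : ℕ → ∀ i, X i} {i : Fin (N + 1)}
    (ha : Leg S p i a) (hl : Tendsto h uf (𝓝 p)) (hg : Good p h) (heq : ∀ n, h n i = a n i) :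
    Le p a h := by
  refine (le_iff hX ha.lim hl ha.good hg).2 fun i' hi' => ?_
  by_cases hii : i' = i
  · subst hii
    exact .of_forall fun n => Or.inr (by rw [heq]; exact Branch.refl _ _ _)
  · exact (ha.eq i' hi' hii).mono fun n hn => Or.inl hn

lemma Leg.branch_of_le (hX : CutFam X S) {p : ∀ i, X i} {a h : ℕ → ∀ i, X i} {i : Fin (N + 1)}
    (ha : Leg S p i a) (hl : Tendsto h uf (𝓝 p)) (hg : Good p h) (hle : Le p a h) :
    ∀ᶠ n in uf, Branch (p i) 0 (a n i) (h n i) := by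
  filter_upwards [(le_iff hX ha.lim hl ha.good hg).1 hle i ha.mem, ha.ne] with n h1 h2
  exact h1.resolve_left h2

/-- Two legs in different coordinates lie below a common germ. -/
lemma exists_mix (hX : CutFam X S) {p : ∀ i, X i} {a b : ℕ → ∀ i, X i} {i j : Fin (N + 1)}
    (ha : Leg S p i a) (hb : Leg S p j b) (hij : i ≠ j) :
    ∃ h, Tendsto h uf (𝓝 p) ∧ Good p h ∧ Le p a h ∧ Le p b h := by
  set h : ℕ → ∀ i, X i := fun n => Function.update (Function.update p i (a n i)) j (b n j) with hh
  obtain ⟨h1, h2⟩ := mix_germ (g := h) hX fun i' => by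
    by_cases hj : i' = j
    · subst hj
      exact Or.inl ⟨b, hb.lim, hb.good, fun n => by simp [hh]⟩
    by_cases hi : i' = i
    · subst hi
      exact Or.inl ⟨a, ha.lim, ha.good, fun n => by simp [hh, hj]⟩
    · exact Or.inr fun n => by simp [hh, hi, hj]
  exact ⟨h, h1, h2, ha.le_mix hX h1 h2 fun n => by simp [hh, hij],
    hb.le_mix hX h1 h2 fun n => by simp [hh]⟩

/-- Legs at the same coordinate in different branches are sent to such legs. -/
lemma Leg.map_pair (hX : CutFam X S) (hY : CutFam Y T) (hF : BiLip A F) {p : ∀ i, X i}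
    {i j j' : Fin (N + 1)} {a b : ℕ → ∀ i, X i} (ha : Leg S p i a) (hb : Leg S p i b)
    (hab : ∀ᶠ n in uf, ¬ Branch (p i) 0 (a n i) (b n i)) (ha' : Leg T (F p) j fun n => F (a n))
    (hb' : Leg T (F p) j' fun n => F (b n)) :
    j = j' ∧ ∀ᶠ n in uf, ¬ Branch (F p j) 0 (F (a n) j) (F (b n) j) := by
  have key : ∀ h, Tendsto h uf (𝓝 (F p)) → Good (F p) h → Le (F p) (fun n => F (a n)) h →
      Le (F p) (fun n => F (b n)) h → False := by
    intro h h1 h2 h3 h4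
    have h1' := tendsto_map hF.symm h1
    have h2' := h2.map hY hX hF.symm h1
    have h3' := h3.map hY hX hF.symm ha'.lim h1
    have h4' := h4.map hY hX hF.symm hb'.lim h1
    simp only [Equiv.symm_apply_apply] at h1' h2' h3' h4'
    obtain ⟨n, hn, hna, hnb⟩ := (hab.and ((ha.branch_of_le hX h1' h2' h3').and
      (hb.branch_of_le hX h1' h2' h4'))).exists
    exact hn (hna.trans hnb.symm)
  have hjj : j = j' := by
    by_contra hne
    obtain ⟨h, h1, h2, h3, h4⟩ := exists_mix hY ha' hb' hne
    exact key h h1 h2 h3 h4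
  subst hjj
  refine ⟨rfl, ?_⟩
  rw [Ultrafilter.eventually_not]
  intro hcon
  refine key _ hb'.lim hb'.good ((le_iff hY ha'.lim hb'.lim ha'.good hb'.good).2 fun k hk => ?_)
    fun _ _ h => h
  by_cases hkj : k = j
  · subst hkj
    exact hcon.mono fun n hn => Or.inr hn
  · exact (ha'.eq k hk hkj).mono fun n hn => Or.inl hn

/-- Legs in different coordinates are sent to legs in different coordinates. -/
lemma Leg.map_ne (hX : CutFam X S) (hY : CutFam Y T) (hF : BiLip A F) {p : ∀ i, X i}
    {i i' j j' : Fin (N + 1)} (hi : i ≠ i') {a a' b : ℕ → ∀ i, X i} (ha : Leg S p i a)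
    (ha' : Leg S p i a') (hb : Leg S p i' b)
    (hab : ∀ᶠ n in uf, ¬ Branch (p i) 0 (a n i) (a' n i)) (hFa : Leg T (F p) j fun n => F (a n))
    (hFb : Leg T (F p) j' fun n => F (b n)) : j ≠ j' := by
  rintro rfl
  obtain ⟨j', hFa'⟩ := ha'.map hX hY hF
  obtain ⟨rfl, h0⟩ := Leg.map_pair hX hY hF ha ha' hab hFa hFa'
  have key : ∀ a, Leg S p i a → Leg T (F p) j (fun n => F (a n)) →
      ∀ᶠ n in uf, Branch (F p j) 0 (F (a n) j) (F (b n) j) := by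
    intro a ha hFa
    obtain ⟨h, h1, h2, h3, h4⟩ := exists_mix hX ha hb hi
    have h1' := tendsto_map hF h1
    have h2' := h2.map hX hY hF h1
    filter_upwards [hFa.branch_of_le hY h1' h2' (h3.map hX hY hF ha.lim h1),
      hFb.branch_of_le hY h1' h2' (h4.map hX hY hF hb.lim h1)] with n hn1 hn2
    exact hn1.trans hn2.symm
  obtain ⟨n, hn, h1, h2⟩ := (h0.and ((key a ha hFa).and (key a' ha' hFa'))).exists
  exact hn (h1.trans h2.symm)

end Transport
end DeRahmSplit

namespace DeRahmSplit

open Filter Topology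
open scoped NNReal

/-- Three rays in different branches at a point. -/
structure Rays {Y : Type*} [MetricSpace Y] (C c : ℝ) (p : Y) (ρ : Fin 3 → ℝ → Y) : Prop where
  zero : ∀ k, ρ k 0 = p
  lip : ∀ k, ∀ t ≥ 0, ∀ t' ≥ 0, dist (ρ k t) (ρ k t') ≤ C * |t - t'|
  dist : ∀ k, ∀ t ≥ 0, dist (ρ k t) p = c * t
  cut : ∀ k, ∀ t ≥ 0, ∃ χ : Y → F2, Adm 0 (ρ k t) χ ∧ (∀ u > t, χ (ρ k u) = 1) ∧
    (∀ u ≥ 0, u < t → χ (ρ k u) = 0) ∧ ∀ k' ≠ k, ∀ u ≥ 0, χ (ρ k' u) = 0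

lemma Tripod.rays {Y : Type*} [MetricSpace Y] (h : Tripod Y) (p : Y) :
    ∃ C c ρ, 0 < C ∧ 0 < c ∧ Rays C c p ρ := by
  obtain ⟨C, c, hC, hc, h⟩ := h
  obtain ⟨ρ, h1, h2, h3, h4⟩ := h p
  exact ⟨C, c, ρ, hC, hc, h1, h2, h3, h4⟩

lemma Rays.ne {Y : Type*} [MetricSpace Y] {C c : ℝ} {p : Y} {ρ : Fin 3 → ℝ → Y}
    (h : Rays C c p ρ) (hc : 0 < c) {k k' : Fin 3} {t t' : ℝ} (ht : 0 ≤ t) (ht' : 0 ≤ t')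
    (hne : t ≠ t') : ρ k t ≠ ρ k' t' := by
  intro heq
  have h1 := h.dist k t ht
  rw [heq, h.dist k' t' ht'] at h1
  exact hne (mul_left_cancel₀ hc.ne' h1).symm

lemma Rays.not_branch {Y : Type*} [MetricSpace Y] {C c : ℝ} {p : Y} {ρ : Fin 3 → ℝ → Y}
    (h : Rays C c p ρ) {k k' : Fin 3} {t t' : ℝ} (ht : 0 < t) (ht' : 0 ≤ t') (hk : k' ≠ k) :
    ¬ Branch p 0 (ρ k t) (ρ k' t') := by
  intro hb
  obtain ⟨χ, hχ, h1, -, h2⟩ := h.cut k 0 le_rfl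
  rw [h.zero] at hχ
  have := hb.const hχ
  rw [h1 t ht, h2 k' hk t' ht'] at this
  exact one_ne_zero this

variable {N : ℕ} {X Y : Fin (N + 1) → Type*} [∀ i, MetricSpace (X i)] [∀ i, MetricSpace (Y i)]
  {S T : Set (Fin (N + 1))} {A : ℝ} {F : (∀ i, X i) ≃ (∀ i, Y i)}

lemma ray_tendsto {p : ∀ i, X i} {i : Fin (N + 1)} {C c : ℝ} {ρ : Fin 3 → ℝ → X i}
    (hρ : Rays C c (p i) ρ) (k : Fin 3) {t : ℝ} (ht : 0 ≤ t) {l : Filter ℕ} {τ : ℕ → ℝ}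
    (hτ : Tendsto τ l (𝓝 t)) (h0 : ∀ n, 0 ≤ τ n) :
    Tendsto (fun n => Function.update p i (ρ k (τ n))) l (𝓝 (Function.update p i (ρ k t))) := by
  refine tendsto_const_nhds.update i ?_
  rw [tendsto_iff_dist_tendsto_zero]
  have h1 : Tendsto (fun n => C * |τ n - t|) l (𝓝 0) := by
    simpa using ((hτ.sub_const t).abs.const_mul C)
  exact squeeze_zero (fun _ => dist_nonneg) (fun n => hρ.lip k _ (h0 n) _ ht) h1

lemma ray_leg (hX : CutFam X S) {p : ∀ i, X i} {i : Fin (N + 1)} (hi : i ∈ S) {C c : ℝ}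
    (hc : 0 < c) {ρ : Fin 3 → ℝ → X i} (hρ : Rays C c (p i) ρ) (k : Fin 3) {t : ℝ} (ht : 0 ≤ t)
    {τ : ℕ → ℝ} (hτ : Tendsto τ uf (𝓝 t)) (h0 : ∀ n, 0 ≤ τ n) (hne : ∀ n, τ n ≠ t) :
    Leg S (Function.update p i (ρ k t)) i fun n => Function.update p i (ρ k (τ n)) := by
  have hl := ray_tendsto hρ k ht hτ h0
  refine ⟨hi, hl, hX.good hl fun i' => ?_, ?_, fun i' _ hi' => ?_⟩
  · by_cases hii : i' = i
    · subst hii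
      simp only [Function.update_self]
      obtain ⟨k', hk⟩ : ∃ k' : Fin 3, k' ≠ k := exists_ne k
      refine ⟨ρ k (t + 1), ρ k' (t + 1), hρ.ne hc (by linarith) ht (by linarith),
        hρ.ne hc (by linarith) ht (by linarith), ?_⟩
      filter_upwards [hτ.eventually_lt_const (lt_add_one t)] with n hn
      obtain ⟨χ, hχ, h1, -, h2⟩ := hρ.cut k (τ n) (h0 n)
      refine Sep.of_adm hχ ?_
      rw [h1 _ hn, h2 k' hk _ (by linarith)]
      exact one_ne_zero
    · simp only [Function.update_of_ne hii]
      exact cgood_const (hX.cut i') _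
  · exact .of_forall fun n => by simpa using hρ.ne hc (h0 n) ht (hne n)
  · exact .of_forall fun n => by simp [hi']

lemma tendsto_uf_add (t : ℝ) : Tendsto (fun n : ℕ => t + 1 / ((n : ℝ) + 1)) uf (𝓝 t) := by
  have := (tendsto_one_div_add_atTop_nhds_zero_nat (𝕜 := ℝ)).const_add t
  rw [add_zero] at this
  exact this.mono_left Nat.hyperfilter_le_atTop

lemma ray_leg_zero (hX : CutFam X S) {p : ∀ i, X i} {i : Fin (N + 1)} (hi : i ∈ S) {C c : ℝ}
    (hc : 0 < c) {ρ : Fin 3 → ℝ → X i} (hρ : Rays C c (p i) ρ) (k : Fin 3) :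
    Leg S p i fun n => Function.update p i (ρ k (0 + 1 / ((n : ℝ) + 1))) := by
  have := ray_leg hX hi hc hρ k le_rfl (tendsto_uf_add 0) (fun n => by positivity)
    fun n => by positivity
  rwa [hρ.zero, Function.update_eq_self] at this

variable (S T F) in
/-- The coordinate `j` in which the images of the legs at coordinate `i` move. -/
def IsIdx (p : ∀ i, X i) (i j : Fin (N + 1)) : Prop :=
  ∀ a, Leg S p i a → Leg T (F p) j fun n => F (a n)

lemma exists_idx (hX : CutFam X S) (hY : CutFam Y T) (hF : BiLip A F) (p : ∀ i, X i)
    {i : Fin (N + 1)} (hi : i ∈ S) : ∃ j ∈ T, IsIdx S T F p i j := by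
  obtain ⟨C, c, ρ, hC, hc, hρ⟩ := (hX.tri i hi).rays (p i)
  have hl := ray_leg_zero hX hi hc hρ
  choose j hj using fun k => (hl k).map hX hY hF
  have hjj : ∀ k k', k' ≠ k → j k = j k' := fun k k' hk =>
    (Leg.map_pair hX hY hF (hl k) (hl k') (.of_forall fun n => by
      simpa using hρ.not_branch (by positivity) (by positivity) hk) (hj k) (hj k')).1
  refine ⟨j 0, (hj 0).mem, fun a ha => ?_⟩
  obtain ⟨j', hj'⟩ := ha.map hX hY hF
  obtain ⟨k, hk⟩ : ∃ k, ∀ᶠ n in uf,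
      ¬ Branch (p i) 0 (a n i) (ρ k (0 + 1 / ((n : ℝ) + 1))) := by
    by_contra hcon
    push Not at hcon
    obtain ⟨n, h0, h1⟩ := ((hcon 0).and (hcon 1)).exists
    exact hρ.not_branch (k := 0) (k' := 1) (by positivity) (by positivity) (by decide)
      (h0.symm.trans h1)
  have h1 := (Leg.map_pair hX hY hF ha (hl k) (by simpa using hk) hj' (hj k)).1
  have h2 : j k = j 0 := by
    by_cases hk0 : k = 0
    · rw [hk0]
    · exact (hjj 0 k hk0).symm
  rw [← h2, ← h1]
  exact hj'

lemma IsIdx.ne (hX : CutFam X S) (hY : CutFam Y T) (hF : BiLip A F) {p : ∀ i, X i}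
    {i i' j j' : Fin (N + 1)} (hi : i ∈ S) (hi' : i' ∈ S) (hii : i ≠ i')
    (h : IsIdx S T F p i j) (h' : IsIdx S T F p i' j') : j ≠ j' := by
  obtain ⟨C, c, ρ, hC, hc, hρ⟩ := (hX.tri i hi).rays (p i)
  obtain ⟨C', c', ρ', hC', hc', hρ'⟩ := (hX.tri i' hi').rays (p i')
  have h0 := ray_leg_zero hX hi hc hρ
  have h0' := ray_leg_zero hX hi' hc' hρ' 0
  refine Leg.map_ne hX hY hF hii (h0 0) (h0 1) h0' (.of_forall fun n => ?_) (h _ (h0 0)) (h' _ h0')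
  simpa using hρ.not_branch (k := 0) (k' := 1) (t := 0 + 1 / ((n : ℝ) + 1))
    (by positivity) (by positivity) (by decide)

/-- Along a ray in the coordinate `i` only one tripod coordinate of the image changes. -/
lemma ray_const (hX : CutFam X S) (hY : CutFam Y T) (hF : BiLip A F) {p : ∀ i, X i}
    {i j : Fin (N + 1)} (hi : i ∈ S) (hj : IsIdx S T F p i j) {C c : ℝ}
    (hc : 0 < c) {ρ : Fin 3 → ℝ → X i} (hρ : Rays C c (p i) ρ) (k : Fin 3) {t : ℝ} (ht : 0 ≤ t)
    {j' : Fin (N + 1)} (hj' : j' ∈ T) (hjj : j' ≠ j) :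
    F (Function.update p i (ρ k t)) j' = F p j' := by
  set r : ℝ≥0 → ∀ i, X i := fun u => Function.update p i (ρ k u) with hr
  have hr0 : r 0 = p := by simp [hr, hρ.zero]
  choose J hJT hJ using fun u => exists_idx hX hY hF (r u) hi
  have hJ0 : J 0 = j := by
    have hl := ray_leg_zero hX hi hc hρ k
    have h1 := hJ 0
    rw [hr0] at h1
    exact (h1 _ hl).unique (hj _ hl)
  have hloc : ∀ u, ∀ j' ∈ T, j' ≠ J u → ∀ᶠ s in 𝓝 u, F (r s) j' = F (r u) j' := by
    intro u j' hj' hne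
    by_contra hcon
    obtain ⟨τ, hτ, hτn⟩ := exists_seq_forall_of_frequently (not_eventually.1 hcon)
    have hτ' := (NNReal.tendsto_coe.2 hτ).mono_left Nat.hyperfilter_le_atTop
    have hl := ray_leg hX hi hc hρ k u.2 hτ' (fun n => (τ n).2) fun n h =>
      hτn n (by rw [NNReal.coe_inj.1 h])
    obtain ⟨n, hn⟩ := ((hJ u _ hl).eq j' hj' hne).exists
    exact hτn n hn
  have hJc : IsLocallyConstant J := by
    rw [IsLocallyConstant.iff_eventually_eq]
    intro u
    have hE : ∀ᶠ s in 𝓝 u, ∀ j' : Fin (N + 1), j' ∈ T → j' ≠ J u →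
        F (r s) j' = F (r u) j' := by
      simp only [eventually_all]
      exact hloc u
    filter_upwards [eventually_eventually_nhds.2 hE] with s hs
    by_contra hne
    have hl := ray_leg hX hi hc hρ k s.2 (tendsto_uf_add s) (fun n => by positivity)
      fun n => by
        have : (0 : ℝ) < 1 / ((n : ℝ) + 1) := by positivity
        exact (lt_add_of_pos_right _ this).ne'
    have hlim : Tendsto (fun n : ℕ => s + 1 / ((n : ℝ≥0) + 1)) uf (𝓝 s) := by
      rw [← NNReal.tendsto_coe]
      simpa using tendsto_uf_add s
    obtain ⟨n, h1, h2⟩ := ((hJ s _ hl).ne.and (hlim.eventually hs)).exists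
    apply h1
    have h3 := h2 (J s) (hJT s) hne
    have h4 := hs.self_of_nhds (J s) (hJT s) hne
    simp only [hr, NNReal.coe_add, NNReal.coe_div, NNReal.coe_one, NNReal.coe_natCast] at h3 h4
    exact h3.trans h4.symm
  have hlc : IsLocallyConstant fun u => F (r u) j' := by
    rw [IsLocallyConstant.iff_eventually_eq]
    intro u
    refine hloc u j' hj' ?_
    rw [hJc.apply_eq_of_preconnectedSpace u 0, hJ0]
    exact hjj
  have := hlc.apply_eq_of_preconnectedSpace ⟨t, ht⟩ 0
  simp only [hr0] at this
  exact this

/-- Moving the other coordinates does not change the tripod coordinates of the image. -/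
lemma line_move (hX : CutFam X S) (hY : CutFam Y T) (hF : BiLip A F) {p q : ∀ i, X i}
    (hpq : ∀ i ∈ S, p i = q i) {j : Fin (N + 1)} (hj : j ∈ T) : F p j = F q j := by
  have hpath : ∀ i, ∃ γ : ℝ → X i, Continuous γ ∧ γ 0 = p i ∧ γ 1 = q i ∧
      (p i = q i → ∀ t, γ t = p i) := by
    intro i
    by_cases he : p i = q i
    · exact ⟨fun _ => p i, continuous_const, rfl, he, fun _ _ => rfl⟩
    · obtain ⟨γ, D, hD, hγ, h1, h0⟩ := (hX.cut i).geod.path (q i) (p i)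
      have hc := (LipschitzWith.of_dist_le_mul (K := ⟨D, hD.le⟩) fun x y => hγ x y).continuous
      exact ⟨fun t => γ (2 * t - 1), by fun_prop, by simpa using h0, by norm_num [h1],
        fun h => absurd h he⟩
  choose γ hγ h0 h1 hc using hpath
  set r : ℝ → ∀ i, X i := fun t i => γ i t with hr
  have hrc : Continuous r := continuous_pi hγ
  have hlc : IsLocallyConstant fun t => F (r t) j := by
    rw [IsLocallyConstant.iff_eventually_eq]
    intro t
    by_contra hcon
    obtain ⟨τ, hτ, hτn⟩ := exists_seq_forall_of_frequently (not_eventually.1 hcon)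
    have hlim : Tendsto (fun n => r (τ n)) uf (𝓝 (r t)) :=
      (hrc.tendsto t).comp (hτ.mono_left Nat.hyperfilter_le_atTop)
    have hS : ∀ i ∈ S, ∀ n, r (τ n) i = r t i := fun i hi n => by
      simp only [hr, hc i (hpq i hi)]
    have hgood : Good (r t) fun n => r (τ n) := hX.good hlim fun i => by
      by_cases hi : i ∈ S
      · simpa only [hS i hi] using cgood_const (hX.cut i) _
      · obtain ⟨a, b, ha, hb, χ, hχ, hne⟩ := (hX.cut i).two (r t i)
        have ha0 := dist_pos.2 ha
        have hb0 := dist_pos.2 hb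
        refine ⟨a, b, ha, hb, ?_⟩
        have hm : (0 : ℝ) < min (dist a (r t i)) (dist b (r t i)) / 4 := by positivity
        filter_upwards [(tendsto_pi_nhds.1 hlim i) (Metric.ball_mem_nhds _ hm)] with n hn
        have hn' : dist (r (τ n) i) (r t i) < _ := hn
        rw [dist_comm] at hn'
        obtain ⟨s', hs', hz⟩ := hX.line i hi (r t i) (r (τ n) i) 0 χ le_rfl hχ
        refine Sep.of_adm hs' ?_
        rw [hz a (by linarith [min_le_left (dist a (r t i)) (dist b (r t i))]),
          hz b (by linarith [min_le_right (dist a (r t i)) (dist b (r t i))])]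
        exact hne
    obtain ⟨n, hn⟩ := (trivial_map hX hY hF hlim hgood
      (fun i hi => .of_forall (hS i hi)) j hj).exists
    exact hτn n hn
  have := hlc.apply_eq_of_preconnectedSpace 0 1
  have e0 : r 0 = p := funext h0
  have e1 : r 1 = q := funext h1
  simpa only [e0, e1] using this

/-- The image of a ray goes to infinity in the coordinate in which it moves. -/
lemma ray_growth (hX : CutFam X S) (hY : CutFam Y T) (hF : BiLip A F) {p : ∀ i, X i}
    {i j : Fin (N + 1)} (hi : i ∈ S) (hj : IsIdx S T F p i j) {C c : ℝ}
    (hc : 0 < c) {ρ : Fin 3 → ℝ → X i} (hρ : Rays C c (p i) ρ) (k : Fin 3) {t : ℝ} (ht : 0 ≤ t) :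
    c * t ≤ A * dist (F (Function.update p i (ρ k t)) j) (F p j) := by
  classical
  set q := Function.update p i (ρ k t) with hq
  set z : ∀ j, Y j := fun j' => if j' ∈ T then F p j' else F q j' with hz
  have h1 : F.symm z i = p i := by
    have := line_move hY hX hF.symm (p := z) (q := F p) (fun j' hj' => by simp [hz, hj']) hi
    rwa [Equiv.symm_apply_apply] at this
  have h2 : dist (F q) z ≤ dist (F q j) (F p j) := by
    refine (dist_pi_le_iff dist_nonneg).2 fun j' => ?_
    by_cases hT : j' ∈ T
    · by_cases hjj : j' = j
      · subst hjj; simp [hz, hT]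
      · have := ray_const hX hY hF hi hj hc hρ k ht hT hjj
        simp only [hz, hT, if_true, hq, this, dist_self]
        exact dist_nonneg
    · simp [hz, hT]
  have h3 := hF.ge q (F.symm z)
  rw [Equiv.apply_symm_apply] at h3
  have h4 := dist_le_pi_dist q (F.symm z) i
  rw [h1, hq, Function.update_self, hρ.dist k t ht] at h4
  exact h4.trans (h3.trans (mul_le_mul_of_nonneg_left h2 hF.pos.le))

/-- A path avoiding a point stays in one branch. -/
lemma branch_of_path {Z : Type*} [MetricSpace Z] {y : Z} {γ : ℝ → Z}
    (hγ : ContinuousOn γ (Set.Ioi 0)) (hy : ∀ t > 0, γ t ≠ y) {t t' : ℝ} (ht : 0 < t)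
    (ht' : 0 < t') : Branch y 0 (γ t) (γ t') := by
  have hlc : IsLocallyConstant fun u : Set.Ioi (0 : ℝ) => Branch y 0 (γ t) (γ u) := by
    rw [IsLocallyConstant.iff_eventually_eq]
    intro u
    have hc : Continuous fun u : Set.Ioi (0 : ℝ) => γ u := hγ.domRestrict
    have h0 := dist_pos.2 (hy u u.2)
    filter_upwards [(hc.tendsto u) (Metric.ball_mem_nhds _ h0)] with v hv
    have hv' : dist (γ v) (γ u) < dist (γ u) y := hv
    have hb : Branch y 0 (γ v) (γ u) := .of_lt (by linarith [dist_nonneg (x := γ v) (y := y)])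
    exact propext ⟨fun h => h.trans hb, fun h => h.trans hb.symm⟩
  have : PreconnectedSpace (Set.Ioi (0 : ℝ)) := Subtype.preconnectedSpace isPreconnected_Ioi
  have := hlc.apply_eq_of_preconnectedSpace ⟨t, ht⟩ ⟨t', ht'⟩
  simp only at this
  exact this ▸ Branch.refl _ _ _

/-- The images of two rays are in different branches. -/
lemma ray_image (hX : CutFam X S) (hY : CutFam Y T) (hF : BiLip A F) {p : ∀ i, X i}
    {i j : Fin (N + 1)} (hi : i ∈ S) (hj : IsIdx S T F p i j) {C c : ℝ}
    (hc : 0 < c) {ρ : Fin 3 → ℝ → X i} (hρ : Rays C c (p i) ρ) {k k' : Fin 3} (hk : k' ≠ k)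
    {t t' : ℝ} (ht : 0 < t) (ht' : 0 < t') :
    ¬ Branch (F p j) 0 (F (Function.update p i (ρ k t)) j)
      (F (Function.update p i (ρ k' t')) j) := by
  intro hb
  have hpath : ∀ k, ∀ u > 0, ∀ v > 0, Branch (F p j) 0 (F (Function.update p i (ρ k u)) j)
      (F (Function.update p i (ρ k v)) j) := by
    intro k u hu v hv
    refine branch_of_path (γ := fun u => F (Function.update p i (ρ k u)) j) ?_ ?_ hu hv
    · have h1 : ContinuousOn (fun u => ρ k u) (Set.Ioi 0) := by
        refine continuousOn_iff_continuous_domRestrict.2 ?_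
        refine continuous_iff_continuousAt.2 fun u => ?_
        refine tendsto_iff_dist_tendsto_zero.2 ?_
        have h2 : Tendsto (fun v : Set.Ioi (0 : ℝ) => C * |(v : ℝ) - u|) (𝓝 u) (𝓝 0) := by
          have : Continuous fun v : Set.Ioi (0 : ℝ) => C * |(v : ℝ) - u| := by fun_prop
          simpa using this.tendsto u
        exact squeeze_zero (fun _ => dist_nonneg)
          (fun v => hρ.lip k _ (le_of_lt v.2) _ (le_of_lt u.2)) h2
      have h2 : Continuous fun x : X i => F (Function.update p i x) j :=
        (continuous_apply j).comp (hF.continuous.comp (continuous_const.update i continuous_id))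
      exact h2.comp_continuousOn h1
    · intro t ht he
      have := ray_growth hX hY hF hi hj hc hρ k ht.le
      rw [he, dist_self, mul_zero] at this
      have := mul_pos hc ht
      linarith
  have hl := ray_leg_zero hX hi hc hρ
  obtain ⟨n, hn⟩ := (Leg.map_pair hX hY hF (hl k) (hl k') (.of_forall fun n => by
      simpa using hρ.not_branch (by positivity) (by positivity) hk) (hj _ (hl k))
      (hj _ (hl k'))).2.exists
  exact hn (((hpath k _ (by positivity) t ht).trans hb).trans (hpath k' _ ht' _ (by positivity)))

/-- A bounded perturbation of three diverging rays has the same origin. -/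
lemma origin_eq {Z : Type*} [MetricSpace Z] {y y' : Z} {a a' : Fin 3 → Z} {D : ℝ}
    (h : ∀ k k', k' ≠ k → ¬ Branch y 0 (a k) (a k'))
    (h' : ∀ k k', k' ≠ k → ¬ Branch y' 0 (a' k) (a' k'))
    (hD : ∀ k, dist (a k) (a' k) ≤ D) (hfar : ∀ k, D < dist (a k) y') : y = y' := by
  by_contra hne
  have h0 : 0 < dist y y' := dist_pos.2 hne
  have key : ∀ k, ¬ Branch y 0 (a k) y' → Branch y' 0 (a' k) y := by
    intro k hk
    have h1 := dist_of_not_branch hk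
    rw [dist_comm y' y] at h1
    have h2 : Branch y' 0 (a k) y := .of_lt (by linarith)
    have h3 : Branch y' 0 (a k) (a' k) :=
      .of_lt (by linarith [hD k, hfar k, dist_nonneg (x := a' k) (y := y')])
    exact h3.symm.trans h2
  obtain ⟨k, k', hk, h1, h2⟩ : ∃ k k', k' ≠ k ∧ ¬ Branch y 0 (a k) y' ∧ ¬ Branch y 0 (a k') y' := by
    by_cases h0 : Branch y 0 (a 0) y'
    · exact ⟨1, 2, by decide, fun h1 => h 0 1 (by decide) (h0.trans h1.symm),
        fun h1 => h 0 2 (by decide) (h0.trans h1.symm)⟩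
    · by_cases h1 : Branch y 0 (a 1) y'
      · exact ⟨0, 2, by decide, h0, fun h2 => h 1 2 (by decide) (h1.trans h2.symm)⟩
      · exact ⟨0, 1, by decide, h0, h1⟩
  exact h' k k' hk ((key k h1).trans (key k' h2).symm)

/-- The image in the coordinate `j` depends only on the coordinate `i`. -/
lemma idx_coord (hX : CutFam X S) (hY : CutFam Y T) (hF : BiLip A F) {p p' : ∀ i, X i}
    {i j j' : Fin (N + 1)} (hi : i ∈ S) (hp : p i = p' i) (hj : IsIdx S T F p i j)
    (hj' : IsIdx S T F p' i j') : j = j' ∧ F p j = F p' j := by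
  obtain ⟨C, c, ρ, hC, hc, hρ⟩ := (hX.tri i hi).rays (p i)
  have hρ' := hρ
  rw [hp] at hρ'
  have hd : ∀ k t, ∀ j : Fin (N + 1), dist (F (Function.update p i (ρ k t)) j)
      (F (Function.update p' i (ρ k t)) j) ≤ A * dist p p' := by
    intro k t j
    refine (dist_le_pi_dist _ _ j).trans ((hF.le _ _).trans
      (mul_le_mul_of_nonneg_left ?_ hF.pos.le))
    refine (dist_pi_le_iff dist_nonneg).2 fun i' => ?_
    by_cases hii : i' = i
    · subst hii; simp
    · simpa [hii] using dist_le_pi_dist p p' i'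
  have hA := hF.pos
  have hjT : j ∈ T := (hj _ (ray_leg_zero hX hi hc hρ 0)).mem
  have hjj : j = j' := by
    by_contra hne
    set t : ℝ := A * (A * dist p p' + dist (F p' j) (F p j) + 1) / c with ht
    have ht0 : 0 ≤ t := by positivity
    have h1 := ray_growth hX hY hF hi hj hc hρ 0 ht0
    have h2 := hd 0 t j
    rw [ray_const hX hY hF hi hj' hc hρ' 0 ht0 hjT hne] at h2
    have h3 := dist_triangle (F (Function.update p i (ρ 0 t)) j) (F p' j) (F p j)
    have h4 : c * t = A * (A * dist p p' + dist (F p' j) (F p j) + 1) := by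
      rw [ht]; field_simp
    rw [h4] at h1
    have h5 := le_of_mul_le_mul_left h1 hA
    linarith
  subst hjj
  refine ⟨rfl, ?_⟩
  set t : ℝ := A * (A * dist p p' + dist (F p' j) (F p j) + 1) / c with ht
  have ht0 : 0 < t := by positivity
  refine origin_eq (a := fun k => F (Function.update p i (ρ k t)) j)
    (a' := fun k => F (Function.update p' i (ρ k t)) j) (D := A * dist p p')
    (fun k k' hk => ray_image hX hY hF hi hj hc hρ hk ht0 ht0)
    (fun k k' hk => ray_image hX hY hF hi hj' hc hρ' hk ht0 ht0)
    (fun k => hd k t j) fun k => ?_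
  have h1 := ray_growth hX hY hF hi hj hc hρ k ht0.le
  have h3 := dist_triangle (F (Function.update p i (ρ k t)) j) (F p' j) (F p j)
  have h4 : c * t = A * (A * dist p p' + dist (F p' j) (F p j) + 1) := by
    rw [ht]; field_simp
  rw [h4] at h1
  have h5 := le_of_mul_le_mul_left h1 hA
  show _ < dist (F (Function.update p i (ρ k t)) j) (F p' j)
  linarith

lemma exists_idx_map (hX : CutFam X S) (hY : CutFam Y T) (hF : BiLip A F) (p : ∀ i, X i) :
    ∃ f : S → T, Function.Injective f ∧ ∀ i : S, IsIdx S T F p i (f i) := by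
  choose J hJT hJ using fun i : S => exists_idx hX hY hF p i.2
  refine ⟨fun i => ⟨J i, hJT i⟩, fun i i' h => ?_, hJ⟩
  by_contra hne
  exact IsIdx.ne hX hY hF i.2 i'.2 (fun h => hne (Subtype.ext h)) (hJ i) (hJ i')
    (congrArg Subtype.val h)

/-- A bilipschitz bijection of products splits on the tripod factors. -/
theorem splits (hX : CutFam X S) (hY : CutFam Y T) (hF : BiLip A F) (p₀ : ∀ i, X i) :
    ∃ σ : S ≃ T, ∀ i : S, ∀ p p' : ∀ i, X i, p i = p' i → F p (σ i) = F p' (σ i) := by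
  classical
  choose f hinj hidx using exists_idx_map hX hY hF
  have hbij : ∀ p, Function.Bijective (f p) := by
    intro p
    obtain ⟨g, hg, -⟩ := exists_idx_map hY hX hF.symm (F p)
    refine (Fintype.bijective_iff_injective_and_card _).2 ⟨hinj p, le_antisymm ?_ ?_⟩
    · exact Fintype.card_le_of_injective _ (hinj p)
    · exact Fintype.card_le_of_injective _ hg
  have hagree : ∀ p q : ∀ i, X i, ∀ i : S, p i = q i → f p i = f q i := fun p q i h =>
    Subtype.ext (idx_coord hX hY hF i.2 h (hidx p i) (hidx q i)).1
  have hconst : ∀ p q, f p = f q := by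
    intro p q
    funext i
    set r : ∀ i, X i := Function.update p (i : Fin (N + 1)) (q i) with hr
    have h1 : f r i = f q i := hagree r q i (by simp [hr])
    have h2 : ∀ i' : S, i' ≠ i → f r i' = f p i' := fun i' hi' => hagree r p i' (by
      simp [hr, Subtype.coe_ne_coe.2 hi'])
    rw [← h1]
    obtain ⟨i', hi'⟩ := (hbij r).2 (f p i)
    by_cases h : i' = i
    · rw [← hi', h]
    · exact absurd ((hbij p).1 ((h2 i' h).symm.trans hi')) h
  refine ⟨Equiv.ofBijective _ (hbij p₀), fun i p p' h => ?_⟩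
  have h1 := (idx_coord hX hY hF i.2 h (hidx p i) (hidx p' i)).2
  rwa [hconst p p₀] at h1

end DeRahmSplit

namespace DeRahmSplit

open Filter Topology

section

variable {N : ℕ} {X Y : Fin (N + 1) → Type*} [∀ i, MetricSpace (X i)] [∀ i, MetricSpace (Y i)]
  {S T : Set (Fin (N + 1))} {A A' : ℝ} {F F' : (∀ i, X i) ≃ (∀ i, Y i)}

lemma isIdx_of_splits (hX : CutFam X S) (hY : CutFam Y T) (hF : BiLip A F) (σ : S ≃ T)
    (hσ : ∀ i : S, ∀ p p' : ∀ i, X i, p i = p' i → F p (σ i) = F p' (σ i)) (p : ∀ i, X i) (i : S) :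
    IsIdx S T F p i (σ i) := by
  obtain ⟨j, hj, h⟩ := exists_idx hX hY hF p i.2
  obtain ⟨C, c, ρ, hC, hc, hρ⟩ := (hX.tri i i.2).rays (p i)
  obtain ⟨i', hi'⟩ := σ.surjective ⟨j, hj⟩
  by_cases hii : i' = i
  · rw [← hii, hi', hii]; exact h
  · have h1 := ray_growth hX hY hF i.2 h hc hρ 0 zero_le_one
    have h2 := hσ i' (Function.update p i (ρ 0 1)) p (by
      simp [Subtype.coe_ne_coe.2 hii])
    rw [hi'] at h2
    simp only at h2
    rw [h2, dist_self] at h1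
    linarith

lemma split_eq_of_dist_le (hX : CutFam X S) (hY : CutFam Y T) (hF : BiLip A F) (hF' : BiLip A' F')
    (σ : S ≃ T) (hσ : ∀ i : S, ∀ p p' : ∀ i, X i, p i = p' i → F p (σ i) = F p' (σ i))
    (hσ' : ∀ i : S, ∀ p p' : ∀ i, X i, p i = p' i → F' p (σ i) = F' p' (σ i)) (p : ∀ i, X i)
    (i : S) {D : ℝ} (hD : ∀ x, dist (F (Function.update p i x) (σ i))
      (F' (Function.update p i x) (σ i)) ≤ D) : F p (σ i) = F' p (σ i) := by
  have hj := isIdx_of_splits hX hY hF σ hσ p i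
  have hj' := isIdx_of_splits hX hY hF' σ hσ' p i
  obtain ⟨C, c, ρ, hC, hc, hρ⟩ := (hX.tri i i.2).rays (p i)
  have hA := hF.pos
  have hD0 : 0 ≤ D := dist_nonneg.trans (hD (p i))
  set j := σ i
  set t : ℝ := A * (D + dist (F' p j) (F p j) + 1) / c with ht
  have ht0 : 0 < t := by positivity
  refine origin_eq (a := fun k => F (Function.update p i (ρ k t)) j)
    (a' := fun k => F' (Function.update p i (ρ k t)) j) (D := D)
    (fun k k' hk => ray_image hX hY hF i.2 hj hc hρ hk ht0 ht0)
    (fun k k' hk => ray_image hX hY hF' i.2 hj' hc hρ hk ht0 ht0)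
    (fun k => hD _) fun k => ?_
  have h1 := ray_growth hX hY hF i.2 hj hc hρ k ht0.le
  have h3 := dist_triangle (F (Function.update p i (ρ k t)) j) (F' p j) (F p j)
  have h4 : c * t = A * (D + dist (F' p j) (F p j) + 1) := by
    rw [ht]; field_simp
  rw [h4] at h1
  have h5 := le_of_mul_le_mul_left h1 hA
  show _ < dist (F (Function.update p i (ρ k t)) j) (F' p j)
  linarith

end

variable {N M : ℕ} {X : Fin N → Type*} {Y : Fin M → Type*} [∀ i, MetricSpace (X i)]
  [∀ i, MetricSpace (Y i)] {S : Set (Fin N)} {T : Set (Fin M)} {A A' : ℝ}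
  {F F' : (∀ i, X i) ≃ (∀ i, Y i)}

/-- Bilipschitz products of spaces with cut points have the same number of factors, and the
tripod factors match. -/
theorem cone_splits (hX : CutFam X S) (hY : CutFam Y T) (hF : BiLip A F) (p₀ : ∀ i, X i) :
    N = M ∧ ∃ σ : S ≃ T, ∀ i : S, ∀ p p' : ∀ i, X i, p i = p' i → F p (σ i) = F p' (σ i) := by
  have h : N = M := le_antisymm (dim_le hY.cut hX.cut hF.symm (F p₀)) (dim_le hX.cut hY.cut hF p₀)
  refine ⟨h, ?_⟩
  subst h
  obtain _ | N := N
  · exact ⟨⟨fun i => i.1.elim0, fun i => i.1.elim0, fun i => i.1.elim0, fun i => i.1.elim0⟩,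
      fun i => i.1.elim0⟩
  · exact splits hX hY hF p₀

theorem cone_split_eq (hX : CutFam X S) (hY : CutFam Y T) (hF : BiLip A F) (hF' : BiLip A' F')
    (σ : S ≃ T) (hσ : ∀ i : S, ∀ p p' : ∀ i, X i, p i = p' i → F p (σ i) = F p' (σ i))
    (hσ' : ∀ i : S, ∀ p p' : ∀ i, X i, p i = p' i → F' p (σ i) = F' p' (σ i)) (p : ∀ i, X i)
    (i : S) {D : ℝ} (hD : ∀ x, dist (F (Function.update p i x) (σ i))
      (F' (Function.update p i x) (σ i)) ≤ D) : F p (σ i) = F' p (σ i) := by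
  have h : N = M := (cone_splits hX hY hF p).1
  subst h
  obtain _ | N := N
  · exact i.1.elim0
  · exact split_eq_of_dist_le hX hY hF hF' σ hσ hσ' p i hD

end DeRahmSplit

namespace DeRahmSplit

open Filter Topology

/-- A sequence of scales going to infinity. -/
structure Scale where
  val : ℕ → ℝ
  pos : ∀ n, 0 < val n
  lim : Tendsto val atTop atTop

variable (G : Type*) [Group G] [PseudoMetricSpace G] (R : Scale)

/-- Sequences growing at most linearly in the scale. -/
def AsymSeq : Type _ := {x : ℕ → G // ∃ B, ∀ n, dist (x n) 1 ≤ B * R.val n}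

variable {G R}

lemma AsymSeq.exists_tendsto (x y : AsymSeq G R) :
    ∃ c, Tendsto (fun n => dist (x.1 n) (y.1 n) / R.val n) uf (𝓝 c) := by
  obtain ⟨B, hB⟩ := x.2
  obtain ⟨B', hB'⟩ := y.2
  have h : ∀ n, dist (x.1 n) (y.1 n) / R.val n ∈ Set.Icc 0 (B + B') := by
    intro n
    refine ⟨div_nonneg dist_nonneg (R.pos n).le, (div_le_iff₀ (R.pos n)).2 ?_⟩
    linarith [dist_triangle_right (x.1 n) (y.1 n) 1, hB n, hB' n]
  obtain ⟨c, -, hc⟩ := (isCompact_Icc (a := (0 : ℝ)) (b := B + B')).ultrafilter_le_nhds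
    ((hyperfilter ℕ).map fun n => dist (x.1 n) (y.1 n) / R.val n)
    (le_principal_iff.2 (Filter.mem_map.2 (univ_mem' h)))
  exact ⟨c, hc⟩

instance : PseudoMetricSpace (AsymSeq G R) where
  dist x y := (AsymSeq.exists_tendsto x y).choose
  dist_self x := by
    refine tendsto_nhds_unique (AsymSeq.exists_tendsto x x).choose_spec ?_
    simp
  dist_comm x y := by
    refine tendsto_nhds_unique (AsymSeq.exists_tendsto x y).choose_spec ?_
    simpa only [dist_comm] using (AsymSeq.exists_tendsto y x).choose_spec
  dist_triangle x y z := by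
    refine le_of_tendsto_of_tendsto' (AsymSeq.exists_tendsto x z).choose_spec
      ((AsymSeq.exists_tendsto x y).choose_spec.add (AsymSeq.exists_tendsto y z).choose_spec)
      fun n => ?_
    rw [← add_div]
    exact div_le_div_of_nonneg_right (dist_triangle _ _ _) (R.pos n).le

lemma AsymSeq.tendsto (x y : AsymSeq G R) :
    Tendsto (fun n => dist (x.1 n) (y.1 n) / R.val n) uf (𝓝 (dist x y)) :=
  (AsymSeq.exists_tendsto x y).choose_spec

variable (G R) in
/-- The asymptotic cone of a group, based at the identity. -/
def Cone : Type _ := SeparationQuotient (AsymSeq G R)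

instance : MetricSpace (Cone G R) := inferInstanceAs (MetricSpace (SeparationQuotient _))

namespace Cone

/-- The point of the cone given by a sequence. -/
def mk (x : AsymSeq G R) : Cone G R := SeparationQuotient.mk x

/-- A sequence representing a point of the cone. -/
def rep (p : Cone G R) : AsymSeq G R := (SeparationQuotient.surjective_mk p).choose

@[simp] lemma mk_rep (p : Cone G R) : mk p.rep = p := (SeparationQuotient.surjective_mk p).choose_spec

lemma dist_mk (x y : AsymSeq G R) : dist (mk x) (mk y) = dist x y := SeparationQuotient.dist_mk x y

lemma tendsto (x y : AsymSeq G R) :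
    Tendsto (fun n => dist (x.1 n) (y.1 n) / R.val n) uf (𝓝 (dist (mk x) (mk y))) := by
  rw [dist_mk]; exact AsymSeq.tendsto x y

lemma tendsto_rep (p q : Cone G R) :
    Tendsto (fun n => dist (p.rep.1 n) (q.rep.1 n) / R.val n) uf (𝓝 (dist p q)) := by
  simpa using tendsto p.rep q.rep

end Cone

lemma uf_le : uf ≤ (atTop : Filter ℕ) := by
  rw [← Nat.cofinite_eq_atTop]; exact hyperfilter_le_cofinite

lemma Scale.uf_lim (R : Scale) : Tendsto R.val uf atTop := R.lim.mono_left uf_le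

lemma Scale.const_div (R : Scale) (A : ℝ) : Tendsto (fun n => A / R.val n) uf (𝓝 0) :=
  R.uf_lim.const_div_atTop A

namespace Cone

lemma dist_le {x y : AsymSeq G R} {c A : ℝ}
    (h : ∀ᶠ n in uf, dist (x.1 n) (y.1 n) ≤ c * R.val n + A) : dist (mk x) (mk y) ≤ c := by
  have h1 : Tendsto (fun n => c + A / R.val n) uf (𝓝 c) := by
    simpa using (R.const_div A).const_add c
  refine le_of_tendsto_of_tendsto (tendsto x y) h1 (h.mono fun n hn => ?_)
  rw [div_le_iff₀ (R.pos n), add_mul, div_mul_cancel₀ _ (R.pos n).ne']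
  exact hn

lemma le_dist {x y : AsymSeq G R} {c A : ℝ}
    (h : ∀ᶠ n in uf, c * R.val n - A ≤ dist (x.1 n) (y.1 n)) : c ≤ dist (mk x) (mk y) := by
  have h1 : Tendsto (fun n => c - A / R.val n) uf (𝓝 c) := by
    simpa using (R.const_div A).const_sub c
  refine le_of_tendsto_of_tendsto h1 (tendsto x y) (h.mono fun n hn => ?_)
  rw [le_div_iff₀ (R.pos n), sub_mul, div_mul_cancel₀ _ (R.pos n).ne']
  exact hn

end Cone

end DeRahmSplit

namespace DeRahmSplit

open Filter Topology

/-- A line is a cut space. -/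
structure IsLine (Y : Type*) [MetricSpace Y] (ψ : Y → ℝ) : Prop where
  dist : ∀ x y, dist x y = |ψ x - ψ y|
  surj : Function.Surjective ψ

lemma IsLine.geod {Y : Type*} [MetricSpace Y] {ψ : Y → ℝ} (h : IsLine Y ψ) : Geod Y := by
  intro x y
  choose inv hinv using h.surj
  have hinj : ∀ a b, ψ a = ψ b → a = b := fun a b hab => dist_eq_zero.1 (by rw [h.dist, hab]; simp)
  rcases le_total (ψ x) (ψ y) with hxy | hxy
  · refine ⟨fun t => inv (ψ x + t), hinj _ _ (by simp [hinv]), hinj _ _ ?_, fun s _ t _ => ?_⟩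
    · rw [hinv, h.dist, abs_of_nonpos (by linarith)]; ring
    · rw [h.dist, hinv, hinv, add_sub_add_left_eq_sub]
  · refine ⟨fun t => inv (ψ x - t), hinj _ _ (by simp [hinv]), hinj _ _ ?_, fun s _ t _ => ?_⟩
    · rw [hinv, h.dist, abs_of_nonneg (by linarith)]; ring
    · rw [h.dist, hinv, hinv, sub_sub_sub_cancel_left, abs_sub_comm]

/-- Moving towards zero by a given amount. -/
def shrink (c u : ℝ) : ℝ := u - max (-c) (min u c)

lemma shrink_lip {c u v : ℝ} (hc : 0 ≤ c) : |shrink c u - shrink c v| ≤ |u - v| := by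
  unfold shrink
  rcases le_total u v with h | h <;> rcases max_cases (-c) (min u c) with h1 | h1 <;>
    rcases max_cases (-c) (min v c) with h2 | h2 <;> rcases min_cases u c with h3 | h3 <;>
    rcases min_cases v c with h4 | h4 <;> rw [abs_le] <;>
    (first | rw [abs_of_nonneg (sub_nonneg.2 h)] | rw [abs_of_nonpos (sub_nonpos.2 h)]) <;>
    constructor <;> linarith

lemma shrink_step {c c' u : ℝ} (hc : 0 ≤ c) (hcc : c ≤ c') :
    |shrink c u - shrink c' u| ≤ c' - c := by
  unfold shrink
  rw [abs_le]
  rcases max_cases (-c) (min u c) with h1 | h1 <;>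
    rcases max_cases (-c') (min u c') with h2 | h2 <;> rcases min_cases u c with h3 | h3 <;>
    rcases min_cases u c' with h4 | h4 <;> constructor <;> linarith

lemma shrink_eq_zero {c u : ℝ} (h : |u| ≤ c) : shrink c u = 0 := by
  rw [abs_le] at h
  rw [shrink, min_eq_left h.2, max_eq_right h.1, sub_self]

lemma IsLine.contr {Y : Type*} [MetricSpace Y] {ψ : Y → ℝ} (h : IsLine Y ψ) : Contr Y := by
  choose inv hinv using h.surj
  have hinj : ∀ a b, ψ a = ψ b → a = b := fun a b hab => dist_eq_zero.1 (by rw [h.dist, hab]; simp)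
  refine ⟨1, le_rfl, fun e ε hε F hF => ?_⟩
  obtain ⟨B, hB⟩ := (hF.image fun x => |ψ x - ψ e|).bddAbove
  obtain ⟨m, hm⟩ := exists_nat_gt (B / ε)
  rw [div_lt_iff₀ hε] at hm
  refine ⟨fun k x => inv (ψ e + shrink (k * ε) (ψ x - ψ e)), m, fun x => hinj _ _ ?_,
    fun k => hinj _ _ ?_, fun k x y => ?_, fun k x => ?_, fun k hk x hx => hinj _ _ ?_⟩
  · rw [hinv]; simp [shrink]
  · rw [hinv, sub_self, shrink_eq_zero (by rw [abs_zero]; positivity), add_zero]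
  · rw [h.dist, hinv, hinv, h.dist, add_sub_add_left_eq_sub, one_mul]
    refine (shrink_lip (by positivity)).trans_eq ?_
    congr 1; ring
  · rw [h.dist, hinv, hinv, add_sub_add_left_eq_sub]
    refine (shrink_step (by positivity) ?_).trans_eq ?_
    · push_cast; nlinarith
    · push_cast; ring
  · rw [hinv, shrink_eq_zero, add_zero]
    refine (hB ⟨x, hx, rfl⟩).trans (hm.le.trans ?_)
    have : (m : ℝ) ≤ k := by exact_mod_cast hk
    nlinarith

lemma IsLine.far {Y : Type*} [MetricSpace Y] {ψ : Y → ℝ} (h : IsLine Y ψ) : Far Y := by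
  intro q δ
  obtain ⟨x, hx⟩ := h.surj (ψ q + δ)
  exact ⟨x, by rw [h.dist, hx, add_sub_cancel_left]; exact le_abs_self _⟩

open Classical in
lemma IsLine.adm {Y : Type*} [MetricSpace Y] {ψ : Y → ℝ} (h : IsLine Y ψ) (y : Y) (a b : F2) :
    Adm 0 y fun z => if ψ y < ψ z then a else b := by
  intro z z' hz
  simp only [h.dist]
  by_cases h1 : ψ y < ψ z <;> by_cases h2 : ψ y < ψ z' <;> simp only [h1, h2, if_true, if_false] at hz
  · exact absurd rfl hz
  · push Not at h2
    rw [abs_of_nonneg (by linarith), abs_of_nonpos (by linarith), abs_of_nonneg (by linarith)]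
    linarith
  · push Not at h1
    rw [abs_of_nonpos (by linarith), abs_of_nonneg (by linarith), abs_of_nonpos (by linarith)]
    linarith
  · exact absurd rfl hz

lemma IsLine.cutSpace {Y : Type*} [MetricSpace Y] {ψ : Y → ℝ} (h : IsLine Y ψ) : CutSpace Y := by
  classical
  refine ⟨h.geod, h.contr, h.far, fun p => ?_⟩
  obtain ⟨a, ha⟩ := h.surj (ψ p + 1)
  obtain ⟨b, hb⟩ := h.surj (ψ p - 1)
  refine ⟨a, b, ?_, ?_, _, h.adm p 1 0, ?_⟩
  · rintro rfl; linarith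
  · rintro rfl; linarith
  · simp [ha, hb]

lemma IsLine.rprop {Y : Type*} [MetricSpace Y] {ψ : Y → ℝ} (h : IsLine Y ψ) : Rprop Y := by
  classical
  intro y y' δ s hδ hs
  obtain ⟨a, ha⟩ := h.surj (ψ y + δ + 1)
  obtain ⟨b, hb⟩ := h.surj (ψ y - δ - 1)
  refine ⟨_, h.adm y' (s a) (s b), fun z hz => ?_⟩
  rw [h.dist, h.dist] at hz
  have h0 := abs_nonneg (ψ y - ψ y')
  have h1 := neg_abs_le (ψ y - ψ y')
  have h2 := le_abs_self (ψ y - ψ y')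
  rcases le_total (ψ y) (ψ z) with hyz | hyz
  · rw [abs_of_nonneg (sub_nonneg.2 hyz)] at hz
    rw [if_pos (by linarith)]
    by_contra hne
    have := hs _ _ hne
    rw [h.dist, h.dist, h.dist, ha, abs_of_nonneg (by linarith), abs_of_nonneg (by linarith)] at this
    rcases abs_cases (ψ y + δ + 1 - ψ z) with h3 | h3 <;> linarith
  · rw [abs_of_nonpos (sub_nonpos.2 hyz)] at hz
    rw [if_neg (by linarith)]
    by_contra hne
    have := hs _ _ hne
    rw [h.dist, h.dist, h.dist, hb, abs_of_nonpos (by linarith), abs_of_nonpos (by linarith)] at this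
    rcases abs_cases (ψ y - δ - 1 - ψ z) with h3 | h3 <;> linarith

variable (G : Type*) [Group G] [PseudoMetricSpace G]

/-- An infinite cyclic group with its usual metric. -/
def DLine : Prop := ∃ φ : G → ℤ, (∀ x y, φ (x * y) = φ x + φ y) ∧ Function.Surjective φ ∧
  ∀ x y, dist x y = |(φ x : ℝ) - φ y|

/-- Points are joined to the identity by discrete geodesics. -/
def DGeod : Prop := ∀ x : G, ∃ (q : ℕ → G) (d : ℕ), q 0 = 1 ∧ q d = x ∧ dist x 1 = d ∧
  ∀ a b : ℕ, dist (q a) (q b) ≤ |(a : ℝ) - b|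

/-- The group retracts to the identity by short steps, with uniform Lipschitz constants. -/
def DContr : Prop := ∃ (C : ℝ) (P : G → G), 1 ≤ C ∧ P 1 = 1 ∧
  (∀ k x y, dist (P^[k] x) (P^[k] y) ≤ C * dist x y) ∧ (∀ x, dist (P x) x ≤ C) ∧
  ∀ x (k : ℕ), dist x 1 ≤ k → P^[k] x = 1

/-- Three periodic rays with disjoint shadows, separated by the identity. -/
def DTrip : Prop := ∃ (L : ℕ) (C : ℝ) (w : Fin 3 → G) (D : Fin 3 → ℕ → Set G), 0 < L ∧
  (∀ (k) (m : ℕ), dist (w k ^ m) 1 = L * m) ∧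
  (∀ k m, ∀ x ∈ D k (m + 1), ∀ y ∉ D k m, dist x 1 + dist y 1 ≤ dist x y + C * (m + 1)) ∧
  (∀ (k) (m m' : ℕ), m ≤ m' → w k ^ m' ∈ D k m) ∧
  ∀ k k', k' ≠ k → ∀ i j : ℕ, (w k ^ j)⁻¹ * w k' ^ i ∉ D k 1

variable {G}

lemma DLine.isLine (h : DLine G) (R : Scale) : ∃ ψ, IsLine (Cone G R) ψ := by
  obtain ⟨φ, hφ, hsurj, hd⟩ := h
  have hφ1 : φ 1 = 0 := by simpa using hφ 1 1
  have hlim : ∀ x : AsymSeq G R, ∃ c, Tendsto (fun n => (φ (x.1 n) : ℝ) / R.val n) uf (𝓝 c) := by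
    intro x
    obtain ⟨B, hB⟩ := x.2
    have h : ∀ n, (φ (x.1 n) : ℝ) / R.val n ∈ Set.Icc (-B) B := by
      intro n
      have := hB n
      rw [hd, hφ1, Int.cast_zero, sub_zero, abs_le] at this
      have hR := R.pos n
      exact ⟨by rw [le_div_iff₀ hR]; linarith, by rw [div_le_iff₀ hR]; linarith⟩
    obtain ⟨c, -, hc⟩ := (isCompact_Icc (a := -B) (b := B)).ultrafilter_le_nhds
      ((hyperfilter ℕ).map fun n => (φ (x.1 n) : ℝ) / R.val n)
      (le_principal_iff.2 (Filter.mem_map.2 (univ_mem' h)))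
    exact ⟨c, hc⟩
  choose lim hlim using hlim
  have hdist : ∀ x y : AsymSeq G R, dist (Cone.mk x) (Cone.mk y) = |lim x - lim y| := by
    intro x y
    refine tendsto_nhds_unique (Cone.tendsto x y) (((hlim x).sub (hlim y)).abs.congr fun n => ?_)
    rw [← sub_div, abs_div, abs_of_pos (R.pos n), hd]
  refine ⟨fun p => lim p.rep, fun p q => ?_, fun t => ?_⟩
  · rw [← hdist, Cone.mk_rep, Cone.mk_rep]
  · choose inv hinv using hsurj
    have hb : ∀ n, |((⌊t * R.val n⌋ : ℤ) : ℝ) - t * R.val n| ≤ 1 := fun n => by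
      rw [abs_le]; constructor <;> linarith [Int.floor_le (t * R.val n),
        Int.lt_floor_add_one (t * R.val n)]
    obtain ⟨B, hB⟩ := (R.lim.eventually_ge_atTop 1).exists_forall_of_atTop
    obtain ⟨c, hc⟩ : ∃ c, ∀ n, 1 ≤ c * R.val n := by
      refine ⟨1 + ∑ n ∈ Finset.range B, (R.val n)⁻¹, fun n => ?_⟩
      have hs : 0 ≤ ∑ n ∈ Finset.range B, (R.val n)⁻¹ :=
        Finset.sum_nonneg fun n _ => (inv_pos.2 (R.pos n)).le
      rcases le_or_gt B n with h | h
      · nlinarith [hB n h]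
      · have := Finset.single_le_sum (f := fun n => (R.val n)⁻¹)
          (fun n _ => (inv_pos.2 (R.pos n)).le) (Finset.mem_range.2 h)
        have h1 : (R.val n)⁻¹ * R.val n = 1 := inv_mul_cancel₀ (R.pos n).ne'
        nlinarith [R.pos n, mul_le_mul_of_nonneg_right this (R.pos n).le]
    let x : AsymSeq G R := ⟨fun n => inv ⌊t * R.val n⌋, |t| + c, fun n => by
      rw [hd, hφ1, hinv, Int.cast_zero, sub_zero]
      have h1 := abs_sub_abs_le_abs_sub ((⌊t * R.val n⌋ : ℤ) : ℝ) (t * R.val n)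
      rw [abs_mul, abs_of_pos (R.pos n)] at h1
      linarith [hb n, hc n]⟩
    have hx : lim x = t := by
      refine tendsto_nhds_unique (hlim x) ?_
      rw [tendsto_iff_dist_tendsto_zero]
      refine squeeze_zero (fun _ => dist_nonneg) (fun n => ?_) (R.const_div 1)
      rw [Real.dist_eq]
      have : (φ (x.1 n) : ℝ) / R.val n - t = (((⌊t * R.val n⌋ : ℤ) : ℝ) - t * R.val n) / R.val n := by
        rw [sub_div, mul_div_cancel_right₀ _ (R.pos n).ne']
        simp only [x, hinv]
      rw [this, abs_div, abs_of_pos (R.pos n)]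
      exact div_le_div_of_nonneg_right (hb n) (R.pos n).le
    refine ⟨Cone.mk x, ?_⟩
    have h0 : |lim (Cone.mk x).rep - lim x| = 0 := by
      rw [← hdist, Cone.mk_rep, dist_self]
    show lim (Cone.mk x).rep = t
    rw [← hx]
    exact sub_eq_zero.1 (abs_eq_zero.1 h0)

end DeRahmSplit

namespace DeRahmSplit

open Filter Topology

variable {G : Type*} [Group G] [PseudoMetricSpace G] [IsIsometricSMul G G] {R : Scale}

lemma dist_inv_mul_one (x y : G) : dist (x⁻¹ * y) 1 = dist y x := by
  rw [← dist_mul_left x, mul_inv_cancel_left, mul_one]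

lemma DGeod.cone (h : DGeod G) : Geod (Cone G R) := by
  intro x y
  choose q d h0 hd hx hq using h
  set g : ℕ → G := fun n => (x.rep.1 n)⁻¹ * y.rep.1 n with hg
  set τ : ℝ → ℕ → ℕ := fun t n => min ⌊t * R.val n⌋₊ (d (g n)) with hτ
  have hdn : ∀ n, (d (g n) : ℝ) = dist (x.rep.1 n) (y.rep.1 n) := fun n => by
    rw [← hx, hg]; simp only; rw [dist_inv_mul_one, dist_comm]
  have hqd : ∀ n a, dist (q (g n) a) 1 ≤ a := fun n a => by
    have := hq (g n) a 0
    rwa [h0, Nat.cast_zero, sub_zero, Nat.abs_cast] at this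
  let s : ℝ → AsymSeq G R := fun t => ⟨fun n => x.rep.1 n * q (g n) (τ t n), by
    obtain ⟨B, hB⟩ := x.rep.2
    obtain ⟨B', hB'⟩ := y.rep.2
    refine ⟨B + B' + B, fun n => ?_⟩
    have h1 : dist (x.rep.1 n * q (g n) (τ t n)) (x.rep.1 n) ≤ dist (x.rep.1 n) (y.rep.1 n) := by
      conv_lhs => rw [← mul_one (x.rep.1 n), mul_assoc, dist_mul_left, one_mul]
      refine (hqd _ _).trans ?_
      rw [← hdn]
      exact_mod_cast min_le_right _ _
    linarith [dist_triangle (x.rep.1 n * q (g n) (τ t n)) (x.rep.1 n) 1, hB n, hB' n,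
      dist_triangle_right (x.rep.1 n) (y.rep.1 n) 1]⟩
  refine ⟨fun t => Cone.mk (s t), ?_, ?_, ?_⟩
  · conv_rhs => rw [← Cone.mk_rep x]
    refine congrArg Cone.mk (Subtype.ext (funext fun n => ?_))
    simp [s, hτ, h0]
  · conv_rhs => rw [← Cone.mk_rep y]
    refine dist_le_zero.1 (le_of_forall_pos_le_add fun ε hε => ?_)
    rw [zero_add]
    have hlim := Cone.tendsto_rep x y
    refine Cone.dist_le (A := 1) ((hlim.eventually_le_const (u := dist x y + ε)
      (by linarith)).mono fun n hn => ?_)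
    have e : y.rep.1 n = x.rep.1 n * q (g n) (d (g n)) := by rw [hd, hg]; simp
    rw [div_le_iff₀ (R.pos n), ← hdn] at hn
    show dist (x.rep.1 n * q (g n) (τ (dist x y) n)) (y.rep.1 n) ≤ _
    rw [e, dist_mul_left]
    refine (hq _ _ _).trans ?_
    have h1 := Nat.lt_floor_add_one (dist x y * R.val n)
    have h2 : τ (dist x y) n ≤ d (g n) := min_le_right _ _
    have h2' : (τ (dist x y) n : ℝ) ≤ d (g n) := by exact_mod_cast h2
    rw [abs_of_nonpos (by linarith)]
    have := mul_nonneg hε.le (R.pos n).le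
    rcases min_choice ⌊dist x y * R.val n⌋₊ (d (g n)) with h3 | h3 <;>
      simp only [hτ, h3] <;> nlinarith
  · intro a ha b hb
    refine Cone.dist_le (A := 1) (.of_forall fun n => ?_)
    show dist (x.rep.1 n * q (g n) (τ a n)) (x.rep.1 n * q (g n) (τ b n)) ≤ _
    rw [dist_mul_left]
    refine (hq _ _ _).trans ?_
    have h1 : |(τ a n : ℝ) - τ b n| ≤ |(⌊a * R.val n⌋₊ : ℝ) - ⌊b * R.val n⌋₊| := by
      simp only [hτ, Nat.cast_min]
      exact abs_min_sub_min_le_max _ _ _ _ |>.trans (by simp)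
    refine h1.trans ?_
    have ha' := mul_nonneg ha.1 (R.pos n).le
    have hb' := mul_nonneg hb.1 (R.pos n).le
    have e : |a - b| * R.val n = |a * R.val n - b * R.val n| := by
      rw [← sub_mul, abs_mul, abs_of_pos (R.pos n)]
    rw [e]
    rw [abs_le]
    have := neg_abs_le (a * R.val n - b * R.val n)
    have := le_abs_self (a * R.val n - b * R.val n)
    constructor <;> linarith [Nat.floor_le ha', Nat.floor_le hb',
      Nat.lt_floor_add_one (a * R.val n), Nat.lt_floor_add_one (b * R.val n)]

lemma DContr.cone (h : DContr G) : Contr (Cone G R) := by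
  obtain ⟨C, P, hC, hP1, hPl, hPs, hPd⟩ := h
  have hP1k : ∀ k, P^[k] 1 = 1 := fun k => Function.iterate_fixed hP1 k
  have hstep : ∀ k j x, dist (P^[k] x) (P^[k + j] x) ≤ C * j := by
    intro k j x
    induction j with
    | zero => simp
    | succ j ih =>
      have := hPs (P^[k + j] x)
      rw [← Function.iterate_succ_apply' P, dist_comm] at this
      rw [← add_assoc]
      push_cast
      linarith [dist_triangle (P^[k] x) (P^[k + j] x) (P^[k + j + 1] x)]
  refine ⟨C, hC, fun e ε hε F hF => ?_⟩
  have hs : 0 < ε / C := by positivity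
  set s := ε / C with hsdef
  have hsC : C * s = ε := by rw [hsdef]; field_simp
  let T : ℕ → Cone G R → AsymSeq G R := fun k x =>
    ⟨fun n => e.rep.1 n * P^[k * ⌊s * R.val n⌋₊] ((e.rep.1 n)⁻¹ * x.rep.1 n), by
      obtain ⟨B, hB⟩ := e.rep.2
      obtain ⟨B', hB'⟩ := x.rep.2
      refine ⟨C * (B' + B) + B, fun n => ?_⟩
      have h1 := hPl (k * ⌊s * R.val n⌋₊) ((e.rep.1 n)⁻¹ * x.rep.1 n) 1
      rw [hP1k, dist_inv_mul_one, ← dist_mul_left (e.rep.1 n), mul_one] at h1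
      have h2 : C * dist (x.rep.1 n) (e.rep.1 n) ≤ C * ((B' + B) * R.val n) := by
        refine mul_le_mul_of_nonneg_left ?_ (by linarith)
        linarith [dist_triangle_right (x.rep.1 n) (e.rep.1 n) 1, hB n, hB' n]
      linarith [dist_triangle (e.rep.1 n * P^[k * ⌊s * R.val n⌋₊] ((e.rep.1 n)⁻¹ * x.rep.1 n))
        (e.rep.1 n) 1, hB n]⟩
  obtain ⟨B, hB⟩ := (hF.image fun x => dist x e).bddAbove
  obtain ⟨m, hm⟩ := exists_nat_gt ((B + 1) / s)
  rw [div_lt_iff₀ hs] at hm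
  refine ⟨fun k x => Cone.mk (T k x), m, fun x => ?_, fun k => ?_, fun k x y => ?_, fun k x => ?_,
    fun k hk x hx => ?_⟩
  · conv_rhs => rw [← Cone.mk_rep x]
    exact congrArg Cone.mk (Subtype.ext (funext fun n => by simp [T]))
  · conv_rhs => rw [← Cone.mk_rep e]
    exact congrArg Cone.mk (Subtype.ext (funext fun n => by simp [T, hP1k]))
  · refine le_of_tendsto_of_tendsto' (Cone.tendsto _ _) ((Cone.tendsto_rep x y).const_mul C)
      fun n => ?_
    rw [← mul_div_assoc]
    refine div_le_div_of_nonneg_right ?_ (R.pos n).le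
    show dist (e.rep.1 n * _) (e.rep.1 n * _) ≤ _
    rw [dist_mul_left]
    refine (hPl _ _ _).trans ?_
    rw [dist_mul_left]
  · refine Cone.dist_le (A := 0) (.of_forall fun n => ?_)
    show dist (e.rep.1 n * _) (e.rep.1 n * _) ≤ _
    rw [dist_mul_left, add_mul, one_mul, add_zero]
    refine (hstep _ _ _).trans ?_
    rw [← hsC, mul_assoc]
    exact mul_le_mul_of_nonneg_left (Nat.floor_le (mul_nonneg hs.le (R.pos n).le)) (by linarith)
  · conv_rhs => rw [← Cone.mk_rep e]
    refine dist_le_zero.1 (Cone.dist_le (A := 0) ?_)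
    have h1 := (Cone.tendsto_rep x e).eventually_le_const (u := B + 1 / 2)
      (by linarith [hB ⟨x, hx, rfl⟩])
    have h2 : ∀ᶠ n in uf, k / (k * s - (B + 1 / 2)) ≤ R.val n := R.uf_lim.eventually_ge_atTop _
    filter_upwards [h1, h2] with n hn hn'
    have hk' : (m : ℝ) ≤ k := by exact_mod_cast hk
    have hpos : 0 < k * s - (B + 1 / 2) := by nlinarith
    rw [div_le_iff₀ (R.pos n)] at hn
    rw [div_le_iff₀ hpos] at hn'
    have h3 := Nat.lt_floor_add_one (s * R.val n)
    show dist (e.rep.1 n * P^[k * ⌊s * R.val n⌋₊] ((e.rep.1 n)⁻¹ * x.rep.1 n)) (e.rep.1 n) ≤ _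
    rw [hPd, mul_one, dist_self]
    · simp
    · rw [dist_inv_mul_one]
      refine hn.trans ?_
      push_cast
      nlinarith [(Nat.cast_nonneg k : (0 : ℝ) ≤ k)]

end DeRahmSplit

namespace DeRahmSplit

open Filter Topology

variable {G : Type*} [Group G] [PseudoMetricSpace G] [IsIsometricSMul G G] {R : Scale}

/-- The limit of the shadows `D m`, based at a sequence. -/
def shadow (D : ℕ → Set G) (z x : AsymSeq G R) : Prop :=
  ∀ m, ∀ᶠ n in uf, (z.1 n)⁻¹ * x.1 n ∈ D m

lemma shadow_dist {D : ℕ → Set G} {C : ℝ}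
    (hD : ∀ m, ∀ x ∈ D (m + 1), ∀ y ∉ D m, dist x 1 + dist y 1 ≤ dist x y + C * (m + 1))
    {z x y : AsymSeq G R} (hx : shadow D z x) (hy : ¬ shadow D z y) :
    dist (Cone.mk x) (Cone.mk z) + dist (Cone.mk y) (Cone.mk z) ≤ dist (Cone.mk x) (Cone.mk y) := by
  unfold shadow at hy
  push Not at hy
  obtain ⟨m, hm⟩ := hy
  have hm : ∀ᶠ n in uf, (z.1 n)⁻¹ * y.1 n ∉ D m := by
    simpa using hm
  have h1 : Tendsto (fun n => dist (x.1 n) (y.1 n) / R.val n + C * (m + 1) / R.val n) uf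
      (𝓝 (dist (Cone.mk x) (Cone.mk y) + 0)) := (Cone.tendsto x y).add (R.const_div _)
  rw [add_zero] at h1
  refine le_of_tendsto_of_tendsto ((Cone.tendsto x z).add (Cone.tendsto y z)) h1 ?_
  filter_upwards [hx (m + 1), hm] with n h2 h3
  have := hD m _ h2 _ h3
  rw [dist_inv_mul_one, dist_inv_mul_one, dist_mul_left] at this
  rw [← add_div, ← add_div]
  exact div_le_div_of_nonneg_right this (R.pos n).le

lemma shadow_congr {D : ℕ → Set G} {C : ℝ}
    (hD : ∀ m, ∀ x ∈ D (m + 1), ∀ y ∉ D m, dist x 1 + dist y 1 ≤ dist x y + C * (m + 1))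
    {z x y : AsymSeq G R} (hx : shadow D z x) (h : Cone.mk x = Cone.mk y)
    (hz : Cone.mk x ≠ Cone.mk z) : shadow D z y := by
  by_contra hy
  have := shadow_dist hD hx hy
  rw [h, dist_self] at this
  rw [h] at hz
  linarith [dist_pos.2 hz]

lemma DTrip.cone (h : DTrip G) : Tripod (Cone G R) := by
  classical
  obtain ⟨L, C, w, D, hL, hw, hD, hwD, hne⟩ := h
  have hL' : (0 : ℝ) < L := by exact_mod_cast hL
  refine ⟨1, 1, one_pos, one_pos, fun p => ?_⟩
  set a : ℝ → ℕ → ℕ := fun t n => ⌊t * R.val n / L⌋₊ with ha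
  have ha0 : ∀ n, a 0 n = 0 := fun n => by simp [ha]
  have hwd : ∀ k (i j : ℕ), dist (w k ^ i) (w k ^ j) = L * |(i : ℝ) - j| := by
    intro k i j
    wlog hij : i ≤ j generalizing i j
    · rw [dist_comm, this j i (le_of_not_ge hij), abs_sub_comm]
    · obtain ⟨d, rfl⟩ := Nat.exists_eq_add_of_le hij
      rw [pow_add, dist_comm]
      conv_lhs => rw [← mul_one (w k ^ i), mul_assoc, dist_mul_left, one_mul]
      rw [hw]
      rw [Nat.cast_add, show (i : ℝ) - (i + d) = -d by ring, abs_neg, Nat.abs_cast]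
  have hlow : ∀ t n, t * R.val n / L - 1 < a t n := fun t n => by
    linarith [Nat.lt_floor_add_one (t * R.val n / L)]
  have hup : ∀ t n, 0 ≤ t → (a t n : ℝ) ≤ t * R.val n / L := fun t n ht =>
    Nat.floor_le (div_nonneg (mul_nonneg ht (R.pos n).le) hL'.le)
  let r : Fin 3 → ℝ → AsymSeq G R := fun k t => ⟨fun n => p.rep.1 n * w k ^ a t n, by
    obtain ⟨B, hB⟩ := p.rep.2
    refine ⟨|t| + B, fun n => ?_⟩
    have h1 : dist (p.rep.1 n * w k ^ a t n) (p.rep.1 n) ≤ |t| * R.val n := by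
      conv_lhs => rw [← mul_one (p.rep.1 n), mul_assoc, dist_mul_left, one_mul]
      rw [hw]
      have h2 : (a t n : ℝ) ≤ a |t| n := by
        have : a t n ≤ a |t| n := Nat.floor_mono (div_le_div_of_nonneg_right
          (mul_le_mul_of_nonneg_right (le_abs_self t) (R.pos n).le) hL'.le)
        exact_mod_cast this
      have h3 := h2.trans (hup |t| n (abs_nonneg t))
      rwa [le_div_iff₀ hL', mul_comm] at h3
    linarith [dist_triangle (p.rep.1 n * w k ^ a t n) (p.rep.1 n) 1, hB n]⟩
  have hr0 : ∀ k, r k 0 = p.rep := fun k => Subtype.ext (funext fun n => by simp [r, ha0])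
  have hrd : ∀ k, ∀ t ≥ 0, ∀ u ≥ 0, dist (Cone.mk (r k t)) (Cone.mk (r k u)) = |t - u| := by
    intro k t ht u hu
    have e : ∀ n, dist ((r k t).1 n) ((r k u).1 n) = |(L : ℝ) * a t n - L * a u n| := fun n => by
      show dist (p.rep.1 n * w k ^ a t n) (p.rep.1 n * w k ^ a u n) = _
      rw [dist_mul_left, hwd, ← mul_sub, abs_mul, abs_of_pos hL']
    have hb : ∀ n, ∀ t ≥ 0, L * (a t n : ℝ) ≤ t * R.val n ∧ t * R.val n - L ≤ L * (a t n : ℝ) := by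
      intro n t ht
      have h1 := hup t n ht
      have h2 := hlow t n
      rw [le_div_iff₀ hL'] at h1
      rw [sub_lt_iff_lt_add, div_lt_iff₀ hL'] at h2
      constructor <;> linarith
    have hts : ∀ n, |t * R.val n - u * R.val n| = |t - u| * R.val n := fun n => by
      rw [← sub_mul, abs_mul, abs_of_pos (R.pos n)]
    refine le_antisymm (Cone.dist_le (A := L) (.of_forall fun n => ?_))
      (Cone.le_dist (A := L) (.of_forall fun n => ?_)) <;> rw [e, ← hts] <;>
      obtain ⟨h1, h2⟩ := hb n t ht <;> obtain ⟨h3, h4⟩ := hb n u hu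
    · rcases abs_cases (L * (a t n : ℝ) - L * a u n) with h5 | h5 <;>
      rcases abs_cases (t * R.val n - u * R.val n) with h6 | h6 <;> linarith
    · rcases abs_cases (L * (a t n : ℝ) - L * a u n) with h5 | h5 <;>
      rcases abs_cases (t * R.val n - u * R.val n) with h6 | h6 <;> linarith
  have hmono : ∀ t u n, t ≤ u → a t n ≤ a u n := fun t u n h => Nat.floor_mono
    (div_le_div_of_nonneg_right (mul_le_mul_of_nonneg_right h (R.pos n).le) hL'.le)
  have hrp : ∀ k, Cone.mk (r k 0) = p := fun k => by rw [hr0, Cone.mk_rep]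
  refine ⟨fun k t => Cone.mk (r k t), hrp, fun k t ht u hu => by rw [hrd k t ht u hu, one_mul],
    fun k t ht => ?_, fun k t ht => ?_⟩
  · conv_lhs => rw [← hrp k]
    simp only [hrd k t ht 0 le_rfl]
    rw [sub_zero, abs_of_nonneg ht, one_mul]
  have hmk : ∀ x, ¬ shadow (D k) (r k t) x → Cone.mk x ≠ Cone.mk (r k t) →
      ¬ shadow (D k) (r k t) (Cone.mk x).rep := fun x hx hne hs =>
    hx (shadow_congr (hD k) hs (Cone.mk_rep _) (by rwa [Cone.mk_rep]))
  refine ⟨fun q => if q ≠ Cone.mk (r k t) ∧ shadow (D k) (r k t) q.rep then 1 else 0,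
    ?_, fun u hu => ?_, fun u hu0 hu => ?_, fun k' hk' u hu => ?_⟩
  · have key : ∀ q q' : Cone G R, q ≠ Cone.mk (r k t) ∧ shadow (D k) (r k t) q.rep →
        ¬ (q' ≠ Cone.mk (r k t) ∧ shadow (D k) (r k t) q'.rep) →
        dist q (Cone.mk (r k t)) + dist q' (Cone.mk (r k t)) ≤ dist q q' := by
      intro q q' hq hq'
      by_cases h : q' = Cone.mk (r k t)
      · rw [h, dist_self, add_zero]
      · have := shadow_dist (hD k) hq.2 fun hs => hq' ⟨h, hs⟩
        simpa only [Cone.mk_rep] using this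
    intro q q' hqq
    by_cases h1 : q ≠ Cone.mk (r k t) ∧ shadow (D k) (r k t) q.rep <;>
      by_cases h2 : q' ≠ Cone.mk (r k t) ∧ shadow (D k) (r k t) q'.rep
    · exact absurd ((if_pos h1).trans (if_pos h2).symm) hqq
    · linarith [key q q' h1 h2]
    · rw [dist_comm q q']; linarith [key q' q h2 h1]
    · exact absurd ((if_neg h1).trans (if_neg h2).symm) hqq
  · have hne' : Cone.mk (r k u) ≠ Cone.mk (r k t) := by
      rw [← dist_pos, hrd k u (ht.trans hu.le) t ht]
      exact abs_pos.2 (sub_ne_zero.2 hu.ne')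
    refine if_pos ⟨hne', shadow_congr (hD k) (x := r k u) ?_ (Cone.mk_rep _).symm hne'⟩
    intro m
    have : ∀ᶠ n in uf, (m + 1) * L / (u - t) ≤ R.val n := R.uf_lim.eventually_ge_atTop _
    filter_upwards [this] with n hn
    rw [div_le_iff₀ (sub_pos.2 hu)] at hn
    have h1 : m + a t n ≤ a u n := by
      have h2 := hlow u n
      have h3 := hup t n ht
      have h4 : (m : ℝ) + 1 ≤ u * R.val n / L - t * R.val n / L := by
        rw [← sub_div, le_div_iff₀ hL']; linarith
      have : (m + a t n : ℝ) ≤ a u n := by linarith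
      exact_mod_cast this
    show (p.rep.1 n * w k ^ a t n)⁻¹ * (p.rep.1 n * w k ^ a u n) ∈ D k m
    have e : (p.rep.1 n * w k ^ a t n)⁻¹ * (p.rep.1 n * w k ^ a u n) = w k ^ (a u n - a t n) := by
      rw [pow_sub _ (by omega)]
      have := ((Commute.refl (w k)).pow_pow (a u n) (a t n)).inv_right
      rw [this.eq]
      group
    rw [e]
    exact hwD k m _ (by omega)
  · obtain ⟨k', hk'⟩ := exists_ne k
    refine if_neg fun hs => hmk (r k u) (fun hs => ?_) (fun h => ?_) hs.2
    · obtain ⟨n, hn⟩ := (hs 1).exists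
      refine hne k k' hk' 0 (a t n - a u n) ?_
      have e : ((r k t).1 n)⁻¹ * (r k u).1 n = (w k ^ (a t n - a u n))⁻¹ * w k' ^ 0 := by
        show (p.rep.1 n * w k ^ a t n)⁻¹ * (p.rep.1 n * w k ^ a u n) = _
        rw [pow_sub _ (hmono u t n hu.le)]
        group
      rwa [← e]
    · have := hrd k u hu0 t ht
      rw [h, dist_self] at this
      exact (sub_ne_zero.2 hu.ne) (abs_eq_zero.1 this.symm)
  · refine if_neg fun hs => hmk (r k' u) (fun hs => ?_) hs.1 hs.2
    obtain ⟨n, hn⟩ := (hs 1).exists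
    refine hne k k' hk' (a u n) (a t n) ?_
    have e : ((r k t).1 n)⁻¹ * (r k' u).1 n = (w k ^ a t n)⁻¹ * w k' ^ a u n := by
      show (p.rep.1 n * w k ^ a t n)⁻¹ * (p.rep.1 n * w k' ^ a u n) = _
      group
    rwa [← e]

lemma Tripod.cutSpace {Y : Type*} [MetricSpace Y] (h : Tripod Y) (hg : Geod Y) (hc : Contr Y) :
    CutSpace Y := by
  obtain ⟨C, c, hC, hc0, h⟩ := h
  refine ⟨hg, hc, fun q δ => ?_, fun p => ?_⟩
  · obtain ⟨ρ, h0, -, h2, -⟩ := h q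
    refine ⟨ρ 0 (|δ| / c), ?_⟩
    rw [h2 0 _ (by positivity), mul_div_cancel₀ _ hc0.ne']
    exact le_abs_self δ
  · obtain ⟨ρ, h0, -, h2, h3⟩ := h p
    obtain ⟨χ, hχ, h4, -, h5⟩ := h3 0 0 le_rfl
    rw [h0] at hχ
    have hne : ∀ k, ρ k 1 ≠ p := fun k => by
      rw [← dist_pos, h2 k 1 zero_le_one]; linarith
    refine ⟨ρ 0 1, ρ 1 1, hne 0, hne 1, χ, hχ, ?_⟩
    rw [h4 1 one_pos, h5 1 (by decide) 1 zero_le_one]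
    decide

end DeRahmSplit

namespace DeRahmSplit

open Filter Topology

/-- A quasi-isometry together with a coarse inverse. -/
structure QPair {X Y : Type*} [PseudoMetricSpace X] [PseudoMetricSpace Y] (K A : ℝ)
    (F : X → Y) (F' : Y → X) : Prop where
  one_le : 1 ≤ K
  nonneg : 0 ≤ A
  lip : ∀ x x', dist (F x) (F x') ≤ K * dist x x' + A
  lip' : ∀ y y', dist (F' y) (F' y') ≤ K * dist y y' + A
  left : ∀ x, dist (F' (F x)) x ≤ A
  right : ∀ y, dist (F (F' y)) y ≤ A

lemma QPair.symm {X Y : Type*} [PseudoMetricSpace X] [PseudoMetricSpace Y] {K A : ℝ}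
    {F : X → Y} {F' : Y → X} (h : QPair K A F F') : QPair K A F' F :=
  ⟨h.one_le, h.nonneg, h.lip', h.lip, h.right, h.left⟩

lemma Scale.exists_bound (R : Scale) (A : ℝ) : ∃ B ≥ 0, ∀ n, A ≤ B * R.val n := by
  obtain ⟨B, hB⟩ := (R.lim.const_div_atTop A).bddAbove_range
  refine ⟨max B 0, le_max_right _ _, fun n => ?_⟩
  have h := hB ⟨n, rfl⟩
  rw [div_le_iff₀ (R.pos n)] at h
  exact h.trans (mul_le_mul_of_nonneg_right (le_max_left _ _) (R.pos n).le)

variable {N M : ℕ} {G : Fin N → Type} {H : Fin M → Type} [∀ c, Group (G c)]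
  [∀ c, PseudoMetricSpace (G c)] [∀ d, Group (H d)] [∀ d, PseudoMetricSpace (H d)] {R : Scale}

lemma AsymSeq.pi_bound (x : ∀ c, AsymSeq (G c) R) :
    ∃ B ≥ 0, ∀ n, dist (fun c => (x c).1 n) 1 ≤ B * R.val n := by
  choose B hB using fun c => (x c).2
  refine ⟨∑ c, |B c|, Finset.sum_nonneg fun _ _ => abs_nonneg _, fun n => ?_⟩
  refine (dist_pi_le_iff (mul_nonneg (Finset.sum_nonneg fun _ _ => abs_nonneg _)
    (R.pos n).le)).2 fun c => (hB c n).trans (mul_le_mul_of_nonneg_right ?_ (R.pos n).le)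
  exact (le_abs_self _).trans
    (Finset.single_le_sum (f := fun c => |B c|) (fun _ _ => abs_nonneg _) (Finset.mem_univ c))

lemma Cone.pi_dist_le (x y : ∀ c, AsymSeq (G c) R) {c A : ℝ} (hc : 0 ≤ c)
    (h : ∀ᶠ n in uf, dist (fun i => (x i).1 n) (fun i => (y i).1 n) ≤ c * R.val n + A) :
    dist (fun i => Cone.mk (x i)) (fun i => Cone.mk (y i)) ≤ c :=
  (dist_pi_le_iff hc).2 fun i => Cone.dist_le (h.mono fun _ hn =>
    (dist_le_pi_dist (fun j => (x j).1 _) (fun j => (y j).1 _) i).trans hn)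

lemma Cone.pi_eventually_dist_lt (x y : ∀ c, AsymSeq (G c) R) {c : ℝ}
    (h : dist (fun i => Cone.mk (x i)) (fun i => Cone.mk (y i)) < c) :
    ∀ᶠ n in uf, dist (fun i => (x i).1 n) (fun i => (y i).1 n) < c * R.val n := by
  have h1 : ∀ i, ∀ᶠ n in uf, dist ((x i).1 n) ((y i).1 n) < c * R.val n := fun i => by
    filter_upwards [(Cone.tendsto (x i) (y i)).eventually_lt_const
      ((dist_le_pi_dist (fun i => Cone.mk (x i)) (fun i => Cone.mk (y i)) i).trans_lt h)] with n hn
    rwa [div_lt_iff₀ (R.pos n)] at hn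
  filter_upwards [eventually_all.2 h1] with n hn
  exact (dist_pi_lt_iff (mul_pos (dist_nonneg.trans_lt h) (R.pos n))).2 hn

/-- `Φ` is induced on asymptotic cones by the maps `F n`. -/
def Induces (F : ℕ → (∀ c, G c) → ∀ d, H d)
    (Φ : (∀ c, Cone (G c) R) → ∀ d, Cone (H d) R) : Prop :=
  ∀ x : ∀ c, AsymSeq (G c) R, ∃ y : ∀ d, AsymSeq (H d) R,
    (∀ n d, (y d).1 n = F n (fun c => (x c).1 n) d) ∧
      Φ (fun c => Cone.mk (x c)) = fun d => Cone.mk (y d)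

lemma exists_induces {F : ℕ → (∀ c, G c) → ∀ d, H d} {K A B : ℝ} (hK : 0 ≤ K)
    (hF : ∀ n x x', dist (F n x) (F n x') ≤ K * dist x x' + A)
    (hB : ∀ n, dist (F n 1) 1 ≤ B * R.val n) :
    ∃ Φ : (∀ c, Cone (G c) R) → ∀ d, Cone (H d) R, Induces F Φ ∧
      ∀ p q, dist (Φ p) (Φ q) ≤ K * dist p q := by
  have hex : ∀ x : ∀ c, AsymSeq (G c) R, ∃ y : ∀ d, AsymSeq (H d) R,
      ∀ n d, (y d).1 n = F n (fun c => (x c).1 n) d := fun x => by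
    obtain ⟨B', h0, hB'⟩ := AsymSeq.pi_bound x
    obtain ⟨B₂, -, hB₂⟩ := R.exists_bound A
    refine ⟨fun d => ⟨fun n => F n (fun c => (x c).1 n) d, K * B' + B₂ + B, fun n => ?_⟩,
      fun _ _ => rfl⟩
    have h1 := dist_le_pi_dist (F n (fun c => (x c).1 n)) 1 d
    have h2 := dist_triangle (F n (fun c => (x c).1 n)) (F n 1) 1
    have h3 := hF n (fun c => (x c).1 n) 1
    have h4 := mul_le_mul_of_nonneg_left (hB' n) hK
    refine h1.trans ?_
    linarith [hB n, hB₂ n]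
  choose y hy using hex
  have hyd : ∀ x x', dist (fun d => Cone.mk (y x d)) (fun d => Cone.mk (y x' d)) ≤
      K * dist (fun c => Cone.mk (x c)) (fun c => Cone.mk (x' c)) := fun x x' => by
    refine le_of_forall_pos_le_add fun ε hε => ?_
    have hε' : 0 < ε / (K + 1) := div_pos hε (by linarith)
    have h1 := Cone.pi_eventually_dist_lt x x' (lt_add_of_pos_right _ hε')
    refine (Cone.pi_dist_le _ _ (A := A)
      (c := K * (dist (fun c => Cone.mk (x c)) (fun c => Cone.mk (x' c)) + ε / (K + 1)))
      (by positivity) (h1.mono fun n hn => ?_)).trans ?_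
    · simp only [hy]
      refine (hF n _ _).trans ?_
      rw [mul_assoc]
      have := mul_le_mul_of_nonneg_left hn.le hK
      linarith
    · rw [mul_add]
      refine add_le_add_right ?_ _
      rw [mul_div_assoc', div_le_iff₀ (by linarith)]
      nlinarith
  refine ⟨fun p d => Cone.mk (y (fun c => (p c).rep) d), fun x => ⟨y x, hy x, ?_⟩, fun p q => ?_⟩
  · have := hyd (fun c => (Cone.mk (x c)).rep) x
    simp only [Cone.mk_rep, dist_self, mul_zero] at this
    exact dist_le_zero.1 this
  · simpa only [Cone.mk_rep] using hyd (fun c => (p c).rep) (fun c => (q c).rep)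

lemma exists_equiv_induces {F : ℕ → (∀ c, G c) → ∀ d, H d} {F' : ℕ → (∀ d, H d) → ∀ c, G c}
    {K A B : ℝ} (hF : ∀ n, QPair K A (F n) (F' n)) (hB : ∀ n, dist (F n 1) 1 ≤ B * R.val n) :
    ∃ Φ : (∀ c, Cone (G c) R) ≃ ∀ d, Cone (H d) R, Induces F Φ ∧ BiLip K Φ := by
  have hK : 0 < K := zero_lt_one.trans_le (hF 0).one_le
  obtain ⟨Φ, h1, h2⟩ := exists_induces hK.le (fun n => (hF n).lip) hB
  obtain ⟨B₂, -, hB₂⟩ := R.exists_bound (2 * A)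
  obtain ⟨Ψ, h3, h4⟩ := exists_induces (R := R) (B := K * B + B₂) hK.le
    (fun n => (hF n).lip') fun n => by
      have h5 := dist_triangle (F' n 1) (F' n (F n 1)) 1
      have h6 := (hF n).lip' 1 (F n 1)
      have h7 := mul_le_mul_of_nonneg_left (hB n) hK.le
      rw [dist_comm 1] at h6
      linarith [(hF n).left 1, hB₂ n]
  have hl : ∀ p, Ψ (Φ p) = p := fun p => by
    obtain ⟨y, hy, e⟩ := h1 fun c => (p c).rep
    obtain ⟨z, hz, e'⟩ := h3 y
    simp only [Cone.mk_rep] at e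
    rw [e, e']
    refine dist_le_zero.1 ?_
    have := Cone.pi_dist_le z (fun c => (p c).rep) (A := A) le_rfl (.of_forall fun n => ?_)
    · simpa only [Cone.mk_rep] using this
    · simp only [hz, hy, zero_mul, zero_add]
      exact (hF n).left _
  have hr : ∀ p, Φ (Ψ p) = p := fun p => by
    obtain ⟨y, hy, e⟩ := h3 fun c => (p c).rep
    obtain ⟨z, hz, e'⟩ := h1 y
    simp only [Cone.mk_rep] at e
    rw [e, e']
    refine dist_le_zero.1 ?_
    have := Cone.pi_dist_le z (fun c => (p c).rep) (A := A) le_rfl (.of_forall fun n => ?_)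
    · simpa only [Cone.mk_rep] using this
    · simp only [hz, hy, zero_mul, zero_add]
      exact (hF n).right _
  refine ⟨⟨Φ, Ψ, hl, hr⟩, h1, hK, h2, fun p q => ?_⟩
  have := h4 (Φ p) (Φ q)
  rwa [hl, hl] at this

end DeRahmSplit

namespace DeRahmSplit

open Filter Topology

lemma exists_dist_eq {Y : Type*} [MetricSpace Y] (h : CutSpace Y) (p : Y) {s : ℝ} (hs : 0 ≤ s) :
    ∃ y, dist y p = s := by
  obtain ⟨x, hx⟩ := h.far p s
  obtain ⟨γ, h0, h1, hγ⟩ := h.geod p x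
  rw [dist_comm] at hx
  have h2 := hγ s ⟨hs, hx⟩ 0 ⟨le_rfl, dist_nonneg⟩
  have h3 := hγ s ⟨hs, hx⟩ (dist p x) ⟨dist_nonneg, le_rfl⟩
  rw [h0, sub_zero, abs_of_nonneg hs] at h2
  rw [h1, abs_of_nonpos (by linarith)] at h3
  refine ⟨γ s, h2.antisymm ?_⟩
  linarith [dist_triangle_left p x (γ s)]

/-- On the unit ball the `σ i` coordinate of `Φ` depends up to `ε` on the `i` coordinate only. -/
def UnitGood {N M : ℕ} {X : Fin N → Type*} {Y : Fin M → Type*} [∀ c, MetricSpace (X c)]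
    [∀ d, MetricSpace (Y d)] {S : Set (Fin N)} {T : Set (Fin M)}
    (Φ : (∀ c, X c) → ∀ d, Y d) (p₀ : ∀ c, X c) (σ : S ≃ T) (ε : ℝ) : Prop :=
  ∀ (i : S) (p p' : ∀ c, X c), p i = p' i → dist p p₀ < 1 → dist p' p₀ < 1 →
    dist (Φ p (σ i)) (Φ p' (σ i)) ≤ ε

lemma UnitGood.unique {N M : ℕ} {X : Fin N → Type*} {Y : Fin M → Type*} [∀ c, MetricSpace (X c)]
    [∀ d, MetricSpace (Y d)] {S : Set (Fin N)} {T : Set (Fin M)} {K ε : ℝ}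
    {Φ : (∀ c, X c) ≃ ∀ d, Y d} (hΦ : BiLip K Φ) (hY : ∀ d, CutSpace (Y d)) {p₀ : ∀ c, X c}
    {σ σ' : S ≃ T} (h : UnitGood Φ p₀ σ ε) (h' : UnitGood Φ p₀ σ' ε) (hε : 4 * K * ε < 1) :
    σ = σ' := by
  by_contra hne
  obtain ⟨i, hi⟩ : ∃ i, σ i ≠ σ' i := by
    by_contra! h1
    exact hne (Equiv.ext h1)
  have hK := hΦ.pos
  obtain ⟨i', hi'⟩ := σ'.surjective (σ i)
  have hii : i' ≠ i := fun e => hi (by rw [← hi', e])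
  obtain ⟨y, hy⟩ := exists_dist_eq (hY (σ i)) (Φ p₀ (σ i)) (s := 1 / (2 * K)) (by positivity)
  obtain ⟨p, hp⟩ := Φ.surjective (Function.update (Φ p₀) (σ i) y)
  have hd : dist p p₀ ≤ 1 / 2 := by
    refine (hΦ.ge p p₀).trans ?_
    have h1 : dist (Φ p) (Φ p₀) ≤ 1 / (2 * K) := (dist_pi_le_iff (by positivity)).2 fun d => by
      rw [hp]
      by_cases e : d = σ i
      · subst e; rw [Function.update_self]; exact hy.le
      · rw [Function.update_of_ne e, dist_self]; positivity
    calc K * dist (Φ p) (Φ p₀) ≤ K * (1 / (2 * K)) := mul_le_mul_of_nonneg_left h1 hK.le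
      _ = 1 / 2 := by field_simp
  have hd' : dist (Function.update p i (p₀ i)) p₀ ≤ 1 / 2 :=
    (dist_pi_le_iff (by norm_num)).2 fun c => by
      by_cases e : c = i
      · subst e; rw [Function.update_self, dist_self]; norm_num
      · rw [Function.update_of_ne e]; exact (dist_le_pi_dist p p₀ c).trans hd
  have h1 := h i (Function.update p i (p₀ i)) p₀ (Function.update_self _ _ _) (by linarith)
    (by simp)
  have h2 := h' i' p (Function.update p i (p₀ i))
    (Function.update_of_ne (fun e => hii (Subtype.ext e)) _ _).symm (by linarith) (by linarith)
  rw [hi'] at h2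
  have h3 : Φ p (σ i) = y := by rw [hp, Function.update_self]
  have h4 := dist_triangle (Φ p (σ i)) (Φ (Function.update p i (p₀ i)) (σ i)) (Φ p₀ (σ i))
  rw [h3, hy] at h4
  rw [h3] at h2
  have h5 : 1 / (2 * K) ≤ 2 * ε := by linarith
  rw [div_le_iff₀ (by positivity)] at h5
  linarith

/-- A family of groups of one of the two types occurring as factors. -/
structure AsymFam {N : ℕ} (G : Fin N → Type) [∀ c, Group (G c)] [∀ c, PseudoMetricSpace (G c)]
    (S : Set (Fin N)) : Prop where
  geod : ∀ i ∈ S, DGeod (G i)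
  contr : ∀ i ∈ S, DContr (G i)
  trip : ∀ i ∈ S, DTrip (G i)
  line : ∀ i ∉ S, DLine (G i)

variable {N M : ℕ} {G : Fin N → Type} {H : Fin M → Type} [∀ c, Group (G c)]
  [∀ c, PseudoMetricSpace (G c)] [∀ d, Group (H d)] [∀ d, PseudoMetricSpace (H d)] {R : Scale}
  [∀ c, IsIsometricSMul (G c) (G c)] [∀ d, IsIsometricSMul (H d) (H d)]
  {S : Set (Fin N)} {T : Set (Fin M)}

lemma AsymFam.cutFam (h : AsymFam G S) (R : Scale) : CutFam (fun c => Cone (G c) R) S where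
  cut i := by
    by_cases hi : i ∈ S
    · exact (h.trip i hi).cone.cutSpace (h.geod i hi).cone (h.contr i hi).cone
    · obtain ⟨ψ, hψ⟩ := (h.line i hi).isLine R
      exact hψ.cutSpace
  tri i hi := (h.trip i hi).cone
  line i hi := by
    obtain ⟨ψ, hψ⟩ := (h.line i hi).isLine R
    exact hψ.rprop

/-- The map `F`, translated on both sides. -/
def shiftMap (F : (∀ c, G c) → ∀ d, H d) (h : ∀ d, H d) (o x : ∀ c, G c) : ∀ d, H d := h * F (o * x)

lemma QPair.shift {K A : ℝ} {F : (∀ c, G c) → ∀ d, H d} {F' : (∀ d, H d) → ∀ c, G c}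
    (hF : QPair K A F F') (h : ∀ d, H d) (o : ∀ c, G c) :
    QPair K A (shiftMap F h o) (fun y => o⁻¹ * F' (h⁻¹ * y)) where
  one_le := hF.one_le
  nonneg := hF.nonneg
  lip x x' := by
    simp only [shiftMap, dist_mul_left]
    simpa only [dist_mul_left] using hF.lip (o * x) (o * x')
  lip' y y' := by
    rw [dist_mul_left]
    simpa only [dist_mul_left] using hF.lip' (h⁻¹ * y) (h⁻¹ * y')
  left x := by
    simp only [shiftMap, inv_mul_cancel_left]
    simpa only [dist_mul_left, inv_mul_cancel_left] using
      (dist_mul_left o⁻¹ (F' (F (o * x))) (o * x)).trans_le (hF.left (o * x))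
  right y := by
    simp only [shiftMap, mul_inv_cancel_left]
    simpa only [dist_mul_left, mul_inv_cancel_left] using
      (dist_mul_left h (F (F' (h⁻¹ * y))) (h⁻¹ * y)).trans_le (hF.right (h⁻¹ * y))

/-- The constant sequence at the identity. -/
def AsymSeq.one {G : Type*} [Group G] [PseudoMetricSpace G] : AsymSeq G R :=
  ⟨fun _ => 1, 0, fun _ => by simp⟩

/-- On a ball the `σ i` coordinate of `F` depends on the `i` coordinate only, up to a small
multiple of the radius. -/
def BallGood (F : (∀ c, G c) → ∀ d, H d) (σ : S ≃ T) (o : ∀ c, G c) (r ε : ℝ) : Prop :=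
  ∀ (i : S) (x x' : ∀ c, G c), x i = x' i → dist x o < r → dist x' o < r →
    dist (F x (σ i)) (F x' (σ i)) ≤ ε * r

lemma BallGood.mono {F : (∀ c, G c) → ∀ d, H d} {σ : S ≃ T} {o o' : ∀ c, G c} {r r' ε ε' : ℝ}
    (h : BallGood F σ o r ε) (h1 : dist o' o + r' ≤ r) (h2 : ε * r ≤ ε' * r') :
    BallGood F σ o' r' ε' := fun i x x' e hx hx' => by
  refine (h i x x' e ?_ ?_).trans h2
  · linarith [dist_triangle x o' o]
  · linarith [dist_triangle x' o' o]

variable {K A : ℝ} {F : (∀ c, G c) → ∀ d, H d} {F' : (∀ d, H d) → ∀ c, G c}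

lemma QPair.exists_cone (hF : QPair K A F F') (o : ℕ → ∀ c, G c) (h : ℕ → ∀ d, H d) {B : ℝ}
    (hB : ∀ n, dist (h n * F (o n)) 1 ≤ B * R.val n) :
    ∃ Φ : (∀ c, Cone (G c) R) ≃ ∀ d, Cone (H d) R,
      Induces (fun n => shiftMap F (h n) (o n)) Φ ∧ BiLip K Φ :=
  exists_equiv_induces (fun n => hF.shift (h n) (o n)) fun n => by
    simpa only [shiftMap, mul_one] using hB n

lemma QPair.exists_cone' (hF : QPair K A F F') (o : ℕ → ∀ c, G c) (R : Scale) :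
    ∃ Φ : (∀ c, Cone (G c) R) ≃ ∀ d, Cone (H d) R,
      Induces (fun n => shiftMap F (F (o n))⁻¹ (o n)) Φ ∧ BiLip K Φ :=
  hF.exists_cone o (fun n => (F (o n))⁻¹) (B := 0) fun n => by simp

lemma BallGood.unitGood {o : ℕ → ∀ c, G c} {h : ℕ → ∀ d, H d}
    {Φ : (∀ c, Cone (G c) R) → ∀ d, Cone (H d) R}
    (hΦ : Induces (fun n => shiftMap F (h n) (o n)) Φ) {σ : S ≃ T} {ε : ℝ}
    (hg : ∀ᶠ n in uf, BallGood F σ (o n) (R.val n) ε) :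
    UnitGood Φ (fun _ => Cone.mk AsymSeq.one) σ ε := fun i p p' e hp hp' => by
  obtain ⟨y, hy, ey⟩ := hΦ fun c => (p c).rep
  obtain ⟨y', hy', ey'⟩ := hΦ fun c => (p' c).rep
  have h1 : ∀ q : ∀ c, Cone (G c) R, dist q (fun _ => Cone.mk AsymSeq.one) < 1 →
      ∀ᶠ n in uf, dist (o n * fun c => (q c).rep.1 n) (o n) < R.val n := fun q hq => by
    have := Cone.pi_eventually_dist_lt (fun c => (q c).rep) (fun _ => AsymSeq.one)
      (by simpa only [Cone.mk_rep] using hq)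
    refine this.mono fun n hn => ?_
    rw [one_mul] at hn
    conv_lhs => rw [← mul_one (o n), mul_assoc, dist_mul_left, one_mul]
    exact hn
  simp only [Cone.mk_rep] at ey ey'
  rw [ey, ey']
  refine Cone.dist_le (A := 0) ?_
  filter_upwards [h1 p hp, h1 p' hp', hg] with n h2 h3 h4
  rw [hy, hy', add_zero]
  refine (dist_mul_left _ _ _).trans_le (h4 i _ _ ?_ h2 h3)
  simp only [Pi.mul_apply, e]

end DeRahmSplit

namespace DeRahmSplit

open Filter Topology

lemma uf_const {α : Type*} [Finite α] (f : ℕ → α) : ∃ a, ∀ᶠ n in uf, f n = a := by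
  obtain ⟨a, ha⟩ := (uf.map f).eq_pure_of_finite
  have h : ({a} : Set α) ∈ uf.map f := by rw [ha]; exact Set.mem_singleton a
  exact ⟨a, h⟩

lemma Scale.tendsto_of_le {r : ℕ → ℝ} (h : ∀ n : ℕ, (n : ℝ) + 1 ≤ r n) : Tendsto r atTop atTop :=
  tendsto_atTop_mono (fun n => by linarith [h n]) tendsto_natCast_atTop_atTop

/-- The scale given by a sequence of radii. -/
def Scale.ofLe {r : ℕ → ℝ} (h : ∀ n : ℕ, (n : ℝ) + 1 ≤ r n) : Scale :=
  ⟨r, fun n => (Nat.cast_add_one_pos n).trans_le (h n), Scale.tendsto_of_le h⟩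

variable {N M : ℕ} {G : Fin N → Type} {H : Fin M → Type} [∀ c, Group (G c)]
  [∀ c, PseudoMetricSpace (G c)] [∀ d, Group (H d)] [∀ d, PseudoMetricSpace (H d)] {R : Scale}
  [∀ c, IsIsometricSMul (G c) (G c)] [∀ d, IsIsometricSMul (H d) (H d)]
  {S : Set (Fin N)} {T : Set (Fin M)}
  {K A : ℝ} {F : (∀ c, G c) → ∀ d, H d} {F' : (∀ d, H d) → ∀ c, G c}

lemma exists_ballGood (hG : AsymFam G S) (hH : AsymFam H T) (hF : QPair K A F F') {ε : ℝ}
    (hε : 0 < ε) : ∃ r₀ : ℝ, 0 < r₀ ∧ ∀ o, ∀ r ≥ r₀, ∃ σ : S ≃ T, BallGood F σ o r ε := by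
  by_contra! hcon
  have h1 : ∀ n : ℕ, ∃ o r, (n : ℝ) + 1 ≤ r ∧ ∀ σ : S ≃ T, ¬ BallGood F σ o r ε := fun n => by
    obtain ⟨o, r, h, h'⟩ := hcon (n + 1) (by positivity)
    exact ⟨o, r, h, h'⟩
  choose o r hr hb using h1
  let R : Scale := Scale.ofLe hr
  obtain ⟨Φ, hΦ, hK⟩ := hF.exists_cone' o R
  obtain ⟨-, σ, hσ⟩ := cone_splits (hG.cutFam R) (hH.cutFam R) hK fun _ => Cone.mk AsymSeq.one
  have h2 : ∀ n, ∃ (i : S) (x x' : ∀ c, G c), x i = x' i ∧ dist x (o n) < r n ∧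
      dist x' (o n) < r n ∧ ε * r n < dist (F x (σ i)) (F x' (σ i)) := fun n => by
    by_contra! h
    exact hb n σ fun i x x' e hx hx' => h i x x' e hx hx'
  choose i x x' hi hx hx' hlt using h2
  obtain ⟨i₀, hi₀⟩ := uf_const i
  have hseq : ∀ z : ℕ → ∀ c, G c, (∀ n, dist (z n) (o n) < r n) →
      ∀ c, ∃ B, ∀ n, dist ((o n c)⁻¹ * z n c) 1 ≤ B * R.val n := fun z hz c =>
    ⟨1, fun n => by
      rw [dist_inv_mul_one, one_mul]
      exact (dist_le_pi_dist (z n) (o n) c).trans (hz n).le⟩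
  let X : ∀ c, AsymSeq (G c) R := fun c => ⟨_, hseq x hx c⟩
  let X' : ∀ c, AsymSeq (G c) R := fun c => ⟨_, hseq x' hx' c⟩
  have hX : (fun c => Cone.mk (X c)) i₀ = (fun c => Cone.mk (X' c)) i₀ := by
    refine dist_le_zero.1 (Cone.dist_le (A := 0) (hi₀.mono fun n hn => ?_))
    have e : (X i₀).1 n = (X' i₀).1 n := by
      show (o n i₀)⁻¹ * x n i₀ = (o n i₀)⁻¹ * x' n i₀
      rw [← hn, hi]
    rw [e, dist_self, zero_mul, zero_add]
  have h3 := hσ i₀ (fun c => Cone.mk (X c)) (fun c => Cone.mk (X' c)) hX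
  obtain ⟨y, hy, e⟩ := hΦ X
  obtain ⟨y', hy', e'⟩ := hΦ X'
  rw [e, e'] at h3
  have h4 : ε ≤ dist (Cone.mk (y (σ i₀))) (Cone.mk (y' (σ i₀))) :=
    Cone.le_dist (A := 0) (hi₀.mono fun n hn => by
      rw [hy, hy', sub_zero]
      have e1 : ∀ z : ℕ → ∀ c, G c, (o n * fun c => (o n c)⁻¹ * z n c) = z n := fun z =>
        funext fun c => mul_inv_cancel_left _ _
      refine (hlt n).le.trans ?_
      rw [hn]
      refine le_of_eq (Eq.trans ?_ (dist_mul_left ((F (o n))⁻¹ (σ i₀)) _ _).symm)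
      show _ = dist (F (o n * fun c => (o n c)⁻¹ * x n c) (σ i₀))
        (F (o n * fun c => (o n c)⁻¹ * x' n c) (σ i₀))
      rw [e1, e1])
  dsimp only at h3
  rw [h3, dist_self] at h4
  linarith

lemma ballGood_unique (hH : AsymFam H T) (hF : QPair K A F F') {ε : ℝ} (hε : 4 * K * ε < 1) :
    ∃ r₀ : ℝ, 0 < r₀ ∧ ∀ o, ∀ r ≥ r₀, ∀ σ σ' : S ≃ T, BallGood F σ o r ε →
      BallGood F σ' o r ε → σ = σ' := by
  by_contra! hcon
  have h1 : ∀ n : ℕ, ∃ o r, (n : ℝ) + 1 ≤ r ∧ ∃ σ σ' : S ≃ T, BallGood F σ o r ε ∧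
      BallGood F σ' o r ε ∧ σ ≠ σ' := fun n => by
    obtain ⟨o, r, h, σ, σ', h'⟩ := hcon (n + 1) (by positivity)
    exact ⟨o, r, h, σ, σ', h'⟩
  choose o r hr σ σ' hσ hσ' hne using h1
  let R : Scale := Scale.ofLe hr
  obtain ⟨Φ, hΦ, hK⟩ := hF.exists_cone' o R
  obtain ⟨σ₀, h₀⟩ := uf_const σ
  obtain ⟨σ₁, h₁⟩ := uf_const σ'
  have e : σ₀ = σ₁ := UnitGood.unique hK (hH.cutFam R).cut
    (BallGood.unitGood hΦ (h₀.mono fun n hn => hn ▸ hσ n))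
    (BallGood.unitGood hΦ (h₁.mono fun n hn => hn ▸ hσ' n)) hε
  obtain ⟨n, hn, hn'⟩ := (h₀.and h₁).exists
  exact hne n (by rw [hn, hn', e])

/-- All asymptotic cones split along a common bijection of the factors. -/
lemma exists_common_split (hG : AsymFam G S) (hH : AsymFam H T) (hF : QPair K A F F') :
    ∃ σ : S ≃ T, ∀ (R : Scale) (o : ℕ → ∀ c, G c) (h : ℕ → ∀ d, H d)
      (Φ : (∀ c, Cone (G c) R) ≃ ∀ d, Cone (H d) R),
      Induces (fun n => shiftMap F (h n) (o n)) Φ → BiLip K Φ →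
      ∀ (i : S) (p p' : ∀ c, Cone (G c) R), p i = p' i → Φ p (σ i) = Φ p' (σ i) := by
  have hK0 : 0 < K := zero_lt_one.trans_le hF.one_le
  set ε : ℝ := 1 / (32 * K) with hε
  have hε0 : 0 < ε := by positivity
  have hε4 : 4 * K * (4 * ε) < 1 := by
    rw [hε, show 4 * K * (4 * (1 / (32 * K))) = 1 / 2 by field_simp; norm_num]; norm_num
  obtain ⟨r₁, hr₁, hex⟩ := exists_ballGood hG hH hF hε0
  obtain ⟨r₂, hr₂, huniq⟩ := ballGood_unique (S := S) (G := G) hH hF hε4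
  set r₀ := max r₁ r₂ with hr₀
  have h0 : 0 < r₀ := lt_max_of_lt_left hr₁
  replace hex : ∀ o, ∀ r ≥ r₀, ∃ σ : S ≃ T, BallGood F σ o r ε := fun o r hr =>
    hex o r ((le_max_left _ _).trans hr)
  replace huniq : ∀ o, ∀ r ≥ r₀, ∀ σ σ' : S ≃ T, BallGood F σ o r (4 * ε) →
      BallGood F σ' o r (4 * ε) → σ = σ' := fun o r hr =>
    huniq o r ((le_max_right _ _).trans hr)
  have hpt : ∀ o, ∃ σ : S ≃ T, ∀ r ≥ r₀, BallGood F σ o r (2 * ε) := fun o => by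
    obtain ⟨σ, hσ⟩ := hex o r₀ le_rfl
    have hpow : ∀ a : ℕ, r₀ ≤ 2 ^ a * r₀ := fun a =>
      le_mul_of_one_le_left h0.le (one_le_pow₀ one_le_two)
    have hind : ∀ a : ℕ, BallGood F σ o (2 ^ a * r₀) ε := fun a => by
      induction a with
      | zero => simpa using hσ
      | succ a ih =>
        obtain ⟨σ', hσ'⟩ := hex o (2 ^ (a + 1) * r₀) (hpow _)
        have hpos : 0 < 2 ^ a * r₀ := by positivity
        have h1 : BallGood F σ' o (2 ^ a * r₀) (4 * ε) := hσ'.mono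
          (by rw [dist_self, pow_succ]; linarith) (by rw [pow_succ]; nlinarith)
        have h2 : BallGood F σ o (2 ^ a * r₀) (4 * ε) := ih.mono
          (by rw [dist_self]; linarith) (by nlinarith)
        rwa [huniq o _ (hpow a) σ σ' h2 h1]
    refine ⟨σ, fun r hr => ?_⟩
    obtain ⟨a, ha1, ha2⟩ := exists_nat_pow_near (x := r / r₀) ((one_le_div h0).2 hr) one_lt_two
    rw [le_div_iff₀ h0] at ha1
    rw [div_lt_iff₀ h0] at ha2
    exact (hind (a + 1)).mono (by rw [dist_self, zero_add]; exact ha2.le)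
      (by rw [pow_succ]; nlinarith)
  obtain ⟨σ, hσ⟩ := hpt 1
  have hall : ∀ o, ∀ r ≥ r₀, BallGood F σ o r (2 * ε) := fun o => by
    obtain ⟨σ', hσ'⟩ := hpt o
    set r := max r₀ (dist o 1) with hr
    have h1 : r₀ ≤ r := le_max_left _ _
    have h2 : BallGood F σ o r (4 * ε) := (hσ (2 * r) (by linarith)).mono
      (by linarith [le_max_right r₀ (dist o 1)]) (by nlinarith)
    have h3 : BallGood F σ' o r (4 * ε) := (hσ' r h1).mono (by simp) (by nlinarith)
    rwa [huniq o r h1 σ σ' h2 h3]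
  refine ⟨σ, fun R o h Φ hΦ hK => ?_⟩
  obtain ⟨-, σ', hσ'⟩ := cone_splits (hG.cutFam R) (hH.cutFam R) hK fun _ => Cone.mk AsymSeq.one
  have e : σ = σ' := by
    refine UnitGood.unique (ε := 2 * ε) hK (hH.cutFam R).cut (BallGood.unitGood hΦ ?_)
      (fun i p p' e _ _ => ?_) (by nlinarith)
    · filter_upwards [R.uf_lim.eventually_ge_atTop r₀] with n hn using hall _ _ hn
    · rw [hσ' i p p' e, dist_self]; positivity
  rw [e]
  exact hσ'

/-- Quasi-isometries of products split up to bounded error. -/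
theorem coarse_splits (hG : AsymFam G S) (hH : AsymFam H T) (hF : QPair K A F F') :
    N = M ∧ ∃ σ : S ≃ T, ∃ D : ℝ, 0 ≤ D ∧ ∀ (i : S) (x x' : ∀ c, G c), x i = x' i →
      dist (F x (σ i)) (F x' (σ i)) ≤ D := by
  have hNM : N = M := by
    obtain ⟨Φ, -, hK⟩ := hF.exists_cone' (fun _ => 1) (Scale.ofLe fun n => le_refl ((n : ℝ) + 1))
    exact (cone_splits (hG.cutFam _) (hH.cutFam _) hK fun _ => Cone.mk AsymSeq.one).1
  refine ⟨hNM, ?_⟩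
  obtain ⟨σ, hσ⟩ := exists_common_split hG hH hF
  refine ⟨σ, ?_⟩
  suffices h : ∀ i : S, ∃ D : ℝ, ∀ x x' : ∀ c, G c, x i = x' i →
      dist (F x (σ i)) (F x' (σ i)) ≤ D by
    classical
    choose D hD using h
    refine ⟨∑ i, |D i|, Finset.sum_nonneg fun _ _ => abs_nonneg _, fun i x x' e => ?_⟩
    exact (hD i x x' e).trans ((le_abs_self _).trans
      (Finset.single_le_sum (f := fun i => |D i|) (fun _ _ => abs_nonneg _) (Finset.mem_univ i)))
  intro i
  by_contra! hcon
  choose x x' hxx hlt using fun n : ℕ => hcon (n + 1)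
  let u : ℕ → G i → ∀ c, G c := fun n t => Function.update (x n) i t
  let u' : ℕ → G i → ∀ c, G c := fun n t => Function.update (x' n) i t
  let s : ℕ → G i → ℝ := fun n t => dist (F (u n t) (σ i)) (F (u' n t) (σ i))
  have hK0 : 0 ≤ K := zero_le_one.trans hF.one_le
  have hbdd : ∀ n, BddAbove (Set.range (s n)) := fun n => by
    refine ⟨K * dist (x n) (x' n) + A, ?_⟩
    rintro _ ⟨t, rfl⟩
    refine (dist_le_pi_dist (F (u n t)) (F (u' n t)) (σ i)).trans ((hF.lip _ _).trans ?_)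
    refine add_le_add_left (mul_le_mul_of_nonneg_left ?_ hK0) _
    refine (dist_pi_le_iff dist_nonneg).2 fun c => ?_
    by_cases e : c = i
    · subst e
      simp only [u, u', Function.update_self, dist_self]
      exact dist_nonneg
    · simp only [u, u', Function.update_of_ne e]
      exact dist_le_pi_dist _ _ c
  have hsup : ∀ n : ℕ, (n : ℝ) + 1 ≤ ⨆ t, s n t := fun n => by
    refine (hlt n).le.trans (le_trans (le_of_eq ?_) (le_ciSup (hbdd n) (x n i)))
    have e : u' n (x n i) = x' n := by
      show Function.update (x' n) i (x n i) = _
      rw [hxx, Function.update_eq_self]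
    show _ = dist (F (Function.update (x n) i (x n i)) (σ i)) (F (u' n (x n i)) (σ i))
    rw [e, Function.update_eq_self]
  let R : Scale := Scale.ofLe hsup
  have hR : ∀ n, R.val n = ⨆ t, s n t := fun _ => rfl
  have ht : ∀ n, ∃ t, R.val n / 2 < s n t := fun n =>
    exists_lt_of_lt_ciSup (half_lt_self (R.pos n))
  choose t ht using ht
  have hle : ∀ n τ, s n τ ≤ R.val n := fun n τ => le_ciSup (hbdd n) τ
  let o : ℕ → ∀ c, G c := fun n => u n (t n)
  let o' : ℕ → ∀ c, G c := fun n => u' n (t n)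
  let h' : ℕ → ∀ d, H d := fun n => Function.update (F (o' n))⁻¹ (σ i) (F (o n) (σ i))⁻¹
  obtain ⟨Φ, hΦ, hK⟩ := hF.exists_cone' o R
  obtain ⟨Φ', hΦ', hK'⟩ := hF.exists_cone (R := R) o' h' (B := 1) fun n => by
    refine (dist_pi_le_iff (by rw [one_mul]; exact (R.pos n).le)).2 fun d => ?_
    by_cases e : d = σ i
    · subst e
      simp only [h', Pi.mul_apply, Function.update_self, Pi.one_apply]
      rw [dist_inv_mul_one, one_mul, dist_comm]
      exact hle n (t n)
    · simp only [h', Pi.mul_apply, Function.update_of_ne e, Pi.one_apply, Pi.inv_apply,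
        inv_mul_cancel, dist_self, one_mul]
      exact (R.pos n).le
  have hmul : ∀ n τ, o n * Function.update (1 : ∀ c, G c) i τ = u n (t n * τ) := fun n τ => by
    funext c
    by_cases e : c = i
    · subst e; simp [o, u]
    · simp [o, u, Function.update_of_ne e]
  have hmul' : ∀ n τ, o' n * Function.update (1 : ∀ c, G c) i τ = u' n (t n * τ) := fun n τ => by
    funext c
    by_cases e : c = i
    · subst e; simp [o', u']
    · simp [o', u', Function.update_of_ne e]
  let p : ∀ c, Cone (G c) R := fun _ => Cone.mk AsymSeq.one
  have hupd : ∀ z : AsymSeq (G i) R, ∃ y y' : AsymSeq (H (σ i)) R,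
      Φ (Function.update p i (Cone.mk z)) (σ i) = Cone.mk y ∧
      Φ' (Function.update p i (Cone.mk z)) (σ i) = Cone.mk y' ∧
      ∀ n, dist (y.1 n) (y'.1 n) = s n (t n * z.1 n) := fun z => by
    let Z : ∀ c, AsymSeq (G c) R := Function.update (fun _ => AsymSeq.one) i z
    have hZ : (fun c => Cone.mk (Z c)) = Function.update p i (Cone.mk z) := by
      funext c
      by_cases e : c = i
      · subst e; simp [Z]
      · simp [Z, p, Function.update_of_ne e]
    have hZn : ∀ n, (fun c => (Z c).1 n) = Function.update (1 : ∀ c, G c) i (z.1 n) := fun n => by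
      funext c
      by_cases e : c = i
      · subst e; simp [Z]
      · have h1 : Z c = AsymSeq.one := Function.update_of_ne e _ _
        rw [h1, Function.update_of_ne e]
        rfl
    obtain ⟨y, hy, e⟩ := hΦ Z
    obtain ⟨y', hy', e'⟩ := hΦ' Z
    rw [hZ] at e e'
    refine ⟨y (σ i), y' (σ i), by rw [e], by rw [e'], fun n => ?_⟩
    rw [hy, hy', hZn]
    show dist ((F (o n))⁻¹ (σ i) * F (o n * _) (σ i)) (h' n (σ i) * F (o' n * _) (σ i)) = _
    rw [hmul, hmul', Pi.inv_apply]
    simp only [h', Function.update_self]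
    rw [dist_mul_left]
  have heq := cone_split_eq (hG.cutFam R) (hH.cutFam R) hK hK' σ (hσ R _ _ Φ hΦ hK)
    (hσ R _ _ Φ' hΦ' hK') p i (D := 1) fun ξ => by
      obtain ⟨y, y', e, e', hd⟩ := hupd ξ.rep
      rw [Cone.mk_rep] at e e'
      rw [e, e']
      exact Cone.dist_le (A := 0) (.of_forall fun n => by
        rw [hd, one_mul, add_zero]; exact hle n _)
  obtain ⟨y, y', e, e', hd⟩ := hupd AsymSeq.one
  have hp : Function.update p (i : Fin N) (Cone.mk AsymSeq.one) = p := Function.update_eq_self _ _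
  rw [hp] at e e'
  rw [e, e'] at heq
  have h1 : (1 / 2 : ℝ) ≤ dist (Cone.mk y) (Cone.mk y') :=
    Cone.le_dist (A := 0) (.of_forall fun n => by
      rw [hd]
      have : t n * (AsymSeq.one : AsymSeq (G i) R).1 n = t n := mul_one _
      rw [this]
      linarith [ht n])
  rw [heq, dist_self] at h1
  norm_num at h1

end DeRahmSplit

namespace DeRahmSplit

open Classical in
/-- Remove a letter from the start of a word, after moving it there by commutations. -/
def rem {V : Type} (Γ : SimpleGraph V) (a : V × Bool) : List (V × Bool) → Option (List (V × Bool))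
  | [] => none
  | b :: w => if b = a then some w else if Γ.Adj a.1 b.1 then (rem Γ a w).map (b :: ·) else none

/-- Words equal up to commutations. -/
inductive Tr {V : Type} (Γ : SimpleGraph V) : List (V × Bool) → List (V × Bool) → Prop
  | refl (w) : Tr Γ w w
  | cons (a) {w w'} : Tr Γ w w' → Tr Γ (a :: w) (a :: w')
  | swap {a b : V × Bool} (w) : Γ.Adj a.1 b.1 → Tr Γ (a :: b :: w) (b :: a :: w)
  | trans {w w' w''} : Tr Γ w w' → Tr Γ w' w'' → Tr Γ w w''

/-- The inverse letter. -/
def inv {V : Type} (a : V × Bool) : V × Bool := (a.1, !a.2)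

variable {V : Type} {Γ : SimpleGraph V} {a b : V × Bool} {w w' : List (V × Bool)}

@[simp] lemma inv_inv : inv (inv a) = a := by simp [inv]

lemma ne_of_adj (h : Γ.Adj a.1 b.1) : a ≠ b := fun e => Γ.loopless.irrefl _ (e ▸ h)

variable (Γ) in
/-- Words without cancellation up to commutations. -/
def Red : List (V × Bool) → Prop
  | [] => True
  | a :: w => rem Γ (inv a) w = none ∧ Red w

lemma Red.cons (hw : Red Γ w) (h : rem Γ (inv a) w = none) : Red Γ (a :: w) := ⟨h, hw⟩

lemma rem_self : rem Γ a (a :: w) = some w := by simp [rem]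

lemma rem_adj (h : Γ.Adj a.1 b.1) : rem Γ a (b :: w) = (rem Γ a w).map (b :: ·) := by
  rw [rem, if_neg (ne_of_adj h).symm, if_pos h]

lemma rem_of_not (h : ¬ Γ.Adj a.1 b.1) (h' : b ≠ a) : rem Γ a (b :: w) = none := by
  rw [rem, if_neg h', if_neg h]

lemma Tr.symm (h : Tr Γ w w') : Tr Γ w' w := by
  induction h with
  | refl w => exact .refl w
  | cons a _ ih => exact .cons a ih
  | swap w h => exact .swap w h.symm
  | trans _ _ h1 h2 => exact h2.trans h1

lemma Tr.length (h : Tr Γ w w') : w.length = w'.length := by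
  induction h with
  | refl w => rfl
  | cons a _ ih => simp [ih]
  | swap w h => rfl
  | trans _ _ h1 h2 => exact h1.trans h2

lemma rem_tr {r : List (V × Bool)} (h : rem Γ a w = some r) : Tr Γ w (a :: r) := by
  induction w generalizing r with
  | nil => simp [rem] at h
  | cons b w ih =>
    by_cases h1 : b = a
    · subst h1
      rw [rem_self, Option.some_inj] at h
      subst h
      exact .refl _
    · by_cases h2 : Γ.Adj a.1 b.1
      · rw [rem_adj h2, Option.map_eq_some_iff] at h
        obtain ⟨r', h3, rfl⟩ := h
        exact (Tr.cons b (ih h3)).trans (.swap _ h2.symm)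
      · rw [rem_of_not h2 h1] at h
        simp at h

lemma Tr.rem_none (h : Tr Γ w w') (a : V × Bool) : Option.Rel (Tr Γ) (rem Γ a w) (rem Γ a w') := by
  have hrefl : ∀ o : Option (List (V × Bool)), Option.Rel (Tr Γ) o o := fun o => by
    cases o
    · exact .none
    · exact .some (.refl _)
  have hmap : ∀ {o o' : Option (List (V × Bool))} (b), Option.Rel (Tr Γ) o o' →
      Option.Rel (Tr Γ) (o.map (b :: ·)) (o'.map (b :: ·)) := fun b h => by
    cases h with
    | none => exact .none
    | some h => exact .some (.cons b h)
  induction h with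
  | refl w => exact hrefl _
  | @cons b w w' h ih =>
    by_cases h1 : b = a
    · subst h1; rw [rem_self, rem_self]; exact .some h
    · by_cases h2 : Γ.Adj a.1 b.1
      · rw [rem_adj h2, rem_adj h2]; exact hmap b ih
      · rw [rem_of_not h2 h1, rem_of_not h2 h1]; exact .none
  | @swap b c w h =>
    by_cases h1 : b = a
    · subst h1; rw [rem_self, rem_adj h, rem_self]; exact .some (.refl _)
    by_cases h1' : c = a
    · subst h1'; rw [rem_self, rem_adj h.symm, rem_self]; exact .some (.refl _)
    by_cases h2 : Γ.Adj a.1 b.1 <;> by_cases h3 : Γ.Adj a.1 c.1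
    · rw [rem_adj h2, rem_adj h3, rem_adj h3, rem_adj h2]
      cases rem Γ a w with
      | none => exact .none
      | some r => exact .some (.swap _ h)
    · rw [rem_adj h2, rem_of_not h3 h1', rem_of_not h3 h1']; exact .none
    · rw [rem_of_not h2 h1, rem_adj h3, rem_of_not h2 h1]; exact .none
    · rw [rem_of_not h2 h1, rem_of_not h3 h1']; exact .none
  | trans _ _ h1 h2 =>
    revert h1 h2
    generalize rem Γ a _ = x
    generalize rem Γ a _ = y
    generalize rem Γ a _ = z
    intro h1 h2
    cases h1 with
    | none => exact h2
    | some h1 => cases h2 with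
      | some h2 => exact .some (h1.trans h2)

lemma Tr.rem_eq_none (h : Tr Γ w w') : rem Γ a w = none ↔ rem Γ a w' = none := by
  have := h.rem_none a
  revert this
  generalize rem Γ a w = x
  generalize rem Γ a w' = y
  intro this
  cases this <;> simp

lemma Tr.rem_some {r : List (V × Bool)} (h : Tr Γ w w') (hr : rem Γ a w = some r) :
    ∃ r', rem Γ a w' = some r' ∧ Tr Γ r r' := by
  have := h.rem_none a
  rw [hr] at this
  revert this
  generalize rem Γ a w' = y
  intro this
  cases this with
  | some h => exact ⟨_, rfl, h⟩

lemma Tr.red (h : Tr Γ w w') : Red Γ w ↔ Red Γ w' := by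
  induction h with
  | refl w => rfl
  | @cons b w w' h ih => exact and_congr h.rem_eq_none ih
  | @swap b c w h =>
    simp only [Red]
    rw [rem_adj (a := inv b) (b := c) h, rem_adj (a := inv c) (b := b) h.symm,
      Option.map_eq_none_iff, Option.map_eq_none_iff]
    tauto
  | trans _ _ h1 h2 => exact h1.trans h2

lemma Red.of_rem {r : List (V × Bool)} (h : Red Γ w) (hr : rem Γ a w = some r) :
    Red Γ (a :: r) := (rem_tr hr).red.1 h

variable (Γ) in
/-- Reduced words up to commutations. -/
def Trace : Type := Quot fun w w' : {w : List (V × Bool) // Red Γ w} => Tr Γ w.1 w'.1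

/-- The class of a reduced word. -/
def Trace.mk (w : List (V × Bool)) (h : Red Γ w) : Trace Γ := Quot.mk _ ⟨w, h⟩

lemma Trace.sound (h : Tr Γ w w') (hw : Red Γ w) (hw' : Red Γ w') : mk w hw = mk w' hw' :=
  Quot.sound h

lemma Trace.ind {p : Trace Γ → Prop} (h : ∀ w (hw : Red Γ w), p (mk w hw)) (x : Trace Γ) : p x :=
  Quot.ind (fun ⟨w, hw⟩ => h w hw) x

open Classical in
variable (Γ) in
/-- Left multiplication of a trace by a letter. -/
def push (a : V × Bool) : Trace Γ → Trace Γ := Quot.lift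
  (fun w => if h : rem Γ (inv a) w.1 = none then Trace.mk (a :: w.1) (w.2.cons h)
    else Trace.mk ((rem Γ (inv a) w.1).get (Option.isSome_iff_ne_none.2 h))
      (w.2.of_rem (Option.some_get _).symm).2)
  (by
    rintro ⟨w, hw⟩ ⟨w', hw'⟩ h
    dsimp only at h ⊢
    by_cases h1 : rem Γ (inv a) w = none
    · rw [dif_pos h1, dif_pos (h.rem_eq_none.1 h1)]
      exact Trace.sound (.cons a h) _ _
    · rw [dif_neg h1, dif_neg (fun h2 => h1 (h.rem_eq_none.2 h2))]
      refine Trace.sound ?_ _ _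
      obtain ⟨r, hr, h3⟩ := h.rem_some (Option.some_get (Option.isSome_iff_ne_none.2 h1)).symm
      simpa only [hr, Option.get_some] using h3)

lemma push_none (hw : Red Γ w) (h : rem Γ (inv a) w = none) :
    push Γ a (Trace.mk w hw) = Trace.mk (a :: w) (hw.cons h) := dif_pos h

lemma push_some {r : List (V × Bool)} (hw : Red Γ w) (h : rem Γ (inv a) w = some r) :
    push Γ a (Trace.mk w hw) = Trace.mk r (hw.of_rem h).2 := by
  refine (dif_neg (by simp [h])).trans (Trace.sound ?_ _ _)
  simp only [h, Option.get_some]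
  exact .refl _

lemma push_inv_push (x : Trace Γ) : push Γ (inv a) (push Γ a x) = x := by
  induction x using Trace.ind with
  | h w hw =>
  rcases h : rem Γ (inv a) w with _ | r
  · rw [push_none hw h, push_some (r := w) _ (by rw [inv_inv]; exact rem_self)]
  · have h1 := hw.of_rem h
    rw [push_some hw h, push_none _ h1.1]
    exact Trace.sound (rem_tr h).symm _ _

lemma push_comm (hab : Γ.Adj a.1 b.1) (x : Trace Γ) :
    push Γ a (push Γ b x) = push Γ b (push Γ a x) := by
  induction x using Trace.ind with
  | h w hw =>
  have key : ∀ {a b : V × Bool}, Γ.Adj a.1 b.1 → ∀ {r}, rem Γ (inv a) w = none →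
      rem Γ (inv b) w = some r → push Γ a (push Γ b (Trace.mk w hw)) =
        push Γ b (push Γ a (Trace.mk w hw)) := fun {a b} hab {r} h1 h2 => by
    have h3 := (rem_tr h2).rem_eq_none.1 h1
    rw [rem_adj (a := inv a) (b := inv b) hab, Option.map_eq_none_iff] at h3
    rw [push_some hw h2, push_none _ h3, push_none hw h1,
      push_some (r := a :: r) _ (by rw [rem_adj (a := inv b) (b := a) hab.symm, h2]; rfl)]
  rcases h1 : rem Γ (inv a) w with _ | r <;> rcases h2 : rem Γ (inv b) w with _ | s
  · rw [push_none hw h1, push_none hw h2, push_none _ (by rw [rem_adj (a := inv a) (b := b) hab, h1]; rfl),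
      push_none _ (by rw [rem_adj (a := inv b) (b := a) hab.symm, h2]; rfl)]
    exact Trace.sound (.swap _ hab) _ _
  · exact key hab h1 h2
  · exact (key hab.symm h2 h1).symm
  · obtain ⟨t, h3, h4⟩ := (rem_tr h1).rem_some h2
    rw [rem_adj (a := inv b) (b := inv a) hab.symm, Option.map_eq_some_iff] at h3
    obtain ⟨q, h5, rfl⟩ := h3
    obtain ⟨t', h6, h7⟩ := h4.symm.rem_some (a := inv a) rem_self
    rw [push_some hw h1, push_some hw h2, push_some _ h5, push_some _ h6]
    exact Trace.sound h7.symm _ _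

end DeRahmSplit

namespace DeRahmSplit

section
variable {V : Type} (Γ : SimpleGraph V)

/-- The group element of a letter. -/
def gen (a : V × Bool) : Raag Γ := if a.2 then raagGen Γ a.1 else (raagGen Γ a.1)⁻¹

/-- The group element of a word. -/
def val (w : List (V × Bool)) : Raag Γ := (w.map (gen Γ)).prod

/-- Left multiplication by a letter as a permutation of traces. -/
def pushPerm (a : V × Bool) : Equiv.Perm (Trace Γ) where
  toFun := push Γ a
  invFun := push Γ (inv a)
  left_inv := push_inv_push
  right_inv x := by simpa using push_inv_push (a := inv a) x

/-- The action on traces by left multiplication. -/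
def act : Raag Γ →* Equiv.Perm (Trace Γ) := PresentedGroup.toGroup (f := fun v => pushPerm Γ (v, true)) (by
  rintro r ⟨x, y, h, rfl⟩
  simp only [map_mul, map_inv, FreeGroup.lift_apply_of]
  rw [mul_inv_eq_one, mul_inv_eq_iff_eq_mul]
  ext t
  exact push_comm (a := (x, true)) (b := (y, true)) h t)

end

variable {V : Type} {Γ : SimpleGraph V} {a b : V × Bool} {w w' : List (V × Bool)}

@[simp] lemma val_nil : val Γ [] = 1 := rfl

@[simp] lemma val_cons : val Γ (a :: w) = gen Γ a * val Γ w := by simp [val]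

@[simp] lemma val_append : val Γ (w ++ w') = val Γ w * val Γ w' := by simp [val]

@[simp] lemma gen_inv : gen Γ (inv a) = (gen Γ a)⁻¹ := by
  obtain ⟨x, _ | _⟩ := a <;> simp [gen, inv]

lemma raagGen_commute {x y : V} (h : Γ.Adj x y) : Commute (raagGen Γ x) (raagGen Γ y) := by
  have := PresentedGroup.one_of_mem (rels := raagRels Γ) ⟨x, y, h, rfl⟩
  simp only [map_mul, map_inv] at this
  rw [mul_inv_eq_one, mul_inv_eq_iff_eq_mul] at this
  exact this

lemma gen_commute (h : Γ.Adj a.1 b.1) : Commute (gen Γ a) (gen Γ b) := by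
  have := raagGen_commute h
  obtain ⟨x, _ | _⟩ := a <;> obtain ⟨y, _ | _⟩ := b <;> simpa [gen] using this

lemma Tr.val (h : Tr Γ w w') : val Γ w = val Γ w' := by
  induction h with
  | refl w => rfl
  | cons a _ ih => simp [ih]
  | swap w h => simp [← mul_assoc, (gen_commute h).eq]
  | trans _ _ h1 h2 => exact h1.trans h2

/-- The group element of a trace. -/
def Trace.ev : Trace Γ → Raag Γ := Quot.lift (fun w => DeRahmSplit.val Γ w.1) fun _ _ h => h.val

/-- The length of a trace. -/
def Trace.len : Trace Γ → ℕ := Quot.lift (fun w => w.1.length) fun _ _ h => h.length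

lemma ev_push (x : Trace Γ) : (push Γ a x).ev = gen Γ a * x.ev := by
  induction x using Trace.ind with
  | h w hw =>
  rcases h : rem Γ (inv a) w with _ | r
  · rw [push_none hw h]; exact val_cons
  · rw [push_some hw h]
    have := (rem_tr h).val
    rw [val_cons, gen_inv, eq_inv_mul_iff_mul_eq] at this
    exact this.symm

lemma act_gen (x : Trace Γ) : act Γ (gen Γ a) x = push Γ a x := by
  obtain ⟨v, _ | _⟩ := a
  · have : gen Γ (v, false) = (raagGen Γ v)⁻¹ := rfl
    rw [this, map_inv, raagGen, act, PresentedGroup.toGroup.of]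
    rfl
  · have : gen Γ (v, true) = raagGen Γ v := rfl
    rw [this, raagGen, act, PresentedGroup.toGroup.of]
    rfl

/-- Induction over the group by left multiplication by letters. -/
lemma raag_ind {p : Raag Γ → Prop} (h1 : p 1) (h : ∀ a g, p g → p (gen Γ a * g)) (g : Raag Γ) :
    p g := by
  have key : ∀ g : Raag Γ, ∀ h, p h → p (g * h) := by
    intro g
    have hg : g ∈ Subgroup.closure (Set.range (PresentedGroup.of (rels := raagRels Γ))) := by
      rw [PresentedGroup.closure_range_of]; trivial
    induction hg using Subgroup.closure_induction_left with
    | one => simp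
    | mul_left x hx y _ ih =>
      obtain ⟨v, rfl⟩ := hx
      exact fun k hk => by rw [mul_assoc]; exact h (v, true) _ (ih k hk)
    | inv_mul_cancel x hx y _ ih =>
      obtain ⟨v, rfl⟩ := hx
      exact fun k hk => by rw [mul_assoc]; exact h (v, false) _ (ih k hk)
  simpa using key g 1 h1

variable (Γ) in
/-- The word length. -/
def norm (g : Raag Γ) : ℕ := (act Γ g (Trace.mk [] trivial)).len

lemma act_val (hw : Red Γ w) : act Γ (val Γ w) (Trace.mk [] trivial) = Trace.mk w hw := by
  induction w with
  | nil => simp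
  | cons a w ih =>
    rw [val_cons, map_mul, Equiv.Perm.mul_apply, ih hw.2, act_gen, push_none hw.2 hw.1]

lemma norm_val (hw : Red Γ w) : norm Γ (val Γ w) = w.length := by
  rw [norm, act_val hw]; rfl

lemma exists_red (g : Raag Γ) : ∃ w, Red Γ w ∧ val Γ w = g := by
  have key : (act Γ g (Trace.mk [] trivial)).ev = g := by
    induction g using raag_ind with
    | h1 => rw [map_one]; rfl
    | h a g ih => rw [map_mul, Equiv.Perm.mul_apply, act_gen, ev_push, ih]
  generalize act Γ g (Trace.mk [] trivial) = x at key
  induction x using Trace.ind with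
  | h w hw => exact ⟨w, hw, key⟩

lemma norm_gen_mul (hw : Red Γ w) : (Red Γ (a :: w) ∧ norm Γ (gen Γ a * val Γ w) = w.length + 1) ∨
    ∃ r, rem Γ (inv a) w = some r ∧ norm Γ (gen Γ a * val Γ w) + 1 = w.length := by
  rcases h : rem Γ (inv a) w with _ | r
  · refine .inl ⟨hw.cons h, ?_⟩
    rw [← val_cons, norm_val (hw.cons h)]; rfl
  · refine .inr ⟨r, rfl, ?_⟩
    have h1 := (rem_tr h).val
    rw [val_cons, gen_inv] at h1
    rw [h1, mul_inv_cancel_left, norm_val (hw.of_rem h).2, (rem_tr h).length]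
    rfl

lemma norm_gen_mul_le (g : Raag Γ) : norm Γ (gen Γ a * g) ≤ norm Γ g + 1 := by
  obtain ⟨w, hw, rfl⟩ := exists_red g
  rw [norm_val hw]
  rcases norm_gen_mul (a := a) hw with h | ⟨r, _, h⟩ <;> omega

lemma norm_val_mul_le (g : Raag Γ) : norm Γ (val Γ w * g) ≤ w.length + norm Γ g := by
  induction w with
  | nil => simp
  | cons a w ih =>
    rw [val_cons, mul_assoc, List.length_cons]
    have := norm_gen_mul_le (a := a) (val Γ w * g)
    omega

@[simp] lemma norm_one : norm Γ (1 : Raag Γ) = 0 := norm_val (w := []) trivial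

lemma norm_mul_le (g h : Raag Γ) : norm Γ (g * h) ≤ norm Γ g + norm Γ h := by
  obtain ⟨w, hw, rfl⟩ := exists_red g
  rw [norm_val hw]
  exact norm_val_mul_le h

lemma norm_val_le : norm Γ (val Γ w) ≤ w.length := by
  simpa using norm_val_mul_le (Γ := Γ) (w := w) 1

lemma val_inv (w : List (V × Bool)) : (val Γ w)⁻¹ = val Γ (w.map inv).reverse := by
  induction w with
  | nil => simp
  | cons a w ih => simp [ih]

@[simp] lemma norm_inv (g : Raag Γ) : norm Γ g⁻¹ = norm Γ g := by
  have key : ∀ g : Raag Γ, norm Γ g⁻¹ ≤ norm Γ g := fun g => by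
    obtain ⟨w, hw, rfl⟩ := exists_red g
    rw [norm_val hw, val_inv]
    exact norm_val_le.trans (by simp)
  exact le_antisymm (key g) (by simpa using key g⁻¹)

lemma wordDist_eq {G : Type*} [Group G] (j : G →* Raag Γ) (hj : Function.Injective j) {S : Set G}
    (hS : ∀ s ∈ S, ∃ v, j s = raagGen Γ v) {x y : G} (hw : val Γ w = j (x⁻¹ * y))
    (hl : w.length ≤ norm Γ (j (x⁻¹ * y))) (hwS : ∀ a ∈ w, ∃ s ∈ S, j s = raagGen Γ a.1) :
    wordDist S x y = norm Γ (j (x⁻¹ * y)) := by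
  refine IsLeast.csInf_eq ⟨?_, ?_⟩
  · have key : ∃ l : List G, (∀ x ∈ l, x ∈ S ∨ x⁻¹ ∈ S) ∧ l.length = w.length ∧
        j l.prod = val Γ w := by
      clear hw hl
      induction w with
      | nil => exact ⟨[], by simp⟩
      | cons a w ih =>
        obtain ⟨l, h1, h2, h3⟩ := ih fun b hb => hwS b (List.mem_cons_of_mem _ hb)
        obtain ⟨s, hs, h⟩ := hwS a List.mem_cons_self
        obtain ⟨v, _ | _⟩ := a
        · exact ⟨s⁻¹ :: l, by simpa [hs] using h1, by simp [h2], by simp [h3, h, gen]⟩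
        · exact ⟨s :: l, by simpa [hs] using h1, by simp [h2], by simp [h3, h, gen]⟩
    obtain ⟨l, h1, h2, h3⟩ := key
    refine ⟨l, ⟨h1, ?_⟩, ?_⟩
    · rw [hj (h3.trans hw), mul_inv_cancel_left]
    · simp only [h2, Nat.cast_inj]
      exact hl.antisymm (hw ▸ norm_val_le)
  · rintro _ ⟨l, ⟨hl, h⟩, rfl⟩
    rw [← h, inv_mul_cancel_left]
    simp only [Nat.cast_le]
    clear h
    induction l with
    | nil => simp
    | cons z l ih =>
      have hz : ∃ a, j z = gen Γ a := by
        rcases hl z List.mem_cons_self with h | h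
        · obtain ⟨v, hv⟩ := hS _ h
          exact ⟨(v, true), hv⟩
        · obtain ⟨v, hv⟩ := hS _ h
          exact ⟨(v, false), by rw [map_inv, inv_eq_iff_eq_inv] at hv; simp [gen, hv]⟩
      obtain ⟨a, ha⟩ := hz
      rw [List.prod_cons, map_mul, ha]
      exact (norm_gen_mul_le _).trans
        (Nat.succ_le_succ (ih fun x hx => hl x (List.mem_cons_of_mem _ hx)))

lemma raagDist_eq (x y : Raag Γ) : raagDist Γ x y = norm Γ (x⁻¹ * y) := by
  obtain ⟨w, hw, h⟩ := exists_red (x⁻¹ * y)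
  exact wordDist_eq (MonoidHom.id _) Function.injective_id (by rintro _ ⟨v, rfl⟩; exact ⟨v, rfl⟩) h
    (by simp [← h, norm_val hw]) fun a _ => ⟨_, ⟨a.1, rfl⟩, rfl⟩

instance : PseudoMetricSpace (Raag Γ) where
  dist x y := norm Γ (x⁻¹ * y)
  dist_self x := by simp
  dist_comm x y := by rw [← norm_inv]; simp
  dist_triangle x y z := by
    have := norm_mul_le (x⁻¹ * y) (y⁻¹ * z)
    rw [mul_assoc, mul_inv_cancel_left] at this
    exact_mod_cast this

lemma dist_eq_norm (x y : Raag Γ) : dist x y = norm Γ (x⁻¹ * y) := rfl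

lemma dist_one (x : Raag Γ) : dist x 1 = norm Γ x := by simp [dist_eq_norm]

instance : IsIsometricSMul (Raag Γ) (Raag Γ) :=
  ⟨fun c => Isometry.of_dist_eq fun x y => by simp [dist_eq_norm, mul_assoc]⟩

/-- Left descents. -/
def Des (a : V × Bool) (g : Raag Γ) : Prop := norm Γ ((gen Γ a)⁻¹ * g) + 1 = norm Γ g

lemma des_val (hw : Red Γ w) : Des a (val Γ w) ↔ rem Γ a w ≠ none := by
  have := norm_gen_mul (a := inv a) hw
  rw [inv_inv, gen_inv] at this
  rw [Des, norm_val hw]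
  rcases this with ⟨h1, h⟩ | ⟨r, h1, h⟩
  · have h2 := h1.1
    rw [inv_inv] at h2
    simp only [h2, ne_eq, not_true, iff_false]
    omega
  · simp [h1, h]

lemma norm_gen_mul_or (a : V × Bool) (g : Raag Γ) :
    norm Γ (gen Γ a * g) = norm Γ g + 1 ∨ Des (inv a) g := by
  obtain ⟨w, hw, rfl⟩ := exists_red g
  rw [des_val hw, norm_val hw]
  rcases norm_gen_mul (a := a) hw with h | ⟨r, h, _⟩
  · exact .inl h.2
  · exact .inr (by simp [h])

lemma Des.not (h : Des (inv a) (g : Raag Γ)) : norm Γ (gen Γ a * g) ≠ norm Γ g + 1 := by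
  rw [Des, gen_inv, _root_.inv_inv] at h
  omega

lemma des_gen_mul {g : Raag Γ} (h : norm Γ (gen Γ a * g) = norm Γ g + 1) :
    Des b (gen Γ a * g) ↔ b = a ∨ Γ.Adj a.1 b.1 ∧ Des b g := by
  obtain ⟨w, hw, rfl⟩ := exists_red g
  rcases norm_gen_mul (a := a) hw with h1 | ⟨r, _, h1⟩
  · rw [← val_cons, des_val h1.1, des_val hw]
    by_cases h2 : b = a
    · simp [h2, rem_self]
    · by_cases h3 : Γ.Adj b.1 a.1
      · simp [rem_adj h3, h2, h3.symm]
      · simp [rem_of_not h3 (Ne.symm h2), h2, Γ.adj_comm a.1, h3]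
  · rw [norm_val hw] at h; omega

lemma Des.adj {g : Raag Γ} (ha : Des a g) (hb : Des b g) (hab : b ≠ a) : Γ.Adj a.1 b.1 := by
  have h : norm Γ (gen Γ a * ((gen Γ a)⁻¹ * g)) = norm Γ ((gen Γ a)⁻¹ * g) + 1 := by
    rw [mul_inv_cancel_left]; exact ha.symm
  have := des_gen_mul (b := b) h
  rw [mul_inv_cancel_left] at this
  exact ((this.1 hb).resolve_left hab).1

lemma exists_des {g : Raag Γ} (h : norm Γ g ≠ 0) : ∃ a, Des a g := by
  obtain ⟨w, hw, rfl⟩ := exists_red g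
  cases w with
  | nil => simp at h
  | cons a w => exact ⟨a, (des_val hw).2 (by simp [rem_self])⟩

lemma eq_one_of_norm {g : Raag Γ} (h : norm Γ g = 0) : g = 1 := by
  obtain ⟨w, hw, rfl⟩ := exists_red g
  rw [norm_val hw, List.length_eq_zero_iff] at h
  simp [h]

lemma norm_inv_mul {x y : Raag Γ} (h : ∀ a, Des a x → ¬ Des a y) :
    norm Γ (x⁻¹ * y) = norm Γ x + norm Γ y := by
  obtain ⟨w, hw, rfl⟩ := exists_red x
  induction w generalizing y with
  | nil => simp
  | cons a w ih =>
    have hn : norm Γ (gen Γ a * val Γ w) = norm Γ (val Γ w) + 1 := by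
      rw [← val_cons, norm_val hw, norm_val hw.2]; rfl
    have ha : Des a (val Γ (a :: w)) := (des_val hw).2 (by simp [rem_self])
    have h1 : norm Γ (gen Γ (inv a) * y) = norm Γ y + 1 :=
      (norm_gen_mul_or (inv a) y).resolve_right (by rw [inv_inv]; exact h a ha)
    have := ih (y := gen Γ (inv a) * y) hw.2 (fun b hb hb' => by
      rcases (des_gen_mul h1).1 hb' with rfl | ⟨hadj, hd⟩
      · exact (des_val hw.2).1 hb hw.1
      · exact h b (by rw [val_cons]; exact (des_gen_mul hn).2 (.inr ⟨hadj, hb⟩)) hd)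
    rw [val_cons, hn, mul_inv_rev, mul_assoc, ← gen_inv, this, h1]
    omega

end DeRahmSplit

namespace DeRahmSplit

variable {V : Type} {Γ : SimpleGraph V} {a b : V × Bool} {l m : List (V × Bool)}

variable (Γ) in
lemma raag_geod : DGeod (Raag Γ) := fun x => by
  obtain ⟨w, hw, rfl⟩ := exists_red x
  refine ⟨fun n => val Γ (w.take n), w.length, rfl, by simp, by rw [dist_one, norm_val hw], ?_⟩
  have key : ∀ i j : ℕ, i ≤ j → dist (val Γ (w.take i)) (val Γ (w.take j)) ≤ |(i : ℝ) - j| := by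
    intro i j h
    obtain ⟨n, rfl⟩ := Nat.exists_eq_add_of_le h
    rw [dist_eq_norm, List.take_add, val_append, inv_mul_cancel_left, abs_sub_comm, Nat.cast_add,
      add_sub_cancel_left, Nat.abs_cast]
    exact_mod_cast norm_val_le.trans (List.length_take_le _ _)
  intro i j
  rcases le_total i j with h | h
  · exact key i j h
  · rw [dist_comm, abs_sub_comm]; exact key j i h

variable (Γ) in
/-- Lists of pairwise commuting letters. -/
def Clique (l : List (V × Bool)) : Prop := l.Pairwise fun a b => Γ.Adj a.1 b.1

lemma Clique.perm (hl : Clique Γ l) (h : l.Perm m) : val Γ l = val Γ m :=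
  (h.map _).prod_eq' (List.pairwise_map.2 (hl.imp fun h => gen_commute h))

lemma Clique.adj (hl : Clique Γ l) (ha : a ∈ l) (hb : b ∈ l) (hab : a ≠ b) : Γ.Adj a.1 b.1 :=
  have : Std.Symm fun a b : V × Bool => Γ.Adj a.1 b.1 := ⟨fun _ _ h => h.symm⟩
  List.Pairwise.forall hl ha hb hab

lemma Clique.mul_comm (h : ∀ b ∈ l, Γ.Adj a.1 b.1) : val Γ l * gen Γ a = gen Γ a * val Γ l := by
  induction l with
  | nil => simp
  | cons c l ih =>
    rw [val_cons, mul_assoc, ih fun b hb => h b (List.mem_cons_of_mem _ hb), ← mul_assoc,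
      ← (gen_commute (h c List.mem_cons_self)).eq, mul_assoc]

lemma des_clique_mul {y : Raag Γ} (hl : Clique Γ l)
    (h : norm Γ (val Γ l * y) = l.length + norm Γ y) :
    Des b (val Γ l * y) ↔ b ∈ l ∨ (∀ a ∈ l, Γ.Adj a.1 b.1) ∧ Des b y := by
  induction l with
  | nil => simp
  | cons a l ih =>
    have h1 := norm_val_mul_le (w := l) y
    have h2 := norm_gen_mul_le (a := a) (val Γ l * y)
    rw [val_cons, mul_assoc, List.length_cons] at h
    rw [val_cons, mul_assoc, des_gen_mul (by omega), ih hl.tail (by omega)]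
    have h3 := (List.pairwise_cons.1 hl).1
    simp only [List.mem_cons, forall_eq_or_imp]
    constructor
    · rintro (h | ⟨h, h' | h'⟩)
      exacts [.inl (.inl h), .inl (.inr h'), .inr ⟨⟨h, h'.1⟩, h'.2⟩]
    · rintro ((h | h) | h)
      exacts [.inl h, .inr ⟨h3 _ h, .inl h⟩, .inr ⟨h.1.1, .inr ⟨h.1.2, h.2⟩⟩]

lemma clique_split (hl : Clique Γ l) (x : Raag Γ) : ∃ (p n : List (V × Bool)) (y : Raag Γ),
    Clique Γ p ∧ Clique Γ n ∧ (∀ v : V, (∀ a ∈ l, Γ.Adj v a.1) → (∀ a ∈ p, Γ.Adj v a.1) ∧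
      ∀ a ∈ n, Γ.Adj v a.1) ∧
    norm Γ (val Γ p * y) = p.length + norm Γ y ∧ norm Γ (val Γ n * y) = n.length + norm Γ y ∧
    x = val Γ n * y ∧ val Γ l * x = val Γ p * y := by
  induction l with
  | nil => exact ⟨[], [], x, .nil, .nil, by simp, by simp, by simp, by simp, by simp⟩
  | cons a l ih =>
    obtain ⟨p, n, y, hp, hn, hv, hpy, hny, rfl, hx⟩ := ih hl.tail
    have ha := (List.pairwise_cons.1 hl).1
    obtain ⟨hap, han⟩ := hv a.1 ha
    rcases norm_gen_mul_or a y with h | h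
    · refine ⟨a :: p, n, y, List.pairwise_cons.2 ⟨hap, hp⟩, hn, ?_, ?_, hny, rfl, ?_⟩
      · intro v h
        obtain ⟨h1, h2⟩ := hv v fun a h' => h a (List.mem_cons_of_mem _ h')
        exact ⟨by simpa using ⟨h a List.mem_cons_self, by simpa using h1⟩, h2⟩
      · rw [val_cons, mul_assoc, List.length_cons]
        rcases norm_gen_mul_or a (val Γ p * y) with h1 | h1
        · omega
        · rcases (des_clique_mul hp hpy).1 h1 with h2 | h2
          · exact (Γ.loopless.irrefl _ (hap (inv a) h2)).elim
          · exact (Des.not h2.2 h).elim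
      · rw [val_cons, mul_assoc, hx, val_cons, mul_assoc]
    · rw [Des, gen_inv, _root_.inv_inv] at h
      refine ⟨p, inv a :: n, gen Γ a * y, hp, List.pairwise_cons.2 ⟨han, hn⟩, ?_, ?_, ?_, ?_, ?_⟩
      · intro v h
        obtain ⟨h1, h2⟩ := hv v fun a h' => h a (List.mem_cons_of_mem _ h')
        exact ⟨h1, by simpa using ⟨h a List.mem_cons_self, by simpa using h2⟩⟩
      · rw [← mul_assoc, Clique.mul_comm hap, mul_assoc]
        have h1 := norm_gen_mul_le (a := inv a) (gen Γ a * (val Γ p * y))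
        have h2 := norm_val_mul_le (w := p) (gen Γ a * y)
        rw [gen_inv, inv_mul_cancel_left] at h1
        rw [← mul_assoc, Clique.mul_comm hap, mul_assoc] at h2
        omega
      · rw [val_cons, mul_assoc, ← mul_assoc (val Γ n), Clique.mul_comm han, gen_inv, mul_assoc,
          inv_mul_cancel_left, hny, List.length_cons]
        omega
      · rw [val_cons, mul_assoc, ← mul_assoc (val Γ n), Clique.mul_comm han, gen_inv, mul_assoc,
          inv_mul_cancel_left]
      · rw [val_cons, mul_assoc, hx, ← mul_assoc (val Γ p), Clique.mul_comm hap, mul_assoc]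

variable (Γ) in
/-- Elements which are products of pairwise commuting letters. -/
def Clq (c : Raag Γ) : Prop := ∃ l, Clique Γ l ∧ val Γ l = c

lemma Clique.inv_map (hl : Clique Γ l) : (val Γ l)⁻¹ = val Γ (l.map inv) := by
  rw [val_inv]
  refine (Clique.perm ?_ (List.reverse_perm _).symm).symm
  exact List.pairwise_map.2 hl

open Classical in
lemma Clique.split (hl : Clique Γ l) (p : V × Bool → Prop) :
    val Γ l = val Γ (l.filter p) * val Γ (l.filter fun a => ¬ p a) := by
  rw [← val_append]
  refine hl.perm ?_
  convert (List.filter_append_perm (fun a => decide (p a)) l).symm using 3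
  ext a; simp

open Classical in
lemma Clique.diff (hl : Clique Γ l) (p q : V × Bool → Prop) :
    Clq Γ ((val Γ (l.filter p))⁻¹ * val Γ (l.filter q)) := by
  have hp : Clique Γ (l.filter p) := List.Pairwise.filter _ hl
  have hq : Clique Γ (l.filter q) := List.Pairwise.filter _ hl
  have h1 := hp.split q
  have h2 := hq.split p
  have h3 : ((l.filter p).filter q) = (l.filter q).filter p := List.filter_comm ..
  refine ⟨((l.filter p).filter fun a => ¬ q a).map inv ++ (l.filter q).filter fun a => ¬ p a, ?_, ?_⟩
  · refine List.pairwise_append.2 ⟨List.pairwise_map.2 (List.Pairwise.filter _ hp), List.Pairwise.filter _ hq, ?_⟩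
    intro a ha b hb
    obtain ⟨c, hc, rfl⟩ := List.mem_map.1 ha
    refine hl.adj (a := c) (b := b) ?_ ?_ ?_
    · exact List.mem_of_mem_filter (List.mem_of_mem_filter hc)
    · exact List.mem_of_mem_filter (List.mem_of_mem_filter hb)
    · rintro rfl
      simp only [List.mem_filter, decide_eq_true_eq] at hc hb
      exact hb.2 hc.1.2
  · rw [val_append, ← Clique.inv_map (List.Pairwise.filter _ hp), h1, h2, h3]
    rw [mul_inv_rev, mul_assoc, inv_mul_cancel_left]

lemma Clique.length_le [Fintype V] (hl : Clique Γ l) : l.length ≤ Fintype.card V := by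
  have : (l.map Prod.fst).Nodup := List.pairwise_map.2 (hl.imp fun h => h.ne)
  simpa using this.length_le_card

lemma clique_of_des {g : Raag Γ} (hn : l.Nodup) (h : ∀ a ∈ l, Des a g) : Clique Γ l := by
  induction l with
  | nil => exact .nil
  | cons a l ih =>
    refine List.pairwise_cons.2 ⟨fun b hb => (h a List.mem_cons_self).adj
      (h b (List.mem_cons_of_mem _ hb)) ?_, ih hn.of_cons fun b hb => h b (List.mem_cons_of_mem _ hb)⟩
    rintro rfl
    exact (List.nodup_cons.1 hn).1 hb

variable [Fintype V]

open Classical in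
variable (Γ) in
/-- The left descents of an element. -/
def descents (g : Raag Γ) : List (V × Bool) :=
  (Finset.univ.filter fun a : V × Bool => Des a g).toList

lemma mem_descents {g : Raag Γ} : a ∈ descents Γ g ↔ Des a g := by simp [descents]

lemma nodup_descents (g : Raag Γ) : (descents Γ g).Nodup := Finset.nodup_toList _

lemma clique_descents (g : Raag Γ) : Clique Γ (descents Γ g) :=
  clique_of_des (nodup_descents g) fun _ => mem_descents.1

variable (Γ) in
/-- Remove all left descents. -/
def peel (g : Raag Γ) : Raag Γ := (val Γ (descents Γ g))⁻¹ * g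

open Classical in
lemma peel_clique_mul {y : Raag Γ} (hl : Clique Γ l)
    (h : norm Γ (val Γ l * y) = l.length + norm Γ y) :
    peel Γ (val Γ l * y) = (val Γ ((descents Γ y).filter fun b => ∀ a ∈ l, Γ.Adj a.1 b.1))⁻¹ * y := by
  have hd : Clique Γ (descents Γ (val Γ l * y)) := clique_descents _
  have : (descents Γ (val Γ l * y)).Perm
      (l ++ (descents Γ y).filter fun b => ∀ a ∈ l, Γ.Adj a.1 b.1) := by
    refine (List.perm_ext_iff_of_nodup (nodup_descents _) ?_).2 fun b => ?_
    · refine List.nodup_append.2 ⟨hl.imp fun h => ne_of_adj h, (nodup_descents _).filter _, ?_⟩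
      rintro a ha _ hb rfl
      simp only [List.mem_filter, decide_eq_true_eq] at hb
      exact Γ.loopless.irrefl _ (hb.2 a ha)
    · rw [mem_descents, des_clique_mul hl h]
      simp [mem_descents, and_comm]
  rw [peel, hd.perm this, val_append, mul_inv_rev, mul_assoc, inv_mul_cancel_left]

/-- Elements differing on the left by a product of pairwise commuting letters. -/
lemma peel_near {x x' : Raag Γ} (h : Clq Γ (x' * x⁻¹)) : Clq Γ (peel Γ x' * (peel Γ x)⁻¹) := by
  classical
  obtain ⟨l, hl, h⟩ := h
  obtain ⟨p, n, y, hp, hn, -, hpy, hny, rfl, h2⟩ := clique_split hl x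
  have : x' = val Γ p * y := by rw [← h2, h]; group
  rw [this, peel_clique_mul hp hpy, peel_clique_mul hn hny]
  have := (clique_descents y).diff (fun b => ∀ a ∈ p, Γ.Adj a.1 b.1) fun b => ∀ a ∈ n, Γ.Adj a.1 b.1
  rw [mul_inv_rev, _root_.inv_inv, mul_assoc, mul_inv_cancel_left]
  convert this

lemma norm_peel_lt {x : Raag Γ} (h : norm Γ x ≠ 0) : norm Γ (peel Γ x) < norm Γ x := by
  have key : ∀ l : List (V × Bool), l.Nodup → (∀ a ∈ l, Des a x) →
      norm Γ ((val Γ l)⁻¹ * x) + l.length = norm Γ x := by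
    intro l
    induction l with
    | nil => simp
    | cons a l ih =>
      intro hn hd
      have hc : Clique Γ (a :: l) := clique_of_des hn hd
      have h1 := ih hn.of_cons fun b hb => hd b (List.mem_cons_of_mem _ hb)
      have h2 := hd a List.mem_cons_self
      rw [← mul_inv_cancel_left (val Γ l) x, des_clique_mul (l := l) hc.tail
        (by rw [mul_inv_cancel_left]; omega)] at h2
      have h3 : Des a ((val Γ l)⁻¹ * x) := (h2.resolve_left (List.nodup_cons.1 hn).1).2
      rw [Des] at h3
      rw [val_cons, ← Clique.mul_comm (List.pairwise_cons.1 hc).1, mul_inv_rev, mul_assoc,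
        List.length_cons]
      omega
  have := key _ (nodup_descents x) fun _ => mem_descents.1
  obtain ⟨a, ha⟩ := exists_des h
  have := List.length_pos_of_mem (mem_descents.2 ha)
  rw [peel]; omega

variable (Γ) in
lemma raag_contr : DContr (Raag Γ) := by
  have hone : peel Γ (1 : Raag Γ) = 1 := by
    refine eq_one_of_norm ?_
    have : descents Γ (1 : Raag Γ) = [] := List.eq_nil_iff_forall_not_mem.2 fun a ha => by
      have := mem_descents.1 ha
      simp [Des] at this
    simp [peel, this]
  set P : Raag Γ → Raag Γ := fun g => (peel Γ g⁻¹)⁻¹ with hP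
  have hit : ∀ k g, P^[k] g = ((peel Γ)^[k] g⁻¹)⁻¹ := by
    intro k
    induction k with
    | zero => simp
    | succ k ih => intro g; rw [Function.iterate_succ_apply, ih, Function.iterate_succ_apply]; simp [hP]
  have hnear : ∀ k (x x' : Raag Γ), Clq Γ (x' * x⁻¹) →
      Clq Γ ((peel Γ)^[k] x' * ((peel Γ)^[k] x)⁻¹) := by
    intro k
    induction k with
    | zero => simp
    | succ k ih =>
      intro x x' h
      rw [Function.iterate_succ_apply, Function.iterate_succ_apply]
      exact ih _ _ (peel_near h)
  have hle : ∀ l : List (V × Bool), Clique Γ l → norm Γ (val Γ l) ≤ Fintype.card V :=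
    fun l h => norm_val_le.trans h.length_le
  set N := Fintype.card V
  have hlip : ∀ k (w : List (V × Bool)) (x : Raag Γ),
      norm Γ ((peel Γ)^[k] (val Γ w * x) * ((peel Γ)^[k] x)⁻¹) ≤ N * w.length := by
    intro k w
    induction w with
    | nil => simp
    | cons a w ih =>
      intro x
      obtain ⟨l, hl, h⟩ := hnear k (val Γ w * x) (gen Γ a * (val Γ w * x))
        ⟨[a], List.pairwise_singleton .., by simp [mul_assoc]⟩
      have h1 := norm_mul_le (val Γ l) ((peel Γ)^[k] (val Γ w * x) * ((peel Γ)^[k] x)⁻¹)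
      rw [h, ← mul_assoc, inv_mul_cancel_right, ← h] at h1
      rw [val_cons, mul_assoc, List.length_cons, mul_add, mul_one]
      have := ih x
      have := hle l hl
      omega
  refine ⟨N + 1, P, by simp, by simp [hP, hone], fun k x y => ?_, fun x => ?_, fun x k h => ?_⟩
  · obtain ⟨w, hw, h⟩ := exists_red (x⁻¹ * y)
    have h1 := hlip k w y⁻¹
    rw [h, mul_inv_cancel_right] at h1
    rw [hit, hit, dist_eq_norm, dist_eq_norm, _root_.inv_inv, ← h, norm_val hw]
    refine le_trans (Nat.cast_le.2 h1) ?_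
    push_cast
    nlinarith [Nat.cast_nonneg (α := ℝ) w.length]
  · have : (P x)⁻¹ * x = (val Γ (descents Γ x⁻¹))⁻¹ := by simp [hP, peel]
    rw [dist_eq_norm, this, norm_inv]
    have := hle _ (clique_descents x⁻¹)
    exact_mod_cast this.trans (Nat.le_succ _)
  · rw [dist_one, Nat.cast_le] at h
    rw [hit]
    rw [inv_eq_one]
    rw [← norm_inv] at h
    generalize x⁻¹ = z at h
    induction k generalizing z with
    | zero => exact eq_one_of_norm (Nat.le_zero.1 h)
    | succ k ih =>
      rw [Function.iterate_succ_apply]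
      by_cases h0 : norm Γ z = 0
      · rw [eq_one_of_norm h0, hone]; exact ih 1 (by simp)
      · have := norm_peel_lt h0; exact ih _ (by omega)

end DeRahmSplit

namespace DeRahmSplit

variable {V : Type} {Γ : SimpleGraph V}

open Classical in
variable (Γ) in
/-- The exponent of a vertex, as a homomorphism. -/
def expoHom (v : V) : Raag Γ →* Multiplicative ℤ :=
  PresentedGroup.toGroup (f := fun x => Multiplicative.ofAdd (if x = v then 1 else 0)) (by
    rintro r ⟨x, y, _, rfl⟩
    simp)

variable (Γ) in
/-- The exponent sum of a vertex. -/
def expo (v : V) (g : Raag Γ) : ℤ := (expoHom Γ v g).toAdd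

lemma expo_mul (v : V) (g h : Raag Γ) : expo Γ v (g * h) = expo Γ v g + expo Γ v h := by
  simp [expo]

lemma expo_inv (v : V) (g : Raag Γ) : expo Γ v g⁻¹ = -expo Γ v g := by simp [expo]

lemma expo_zpow (v : V) (g : Raag Γ) (n : ℤ) : expo Γ v (g ^ n) = n * expo Γ v g := by simp [expo]

open Classical in
lemma expo_gen (v x : V) : expo Γ v (raagGen Γ x) = if x = v then 1 else 0 := by
  simp [expo, expoHom, raagGen, PresentedGroup.toGroup.of]

@[simp] lemma expo_self (v : V) : expo Γ v (raagGen Γ v) = 1 := by simp [expo_gen]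

lemma expo_le (v : V) (g : Raag Γ) : |expo Γ v g| ≤ norm Γ g := by
  obtain ⟨w, hw, rfl⟩ := exists_red g
  rw [norm_val hw]
  clear hw
  induction w with
  | nil => simp [expo]
  | cons a w ih =>
    rw [val_cons, expo_mul, List.length_cons]
    have : |expo Γ v (gen Γ a)| ≤ 1 := by
      obtain ⟨x, _ | _⟩ := a <;> by_cases h : x = v <;> simp [gen, expo_inv, expo_gen, h]
    have := abs_add_le (expo Γ v (gen Γ a)) (expo Γ v (val Γ w))
    push_cast; omega

lemma norm_zpow_le (v : V) (n : ℤ) : (norm Γ (raagGen Γ v ^ n) : ℤ) ≤ |n| := by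
  have key : ∀ n : ℕ, norm Γ (raagGen Γ v ^ n) ≤ n := fun n => by
    induction n with
    | zero => simp
    | succ n ih =>
      rw [pow_succ']
      exact (norm_gen_mul_le (a := (v, true)) _).trans (by omega)
  rw [← Int.natCast_natAbs, Nat.cast_le]
  rcases Int.natAbs_eq n with h | h
  · rw [h, zpow_natCast, Int.natAbs_natCast]; exact key _
  · rw [h, zpow_neg, zpow_natCast, norm_inv, Int.natAbs_neg, Int.natAbs_natCast]; exact key _

lemma raag_line [Unique V] : DLine (Raag Γ) := by
  refine ⟨expo Γ default, expo_mul _, fun n => ⟨raagGen Γ default ^ n, by simp [expo_zpow]⟩, ?_⟩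
  have key : ∀ g : Raag Γ, g = raagGen Γ default ^ expo Γ default g := by
    intro g
    induction g using raag_ind with
    | h1 => simp [expo]
    | h a g ih =>
      rw [expo_mul, zpow_add, ← ih]
      congr 1
      obtain ⟨x, b⟩ := a
      obtain rfl : x = default := Subsingleton.elim _ _
      cases b <;> simp [gen, expo_inv]
  intro x y
  rw [dist_eq_norm]
  have h1 := expo_le default (x⁻¹ * y)
  have h2 := norm_zpow_le (Γ := Γ) default (expo Γ default (x⁻¹ * y))
  rw [← key] at h2
  rw [← Int.cast_natCast, le_antisymm h2 h1, expo_mul, expo_inv, abs_sub_comm]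
  push_cast
  congr 1
  ring

variable {c : ℕ → V × Bool} {b : V × Bool}

/-- A segment of a sequence of letters. -/
def seg (c : ℕ → V × Bool) (s : ℕ) : ℕ → List (V × Bool)
  | 0 => []
  | n + 1 => c s :: seg c (s + 1) n

@[simp] lemma length_seg (s n : ℕ) : (seg c s n).length = n := by
  induction n generalizing s with
  | zero => rfl
  | succ n ih => simp [seg, ih]

lemma seg_add (s m n : ℕ) : seg c s (m + n) = seg c s m ++ seg c (s + m) n := by
  induction m generalizing s with
  | zero => simp [seg]
  | succ m ih => rw [Nat.succ_add, seg, seg, ih, List.cons_append, Nat.succ_add_eq_add_succ]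

lemma des_seg_mul (hc : ∀ n, ¬ Γ.Adj (c n).1 (c (n + 1)).1) {s n : ℕ} {t : Raag Γ}
    (h : norm Γ (val Γ (seg c s n) * t) = n + norm Γ t) (hb : Des b (val Γ (seg c s n) * t)) :
    b = c s ∨ (∀ i < n, Γ.Adj (c (s + i)).1 b.1) ∧ Des b t := by
  induction n generalizing s with
  | zero => exact .inr ⟨by simp, by simpa [seg] using hb⟩
  | succ n ih =>
    rw [seg, val_cons, mul_assoc] at h hb
    have h1 := norm_val_mul_le (w := seg c (s + 1) n) t
    have h2 := norm_gen_mul_le (a := c s) (val Γ (seg c (s + 1) n) * t)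
    rw [length_seg] at h1
    refine ((des_gen_mul (by omega)).1 hb).imp_right fun ⟨h3, h4⟩ => ?_
    rcases ih (by omega) h4 with rfl | ⟨h5, h6⟩
    · exact (hc s h3).elim
    · refine ⟨fun i hi => ?_, h6⟩
      rcases i with _ | i
      · exact h3
      · rw [← Nat.succ_add_eq_add_succ]; exact h5 i (by omega)

lemma norm_seg (hc : ∀ n, ¬ Γ.Adj (c n).1 (c (n + 1)).1) (hi : ∀ n, c (n + 1) ≠ inv (c n))
    (s n : ℕ) : norm Γ (val Γ (seg c s n)) = n := by
  induction n generalizing s with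
  | zero => simp [seg]
  | succ n ih =>
    rw [seg, val_cons]
    rcases norm_gen_mul_or (c s) (val Γ (seg c (s + 1) n)) with h | h
    · rw [h, ih]
    · rcases des_seg_mul (t := 1) (s := s + 1) (n := n) hc (by simp [ih]) (by simpa using h) with h | h
      · exact (hi s h.symm).elim
      · simp [Des] at h

lemma norm_seg_inv_mul (hc : ∀ n, ¬ Γ.Adj (c n).1 (c (n + 1)).1) {L : ℕ}
    (hcov : ∀ v s, ∃ i < L, (c (s + i)).1 = v) {j s : ℕ} {x y : Raag Γ}
    (hx : norm Γ (val Γ (seg c s (j + L)) * x) = j + L + norm Γ x) :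
    norm Γ ((val Γ (seg c s j))⁻¹ * y) + j = norm Γ y ∨
    norm Γ (val Γ (seg c s (j + L)) * x) + norm Γ y ≤
      norm Γ ((val Γ (seg c s (j + L)) * x)⁻¹ * y) + 2 * j := by
  induction j generalizing s y with
  | zero => left; simp [seg]
  | succ j ih =>
    by_cases hd : Des (c s) y
    · have h0 : seg c s (j + 1 + L) = c s :: seg c (s + 1) (j + L) := by
        rw [add_right_comm]; rfl
      rw [h0, val_cons, mul_assoc] at hx ⊢
      have h1 := norm_val_mul_le (w := seg c (s + 1) (j + L)) x
      have h2 := norm_gen_mul_le (a := c s) (val Γ (seg c (s + 1) (j + L)) * x)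
      rw [length_seg] at h1
      rw [Des] at hd
      have := ih (s := s + 1) (y := (gen Γ (c s))⁻¹ * y) (by omega)
      rw [seg, val_cons, mul_inv_rev, mul_assoc, mul_inv_rev (gen Γ (c s)), mul_assoc]
      omega
    · right
      rw [norm_inv_mul]
      · omega
      · intro b hb hy
        rcases des_seg_mul hc hx hb with rfl | ⟨h, _⟩
        · exact hd hy
        · obtain ⟨i, hi, hv⟩ := hcov b.1 s
          exact Γ.loopless.irrefl b.1 (by simpa [hv] using h i (by omega))

lemma seg_pow {L : ℕ} (hp : ∀ n, c (n + L) = c n) (m : ℕ) :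
    val Γ (seg c 0 L) ^ m = val Γ (seg c 0 (m * L)) := by
  induction m with
  | zero => simp [seg]
  | succ m ih =>
    have : ∀ n s, seg c (s + L) n = seg c s n := by
      intro n
      induction n with
      | zero => simp [seg]
      | succ n ih => intro s; rw [seg, seg, hp, add_right_comm, ih]
    rw [pow_succ', ih, ← val_append, add_mul, one_mul, add_comm, seg_add, this]

lemma exists_seq [Fintype V] [Nontrivial V] {H : SimpleGraph V} (hH : H.Connected) :
    ∃ (L : ℕ) (f : ℕ → V), 0 < L ∧ (∀ n, H.Adj (f n) (f (n + 1))) ∧ (∀ n, f (n + L) = f n) ∧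
      ∀ v s, ∃ i < L, f (s + i) = v := by
  classical
  obtain ⟨u, u', huu⟩ := exists_pair_ne V
  have key : ∀ s : Finset V, ∃ p : H.Walk u u, ∀ v ∈ s, v ∈ p.support := by
    intro s
    induction s using Finset.induction with
    | empty => exact ⟨.nil, by simp⟩
    | insert v s _ ih =>
      obtain ⟨p, hp⟩ := ih
      obtain ⟨q⟩ := hH.preconnected u v
      refine ⟨p.append (q.append q.reverse), fun x hx => ?_⟩
      rw [SimpleGraph.Walk.mem_support_append_iff, SimpleGraph.Walk.mem_support_append_iff]
      rcases Finset.mem_insert.1 hx with rfl | hx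
      · exact .inr (.inl q.end_mem_support)
      · exact .inl (hp x hx)
  obtain ⟨p, hp⟩ := key Finset.univ
  have hL : 0 < p.length := by
    by_contra h
    have h1 := SimpleGraph.Walk.nil_iff_support_eq.1
      (SimpleGraph.Walk.length_eq_zero_iff.1 (Nat.eq_zero_of_not_pos h))
    simpa [huu.symm, h1] using hp u' (Finset.mem_univ _)
  refine ⟨p.length, fun n => p.getVert (n % p.length), hL, fun n => ?_, by simp, fun v s => ?_⟩
  · have h := Nat.mod_lt n hL
    have := p.adj_getVert_succ h
    rcases Nat.lt_or_ge (n % p.length + 1) p.length with h1 | h1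
    · rwa [← Nat.mod_eq_of_lt h1, Nat.mod_add_mod] at this
    · have h2 : n % p.length + 1 = p.length := by omega
      have h3 : (n + 1) % p.length = 0 := by rw [← Nat.mod_add_mod, h2, Nat.mod_self]
      dsimp only
      rw [h3]
      rw [h2] at this
      simpa using this
  · obtain ⟨i, hi, hle⟩ := SimpleGraph.Walk.mem_support_iff_exists_getVert.1 (hp v (Finset.mem_univ v))
    have hv : p.getVert (i % p.length) = v := by
      rcases Nat.lt_or_ge i p.length with h | h
      · rwa [Nat.mod_eq_of_lt h]
      · obtain rfl := le_antisymm hle h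
        simpa using hi
    refine ⟨(i + (p.length - 1) * s) % p.length, Nat.mod_lt _ hL, ?_⟩
    dsimp only
    rw [Nat.add_mod_mod]
    have : s + (i + (p.length - 1) * s) = i + p.length * s := by
      obtain ⟨n, hn⟩ := Nat.exists_eq_succ_of_ne_zero hL.ne'
      rw [hn, Nat.succ_sub_one, Nat.succ_mul]; ring
    rw [this, Nat.add_mul_mod_self_left, hv]

lemma raag_trip [Fintype V] [Nontrivial V] (hH : Γᶜ.Connected) : DTrip (Raag Γ) := by
  obtain ⟨L, f, hL, hadj, hp, hcov⟩ := exists_seq hH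
  let c : Fin 3 → ℕ → V × Bool :=
    ![fun n => (f n, true), fun n => (f n, false), fun n => (f (n + 1), true)]
  have hc : ∀ k n, ¬ Γ.Adj (c k n).1 (c k (n + 1)).1 := fun k n => by
    fin_cases k
    exacts [(hadj _).2, (hadj _).2, (hadj _).2]
  have hi : ∀ k n, c k (n + 1) ≠ inv (c k n) := fun k n h => by
    have := congrArg Prod.fst h
    fin_cases k
    exacts [(hadj _).ne this.symm, (hadj _).ne this.symm, (hadj _).ne this.symm]
  have hper : ∀ k n, c k (n + L) = c k n := fun k n => by
    fin_cases k
    exacts [congrArg (·, true) (hp n), congrArg (·, false) (hp n), congrArg (·, true)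
      ((congrArg f (add_right_comm n L 1)).trans (hp _))]
  have hcv : ∀ k v s, ∃ i < L, (c k (s + i)).1 = v := fun k v s => by
    fin_cases k
    · exact hcov v s
    · exact hcov v s
    · simpa [c, add_right_comm] using hcov v (s + 1)
  have h0 : ∀ k k', k' ≠ k → c k 0 ≠ c k' 0 := fun k k' h => by
    have := (hadj 0).ne
    have := (hadj 0).ne.symm
    fin_cases k <;> fin_cases k' <;> simp_all [c]
  have hpow : ∀ k m, norm Γ (val Γ (seg (c k) 0 L) ^ m) = m * L := fun k m => by
    rw [seg_pow (hper k), norm_seg (hc k) (hi k)]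
  have hdiff : ∀ k k', k' ≠ k → ∀ i j, norm Γ ((val Γ (seg (c k) 0 L) ^ j)⁻¹ *
      val Γ (seg (c k') 0 L) ^ i) = j * L + i * L := fun k k' h i j => by
    have key : ∀ k m b, Des b (val Γ (seg (c k) 0 L) ^ m) → b = c k 0 := fun k m b hb => by
      rw [seg_pow (hper k), ← mul_one (val Γ _)] at hb
      exact (des_seg_mul (hc k) (by simp [norm_seg (hc k) (hi k)]) hb).resolve_right
        fun h => by simp [Des] at h
    rw [norm_inv_mul, hpow, hpow]
    intro b hb hb'
    exact h0 k k' h ((key k j b hb).symm.trans (key k' i b hb'))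
  refine ⟨L, 2 * L, fun k => val Γ (seg (c k) 0 L), fun k m => {x | norm Γ
    ((val Γ (seg (c k) 0 L) ^ m)⁻¹ * x) + m * L = norm Γ x}, hL, fun k m => ?_, ?_, ?_, ?_⟩
  · rw [dist_one, hpow]; push_cast; ring
  · intro k m x hx y hy
    simp only [Set.mem_ofPred_eq] at hx hy
    have h1 := norm_seg_inv_mul (Γ := Γ) (c := c k) (hc k) (hcv k) (j := m * L) (s := 0)
      (x := (val Γ (seg (c k) 0 L) ^ (m + 1))⁻¹ * x) (y := y)
    have h2 : m * L + L = (m + 1) * L := by ring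
    rw [h2, ← seg_pow (hper k), ← seg_pow (hper k), mul_inv_cancel_left] at h1
    rw [dist_one, dist_one, dist_eq_norm]
    have h3 := (h1 (by omega)).resolve_left hy
    have h4 : norm Γ x + norm Γ y ≤ norm Γ (x⁻¹ * y) + 2 * L * (m + 1) := by
      nlinarith
    exact_mod_cast h4
  · intro k m m' h
    obtain ⟨n, rfl⟩ := Nat.exists_eq_add_of_le h
    simp only [Set.mem_ofPred_eq]
    rw [pow_add, inv_mul_cancel_left, hpow, ← pow_add, hpow]
    ring
  · intro k k' h i j hm
    simp only [Set.mem_ofPred_eq] at hm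
    rw [← mul_assoc, ← mul_inv_rev, ← pow_add, hdiff k k' h, hdiff k k' h] at hm
    nlinarith

end DeRahmSplit

namespace DeRahmSplit

variable {V W : Type} {Γ : SimpleGraph V} {Λ : SimpleGraph W}

lemma norm_hom_le (j : Raag Γ →* Raag Λ) (hj : ∀ v, norm Λ (j (raagGen Γ v)) ≤ 1) (g : Raag Γ) :
    norm Λ (j g) ≤ norm Γ g := by
  obtain ⟨w, hw, rfl⟩ := exists_red g
  rw [norm_val hw]
  clear hw
  induction w with
  | nil => simp
  | cons a w ih =>
    have : norm Λ (j (gen Γ a)) ≤ 1 := by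
      obtain ⟨v, _ | _⟩ := a <;> simpa [gen] using hj v
    have := norm_mul_le (j (gen Γ a)) (j (val Γ w))
    rw [val_cons, map_mul, List.length_cons]
    omega

/-- The homomorphism induced by a partial map of vertices. -/
def mapHom (φ : V → Option W)
    (h : ∀ x y, Γ.Adj x y → ∀ x' ∈ φ x, ∀ y' ∈ φ y, Λ.Adj x' y') : Raag Γ →* Raag Λ :=
  PresentedGroup.toGroup (f := fun v => (φ v).elim 1 (raagGen Λ)) (by
    rintro r ⟨x, y, hxy, rfl⟩
    simp only [map_mul, map_inv, FreeGroup.lift_apply_of]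
    rw [mul_inv_eq_one, mul_inv_eq_iff_eq_mul]
    have := h x y hxy
    revert this
    generalize φ x = p, φ y = q
    intro this
    rcases p with _ | x' <;> rcases q with _ | y'
    · rfl
    · simp
    · simp
    · exact raagGen_commute (this x' rfl y' rfl))

variable {φ : V → Option W} {h : ∀ x y, Γ.Adj x y → ∀ x' ∈ φ x, ∀ y' ∈ φ y, Λ.Adj x' y'}

lemma mapHom_gen (v : V) : mapHom φ h (raagGen Γ v) = (φ v).elim 1 (raagGen Λ) := by
  rw [mapHom, raagGen, PresentedGroup.toGroup.of]

lemma norm_mapHom_le (g : Raag Γ) : norm Λ (mapHom φ h g) ≤ norm Γ g :=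
  norm_hom_le _ (fun v => by
    rw [mapHom_gen]
    rcases φ v with _ | x
    · simp
    · simpa using norm_zpow_le (Γ := Λ) x 1) g

lemma hom_ext {H : Type*} [Group H] {j j' : Raag Γ →* H}
    (h : ∀ v, j (raagGen Γ v) = j' (raagGen Γ v)) : j = j' := PresentedGroup.ext h

open Classical in
variable (Γ) in
/-- The retraction killing the generators outside of a set. -/
def ret (T : Set V) : Raag Γ →* Raag Γ :=
  mapHom (fun v => if v ∈ T then some v else none) (by
    intro x y h x' hx y' hy
    simp only [Option.mem_def, Option.ite_none_right_eq_some, Option.some_inj] at hx hy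
    rwa [← hx.2, ← hy.2])

variable {T : Set V} {x y : Raag Γ} {v : V}

lemma ret_gen (h : v ∈ T) : ret Γ T (raagGen Γ v) = raagGen Γ v := by
  rw [ret, mapHom_gen, if_pos h]; rfl

lemma ret_gen_of_not (h : v ∉ T) : ret Γ T (raagGen Γ v) = 1 := by
  rw [ret, mapHom_gen, if_neg h]; rfl

lemma norm_ret_le (T : Set V) (x : Raag Γ) : norm Γ (ret Γ T x) ≤ norm Γ x := norm_mapHom_le x

lemma dist_ret_le (T : Set V) (x y : Raag Γ) : dist (ret Γ T x) (ret Γ T y) ≤ dist x y := by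
  simpa [dist_eq_norm] using norm_ret_le T (x⁻¹ * y)

lemma gen_mem (h : v ∈ T) : raagGen Γ v ∈ subRaag Γ T := Subgroup.subset_closure ⟨v, h, rfl⟩

lemma ret_mem (T : Set V) (x : Raag Γ) : ret Γ T x ∈ subRaag Γ T := by
  induction x using raag_ind with
  | h1 => simp
  | h a g ih =>
    rw [map_mul]
    refine mul_mem ?_ ih
    obtain ⟨v, b⟩ := a
    by_cases h : v ∈ T
    · have := gen_mem (Γ := Γ) h
      cases b <;> simpa [gen, ret_gen h] using this
    · cases b <;> simp [gen, ret_gen_of_not h]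

lemma ret_eq_self (h : x ∈ subRaag Γ T) : ret Γ T x = x := by
  have : subRaag Γ T ≤ (ret Γ T).eqLocus (MonoidHom.id _) :=
    (Subgroup.closure_le _).2 (by rintro _ ⟨v, hv, rfl⟩; exact ret_gen hv)
  exact this h

@[simp] lemma ret_ret (T : Set V) (x : Raag Γ) : ret Γ T (ret Γ T x) = ret Γ T x :=
  ret_eq_self (ret_mem T x)

lemma val_filter [DecidablePred (· ∈ T)] (w : List (V × Bool)) :
    val Γ (w.filter fun a => a.1 ∈ T) = ret Γ T (val Γ w) := by
  induction w with
  | nil => simp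
  | cons a w ih =>
    obtain ⟨v, b⟩ := a
    by_cases h : v ∈ T
    · cases b <;> simp [h, ih, gen, ret_gen]
    · cases b <;> simp [h, ih, gen, ret_gen_of_not]

lemma subDist_eq (x y : subRaag Γ T) : subDist Γ T x y = dist x y := by
  classical
  obtain ⟨w, hw, h⟩ := exists_red (x⁻¹ * y : Raag Γ)
  refine wordDist_eq (w := w.filter fun a => a.1 ∈ T) (subRaag Γ T).subtype
    Subtype.val_injective (by rintro s ⟨v, -, h⟩; exact ⟨v, h⟩) ?_ ?_ fun a ha => ?_
  · rw [val_filter, h]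
    exact ret_eq_self (x⁻¹ * y).2
  · refine (List.length_filter_le _ _).trans ?_
    rw [← norm_val hw, h]; rfl
  · have : a.1 ∈ T := by simpa using (List.mem_filter.1 ha).2
    exact ⟨⟨_, gen_mem this⟩, ⟨a.1, this, rfl⟩, rfl⟩

instance (H : Subgroup (Raag Γ)) : IsIsometricSMul H H :=
  ⟨fun c x y => isometry_smul (Raag Γ) (c : Raag Γ) x y⟩

variable (Γ) in
/-- A decomposition of a graph as a join. -/
structure JoinFam {N : ℕ} (T : Fin N → Set V) : Prop where
  cover : ∀ v, ∃ c, v ∈ T c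
  adj : ∀ {c c'}, c ≠ c' → ∀ u ∈ T c, ∀ v ∈ T c', Γ.Adj u v

namespace JoinFam

variable {N : ℕ} {T : Fin N → Set V} (hT : JoinFam Γ T) {c d : Fin N}

include hT

lemma eq_of_mem (h : v ∈ T c) (h' : v ∈ T d) : c = d := by
  by_contra hne
  exact Γ.loopless.irrefl v (hT.adj hne v h v h')

lemma ret_eq_one (hne : c ≠ d) (h : x ∈ subRaag Γ (T d)) : ret Γ (T c) x = 1 := by
  have : subRaag Γ (T d) ≤ (ret Γ (T c)).ker := (Subgroup.closure_le _).2 (by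
    rintro _ ⟨v, hv, rfl⟩; exact ret_gen_of_not fun h' => hne (hT.eq_of_mem h' hv))
  exact this h

lemma prod_ret (g : Raag Γ) : (List.ofFn fun c => ret Γ (T c) g).prod = g := by
  induction g using raag_ind with
  | h1 => simp [List.ofFn_eq_map]
  | h a g ih =>
    obtain ⟨c, hc⟩ := hT.cover a.1
    have key : ∀ l : List (Fin N), l.Nodup → (l.map fun d => ret Γ (T d) (gen Γ a * g)).prod =
        (if c ∈ l then gen Γ a else 1) * (l.map fun d => ret Γ (T d) g).prod := by
      intro l
      induction l with
      | nil => simp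
      | cons d l ih' =>
        intro hl
        rw [List.map_cons, List.prod_cons, ih' hl.of_cons, List.map_cons, List.prod_cons, map_mul]
        by_cases hd : d = c
        · subst hd
          have : ret Γ (T d) (gen Γ a) = gen Γ a := by
            obtain ⟨v, _ | _⟩ := a <;> simp [gen, ret_gen hc]
          simp [this, (List.nodup_cons.1 hl).1, mul_assoc]
        · have h1 : ret Γ (T d) (gen Γ a) = 1 := by
            have := ret_gen_of_not (Γ := Γ) fun h => hd (hT.eq_of_mem h hc)
            obtain ⟨v, _ | _⟩ := a <;> simpa [gen] using this
          have h2 : Commute (gen Γ a) (ret Γ (T d) g) := by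
            classical
            obtain ⟨w, -, rfl⟩ := exists_red g
            rw [← val_filter]
            refine (Clique.mul_comm fun b hb => hT.adj (Ne.symm hd) _ hc _ ?_).symm
            simpa using (List.mem_filter.1 hb).2
          by_cases hl : c ∈ l
          · simp [h1, hl, ← mul_assoc, h2.eq]
          · simp [h1, hl, Ne.symm hd]
    have := key (List.finRange N) (List.nodup_finRange N)
    rw [← List.ofFn_eq_map, ← List.ofFn_eq_map, ih, if_pos (List.mem_finRange c)] at this
    exact this

lemma ret_prod {x : Fin N → Raag Γ} (hx : ∀ c, x c ∈ subRaag Γ (T c)) (c : Fin N) :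
    ret Γ (T c) (List.ofFn x).prod = x c := by
  have key : ∀ l : List (Fin N), l.Nodup → ret Γ (T c) (l.map x).prod =
      if c ∈ l then x c else 1 := by
    intro l
    induction l with
    | nil => simp
    | cons d l ih =>
      intro hl
      rw [List.map_cons, List.prod_cons, map_mul, ih hl.of_cons]
      by_cases hd : c = d
      · subst hd
        simp [ret_eq_self (hx c), (List.nodup_cons.1 hl).1]
      · simp [hT.ret_eq_one hd (hx d), hd]
  rw [List.ofFn_eq_map, key _ (List.nodup_finRange N), if_pos (List.mem_finRange c)]

lemma ext (h : ∀ c, ret Γ (T c) x = ret Γ (T c) y) : x = y := by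
  rw [← hT.prod_ret x, ← hT.prod_ret y]; simp [h]

lemma commute (hx : x ∈ subRaag Γ (T c)) (hy : ret Γ (T c) y = 1) : Commute x y :=
  hT.ext fun d => by
    by_cases hd : d = c
    · subst hd; simp [hy]
    · simp [hT.ret_eq_one hd hx]

lemma dist_le {M : ℝ} (h : ∀ c, dist (ret Γ (T c) x) (ret Γ (T c) y) ≤ M) :
    dist x y ≤ N * M := by
  have key : ∀ l : List (Fin N), ((norm Γ (l.map fun c => ret Γ (T c) (x⁻¹ * y)).prod : ℕ) : ℝ) ≤
      l.length * M := by
    intro l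
    induction l with
    | nil => simp
    | cons c l ih =>
      have h1 : (norm Γ (ret Γ (T c) (x⁻¹ * y)) : ℝ) ≤ M := by simpa [dist_eq_norm] using h c
      have h2 := norm_mul_le (ret Γ (T c) (x⁻¹ * y)) (l.map fun c => ret Γ (T c) (x⁻¹ * y)).prod
      have h3 : ((_ : ℕ) : ℝ) ≤ ((_ : ℕ) : ℝ) := Nat.cast_le.2 h2
      rw [List.map_cons, List.prod_cons, List.length_cons]
      push_cast at h3 ⊢
      linarith
  have := key (List.finRange N)
  rwa [← List.ofFn_eq_map, hT.prod_ret, List.length_finRange] at this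

end JoinFam

end DeRahmSplit

namespace DeRahmSplit

variable {V W : Type} {Γ : SimpleGraph V} {Λ : SimpleGraph W} {T : Set V}

section Transfer

variable {G H : Type*} [Group G] [PseudoMetricSpace G] [Group H] [PseudoMetricSpace H] (e : G ≃* H)
  (he : ∀ x y, dist (e x) (e y) = dist x y)

include he

lemma DLine.congr (h : DLine G) : DLine H := by
  obtain ⟨φ, h1, h2, h3⟩ := h
  refine ⟨fun x => φ (e.symm x), fun x y => by simp [h1], h2.comp e.symm.surjective,
    fun x y => ?_⟩
  rw [← h3, ← he]; simp

lemma DGeod.congr (h : DGeod G) : DGeod H := fun x => by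
  obtain ⟨q, d, h1, h2, h3, h4⟩ := h (e.symm x)
  refine ⟨fun n => e (q n), d, by simp [h1], by simp [h2], ?_, fun a b => by rw [he]; exact h4 a b⟩
  rw [← h3, ← he]; simp

lemma DContr.congr (h : DContr G) : DContr H := by
  obtain ⟨C, p, h1, h2, h3, h4, h5⟩ := h
  have key : ∀ (k : ℕ) x, (fun x => e (p (e.symm x)))^[k] x = e (p^[k] (e.symm x)) := fun k => by
    induction k with
    | zero => simp
    | succ k ih => intro x; rw [Function.iterate_succ_apply, ih, Function.iterate_succ_apply]; simp
  have he' : ∀ x y, dist (e.symm x) (e.symm y) = dist x y := fun x y => by rw [← he]; simp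
  refine ⟨C, fun x => e (p (e.symm x)), h1, by simp [h2], fun k x y => ?_, fun x => ?_,
    fun x k hx => ?_⟩
  · rw [key, key, he, ← he']; exact h3 ..
  · rw [← he']; simpa using h4 (e.symm x)
  · rw [key, h5, map_one]
    rwa [← map_one e.symm, he']

lemma DTrip.congr (h : DTrip G) : DTrip H := by
  obtain ⟨L, C, w, D, h1, h2, h3, h4, h5⟩ := h
  have he' : ∀ x y, dist (e.symm x) (e.symm y) = dist x y := fun x y => by rw [← he]; simp
  refine ⟨L, C, fun k => e (w k), fun k m => e.symm ⁻¹' D k m, h1, fun k m => ?_,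
    fun k m x hx y hy => ?_, fun k m m' h => ?_, fun k k' hk i j => ?_⟩
  · rw [← h2 k, ← he]; simp
  · have := h3 k m _ hx _ hy
    rwa [he', ← map_one e.symm, he', he'] at this
  · simpa using h4 k m m' h
  · simpa using h5 k k' hk i j

end Transfer

variable (Γ T) in
/-- The inclusion of a full subgraph. -/
def incl : Raag (Γ.induce T) →* Raag Γ := mapHom (fun v => some v.1) (by simp)

open Classical in
variable (Γ T) in
/-- The retraction onto a full subgraph. -/
def proj : Raag Γ →* Raag (Γ.induce T) :=
  mapHom (fun v => if h : v ∈ T then some ⟨v, h⟩ else none) (by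
    intro x y h x' hx y' hy
    simp only [Option.mem_def, Option.dite_none_right_eq_some, Option.some_inj] at hx hy
    obtain ⟨_, rfl⟩ := hx
    obtain ⟨_, rfl⟩ := hy
    simpa using h)

lemma proj_incl (g : Raag (Γ.induce T)) : proj Γ T (incl Γ T g) = g := by
  have : (proj Γ T).comp (incl Γ T) = MonoidHom.id _ := hom_ext fun v => by
    simp [incl, proj, mapHom_gen]
  exact DFunLike.congr_fun this g

lemma incl_proj (g : Raag Γ) : incl Γ T (proj Γ T g) = ret Γ T g := by
  have : (incl Γ T).comp (proj Γ T) = ret Γ T := hom_ext fun v => by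
    by_cases h : v ∈ T <;> simp [incl, proj, ret, mapHom_gen, h]
  exact DFunLike.congr_fun this g

lemma incl_mem (g : Raag (Γ.induce T)) : incl Γ T g ∈ subRaag Γ T := by
  rw [← proj_incl g, incl_proj]; exact ret_mem T _

variable (Γ T) in
/-- The group of a full subgraph is a subgroup. -/
def subIso : Raag (Γ.induce T) ≃* subRaag Γ T where
  toFun g := ⟨incl Γ T g, incl_mem g⟩
  invFun x := proj Γ T x
  left_inv := proj_incl
  right_inv x := Subtype.ext <| (incl_proj _).trans (ret_eq_self x.2)
  map_mul' _ _ := Subtype.ext <| map_mul ..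

lemma dist_subIso (x y : Raag (Γ.induce T)) : dist (subIso Γ T x) (subIso Γ T y) = dist x y := by
  change dist (incl Γ T x) (incl Γ T y) = _
  rw [dist_eq_norm, dist_eq_norm, ← map_inv, ← map_mul]
  refine congrArg _ (le_antisymm (norm_mapHom_le _) ?_)
  conv_lhs => rw [← proj_incl (x⁻¹ * y)]
  exact norm_mapHom_le _

lemma compl_connected (h : JoinIrreducibleSet Γ T) (hT : T.Nonempty) :
    (Γ.induce T)ᶜ.Connected := by
  have := hT.to_subtype
  refine ⟨fun x y => ?_⟩
  by_contra hxy
  refine h ⟨(↑) '' {z | (Γ.induce T)ᶜ.Reachable x z}, (↑) '' {z | ¬ (Γ.induce T)ᶜ.Reachable x z},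
    ⟨_, x, .rfl, rfl⟩, ⟨_, y, hxy, rfl⟩, ?_, ?_, ?_⟩
  · exact (Set.disjoint_image_iff Subtype.val_injective).2 (Set.disjoint_left.2 fun z h h' => h' h)
  · rw [← Set.image_union]
    convert Subtype.coe_image_univ T
    ext z; simp [em]
  · rintro _ ⟨a, ha, rfl⟩ _ ⟨b, hb, rfl⟩
    by_contra hab
    refine hb (ha.trans (SimpleGraph.Adj.reachable ?_))
    rw [SimpleGraph.compl_adj]
    exact ⟨by rintro rfl; exact hb ha, by simpa using hab⟩

section Fam

variable {k : ℕ} {hk : 0 < k} {P : V → Fin k}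

lemma joinFam_of_isDeRahm (hP : IsDeRahm Γ hk P) : JoinFam Γ fun i => P ⁻¹' {i} :=
  ⟨fun v => ⟨P v, rfl⟩, fun {c c'} h u hu v hv => by
    obtain rfl : P u = c := hu
    obtain rfl : P v = c' := hv
    exact hP.1 u v (fun e => h (congrArg P e)) h⟩

lemma nontrivial_of_isDeRahm (hP : IsDeRahm Γ hk P) {i : Fin k} (hi : i ≠ ⟨0, hk⟩) :
    Nontrivial (P ⁻¹' {i} : Set V) := by
  obtain ⟨v, hv⟩ := hP.2.2.2.1 i hi
  by_contra hn
  rw [not_nontrivial_iff_subsingleton] at hn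
  refine hi (Eq.trans (Eq.symm hv) (hP.2.2.1 v fun y hy => hP.1 v y hy.symm fun h => hy ?_))
  exact congrArg Subtype.val (Subsingleton.elim (⟨y, h.symm.trans hv⟩ : P ⁻¹' {i}) ⟨v, hv⟩)

/-- The de Rahm decomposition gives a product decomposition of the kind considered above. -/
lemma exists_asymFam [Fintype V] (hP : IsDeRahm Γ hk P) :
    ∃ (N : ℕ) (T : Fin N → Set V) (S : Set (Fin N)) (e : {i : Fin k // i ≠ ⟨0, hk⟩} ≃ S),
      JoinFam Γ T ∧ AsymFam (fun c => ↥(subRaag Γ (T c))) S ∧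
      (∀ i, T (e i) = P ⁻¹' {i.1}) ∧ N = (k - 1) + Nat.card {v // P v = ⟨0, hk⟩} := by
  classical
  let ι := {i : Fin k // i ≠ ⟨0, hk⟩} ⊕ {v // P v = ⟨0, hk⟩}
  let q := Fintype.equivFin ι
  let T' : ι → Set V := Sum.elim (fun i => P ⁻¹' {i.1}) (fun v => {v.1})
  have hj : ∀ i : {i : Fin k // i ≠ ⟨0, hk⟩}, (q.symm (q (.inl i))) = .inl i := fun i => by simp
  have hS : ∀ c ∈ Set.range (q ∘ Sum.inl), ∃ i : Fin k, i ≠ ⟨0, hk⟩ ∧ T' (q.symm c) = P ⁻¹' {i} := by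
    rintro _ ⟨i, rfl⟩
    exact ⟨i, i.2, by simp [T']⟩
  refine ⟨Fintype.card ι, fun c => T' (q.symm c), Set.range (q ∘ Sum.inl),
    Equiv.ofInjective _ (q.injective.comp Sum.inl_injective), ⟨fun v => ?_, ?_⟩,
    ⟨fun c _ => ?_, fun c _ => ?_, fun c hc => ?_, fun c hc => ?_⟩, fun i => ?_, ?_⟩
  · by_cases h : P v = ⟨0, hk⟩
    · exact ⟨q (.inr ⟨v, h⟩), by simp [T']⟩
    · exact ⟨q (.inl ⟨P v, h⟩), by simp [T']⟩
  · intro c c' hc u hu v hv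
    have hne : q.symm c ≠ q.symm c' := q.symm.injective.ne hc
    revert hu hv hne
    generalize q.symm c = a, q.symm c' = b
    rintro hu hv hne
    have hPP : P u ≠ P v → Γ.Adj u v := fun h => hP.1 u v (fun e => h (congrArg P e)) h
    rcases a with a | a <;> rcases b with b | b
    · exact hPP fun h => hne (congrArg _ (Subtype.ext (hu.symm.trans (h.trans hv))))
    · obtain rfl : v = b := hv
      exact hPP fun h => a.2 ((hu.symm.trans h).trans b.2)
    · obtain rfl : u = a := hu
      exact hPP fun h => b.2 (hv.symm.trans (h.symm.trans a.2))
    · obtain rfl : u = a := hu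
      obtain rfl : v = b := hv
      exact hP.2.1 a.2 b.2 fun h => hne (congrArg _ (Subtype.ext h))
  · exact (raag_geod _).congr _ dist_subIso
  · have := Fintype.ofFinite (T' (q.symm c))
    exact (raag_contr _).congr _ dist_subIso
  · obtain ⟨i, hi, h⟩ := hS c hc
    beta_reduce
    rw [h]
    have := Fintype.ofFinite (P ⁻¹' {i} : Set V)
    have := nontrivial_of_isDeRahm hP hi
    exact (raag_trip (compl_connected (hP.2.2.2.2 i hi) (hP.2.2.2.1 i hi))).congr _ dist_subIso
  · obtain ⟨v, hv⟩ : ∃ v, q.symm c = .inr v := by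
      rcases h : q.symm c with i | v
      · exact (hc ⟨i, by simp [← h]⟩).elim
      · exact ⟨v, rfl⟩
    have : T' (q.symm c) = {v.1} := by rw [hv]; rfl
    beta_reduce
    rw [this]
    exact raag_line.congr _ dist_subIso
  · simp [T']
  · rw [Fintype.card_sum, Nat.card_eq_fintype_card]
    simp [Fintype.card_subtype_compl]

end Fam

end DeRahmSplit

namespace DeRahmSplit

variable {V W : Type} {Γ : SimpleGraph V} {Λ : SimpleGraph W}

/-- The component of a map between two factors is coarsely determined by one component of its
argument. -/
def CLip (K A : ℝ) (T : Set V) (T' : Set W) (f : Raag Γ → Raag Λ) : Prop :=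
  ∀ x x', dist (ret Λ T' (f x)) (ret Λ T' (f x')) ≤ K * dist (ret Γ T x) (ret Γ T x') + A

variable {K A : ℝ} {f : Raag Γ → Raag Λ} {f' : Raag Λ → Raag Γ}

lemma CLip.of_fibre {T : Set V} {T' : Set W} {D : ℝ} (hf : ∀ x x', dist (f x) (f x') ≤ K * dist x x' + A)
    (h : ∀ x x', ret Γ T x = ret Γ T x' → dist (ret Λ T' (f x)) (ret Λ T' (f x')) ≤ D) :
    CLip K (A + D) T T' f := fun x x' => by
  have h1 := h (x * ((ret Γ T x)⁻¹ * ret Γ T x')) x' (by simp)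
  have h2 := (dist_ret_le T' _ _).trans (hf x (x * ((ret Γ T x)⁻¹ * ret Γ T x')))
  have h3 : dist x (x * ((ret Γ T x)⁻¹ * ret Γ T x')) = dist (ret Γ T x) (ret Γ T x') := by
    simp [dist_eq_norm]
  rw [h3] at h2
  linarith [dist_triangle (ret Λ T' (f x))
    (ret Λ T' (f (x * ((ret Γ T x)⁻¹ * ret Γ T x')))) (ret Λ T' (f x'))]

section Component

variable {N M : ℕ} {T : Fin N → Set V} {T' : Fin M → Set W}

variable (T T') in
/-- A map between right-angled Artin groups in product coordinates. -/
def coord (f : Raag Γ → Raag Λ) (x : ∀ c, subRaag Γ (T c)) (d : Fin M) : subRaag Λ (T' d) :=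
  ⟨ret Λ (T' d) (f (List.ofFn fun c => (x c : Raag Γ)).prod), ret_mem _ _⟩

lemma coord_lip (hT : JoinFam Γ T) (hK : 1 ≤ K) (hA : 0 ≤ A)
    (hf : ∀ x x', dist (f x) (f x') ≤ K * dist x x' + A) (x x' : ∀ c, subRaag Γ (T c)) :
    dist (coord T T' f x) (coord T T' f x') ≤ K * N * dist x x' + A := by
  have h0 := dist_nonneg (x := x) (y := x')
  refine (dist_pi_le_iff (by positivity)).2 fun d => (dist_ret_le _ _ _).trans ((hf _ _).trans ?_)
  have : dist (List.ofFn fun c => (x c : Raag Γ)).prod (List.ofFn fun c => (x' c : Raag Γ)).prod ≤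
      N * dist x x' := hT.dist_le fun c => by
    rw [hT.ret_prod fun c => (x c).2, hT.ret_prod fun c => (x' c).2]
    exact dist_le_pi_dist x x' c
  nlinarith

lemma coord_coord (hT' : JoinFam Λ T') (hT : JoinFam Γ T) (hA : 0 ≤ A)
    (hf : ∀ x, dist (f' (f x)) x ≤ A) (x : ∀ c, subRaag Γ (T c)) :
    dist (coord T' T f' (coord T T' f x)) x ≤ A := by
  refine (dist_pi_le_iff hA).2 fun c => ?_
  have h1 : (List.ofFn fun d => (coord T T' f x d : Raag Λ)).prod =
    f (List.ofFn fun c => (x c : Raag Γ)).prod := hT'.prod_ret _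
  have h2 := (dist_ret_le (T c) _ _).trans (hf (List.ofFn fun c => (x c : Raag Γ)).prod)
  rw [hT.ret_prod fun c => (x c).2] at h2
  change dist (ret Γ (T c) (f' _)) _ ≤ _
  rwa [h1]

lemma QPair.coord (hT : JoinFam Γ T) (hT' : JoinFam Λ T') (hf : QPair K A f f') :
    QPair (K * (N + M + 1)) A (coord T T' f) (coord T' T f') := by
  have hK := hf.one_le
  have key : ∀ {n N M : ℝ} {r}, 0 ≤ M → 0 ≤ r → n = N → K * n * r + A ≤ K * (N + M + 1) * r + A := by
    rintro n _ M r h h' rfl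
    have := mul_nonneg (mul_nonneg (zero_le_one.trans hK) h') (add_nonneg h zero_le_one)
    linarith
  refine ⟨?_, hf.nonneg, fun x x' => (coord_lip hT hK hf.nonneg hf.lip x x').trans
    (key (Nat.cast_nonneg _) dist_nonneg rfl), fun x x' =>
    (coord_lip hT' hK hf.nonneg hf.lip' x x').trans ?_,
    coord_coord hT' hT hf.nonneg hf.left, coord_coord hT hT' hf.nonneg hf.right⟩
  · have := mul_nonneg (zero_le_one.trans hK) (add_nonneg (Nat.cast_nonneg (α := ℝ) N) (Nat.cast_nonneg (α := ℝ) M))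
    linarith
  · rw [add_comm (N : ℝ)]
    exact key (Nat.cast_nonneg _) dist_nonneg rfl

end Component

lemma le_norm_gen_zpow (v : V) (n : ℕ) : n ≤ norm Γ (raagGen Γ v ^ n) := by
  have := expo_le v (raagGen Γ v ^ (n : ℤ))
  rw [expo_zpow, expo_self] at this
  simpa using this

section DeRahm

variable {k l : ℕ} {hk : 0 < k} {hl : 0 < l} {P : V → Fin k} {Q : W → Fin l}

lemma exists_split [Fintype V] [Fintype W] (hP : IsDeRahm Γ hk P) (hQ : IsDeRahm Λ hl Q) (hf : QPair K A f f') :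
    (k - 1) + Nat.card {v // P v = ⟨0, hk⟩} = (l - 1) + Nat.card {v // Q v = ⟨0, hl⟩} ∧
    ∃ (σ : {i : Fin k // i ≠ ⟨0, hk⟩} ≃ {j : Fin l // j ≠ ⟨0, hl⟩}) (B : ℝ), ∀ i,
      CLip K B (P ⁻¹' {i.1}) (Q ⁻¹' {(σ i).1}) f := by
  obtain ⟨N, T, S, e, hT, hS, he, rfl⟩ := exists_asymFam hP
  obtain ⟨M, T', S', e', hT', hS', he', rfl⟩ := exists_asymFam hQ
  obtain ⟨h, σ, D, -, hD⟩ := coarse_splits hS hS' (hf.coord hT hT')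
  refine ⟨h, (e.trans σ).trans e'.symm, A + D, fun i => CLip.of_fibre hf.lip fun x x' hx => ?_⟩
  have h1 : Q ⁻¹' {(((e.trans σ).trans e'.symm) i).1} = T' (σ (e i)) := by rw [← he']; simp
  have := hD (e i) (fun c => ⟨ret Γ (T c) x, ret_mem _ _⟩) (fun c => ⟨ret Γ (T c) x', ret_mem _ _⟩)
    (Subtype.ext (by rw [he]; exact hx))
  change dist (ret Λ _ (f _)) (ret Λ _ (f _)) ≤ D at this
  rwa [hT.prod_ret, hT.prod_ret, ← h1] at this

lemma exists_split_symm [Fintype V] [Fintype W] (hP : IsDeRahm Γ hk P) (hQ : IsDeRahm Λ hl Q) (hf : QPair K A f f') :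
    (k - 1) + Nat.card {v // P v = ⟨0, hk⟩} = (l - 1) + Nat.card {v // Q v = ⟨0, hl⟩} ∧
    ∃ (σ : {i : Fin k // i ≠ ⟨0, hk⟩} ≃ {j : Fin l // j ≠ ⟨0, hl⟩}) (B : ℝ), ∀ i,
      CLip K B (P ⁻¹' {i.1}) (Q ⁻¹' {(σ i).1}) f ∧
      CLip K B (Q ⁻¹' {(σ i).1}) (P ⁻¹' {i.1}) f' := by
  obtain ⟨h, σ, B, hB⟩ := exists_split hP hQ hf
  obtain ⟨-, τ, B', hB'⟩ := exists_split hQ hP hf.symm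
  have hτ : ∀ i, τ (σ i) = i := fun i => by
    by_contra hne
    obtain ⟨v, hv⟩ := hP.2.2.2.1 _ (τ (σ i)).2
    have hv' : v ∉ P ⁻¹' {i.1} := fun h => hne (Subtype.ext (Eq.trans (Eq.symm hv) h))
    obtain ⟨n, hn⟩ := exists_nat_gt (K * B + B' + A + A)
    have h1 := hB i (raagGen Γ v ^ n) 1
    have h2 := hB' (σ i) (f (raagGen Γ v ^ n)) (f 1)
    have h3 := (dist_ret_le (P ⁻¹' {(τ (σ i)).1}) _ _).trans (hf.left (raagGen Γ v ^ n))
    have h4 := (dist_ret_le (P ⁻¹' {(τ (σ i)).1}) _ _).trans (hf.left 1)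
    have h5 : (n : ℝ) ≤ dist (ret Γ (P ⁻¹' {(τ (σ i)).1}) (raagGen Γ v ^ n))
        (ret Γ (P ⁻¹' {(τ (σ i)).1}) 1) := by
      rw [map_pow, ret_gen hv, map_one, dist_one]
      exact_mod_cast le_norm_gen_zpow v n
    rw [map_pow, ret_gen_of_not hv'] at h1
    simp only [one_pow, map_one, dist_self, mul_zero, zero_add] at h1
    have h6 := mul_le_mul_of_nonneg_left h1 (zero_le_one.trans hf.one_le)
    rw [dist_comm] at h3
    have := dist_triangle4 (ret Γ (P ⁻¹' {(τ (σ i)).1}) (raagGen Γ v ^ n))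
      (ret Γ (P ⁻¹' {(τ (σ i)).1}) (f' (f (raagGen Γ v ^ n))))
      (ret Γ (P ⁻¹' {(τ (σ i)).1}) (f' (f 1))) (ret Γ (P ⁻¹' {(τ (σ i)).1}) 1)
    linarith
  refine ⟨h, σ, max B B', fun i => ⟨fun x x' => (hB i x x').trans ?_, fun x x' => ?_⟩⟩
  · gcongr; exact le_max_left _ _
  · have := hB' (σ i) x x'
    rw [hτ] at this
    refine this.trans ?_
    gcongr; exact le_max_right _ _

end DeRahm

end DeRahmSplit

namespace DeRahmSplit

variable {V W : Type} {Γ : SimpleGraph V} {Λ : SimpleGraph W}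

lemma raagDist_eq_dist : raagDist Γ = dist := by
  funext x y; rw [raagDist_eq]; rfl

lemma subDist_eq_dist {T : Set V} : subDist Γ T = dist := by
  funext x y; rw [subDist_eq]

/-- The image of a coset is at Hausdorff distance at most `A` from another coset. -/
def Fel (f : Raag Γ → Raag Λ) (a : Raag Γ) (u : V) (b : Raag Λ) (w : W) (A : ℝ) : Prop :=
  (∀ n : ℤ, ∃ p : ℤ, dist (f (a * raagGen Γ u ^ n)) (b * raagGen Λ w ^ p) ≤ A) ∧
  ∀ p : ℤ, ∃ n : ℤ, dist (f (a * raagGen Γ u ^ n)) (b * raagGen Λ w ^ p) ≤ A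

variable {f : Raag Γ → Raag Λ} {a a' a'' : Raag Γ} {u u' u'' : V} {b b' : Raag Λ} {w : W} {A : ℝ}

lemma hausLE_iff_fel :
    HausLE (raagDist Λ) (f '' (StdGeod.mk a u).carrier) (StdGeod.mk b w).carrier A ↔
      Fel f a u b w A := by
  simp [HausLE, StdGeod.carrier, StdGeod.param, Fel, raagDist_eq_dist]

lemma hausLE_sub_iff_fel {T : Set V} {T' : Set W} (hu : u ∈ T) (ha : a ∈ subRaag Γ T)
    (hw : w ∈ T') (hb : b ∈ subRaag Λ T') {F : subRaag Γ T → subRaag Λ T'}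
    (hF : ∀ x, (F x : Raag Λ) = f x) :
    HausLE (subDist Λ T') (F '' subStdSet Γ T a u) (subStdSet Λ T' b w) A ↔ Fel f a u b w A := by
  have h1 (n : ℤ) : a * raagGen Γ u ^ n ∈ subRaag Γ T := mul_mem ha (zpow_mem (gen_mem hu) n)
  have h2 (n : ℤ) : b * raagGen Λ w ^ n ∈ subRaag Λ T' := mul_mem hb (zpow_mem (gen_mem hw) n)
  simp only [HausLE, subStdSet, Fel, subDist_eq_dist, Set.forall_mem_image, Set.exists_mem_image,
    Set.mem_ofPred_eq, Subtype.forall, Subtype.exists, Subtype.dist_eq, hF]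
  refine and_congr ⟨fun H n => ?_, ?_⟩ ⟨fun H n => ?_, ?_⟩
  · obtain ⟨_, -, ⟨p, rfl⟩, h⟩ := H _ (h1 n) ⟨n, rfl⟩
    exact ⟨p, h⟩
  · rintro H _ - ⟨n, rfl⟩
    obtain ⟨p, h⟩ := H n
    exact ⟨_, h2 p, ⟨p, rfl⟩, h⟩
  · obtain ⟨_, -, ⟨p, rfl⟩, h⟩ := H _ (h2 n) ⟨n, rfl⟩
    exact ⟨p, h⟩
  · rintro H _ - ⟨n, rfl⟩
    obtain ⟨p, h⟩ := H n
    exact ⟨_, h1 p, ⟨p, rfl⟩, h⟩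

variable (Γ) in
/-- Two cosets of cyclic subgroups are parallel. -/
def Par (a : Raag Γ) (u : V) (a' : Raag Γ) (u' : V) : Prop := ∃ r, Fel id a u a' u' r

lemma parallel_iff : Parallel (StdGeod.mk a u) (StdGeod.mk a' u') ↔ Par Γ a u a' u' := by
  refine ⟨fun ⟨r, _, h⟩ => ⟨r, hausLE_iff_fel.1 (by rwa [Set.image_id])⟩, fun ⟨r, h⟩ => ⟨r, ?_, ?_⟩⟩
  · obtain ⟨p, hp⟩ := h.1 0
    exact dist_nonneg.trans hp
  · simpa using hausLE_iff_fel.2 h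

lemma sub_parallel_iff {T : Set V} (hu : u ∈ T) (ha : a ∈ subRaag Γ T) (hu' : u' ∈ T)
    (ha' : a' ∈ subRaag Γ T) :
    FinHaus (subDist Γ T) (subStdSet Γ T a u) (subStdSet Γ T a' u') ↔ Par Γ a u a' u' := by
  have key r := hausLE_sub_iff_fel (f := id) (A := r) hu ha hu' ha' (F := id) fun _ => rfl
  simp only [Set.image_id] at key
  refine ⟨fun ⟨r, _, h⟩ => ⟨r, (key r).1 h⟩, fun ⟨r, h⟩ => ⟨r, ?_, (key r).2 h⟩⟩
  obtain ⟨p, hp⟩ := h.1 0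
  exact dist_nonneg.trans hp

lemma Par.symm (h : Par Γ a u a' u') : Par Γ a' u' a u := by
  obtain ⟨r, h1, h2⟩ := h
  exact ⟨r, fun n => by simpa [dist_comm] using h2 n, fun n => by simpa [dist_comm] using h1 n⟩

lemma Par.refl (a : Raag Γ) (u : V) : Par Γ a u a u :=
  ⟨0, fun n => ⟨n, by simp⟩, fun n => ⟨n, by simp⟩⟩

lemma Par.trans (h : Par Γ a u a' u') (h' : Par Γ a' u' a'' u'') : Par Γ a u a'' u'' := by
  obtain ⟨r, h1, h2⟩ := h
  obtain ⟨s, h3, h4⟩ := h'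
  refine ⟨r + s, fun n => ?_, fun n => ?_⟩
  · obtain ⟨p, hp⟩ := h1 n
    obtain ⟨q, hq⟩ := h3 p
    exact ⟨q, (dist_triangle ..).trans (add_le_add hp hq)⟩
  · obtain ⟨p, hp⟩ := h4 n
    obtain ⟨q, hq⟩ := h2 p
    exact ⟨q, (dist_triangle ..).trans (add_le_add hq hp)⟩

lemma Par.label_eq (h : Par Γ a u a' u') : u = u' := by
  obtain ⟨r, h1, -⟩ := h
  by_contra hne
  obtain ⟨n, hn⟩ := exists_nat_gt (r + |(expo Γ u (a⁻¹ * a') : ℝ)|)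
  obtain ⟨p, hp⟩ := h1 n
  rw [dist_eq_norm] at hp
  have h2 := expo_le u ((a * raagGen Γ u ^ (n : ℤ))⁻¹ * (a' * raagGen Γ u' ^ p))
  have h3 : ((|expo Γ u ((a * raagGen Γ u ^ (n : ℤ))⁻¹ * (a' * raagGen Γ u' ^ p))| : ℤ) : ℝ) ≤ r :=
    le_trans (by exact_mod_cast h2) hp
  simp only [expo_mul, expo_inv, expo_zpow, expo_self, expo_gen, if_neg (Ne.symm hne)] at h3 hn
  push_cast at h3 hn
  have h4 := (abs_le.1 h3).1
  have h5 := le_abs_self (-(expo Γ u a : ℝ) + expo Γ u a')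
  linarith

lemma par_ret {N : ℕ} {T : Fin N → Set V} (hT : JoinFam Γ T) {i : Fin N} (hu : u ∈ T i) :
    Par Γ (ret Γ (T i) a) u a u := by
  have key (n : ℤ) : dist (ret Γ (T i) a * raagGen Γ u ^ n) (a * raagGen Γ u ^ n) =
      dist (ret Γ (T i) a) a := by
    have := hT.commute (c := i) (y := (ret Γ (T i) a)⁻¹ * a) (zpow_mem (gen_mem hu) n) (by simp)
    rw [dist_eq_norm, dist_eq_norm]
    congr 1
    rw [mul_inv_rev, mul_assoc, ← mul_assoc _ a, ← this.eq, inv_mul_cancel_left]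
  exact ⟨_, fun n => ⟨n, (key n).le⟩, fun n => ⟨n, (key n).le⟩⟩

variable (Γ) in
/-- The parallelism class of a coset. -/
abbrev pcl (a : Raag Γ) (u : V) : Set (Set (Raag Γ)) := parClass (StdGeod.mk a u)

lemma mem_pcl {S : Set (Raag Γ)} :
    S ∈ pcl Γ a u ↔ ∃ a', Par Γ a u a' u ∧ S = (StdGeod.mk a' u).carrier := by
  constructor
  · rintro ⟨⟨a', u'⟩, rfl, h⟩
    rw [parallel_iff] at h
    obtain rfl := h.label_eq
    exact ⟨a', h, rfl⟩
  · rintro ⟨a', h, rfl⟩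
    exact ⟨_, rfl, parallel_iff.2 h⟩

lemma pcl_eq_iff : pcl Γ a u = pcl Γ a' u' ↔ Par Γ a u a' u' := by
  refine ⟨fun h => ?_, fun h => ?_⟩
  · have h1 : (StdGeod.mk a' u').carrier ∈ pcl Γ a u := h ▸ mem_pcl.2 ⟨a', .refl _ _, rfl⟩
    obtain ⟨k, hk, h2⟩ := h1
    refine parallel_iff.1 ?_
    rwa [Parallel, hk]
  · ext S
    refine exists_congr fun k => and_congr_right fun _ => ?_
    rw [parallel_iff, parallel_iff]
    exact ⟨h.symm.trans, h.trans⟩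

end DeRahmSplit

namespace DeRahmSplit

variable {V W : Type} {Γ : SimpleGraph V} {Λ : SimpleGraph W} {K A : ℝ}

section Sub

variable {T : Set V} {B : Set V} {a a' : Raag Γ} {u u' : V}

lemma mem_subParClass (hu : u ∈ T) (ha : a ∈ subRaag Γ T) {S : Set (subRaag Γ T)} :
    S ∈ subParClass Γ T a u ↔ ∃ a' ∈ subRaag Γ T, Par Γ a u a' u ∧ S = subStdSet Γ T a' u := by
  constructor
  · rintro ⟨a', u', hu', ha', rfl, h⟩
    rw [sub_parallel_iff hu ha hu' ha'] at h
    obtain rfl := h.label_eq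
    exact ⟨a', ha', h, rfl⟩
  · rintro ⟨a', ha', h, rfl⟩
    exact ⟨a', u, hu, ha', rfl, (sub_parallel_iff hu ha hu ha').2 h⟩

lemma subParClass_congr (hu : u ∈ T) (ha : a ∈ subRaag Γ T) (hu' : u' ∈ T)
    (ha' : a' ∈ subRaag Γ T) (h : Par Γ a u a' u') :
    subParClass Γ T a u = subParClass Γ T a' u' := by
  obtain rfl := h.label_eq
  ext S
  rw [mem_subParClass hu ha, mem_subParClass hu ha']
  exact exists_congr fun c => and_congr_right fun _ => and_congr_left fun _ =>
    ⟨h.symm.trans, h.trans⟩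

variable (Γ T) in
/-- The parallelism class in the whole group spanned by one in a factor. -/
def span (F : Set (Set (subRaag Γ T))) : Set (Set (Raag Γ)) :=
  {S | ∃ a u, a ∈ subRaag Γ T ∧ u ∈ T ∧ subStdSet Γ T a u ∈ F ∧ S ∈ pcl Γ a u}

lemma span_subParClass (hu : u ∈ T) (ha : a ∈ subRaag Γ T) :
    span Γ T (subParClass Γ T a u) = pcl Γ a u := by
  ext S
  refine ⟨?_, fun h => ⟨a, u, ha, hu, (mem_subParClass hu ha).2 ⟨a, ha, .refl _ _, rfl⟩, h⟩⟩
  rintro ⟨a', u', ha', hu', h, hS⟩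
  obtain ⟨c, v, hv, hc, h, h'⟩ := h
  rw [← h, sub_parallel_iff hu ha hu' ha'] at h'
  rwa [pcl_eq_iff.2 h']

lemma span_bijOn {N : ℕ} {T : Fin N → Set V} (hT : JoinFam Γ T) (i : Fin N) :
    Set.BijOn (span Γ (T i)) (subPeriph Γ (T i) B) (periph Γ (B ∩ T i)) := by
  refine ⟨?_, ?_, ?_⟩
  · rintro _ ⟨a, u, hB, hu, ha, rfl⟩
    exact ⟨⟨a, u⟩, ⟨hB, hu⟩, span_subParClass hu ha⟩
  · rintro _ ⟨a, u, hB, hu, ha, rfl⟩ _ ⟨a', u', hB', hu', ha', rfl⟩ h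
    rw [span_subParClass hu ha, span_subParClass hu' ha', pcl_eq_iff] at h
    exact subParClass_congr hu ha hu' ha' h
  · rintro _ ⟨⟨a, u⟩, ⟨hB, hu⟩, rfl⟩
    exact ⟨_, ⟨_, u, hB, hu, ret_mem _ a, rfl⟩,
      (span_subParClass hu (ret_mem _ a)).trans (pcl_eq_iff.2 (par_ret hT hu))⟩

end Sub

lemma isQIWith_of {X Y : Type*} {dX : X → X → ℝ} {dY : Y → Y → ℝ} {f : X → Y} (hK : 1 ≤ K)
    (hA : 0 ≤ A) (h1 : ∀ x x', dY (f x) (f x') ≤ K * dX x x' + A)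
    (h2 : ∀ x x', dX x x' ≤ K * dY (f x) (f x') + A) (h3 : ∀ y, ∃ x, dY (f x) y ≤ A) :
    IsQIWith K A dX dY f := by
  refine ⟨hK, hA, fun x x' => ⟨?_, h1 x x'⟩, h3⟩
  rw [sub_le_iff_le_add, div_le_iff₀ (by linarith)]
  nlinarith [h2 x x']

/-- A map between two factors inducing a given map of peripheral structures. -/
structure Piece (T : Set V) (T' : Set W) (B : Set V)
    (fs : Set (Set (Raag Γ)) → Set (Set (Raag Λ))) (g : Raag Γ → Raag Λ) (K A : ℝ) : Prop where
  one_le : 1 ≤ K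
  nonneg : 0 ≤ A
  mem : ∀ x, g x ∈ subRaag Λ T'
  comp_ret : ∀ x, g (ret Γ T x) = g x
  lip : ∀ x x', dist (g x) (g x') ≤ K * dist (ret Γ T x) (ret Γ T x') + A
  colip : ∀ x x', dist (ret Γ T x) (ret Γ T x') ≤ K * dist (g x) (g x') + A
  onto : ∀ y, ∃ x, dist (g x) (ret Λ T' y) ≤ A
  label : ∀ a u b w, u ∈ B → fs (pcl Γ a u) = pcl Λ b w → (u ∈ T ↔ w ∈ T')
  fel : ∀ a u b w, u ∈ B → u ∈ T → fs (pcl Γ a u) = pcl Λ b w →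
    ∃ b', Par Λ b w b' w ∧ Fel g a u (ret Λ T' b') w A
  fel' : ∀ a u b w, u ∈ B → u ∈ T → fs (pcl Γ a u) = pcl Λ b w →
    ∃ a', Par Γ a u a' u ∧ Fel g a' u (ret Λ T' b) w A

namespace Piece

variable {k : ℕ} {T : Fin k → Set V} {T' : Fin k → Set W} {B : Set V} {B' : Set W}
  {fs : Set (Set (Raag Γ)) → Set (Set (Raag Λ))} {g : Fin k → Raag Γ → Raag Λ}
  (hT : JoinFam Γ T) (hT' : JoinFam Λ T') (hg : ∀ i, Piece (T i) (T' i) B fs (g i) K A)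

/-- The map between the factors. -/
def fac {T : Set V} {T' : Set W} {g : Raag Γ → Raag Λ} (hg : Piece T T' B fs g K A)
    (x : subRaag Γ T) : subRaag Λ T' := ⟨g x, hg.mem x⟩

include hT hT' hg

lemma exists_relQI_fac (hfs : Set.BijOn fs (periph Γ B) (periph Λ B')) (i : Fin k) :
    ∃ gfs, IsRelQIWith K A (subDist Γ (T i)) (subDist Λ (T' i)) (subPeriph Γ (T i) B)
      (subPeriph Λ (T' i) B') (hg i).fac gfs := by
  have hfsi : Set.BijOn fs (periph Γ (B ∩ T i)) (periph Λ (B' ∩ T' i)) := by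
    refine ⟨?_, hfs.injOn.mono ?_, ?_⟩
    · rintro _ ⟨⟨a, u⟩, ⟨hB, hu⟩, rfl⟩
      obtain ⟨⟨b, w⟩, hw, h⟩ := hfs.mapsTo ⟨⟨a, u⟩, hB, rfl⟩
      exact ⟨⟨b, w⟩, ⟨hw, ((hg i).label a u b w hB h).1 hu⟩, h⟩
    · rintro F ⟨l, hl, h⟩
      exact ⟨l, hl.1, h⟩
    · rintro _ ⟨⟨b, w⟩, ⟨hB, hw⟩, rfl⟩
      obtain ⟨_, ⟨⟨a, u⟩, hu, rfl⟩, h⟩ := hfs.surjOn ⟨⟨b, w⟩, hB, rfl⟩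
      exact ⟨_, ⟨⟨a, u⟩, ⟨hu, ((hg i).label a u b w hu h).2 hw⟩, rfl⟩, h⟩
  have hinv := (span_bijOn (B := B') hT' i).invOn_invFunOn
  have hbij := ((span_bijOn (B := B') hT' i).symm hinv.symm).comp (hfsi.comp (span_bijOn (B := B) hT i))
  refine ⟨_, isQIWith_of (hg i).one_le (hg i).nonneg (fun x x' => ?_) (fun x x' => ?_) (fun y => ?_), hbij,
    ?_⟩
  · have := (hg i).lip x x'
    rw [ret_eq_self x.2, ret_eq_self x'.2] at this
    rwa [subDist_eq_dist, subDist_eq_dist]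
  · have := (hg i).colip x x'
    rw [ret_eq_self x.2, ret_eq_self x'.2] at this
    rwa [subDist_eq_dist, subDist_eq_dist]
  · obtain ⟨x, hx⟩ := (hg i).onto y
    rw [ret_eq_self y.2, ← (hg _).comp_ret] at hx
    exact ⟨⟨_, ret_mem _ x⟩, by rwa [subDist_eq_dist]⟩
  · rintro _ ⟨a, u, hB, hu, ha, rfl⟩
    obtain ⟨⟨b, w⟩, ⟨hB', hw⟩, h⟩ := hfsi.mapsTo ⟨⟨a, u⟩, ⟨hB, hu⟩, rfl⟩
    have hb := ret_mem (T' i) b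
    replace h : fs (pcl Γ a u) = pcl Λ (ret Λ (T' i) b) w :=
      h.trans (pcl_eq_iff.2 (par_ret hT' hw)).symm
    rw [Function.comp_apply, Function.comp_apply, span_subParClass hu ha, h,
      ← span_subParClass hw hb, hinv.1 ⟨_, w, hB', hw, hb, rfl⟩]
    refine ⟨fun S hS => ?_, fun S hS => ?_⟩
    · obtain ⟨a', ha', hp, rfl⟩ := (mem_subParClass hu ha).1 hS
      obtain ⟨b', hb', hF⟩ := (hg i).fel a' u _ w hB hu (pcl_eq_iff.2 hp ▸ h)
      exact ⟨_, (mem_subParClass hw hb).2 ⟨_, ret_mem _ b', hb'.trans (par_ret hT' hw).symm, rfl⟩,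
        (hausLE_sub_iff_fel hu ha' hw (ret_mem _ _) fun _ => rfl).2 hF⟩
    · obtain ⟨b', hb', hp, rfl⟩ := (mem_subParClass hw hb).1 hS
      obtain ⟨a', ha', hF⟩ := (hg i).fel' a u b' w hB hu (h.trans (pcl_eq_iff.2 hp))
      rw [ret_eq_self hb'] at hF
      refine ⟨_, (mem_subParClass hu ha).2 ⟨_, ret_mem _ a', ha'.trans (par_ret hT hu).symm, rfl⟩,
        (hausLE_sub_iff_fel hu (ret_mem _ _) hw hb' fun _ => rfl).2 ?_⟩
      have (n : ℤ) : g i (ret Γ (T i) a' * raagGen Γ u ^ n) =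
          g i (a' * raagGen Γ u ^ n) := by
        rw [← (hg i).comp_ret (a' * _), map_mul, map_zpow, ret_gen hu]
      simpa only [Fel, this] using hF

lemma fel_prod {i : Fin k} {a : Raag Γ} {u : V} {b : Raag Λ} {w : W} (hu : u ∈ T i) (hw : w ∈ T' i)
    (h : Fel (g i) a u (ret Λ (T' i) b) w A)
    (h' : ∀ c ≠ i, dist (g c a) (ret Λ (T' c) b) ≤ A) :
    Fel (fun x => (List.ofFn fun i => g i x).prod) a u b w (k * A) := by
  have key (n p : ℤ) (hnp : dist (g i (a * raagGen Γ u ^ n))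
      (ret Λ (T' i) b * raagGen Λ w ^ p) ≤ A) :
      dist (List.ofFn fun i => g i (a * raagGen Γ u ^ n)).prod (b * raagGen Λ w ^ p) ≤ k * A :=
    hT'.dist_le fun c => by
      rw [hT'.ret_prod fun c => (hg c).mem _]
      by_cases hc : c = i
      · subst hc
        rwa [map_mul, map_zpow, ret_gen hw]
      · rw [← (hg _).comp_ret, map_mul, map_mul, map_zpow, map_zpow,
          ret_gen_of_not fun h => hc (hT.eq_of_mem h hu),
          ret_gen_of_not fun h => hc (hT'.eq_of_mem h hw), one_zpow, one_zpow, mul_one, mul_one,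
          (hg _).comp_ret]
        exact h' c hc
  exact ⟨fun n => (h.1 n).imp fun p hp => key n p hp, fun p => (h.2 p).imp fun n hn => key n p hn⟩

lemma isRelQIWith_prod (hk : 0 < k) (hfs : Set.BijOn fs (periph Γ B) (periph Λ B')) :
    IsRelQIWith (k * K) (k * A) (raagDist Γ) (raagDist Λ) (periph Γ B) (periph Λ B')
      (fun x => (List.ofFn fun i => g i x).prod) fs := by
  have hk1 : (1 : ℝ) ≤ k := by exact_mod_cast hk
  have hK := (hg ⟨0, hk⟩).one_le
  have hA := (hg ⟨0, hk⟩).nonneg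
  refine ⟨isQIWith_of (by nlinarith) (by positivity) (fun x x' => ?_) (fun x x' => ?_)
    (fun y => ?_), hfs, ?_⟩
  · simp only [raagDist_eq_dist]
    rw [mul_assoc, ← mul_add]
    refine hT'.dist_le fun c => ?_
    rw [hT'.ret_prod fun c => (hg c).mem _, hT'.ret_prod fun c => (hg c).mem _]
    refine ((hg c).lip x x').trans ?_
    gcongr
    exact dist_ret_le _ _ _
  · simp only [raagDist_eq_dist]
    rw [mul_assoc, ← mul_add]
    refine hT.dist_le fun c => ((hg c).colip x x').trans ?_
    have := dist_ret_le (T' c) (List.ofFn fun i => g i x).prod (List.ofFn fun i => g i x').prod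
    rw [hT'.ret_prod fun c => (hg c).mem _, hT'.ret_prod fun c => (hg c).mem _] at this
    gcongr
  · choose x hx using fun i => (hg i).onto y
    refine ⟨(List.ofFn fun i => ret Γ (T i) (x i)).prod, ?_⟩
    simp only [raagDist_eq_dist]
    refine hT'.dist_le fun c => ?_
    rw [hT'.ret_prod fun c => (hg c).mem _, ← (hg _).comp_ret, hT.ret_prod fun c => ret_mem _ _, (hg _).comp_ret]
    exact hx c
  · rintro _ ⟨⟨a, u⟩, hB : u ∈ B, rfl⟩
    obtain ⟨⟨b, w⟩, hB', h⟩ := hfs.mapsTo ⟨⟨a, u⟩, hB, rfl⟩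
    obtain ⟨i, hu⟩ := hT.cover u
    have hw := ((hg i).label a u b w hB h).1 hu
    refine ⟨fun S hS => ?_, fun S hS => ?_⟩
    · obtain ⟨a', hp, rfl⟩ := mem_pcl.1 hS
      obtain ⟨b', hb', hF⟩ := (hg i).fel a' u b w hB hu (pcl_eq_iff.2 hp ▸ h)
      let q := (List.ofFn fun i => g i a').prod
      have hq (c : Fin k) : ret Λ (T' c) q = g c a' :=
        hT'.ret_prod (fun c => (hg c).mem _) c
      let b'' := ret Λ (T' i) b' * ((ret Λ (T' i) q)⁻¹ * q)
      have e1 : ret Λ (T' i) b'' = ret Λ (T' i) b' := by simp [b'']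
      refine ⟨(StdGeod.mk b'' w).carrier, h ▸ mem_pcl.2 ⟨b'', ?_, rfl⟩, hausLE_iff_fel.2
        (fel_prod hT hT' hg hu hw (e1 ▸ hF) fun c hc => ?_)⟩
      · have h1 := par_ret hT' hw (a := b'')
        rw [e1] at h1
        exact (hb'.trans (par_ret hT' hw).symm).trans h1
      · simp only [b'', hq, map_mul, map_inv, hT'.ret_eq_one hc (ret_mem (T' i) _),
          hT'.ret_eq_one hc ((hg i).mem a'), inv_one, one_mul]
        rwa [dist_self]
    · rw [h] at hS
      obtain ⟨b', hp, rfl⟩ := mem_pcl.1 hS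
      obtain ⟨a', ha', hF⟩ := (hg i).fel' a u b' w hB hu (h.trans (pcl_eq_iff.2 hp))
      choose x hx using fun i => (hg i).onto b'
      let a'' := (List.ofFn fun c => ret Γ (T c) (if c = i then a' else x c)).prod
      have hq (c : Fin k) : ret Γ (T c) a'' =
        ret Γ (T c) (if c = i then a' else x c) := hT.ret_prod (fun c => ret_mem _ _) c
      have e1 : ret Γ (T i) a'' = ret Γ (T i) a' := by simp [hq]
      refine ⟨(StdGeod.mk a'' u).carrier, mem_pcl.2 ⟨a'', ?_, rfl⟩, hausLE_iff_fel.2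
        (fel_prod hT hT' hg hu hw ?_ fun c hc => ?_)⟩
      · have h1 := par_ret hT hu (a := a'')
        rw [e1] at h1
        exact (ha'.trans (par_ret hT hu).symm).trans h1
      · have (n : ℤ) : g i (a'' * raagGen Γ u ^ n) = g i (a' * raagGen Γ u ^ n) := by
          rw [← (hg _).comp_ret, map_mul, e1, ← map_mul, (hg _).comp_ret]
        simpa only [Fel, this] using hF
      · rw [← (hg _).comp_ret, hq, if_neg hc, (hg _).comp_ret]
        exact hx c

end Piece

end DeRahmSplit

namespace DeRahmSplit

variable {V W : Type} {Γ : SimpleGraph V} {Λ : SimpleGraph W} {K A B : ℝ}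

lemma IsQIWith.exists_qPair {X Y : Type*} [PseudoMetricSpace X] [PseudoMetricSpace Y] {f : X → Y}
    (h : IsQIWith K A dist dist f) : ∃ f', QPair K (3 * K * A) f f' := by
  obtain ⟨hK, hA, h1, h2⟩ := h
  choose f' hf' using h2
  have hKA := mul_le_mul_of_nonneg_right hK hA
  have h3 x x' : dist x x' ≤ K * (dist (f x) (f x') + A) := by
    have := (h1 x x').1
    rwa [sub_le_iff_le_add, div_le_iff₀' (by linarith)] at this
  refine ⟨f', hK, by linarith, fun x x' => by linarith [(h1 x x').2], fun y y' => ?_, fun x => ?_,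
    fun y => by linarith [hf' y]⟩
  · have h4 := dist_triangle4 (f (f' y)) y y' (f (f' y'))
    rw [dist_comm y'] at h4
    have := mul_le_mul_of_nonneg_left (h4.trans (add_le_add (add_le_add_left (hf' y) _) (hf' y')))
      (zero_le_one.trans hK)
    linarith [h3 (f' y) (f' y')]
  · have := mul_le_mul_of_nonneg_left (hf' (f x)) (zero_le_one.trans hK)
    linarith [h3 (f' (f x)) x]

lemma false_of_dist_ret_le {T : Set V} {u : V} (hu : u ∈ T) {a : Raag Γ} {R : ℝ}
    (h : ∀ n : ℤ, dist (ret Γ T (a * raagGen Γ u ^ n)) (ret Γ T a) ≤ R) : False := by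
  obtain ⟨n, hn⟩ := exists_nat_gt R
  have h1 := h n
  have h2 : (n : ℝ) ≤ norm Γ (raagGen Γ u ^ n) := by exact_mod_cast le_norm_gen_zpow u n
  rw [dist_comm, dist_eq_norm, map_mul, inv_mul_cancel_left, map_zpow, ret_gen hu,
    zpow_natCast] at h1
  linarith

variable {S : Set V} {fs : Set (Set (Raag Γ)) → Set (Set (Raag Λ))} {f : Raag Γ → Raag Λ}
  {f' : Raag Λ → Raag Γ} {T : Set V} {T' : Set W}

lemma Piece.of_cLip (hf : QPair K A f f') (h : CLip K B T T' f) (h' : CLip K B T' T f')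
    (h1 : ∀ a u b w, u ∈ S → fs (pcl Γ a u) = pcl Λ b w →
      ∃ b', Par Λ b w b' w ∧ Fel f a u b' w A)
    (h2 : ∀ a u b w, u ∈ S → fs (pcl Γ a u) = pcl Λ b w →
      ∃ a', Par Γ a u a' u ∧ Fel f a' u b w A) :
    Piece T T' S fs (fun x => ret Λ T' (f (ret Γ T x))) K (2 * A + B) := by
  have hA := hf.nonneg
  have hK := zero_le_one.trans hf.one_le
  have hB : 0 ≤ B := by simpa using h 1 1
  have key x : dist (ret Λ T' (f (ret Γ T x))) (ret Λ T' (f x)) ≤ B := by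
    simpa using h (ret Γ T x) x
  have hl a u b w (hu : u ∈ S) (e : fs (pcl Γ a u) = pcl Λ b w) : u ∈ T ↔ w ∈ T' := by
    obtain ⟨b', -, hF⟩ := h1 a u b w hu e
    have hd x y : dist (ret Λ T' x) (ret Λ T' y) ≤ dist x y := dist_ret_le ..
    refine ⟨fun hu => ?_, fun hw => ?_⟩ <;> by_contra hn
    · refine false_of_dist_ret_le hu (a := a) (R := K * (2 * A) + B + 2 * A) fun n => ?_
      obtain ⟨p, hp⟩ := hF.1 n
      obtain ⟨q, hq⟩ := hF.1 0
      have e1 := (hd _ _).trans hp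
      have e2 := (hd _ _).trans hq
      rw [map_mul, map_zpow, ret_gen_of_not hn, one_zpow, mul_one] at e1 e2
      rw [zpow_zero, mul_one] at e2
      have e3 := h' (f (a * raagGen Γ u ^ n)) (f a)
      have e4 := mul_le_mul_of_nonneg_left ((dist_triangle_right _ _ _).trans (add_le_add e1 e2)) hK
      have e5 := (dist_ret_le T _ _).trans (hf.left (a * raagGen Γ u ^ n))
      have e6 := (dist_ret_le T _ _).trans (hf.left a)
      rw [dist_comm] at e5
      linarith [dist_triangle4 (ret Γ T (a * raagGen Γ u ^ n))
        (ret Γ T (f' (f (a * raagGen Γ u ^ n)))) (ret Γ T (f' (f a))) (ret Γ T a)]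
    · refine false_of_dist_ret_le hw (a := b') (R := 2 * A + B) fun n => ?_
      obtain ⟨p, hp⟩ := hF.2 n
      obtain ⟨q, hq⟩ := hF.2 0
      have e1 := (hd _ _).trans hp
      have e2 := (hd _ _).trans hq
      have e3 := h (a * raagGen Γ u ^ p) (a * raagGen Γ u ^ q)
      simp only [map_mul _ a, map_zpow, ret_gen_of_not hn, one_zpow, mul_one, dist_self,
        mul_zero, zero_add] at e3
      rw [zpow_zero, mul_one] at e2
      rw [dist_comm] at e1
      linarith [dist_triangle4 (ret Λ T' (b' * raagGen Λ w ^ n))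
        (ret Λ T' (f (a * raagGen Γ u ^ p))) (ret Λ T' (f (a * raagGen Γ u ^ q))) (ret Λ T' b')]
  have hF a u b w (hw : w ∈ T') (hF : Fel f a u b w A) :
      Fel (fun x => ret Λ T' (f (ret Γ T x))) a u (ret Λ T' b) w (2 * A + B) := by
    have key (n p : ℤ) (h : dist (f (a * raagGen Γ u ^ n)) (b * raagGen Λ w ^ p) ≤ A) :
        dist (ret Λ T' (f (ret Γ T (a * raagGen Γ u ^ n)))) (ret Λ T' b * raagGen Λ w ^ p) ≤
          2 * A + B := by
      have e1 := (dist_ret_le T' _ _).trans h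
      rw [map_mul _ b, map_zpow, ret_gen hw] at e1
      linarith [dist_triangle _ _ (ret Λ T' b * raagGen Λ w ^ p) |>.trans
        (add_le_add (key (a * raagGen Γ u ^ n)) e1)]
    exact ⟨fun n => (hF.1 n).imp fun p hp => key n p hp,
      fun p => (hF.2 p).imp fun n hn => key n p hn⟩
  refine ⟨hf.one_le, by linarith, fun x => ret_mem _ _, fun x => by rw [ret_ret],
    fun x x' => ?_, fun x x' => ?_, fun y => ⟨f' y, ?_⟩, hl, fun a u b w hu hT e => ?_,
    fun a u b w hu hT e => ?_⟩
  · have := h (ret Γ T x) (ret Γ T x')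
    rw [ret_ret, ret_ret] at this
    linarith
  · have e1 := h' (f (ret Γ T x)) (f (ret Γ T x'))
    have e2 := (dist_ret_le T _ _).trans (hf.left (ret Γ T x))
    have e3 := (dist_ret_le T _ _).trans (hf.left (ret Γ T x'))
    rw [ret_ret, dist_comm] at e2
    rw [ret_ret] at e3
    linarith [dist_triangle4 (ret Γ T x) (ret Γ T (f' (f (ret Γ T x))))
      (ret Γ T (f' (f (ret Γ T x')))) (ret Γ T x')]
  · linarith [dist_triangle _ _ (ret Λ T' y) |>.trans
      (add_le_add (key (f' y)) ((dist_ret_le T' _ _).trans (hf.right y)))]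
  · obtain ⟨b', hb, hF'⟩ := h1 a u b w hu e
    exact ⟨b', hb, hF _ _ _ _ ((hl a u b w hu e).1 hT) hF'⟩
  · obtain ⟨a', ha, hF'⟩ := h2 a u b w hu e
    exact ⟨a', ha, hF _ _ _ _ ((hl a u b w hu e).1 hT) hF'⟩

lemma par_one {u : V} (hu : ∀ v ≠ u, Γ.Adj v u) (a : Raag Γ) : Par Γ 1 u a u := by
  have hc : Commute a (raagGen Γ u) := by
    induction a using raag_ind with
    | h1 => exact .one_left _
    | h c g ih =>
      refine .mul_left ?_ ih
      have : Commute (raagGen Γ c.1) (raagGen Γ u) := by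
        by_cases h : c.1 = u
        · rw [h]
        · exact raagGen_commute (hu _ h)
      obtain ⟨v, _ | _⟩ := c <;> simpa [gen] using this
  have key (n : ℤ) : dist (id (1 * raagGen Γ u ^ n)) (a * raagGen Γ u ^ n) ≤ norm Γ a := by
    rw [dist_eq_norm, id, one_mul, (hc.zpow_right n).eq, inv_mul_cancel_left]
  exact ⟨_, fun n => ⟨n, key n⟩, fun n => ⟨n, key n⟩⟩

open Classical in
variable (Γ Λ T) in
/-- The homomorphism sending the generators in `T` to generators that pairwise commute. -/
def cliqueHom {φ : T → W} (hφ : Function.Injective φ) (h : Λ.IsClique (Set.range φ)) :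
    Raag Γ →* Raag Λ :=
  mapHom (fun v => if h : v ∈ T then some (φ ⟨v, h⟩) else none) (by
    intro x y hxy x' hx y' hy
    simp only [Option.mem_def, Option.dite_none_right_eq_some, Option.some_inj] at hx hy
    obtain ⟨h1, rfl⟩ := hx
    obtain ⟨h2, rfl⟩ := hy
    exact h ⟨_, rfl⟩ ⟨_, rfl⟩ fun e => hxy.ne (congrArg Subtype.val (hφ e)))

lemma cliqueHom_gen {φ : T → W} {hφ : Function.Injective φ} {h : Λ.IsClique (Set.range φ)} (v : T) :
    cliqueHom Γ Λ T hφ h (raagGen Γ v) = raagGen Λ (φ v) := by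
  simp [cliqueHom, mapHom_gen]

lemma cliqueHom_comp (β : T ≃ T') {h : Λ.IsClique (Set.range fun v => (β v : W))}
    {h' : Γ.IsClique (Set.range fun v => (β.symm v : V))} (x : Raag Γ) :
    cliqueHom Λ Γ T' (Subtype.val_injective.comp β.symm.injective) h'
      (cliqueHom Γ Λ T (Subtype.val_injective.comp β.injective) h x) = ret Γ T x := by
  have : (cliqueHom Λ Γ T' (Subtype.val_injective.comp β.symm.injective) h').comp
      (cliqueHom Γ Λ T (Subtype.val_injective.comp β.injective) h) = ret Γ T := hom_ext fun v => by
    by_cases hv : v ∈ T <;> simp [cliqueHom, ret, mapHom_gen, hv]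
  exact DFunLike.congr_fun this x

lemma Piece.of_clique (hK : 1 ≤ K) (hA : 0 ≤ A) (hT : ∀ u ∈ T, ∀ v ≠ u, Γ.Adj v u)
    (hT' : ∀ u ∈ T', ∀ v ≠ u, Λ.Adj v u) (β : T ≃ T')
    (hl : ∀ a u b w, u ∈ S → fs (pcl Γ a u) = pcl Λ b w → (u ∈ T ↔ w ∈ T'))
    (hβ : ∀ u : T, u.1 ∈ S → fs (pcl Γ 1 u.1) = pcl Λ 1 (β u).1) :
    ∃ g, Piece T T' S fs g K A := by
  have c : Λ.IsClique (Set.range fun v => (β v : W)) := by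
    rintro _ ⟨x, rfl⟩ _ ⟨y, rfl⟩ h
    exact hT' _ (β y).2 _ h
  have c' : Γ.IsClique (Set.range fun v => (β.symm v : V)) := by
    rintro _ ⟨x, rfl⟩ _ ⟨y, rfl⟩ h
    exact hT _ (β.symm y).2 _ h
  let μ := cliqueHom Γ Λ T (Subtype.val_injective.comp β.injective) c
  let μ' := cliqueHom Λ Γ T' (Subtype.val_injective.comp β.symm.injective) c'
  have h1 (x) : μ' (μ x) = ret Γ T x := cliqueHom_comp β x
  have h2 (y) : μ (μ' y) = ret Λ T' y := cliqueHom_comp β.symm y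
  have h3 (x) : ret Λ T' (μ x) = μ x :=
    DFunLike.congr_fun (hom_ext (j := (ret Λ T').comp μ) (j' := μ) fun v => by
      by_cases hv : v ∈ T <;> simp [μ, cliqueHom, ret, mapHom_gen, hv]) x
  have h4 (x) : μ (ret Γ T x) = μ x := by rw [← h1, h2, h3]
  have h5 (x x') : dist (μ x) (μ x') ≤ dist (ret Γ T x) (ret Γ T x') := by
    rw [← h4 x, ← h4 x', dist_eq_norm, dist_eq_norm, ← map_inv, ← map_mul]
    exact_mod_cast norm_mapHom_le _
  have h6 (x x') : dist (ret Γ T x) (ret Γ T x') ≤ dist (μ x) (μ x') := by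
    rw [← h1 x, ← h1 x', dist_eq_norm, dist_eq_norm, ← map_inv, ← map_mul]
    exact_mod_cast norm_mapHom_le _
  have h7 {r : ℝ} (hr : 0 ≤ r) : r ≤ K * r + A := by nlinarith
  have hF a u b w (hu : u ∈ S) (huT : u ∈ T) (e : fs (pcl Γ a u) = pcl Λ b w) (n : ℤ) :
      μ (a * raagGen Γ u ^ n) = μ a * raagGen Λ w ^ n := by
    have : pcl Λ 1 (β ⟨u, huT⟩).1 = pcl Λ b w := by
      rw [← hβ ⟨u, huT⟩ hu, pcl_eq_iff.2 (par_one (hT u huT) a), e]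
    rw [← (pcl_eq_iff.1 this).label_eq, map_mul, map_zpow]
    exact congrArg (fun z => μ a * z ^ n) (cliqueHom_gen ⟨u, huT⟩)
  refine ⟨μ, hK, hA, fun x => h3 x ▸ ret_mem _ _, h4, fun x x' => (h5 x x').trans (h7 dist_nonneg),
    fun x x' => (h6 x x').trans (h7 dist_nonneg), fun y => ⟨μ' y, by rwa [h2, dist_self]⟩, hl,
    fun a u b w hu huT e => ⟨μ a, ?_, ?_⟩, fun a u b w hu huT e => ⟨μ' b, ?_, ?_⟩⟩
  · have hw := hT' w ((hl a u b w hu e).1 huT)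
    exact (par_one hw _).symm.trans (par_one hw _)
  · have key (n : ℤ) : dist (μ (a * raagGen Γ u ^ n)) (ret Λ T' (μ a) * raagGen Λ w ^ n) ≤ A := by
      rwa [hF a u b w hu huT e, h3, dist_self]
    exact ⟨fun n => ⟨n, key n⟩, fun n => ⟨n, key n⟩⟩
  · exact (par_one (hT u huT) _).symm.trans (par_one (hT u huT) _)
  · have e' : fs (pcl Γ (μ' b) u) = pcl Λ b w := by
      rw [← e, pcl_eq_iff.2 ((par_one (hT u huT) a).symm.trans (par_one (hT u huT) (μ' b)))]
    have key (n : ℤ) : dist (μ (μ' b * raagGen Γ u ^ n)) (ret Λ T' b * raagGen Λ w ^ n) ≤ A := by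
      rwa [hF (μ' b) u b w hu huT e', h2, dist_self]
    exact ⟨fun n => ⟨n, key n⟩, fun n => ⟨n, key n⟩⟩

end DeRahmSplit

namespace DeRahmSplit

lemma exists_equiv_forall_of_injective {α β : Type*} [Finite α] (e : α ≃ β) (s : Set α)
    (r : α → β → Prop) (h : ∀ x ∈ s, ∃ y, r x y) (hr : ∀ x ∈ s, ∀ x' ∈ s, ∀ y,
      r x y → r x' y → x = x') :
    ∃ e : α ≃ β, ∀ x ∈ s, r x (e x) := by
  classical
  have := Fintype.ofFinite α
  choose φ hφ using h
  have hinj : Function.Injective fun x : s => e.symm (φ x x.2) := fun x x' hx =>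
    Subtype.ext (hr x x.2 x' x'.2 _ (hφ x x.2) (by
      rw [show φ x x.2 = φ x' x'.2 from e.symm.injective hx]; exact hφ x' x'.2))
  refine ⟨((Equiv.ofInjective _ hinj).extendSubtype (p := (· ∈ s))).trans e, fun x hx => ?_⟩
  simpa [Equiv.extendSubtype_apply_of_mem _ x hx] using hφ x hx

variable {V W : Type} {Γ : SimpleGraph V} {Λ : SimpleGraph W} {K A A' : ℝ}
  {f : Raag Γ → Raag Λ} {a : Raag Γ} {u : V} {b : Raag Λ} {w : W}

lemma Fel.mono (h : Fel f a u b w A) (hA : A ≤ A') : Fel f a u b w A' :=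
  ⟨fun n => (h.1 n).imp fun _ hp => hp.trans hA, fun n => (h.2 n).imp fun _ hp => hp.trans hA⟩

lemma JoinFam.mem_iff_of_ne {N : ℕ} {T : Fin N → Set V} {T' : Fin N → Set W} (hT : JoinFam Γ T)
    (hT' : JoinFam Λ T') {i : Fin N} (h : ∀ c ≠ i, (u ∈ T c ↔ w ∈ T' c)) :
    u ∈ T i ↔ w ∈ T' i := by
  obtain ⟨c, hc⟩ := hT.cover u
  obtain ⟨d, hd⟩ := hT'.cover w
  refine ⟨fun hu => ?_, fun hw => ?_⟩
  · by_cases hdi : d = i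
    · exact hdi ▸ hd
    · exact absurd (hT.eq_of_mem ((h d hdi).2 hd) hu) hdi
  · by_cases hci : c = i
    · exact hci ▸ hc
    · exact absurd (hT'.eq_of_mem ((h c hci).1 hc) hw) hci

lemma adj_of_isDeRahm {k : ℕ} {hk : 0 < k} {P : V → Fin k} (hP : IsDeRahm Γ hk P) :
    ∀ u ∈ P ⁻¹' {⟨0, hk⟩}, ∀ v ≠ u, Γ.Adj v u := fun u hu v hv => by
  by_cases h : P v = P u
  · exact hP.2.1 (h.trans hu) hu hv
  · exact hP.1 v u hv h

/-- The factors of a relative quasi-isometry between products of groups. -/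
lemma exists_pieces [Finite V] [Finite W] {k : ℕ} {hk : 0 < k} {P : V → Fin k} {Q : W → Fin k}
    (hP : IsDeRahm Γ hk P) (hQ : IsDeRahm Λ hk Q) {BΓ : Set V} {BΛ : Set W}
    {fs : Set (Set (Raag Γ)) → Set (Set (Raag Λ))} (hA : A ≤ A') {f' : Raag Λ → Raag Γ}
    (hf : QPair K A' f f')
    (hrel : IsRelQIWith K A (raagDist Γ) (raagDist Λ) (periph Γ BΓ) (periph Λ BΛ) f fs)
    {σ : Equiv.Perm (Fin k)} {B : ℝ} (h0 : σ ⟨0, hk⟩ = ⟨0, hk⟩)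
    (hT : JoinFam Γ fun i => P ⁻¹' {i}) (hT' : JoinFam Λ fun i => Q ⁻¹' {σ i})
    (hσ : ∀ i ≠ ⟨0, hk⟩, CLip K B (P ⁻¹' {i}) (Q ⁻¹' {σ i}) f ∧
      CLip K B (Q ⁻¹' {σ i}) (P ⁻¹' {i}) f')
    (hcard : Nat.card {v // P v = ⟨0, hk⟩} = Nat.card {v // Q v = ⟨0, hk⟩}) :
    ∃ g : Fin k → Raag Γ → Raag Λ, ∀ i,
      Piece (P ⁻¹' {i}) (Q ⁻¹' {σ i}) BΓ fs (g i) K (2 * A' + max B 0) := by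
  obtain ⟨-, hfs, hH⟩ := hrel
  have h1 a u b w (hu : u ∈ BΓ) (e : fs (pcl Γ a u) = pcl Λ b w) :
      ∃ b', Par Λ b w b' w ∧ Fel f a u b' w A' := by
    obtain ⟨_, hb, h⟩ := (hH _ ⟨⟨a, u⟩, hu, rfl⟩).1 _ (mem_pcl.2 ⟨a, .refl _ _, rfl⟩)
    obtain ⟨b', hb', rfl⟩ := mem_pcl.1 (e ▸ hb)
    exact ⟨b', hb', (hausLE_iff_fel.1 h).mono hA⟩
  have h2 a u b w (hu : u ∈ BΓ) (e : fs (pcl Γ a u) = pcl Λ b w) :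
      ∃ a', Par Γ a u a' u ∧ Fel f a' u b w A' := by
    obtain ⟨_, ha, h⟩ := (hH _ ⟨⟨a, u⟩, hu, rfl⟩).2 (StdGeod.mk b w).carrier
      (e ▸ mem_pcl.2 ⟨b, .refl _ _, rfl⟩)
    obtain ⟨a', ha', rfl⟩ := mem_pcl.1 ha
    exact ⟨a', ha', (hausLE_iff_fel.1 h).mono hA⟩
  have hne i (hi : i ≠ ⟨0, hk⟩) : Piece (P ⁻¹' {i}) (Q ⁻¹' {σ i}) BΓ fs
      (fun x => ret Λ (Q ⁻¹' {σ i}) (f (ret Γ (P ⁻¹' {i}) x))) K (2 * A' + max B 0) :=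
    .of_cLip hf (fun x x' => ((hσ i hi).1 x x').trans (by gcongr; exact le_max_left ..))
      (fun x x' => ((hσ i hi).2 x x').trans (by gcongr; exact le_max_left ..)) h1 h2
  have hl a u b w (hu : u ∈ BΓ) (e : fs (pcl Γ a u) = pcl Λ b w) :
      u ∈ P ⁻¹' {⟨0, hk⟩} ↔ w ∈ Q ⁻¹' {σ ⟨0, hk⟩} :=
    hT.mem_iff_of_ne hT' fun c hc => (hne c hc).label a u b w hu e
  have hQ0 : ∀ w ∈ Q ⁻¹' {σ ⟨0, hk⟩}, ∀ v ≠ w, Λ.Adj v w := by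
    rw [h0]; exact adj_of_isDeRahm hQ
  obtain ⟨e⟩ : Nonempty (P ⁻¹' {⟨0, hk⟩} ≃ Q ⁻¹' {σ ⟨0, hk⟩}) := by
    rw [h0]; exact Finite.card_eq.1 hcard
  obtain ⟨β, hβ⟩ := exists_equiv_forall_of_injective e {x | x.1 ∈ BΓ}
    (fun x y => fs (pcl Γ 1 x.1) = pcl Λ 1 y.1) (fun x hx => by
      obtain ⟨⟨b, w⟩, -, h⟩ := hfs.mapsTo ⟨⟨1, x.1⟩, hx, rfl⟩
      have hw := (hl _ _ _ _ hx h).1 x.2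
      exact ⟨⟨w, hw⟩, h.trans (pcl_eq_iff.2 (par_one (hQ0 w hw) b).symm)⟩)
    fun x hx x' hx' y h h' => Subtype.ext (pcl_eq_iff.1 (hfs.injOn ⟨⟨1, x.1⟩, hx, rfl⟩
      ⟨⟨1, x'.1⟩, hx', rfl⟩ (h.trans h'.symm))).label_eq
  obtain ⟨g, hg⟩ := Piece.of_clique hf.one_le (A := 2 * A' + max B 0)
    (by linarith [hf.nonneg, le_max_right B 0]) (adj_of_isDeRahm hP) hQ0 β hl
    fun u hu => hβ u hu
  have key i : ∃ g, Piece (P ⁻¹' {i}) (Q ⁻¹' {σ i}) BΓ fs g K (2 * A' + max B 0) := by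
    by_cases hi : i = ⟨0, hk⟩
    · exact hi ▸ ⟨g, hg⟩
    · exact ⟨_, hne i hi⟩
  exact ⟨fun i => (key i).choose, fun i => (key i).choose_spec⟩

end DeRahmSplit

/-- A relative quasi-isometry between RAAGs splits, up to replacing
the quasi-isometry while keeping the induced map on peripheral structures, as a product
of relative quasi-isometries of the de Rahm factors. -/
theorem stmt15 {V W : Type} [Fintype V] [Fintype W]
    (Γ : SimpleGraph V) (Λ : SimpleGraph W)
    {k l : ℕ} (hk : 0 < k) (hl : 0 < l)
    (P : V → Fin k) (Q : W → Fin l)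
    (hP : IsDeRahm Γ hk P) (hQ : IsDeRahm Λ hl Q)
    (BΓ : Set V) (BΛ : Set W)
    (f : Raag Γ → Raag Λ) (fs : Set (Set (Raag Γ)) → Set (Set (Raag Λ)))
    (K A : ℝ)
    (hf : IsRelQIWith K A (raagDist Γ) (raagDist Λ) (periph Γ BΓ) (periph Λ BΛ) f fs) :
    k = l ∧
    ∃ σ : Fin k ≃ Fin l,
      ∃ gfac : ∀ i : Fin k, ↥(subRaag Γ (P ⁻¹' {i})) → ↥(subRaag Λ (Q ⁻¹' {σ i})),
        (∀ i : Fin k,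
          ∃ (gfs : Set (Set ↥(subRaag Γ (P ⁻¹' {i}))) →
                Set (Set ↥(subRaag Λ (Q ⁻¹' {σ i})))) (K' A' : ℝ),
            IsRelQIWith K' A' (subDist Γ (P ⁻¹' {i})) (subDist Λ (Q ⁻¹' {σ i}))
              (subPeriph Γ (P ⁻¹' {i}) BΓ) (subPeriph Λ (Q ⁻¹' {σ i}) BΛ)
              (gfac i) gfs) ∧
        ∃ (g : Raag Γ → Raag Λ) (gs : Set (Set (Raag Γ)) → Set (Set (Raag Λ)))
          (K'' A'' : ℝ),
          IsRelQIWith K'' A'' (raagDist Γ) (raagDist Λ)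
            (periph Γ BΓ) (periph Λ BΛ) g gs ∧
          (∀ F ∈ periph Γ BΓ, gs F = fs F) ∧
          (∀ x : ∀ i : Fin k, ↥(subRaag Γ (P ⁻¹' {i})),
            g (List.ofFn fun i => ((x i : Raag Γ))).prod =
              (List.ofFn fun i => ((gfac i (x i) : Raag Λ))).prod) := by
  open DeRahmSplit in
  have hq := hf.1
  rw [raagDist_eq_dist, raagDist_eq_dist] at hq
  obtain ⟨f', hff⟩ := DeRahmSplit.IsQIWith.exists_qPair hq
  obtain ⟨hcard, σ, B, hσ⟩ := exists_split_symm hP hQ hff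
  obtain rfl : k = l := by
    have := Fintype.card_congr σ
    simp only [ne_eq, Fintype.card_subtype_compl, Fintype.card_fin, Fintype.card_unique] at this
    omega
  have h0 : σ.extendSubtype ⟨0, hk⟩ = ⟨0, hk⟩ :=
    not_not.1 (σ.extendSubtype_not_mem _ (not_not.2 rfl))
  have hT := joinFam_of_isDeRahm hP
  have hT' : JoinFam Λ fun i => Q ⁻¹' {σ.extendSubtype i} :=
    ⟨fun v => ⟨σ.extendSubtype.symm (Q v), by simp⟩,
      fun h => (joinFam_of_isDeRahm hQ).adj (σ.extendSubtype.injective.ne h)⟩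
  obtain ⟨g, hg⟩ := exists_pieces hP hQ (by nlinarith [hq.1, hq.2.1]) hff hf h0 hT hT'
    (fun i hi => by rw [σ.extendSubtype_apply_of_mem i hi]; exact hσ ⟨i, hi⟩) (by omega)
  refine ⟨rfl, σ.extendSubtype, fun i => (hg i).fac, fun i => ?_, _, fs, _, _,
    Piece.isRelQIWith_prod hT hT' hg hk hf.2.1, fun _ _ => rfl, fun x => ?_⟩
  · obtain ⟨gfs, h⟩ := Piece.exists_relQI_fac hT hT' hg hf.2.1 i
    exact ⟨gfs, _, _, h⟩
  · refine congrArg (fun t => (List.ofFn t).prod) (funext fun i => ?_)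
    rw [← (hg i).comp_ret, hT.ret_prod fun c => (x c).2]
    rfl

end
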